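/- For every strictly increasing sequence of integers 0 = b_0 < b_1 < b_2 < ... with b_{k+1} − b_k → ∞, one has lim_{K→∞} (1/b_{K+1}) Σ_{k=0}^{K} |Σ_{b_k ≤ n < b_{k+1}} μ(n)| = 0. -/

import Mathlib

open Filter Topology
namespace MR
open MeasureTheory Complex FourierTransform
open scoped ContDiff

structure Bump (w : ℝ → ℝ) (B : ℝ) : Prop where
  sm : ContDiff ℝ ∞ w
  supp : ∀ y, B < |y| → w y = 0
  hB : 1 ≤ B

noncomputable def wh (w : ℝ → ℝ) (t : ℝ) : ℂ := 𝓕 (fun u => (w u : ℂ)) (t / (2 * Real.pi))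

theorem plancherel {f : ℝ → ℂ} (hc : Continuous f) (hf : Integrable f) (hF : Integrable (𝓕 f)) :
    ∫ x, ‖f x‖ ^ 2 = ∫ x, ‖𝓕 f x‖ ^ 2 := by
  have h := VectorFourier.integral_sesq_fourierIntegral_eq_neg_flip (innerSL ℂ (E := ℂ))
    (L := innerₗ ℝ) Real.continuous_fourierChar continuous_inner hf hF
  have h2 : ∀ x, VectorFourier.fourierIntegral Real.fourierChar volume (-(innerₗ ℝ).flip) (𝓕 f) x
      = f x := by
    intro x
    have := congrFun (hc.fourierInv_fourier_eq hf hF) x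
    rw [Real.fourierInv_eq] at this
    rw [← this]
    simp [VectorFourier.fourierIntegral]
  simp only [h2] at h
  have h3 : ∫ x, ((‖f x‖ ^ 2 : ℝ) : ℂ) = ∫ x, ((‖𝓕 f x‖ ^ 2 : ℝ) : ℂ) := by
    have e : ∀ x, VectorFourier.fourierIntegral Real.fourierChar volume (innerₗ ℝ) f x = 𝓕 f x :=
      fun x => rfl
    simp only [e, innerSL_apply_apply, inner_self_eq_norm_sq_to_K] at h
    simpa using h.symm
  rw [integral_complex_ofReal, integral_complex_ofReal] at h3
  exact_mod_cast h3

theorem Bump.compact {w : ℝ → ℝ} {B : ℝ} (h : Bump w B) :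
    HasCompactSupport (fun u => (w u : ℂ)) := by
  refine HasCompactSupport.intro (isCompact_Icc (a := -B) (b := B)) fun y hy => ?_
  rw [h.supp y, ofReal_zero]
  rw [← not_le, abs_le]; exact hy

theorem Bump.smc {w : ℝ → ℝ} {B : ℝ} (h : Bump w B) : ContDiff ℝ ∞ (fun u => (w u : ℂ)) :=
  ofRealCLM.contDiff.comp h.sm

theorem Bump.wh_cont {w : ℝ → ℝ} {B : ℝ} (h : Bump w B) : Continuous (wh w) := by
  have : Continuous ⇑(𝓕 (h.compact.toSchwartzMap h.smc) : SchwartzMap ℝ ℂ) := SchwartzMap.continuous _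
  rw [SchwartzMap.fourier_coe] at this
  exact this.comp (by fun_prop)

theorem Bump.wh_int' {w : ℝ → ℝ} {B : ℝ} (h : Bump w B) :
    Integrable (𝓕 (fun u => (w u : ℂ))) := by
  have : Integrable ⇑(𝓕 (h.compact.toSchwartzMap h.smc) : SchwartzMap ℝ ℂ) := SchwartzMap.integrable _
  rw [SchwartzMap.fourier_coe] at this
  exact this

theorem Bump.wh_int {w : ℝ → ℝ} {B : ℝ} (h : Bump w B) : Integrable (wh w) :=
  h.wh_int'.comp_div (by positivity)

theorem Bump.w_int {w : ℝ → ℝ} {B : ℝ} (h : Bump w B) : Integrable (fun u => (w u : ℂ)) :=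
  h.smc.continuous.integrable_of_hasCompactSupport h.compact

theorem wh_eq (w : ℝ → ℝ) (t : ℝ) : wh w t = ∫ u, cexp (-(t * u : ℝ) * I) * (w u : ℂ) := by
  rw [wh, Real.fourier_eq]
  congr 1; ext u
  rw [Circle.smul_def, Real.fourierChar_apply, smul_eq_mul]
  congr 2
  simp only [RCLike.inner_apply, conj_trivial]
  push_cast
  have : (Real.pi : ℂ) ≠ 0 := by exact_mod_cast Real.pi_ne_zero
  field_simp

theorem Bump.bdd {w : ℝ → ℝ} {B : ℝ} (h : Bump w B) : ∃ C, 0 < C ∧ ∀ u, |w u| ≤ C := by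
  obtain ⟨C, hC⟩ := h.compact.exists_bound_of_continuous h.smc.continuous
  exact ⟨max C 1, by positivity, fun u => by simpa using (hC u).trans (le_max_left _ _)⟩

theorem integrable_tsum' {F : ℕ → ℝ → ℂ} (hc : Continuous fun u => ∑' n, F n u)
    (hs : ∀ u, Summable fun n => ‖F n u‖)
    (hi : ∀ n, Integrable (F n)) (hsum : Summable fun n => ∫ u, ‖F n u‖) :
    Integrable fun u => ∑' n, F n u := by
  refine ⟨hc.aestronglyMeasurable, ?_⟩
  have h1 : ∀ u, ‖∑' n, F n u‖ₑ ≤ ∑' n, ‖F n u‖ₑ := fun u => by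
    rw [enorm_eq_nnnorm]
    have hs' : Summable fun n => ‖F n u‖₊ := by rw [← NNReal.summable_coe]; exact hs u
    refine (ENNReal.coe_le_coe.2 (nnnorm_tsum_le hs')).trans ?_
    rw [ENNReal.coe_tsum hs']; rfl
  refine (lintegral_mono h1).trans_lt ?_
  rw [lintegral_tsum fun n => (hi n).1.enorm]
  have h2 : ∀ n, ∫⁻ u, ‖F n u‖ₑ = ENNReal.ofReal (∫ u, ‖F n u‖) :=
    fun n => (ofReal_integral_norm_eq_lintegral_enorm (hi n)).symm
  simp only [h2]
  exact hsum.tsum_ofReal_lt_top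

theorem dp_aux {φ : ℝ → ℝ} {B : ℝ} (h : Bump φ B) (b : ℕ → ℂ) (hb : Summable fun n => ‖b n‖)
    (lam : ℕ → ℝ) : (Continuous fun u => ∑' n, b n * (φ (u - lam n) : ℂ)) ∧
    (∀ n, Integrable (fun u => b n * (φ (u - lam n) : ℂ))) ∧
    (Summable fun n => ∫ u, ‖b n * (φ (u - lam n) : ℂ)‖) ∧
    (Integrable fun u => ∑' n, b n * (φ (u - lam n) : ℂ)) ∧
    Integrable fun u => ‖∑' n, b n * (φ (u - lam n) : ℂ)‖ ^ 2 := by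
  obtain ⟨C, hC0, hC⟩ := h.bdd
  have hbd : ∀ n u, ‖b n * (φ (u - lam n) : ℂ)‖ ≤ ‖b n‖ * C := fun n u => by
    rw [norm_mul]; gcongr; simpa using hC _
  have hcont : Continuous fun u => ∑' n, b n * (φ (u - lam n) : ℂ) := by
    refine continuous_tsum (fun n => ?_) (hb.mul_right C) hbd
    exact continuous_const.mul (h.smc.continuous.comp (continuous_id.sub continuous_const))
  have hi : ∀ n, Integrable (fun u => b n * (φ (u - lam n) : ℂ)) :=
    fun n => (h.w_int.comp_sub_right (lam n)).const_mul _
  have hnorm : ∀ n, ∫ u, ‖b n * (φ (u - lam n) : ℂ)‖ = ‖b n‖ * ∫ u, ‖(φ u : ℂ)‖ := fun n => by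
    simp only [norm_mul]
    rw [integral_const_mul, integral_sub_right_eq_self (fun u => ‖(φ u : ℂ)‖)]
  have hsum : Summable fun n => ∫ u, ‖b n * (φ (u - lam n) : ℂ)‖ := by
    simp only [hnorm]; exact hb.mul_right _
  have hint : Integrable fun u => ∑' n, b n * (φ (u - lam n) : ℂ) :=
    integrable_tsum' hcont (fun u => (hb.mul_right C).of_nonneg_of_le (fun _ => norm_nonneg _)
      fun n => hbd n u) hi hsum
  refine ⟨hcont, hi, hsum, hint, ?_⟩
  have := hint.norm.bdd_mul (c := ∑' n, ‖b n‖ * C) hcont.norm.aestronglyMeasurable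
    (ae_of_all _ fun u => by rw [norm_norm]; exact tsum_of_norm_bounded (hb.mul_right C).hasSum fun n => hbd n u)
  simpa [pow_two] using this

theorem dp {φ : ℝ → ℝ} {B : ℝ} (h : Bump φ B) (b : ℕ → ℂ) (hb : Summable fun n => ‖b n‖)
    (lam : ℕ → ℝ) : 2 * Real.pi * ∫ u, ‖∑' n, b n * (φ (u - lam n) : ℂ)‖ ^ 2 =
      ∫ t, ‖∑' n, b n * cexp (-(t * lam n : ℝ) * I)‖ ^ 2 * ‖wh φ t‖ ^ 2 := by
  obtain ⟨hcont, hi, hsum, hint, -⟩ := dp_aux h b hb lam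
  have hF : ∀ ξ, 𝓕 (fun u => ∑' n, b n * (φ (u - lam n) : ℂ)) ξ =
      (∑' n, b n * cexp (-(2 * Real.pi * ξ * lam n : ℝ) * I)) * 𝓕 (fun u => (φ u : ℂ)) ξ := by
    intro ξ
    rw [← tsum_mul_right, Real.fourier_eq]
    have e1 : ∀ u, Real.fourierChar (-inner ℝ u ξ) • (∑' n, b n * (φ (u - lam n) : ℂ)) =
        ∑' n, Real.fourierChar (-inner ℝ u ξ) • (b n * (φ (u - lam n) : ℂ)) := by
      intro u
      simp only [Circle.smul_def, smul_eq_mul]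
      rw [tsum_mul_left]
    simp only [e1]
    rw [← integral_tsum_of_summable_integral_norm]
    · congr 1; ext n
      rw [Real.fourier_eq, ← integral_const_mul,
        ← integral_sub_right_eq_self (fun u => b n * cexp (-(2 * Real.pi * ξ * lam n : ℝ) * I) *
          Real.fourierChar (-inner ℝ u ξ) • (φ u : ℂ)) (lam n)]
      congr 1; ext u
      simp only [Circle.smul_def, Real.fourierChar_apply, smul_eq_mul, RCLike.inner_apply,
        conj_trivial]
      rw [show ∀ a b c d : ℂ, a * b * (c * d) = b * c * (a * d) by intros; ring, ← Complex.exp_add]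
      congr 2; push_cast; ring
    · intro n; exact (Real.fourierIntegral_convergent_iff ξ).2 (hi n)
    · simpa only [Circle.norm_smul] using hsum
  have hFi : Integrable (𝓕 (fun u => ∑' n, b n * (φ (u - lam n) : ℂ))) := by
    rw [show 𝓕 (fun u => ∑' n, b n * (φ (u - lam n) : ℂ)) = _ from funext hF]
    refine h.wh_int'.bdd_mul (c := ∑' n, ‖b n‖) ?_ (ae_of_all _ fun ξ => ?_)
    · refine (continuous_tsum (fun n => by fun_prop) hb fun n ξ => ?_).aestronglyMeasurable
      rw [norm_mul, ← ofReal_neg, norm_exp_ofReal_mul_I, mul_one]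
    · have : ∀ n, ‖b n * cexp (-(2 * Real.pi * ξ * lam n : ℝ) * I)‖ = ‖b n‖ := fun n => by
        rw [norm_mul, ← ofReal_neg, norm_exp_ofReal_mul_I, mul_one]
      refine (norm_tsum_le_tsum_norm (by simpa only [this] using hb)).trans ?_
      simp only [this]; rfl
  rw [plancherel hcont hint hFi]
  have := Measure.integral_comp_div (fun ξ => ‖𝓕 (fun u => ∑' n, b n * (φ (u - lam n) : ℂ)) ξ‖ ^ 2)
    (2 * Real.pi)
  rw [abs_of_pos (by positivity), smul_eq_mul] at this
  rw [← this]
  congr 1; ext t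
  rw [hF, norm_mul, mul_pow, wh, mul_div_cancel₀ _ (by positivity)]
end MR
namespace MR
open MeasureTheory Complex FourierTransform
open scoped ContDiff

noncomputable def E (t : ℝ) (n : ℕ) : ℂ := cexp (-(t * Real.log n : ℝ) * I)

@[simp] theorem norm_E (t : ℝ) (n : ℕ) : ‖E t n‖ = 1 := by
  rw [E, ← ofReal_neg, norm_exp_ofReal_mul_I]

theorem E_mul (t : ℝ) {m n : ℕ} (hm : m ≠ 0) (hn : n ≠ 0) : E t (m * n) = E t m * E t n := by
  rw [E, E, E, ← Complex.exp_add, Nat.cast_mul, Real.log_mul (by positivity) (by positivity)]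
  congr 1; push_cast; ring

@[fun_prop] theorem E_cont (n : ℕ) : Continuous fun t => E t n := by unfold E; fun_prop

theorem exists_phi : ∃ φ : ℝ → ℝ, Bump φ 1 ∧ (∀ u, 0 ≤ φ u) ∧ ∫ u, φ u = 1 := by
  let f : ContDiffBump (0 : ℝ) := ⟨1 / 2, 1, by norm_num, by norm_num⟩
  refine ⟨f.normed volume, ⟨f.contDiff_normed, fun y hy => ?_, le_rfl⟩, fun u => f.nonneg_normed u,
    f.integral_normed⟩
  rw [← Function.notMem_support, f.support_normed_eq]
  simpa [f] using hy.le

theorem exists_W (B : ℝ) (hB : 1 ≤ B) : ∃ W : ℝ → ℝ, Bump W (B + 1) ∧ (∀ u, 0 ≤ W u) ∧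
    (∀ u, W u ≤ 1) ∧ ∀ u, |u| ≤ B → W u = 1 := by
  let f : ContDiffBump (0 : ℝ) := ⟨B, B + 1, by linarith, by linarith⟩
  refine ⟨f, ⟨f.contDiff, fun y hy => ?_, by linarith⟩, fun u => f.nonneg, fun u => f.le_one,
    fun u hu => ?_⟩
  · rw [← Function.notMem_support, f.support_eq]
    simpa [f] using hy.le
  · exact f.one_of_mem_closedBall (by simpa [f] using hu)

theorem card_near (S : Finset ℕ) (x r : ℝ) (hr : 0 ≤ r) (h : ∀ m ∈ S, |(m : ℝ) - x| ≤ r) :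
    (S.card : ℝ) ≤ 2 * r + 1 := by
  have h1 : S.image (fun m : ℕ => (m : ℤ)) ⊆ Finset.Icc ⌈x - r⌉ ⌊x + r⌋ := by
    intro z hz
    obtain ⟨m, hm, rfl⟩ := Finset.mem_image.1 hz
    have := abs_le.1 (h m hm)
    rw [Finset.mem_Icc, Int.ceil_le, Int.le_floor]
    push_cast; constructor <;> linarith
  have h2 := Finset.card_le_card h1
  rw [Finset.card_image_of_injective _ Nat.cast_injective, Int.card_Icc] at h2
  have h3 : (S.card : ℝ) ≤ ((⌊x + r⌋ + 1 - ⌈x - r⌉).toNat : ℝ) := by exact_mod_cast h2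
  refine h3.trans ?_
  have h4 : (((⌊x + r⌋ + 1 - ⌈x - r⌉).toNat : ℤ) : ℝ) = max ((⌊x + r⌋ : ℝ) + 1 - ⌈x - r⌉) 0 := by
    rw [Int.toNat_eq_max]; push_cast; rfl
  rw [Int.cast_natCast] at h4
  rw [h4]
  refine max_le ?_ (by linarith)
  linarith [Int.floor_le (x + r), Int.le_ceil (x - r)]

theorem mvt_phi {φ : ℝ → ℝ} {B : ℝ} (h : Bump φ B) : ∃ C, 0 < C ∧ ∀ T : ℝ, 1 ≤ T →
    ∀ (S : Finset ℕ) (c : ℕ → ℂ), (∀ n ∈ S, 1 ≤ n) →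
    ∫ t, ‖∑ n ∈ S, c n * E t n‖ ^ 2 * ‖wh φ (t / T)‖ ^ 2 ≤ C * ∑ n ∈ S, (T + n) * ‖c n‖ ^ 2 := by
  obtain ⟨M, hM, hφ⟩ := h.bdd
  set K := 2 * B * Real.exp (2 * B) with hK
  have hB := h.hB
  have hK0 : 0 < K := by positivity
  refine ⟨2 * Real.pi * (M ^ 2 * (2 * B)) * (1 + 2 * K), by positivity, fun T hT S c hS => ?_⟩
  have hT0 : 0 < T := by linarith
  set lam : ℕ → ℝ := fun n => T * Real.log n with hlam
  have hd := dp h (fun n => if n ∈ S then c n else 0)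
    (summable_of_ne_finset_zero (s := S) (by intro n hn; simp [hn])) lam
  have hts : ∀ g : ℕ → ℂ, ∑' n, (if n ∈ S then c n else 0) * g n = ∑ n ∈ S, c n * g n := by
    intro g
    rw [tsum_eq_sum (s := S) (by intro n hn; simp [hn])]
    exact Finset.sum_congr rfl fun n hn => by simp [hn]
  simp only [hts] at hd
  have hsub := Measure.integral_comp_div (fun t =>
    ‖∑ n ∈ S, c n * cexp (-(t * lam n : ℝ) * I)‖ ^ 2 * ‖wh φ t‖ ^ 2) T
  rw [abs_of_pos hT0, smul_eq_mul, ← hd] at hsub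
  have hE : ∀ t, (fun n => cexp (-(t / T * lam n : ℝ) * I)) = E t := fun t => by
    ext n; rw [E]; congr 4; simp only [hlam]; field_simp
  have hE' : ∀ t n, cexp (-(t / T * lam n : ℝ) * I) = E t n := fun t n => congrFun (hE t) n
  simp only [hE'] at hsub
  rw [hsub]
  have hci : ∀ n m, Integrable fun u => |φ (u - lam n)| * |φ (u - lam m)| := fun n m => by
    refine ((h.w_int.norm.comp_sub_right (lam m)).bdd_mul (c := M) (f := fun u => |φ (u - lam n)|)
      ?_ (ae_of_all _ fun u => ?_)).congr (ae_of_all _ fun u => by simp)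
    · exact ((h.sm.continuous.comp (continuous_id.sub continuous_const)).abs).aestronglyMeasurable
    · simpa using hφ _
  have hpt : ∀ u, ‖∑ n ∈ S, c n * (φ (u - lam n) : ℂ)‖ ^ 2 ≤
      ∑ n ∈ S, ∑ m ∈ S, ‖c n‖ ^ 2 * (|φ (u - lam n)| * |φ (u - lam m)|) := fun u => by
    set a : ℕ → ℝ := fun n => |φ (u - lam n)|
    have h1 : ‖∑ n ∈ S, c n * (φ (u - lam n) : ℂ)‖ ≤ ∑ n ∈ S, ‖c n‖ * a n :=
      (norm_sum_le _ _).trans (le_of_eq (by simp [a]))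
    have h2 : (∑ n ∈ S, ‖c n‖ * a n) ^ 2 ≤ (∑ n ∈ S, ‖c n‖ ^ 2 * a n) * ∑ n ∈ S, a n := by
      refine Finset.sum_sq_le_sum_mul_sum_of_sq_le_mul S (fun n _ => by positivity)
        (fun n _ => by positivity) fun n _ => le_of_eq (by ring)
    refine (pow_le_pow_left₀ (norm_nonneg _) h1 2).trans (h2.trans (le_of_eq ?_))
    rw [Finset.sum_mul_sum]
    exact Finset.sum_congr rfl fun n _ => Finset.sum_congr rfl fun m _ => by ring
  have hint : ∫ u, ‖∑ n ∈ S, c n * (φ (u - lam n) : ℂ)‖ ^ 2 ≤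
      ∑ n ∈ S, ∑ m ∈ S, ‖c n‖ ^ 2 * ∫ u, |φ (u - lam n)| * |φ (u - lam m)| := by
    refine (integral_mono_of_nonneg (ae_of_all _ fun u => by positivity)
      (integrable_finsetSum _ fun n _ => integrable_finsetSum _ fun m _ =>
        (hci n m).const_mul _) (ae_of_all _ hpt)).trans (le_of_eq ?_)
    rw [integral_finsetSum _ fun n _ => integrable_finsetSum _ fun m _ => (hci n m).const_mul _]
    refine Finset.sum_congr rfl fun n _ => ?_
    rw [integral_finsetSum _ fun m _ => (hci n m).const_mul _]
    exact Finset.sum_congr rfl fun m _ => integral_const_mul _ _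
  have hpair : ∀ n m, ∫ u, |φ (u - lam n)| * |φ (u - lam m)| ≤
      if |lam m - lam n| ≤ 2 * B then M ^ 2 * (2 * B) else 0 := by
    intro n m
    split_ifs with hh
    · have : ∫ u, |φ (u - lam n)| * |φ (u - lam m)| ≤
          ∫ u, (Set.Icc (lam n - B) (lam n + B)).indicator (fun _ => M ^ 2) u := by
        refine integral_mono (hci n m) ((integrable_indicator_iff measurableSet_Icc).2
          (integrableOn_const (by simp))) fun u => ?_
        by_cases hu : u ∈ Set.Icc (lam n - B) (lam n + B)
        · simp only [Set.indicator_of_mem hu]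
          rw [sq]; exact mul_le_mul (hφ _) (hφ _) (abs_nonneg _) hM.le
        · have : φ (u - lam n) = 0 := h.supp _ (by
            by_contra hc; rw [not_lt, abs_le] at hc; exact hu ⟨by linarith, by linarith⟩)
          simp [this, Set.indicator_of_notMem hu]
      refine this.trans (le_of_eq ?_)
      rw [integral_indicator measurableSet_Icc, setIntegral_const]
      simp only [Measure.real, Real.volume_Icc, smul_eq_mul]
      rw [ENNReal.toReal_ofReal (by linarith)]; ring
    · refine le_of_eq (integral_eq_zero_of_ae (ae_of_all _ fun u => ?_))
      by_cases hu : B < |u - lam n|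
      · simp [h.supp _ hu]
      · have : B < |u - lam m| := by
          have := abs_sub_le (lam m) u (lam n)
          rw [abs_sub_comm (lam m) u] at this
          linarith
        simp [h.supp _ this]
  have hcnt : ∀ n ∈ S, ∑ m ∈ S, (if |lam m - lam n| ≤ 2 * B then M ^ 2 * (2 * B) else 0) ≤
      (M ^ 2 * (2 * B)) * ((1 + 2 * K) * ((T + n) / T)) := by
    intro n hn
    rw [← Finset.sum_filter, Finset.sum_const, nsmul_eq_mul, mul_comm]
    gcongr
    have hn1 : (1 : ℝ) ≤ n := by exact_mod_cast hS n hn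
    refine (card_near _ n (K * (n / T)) (by positivity) fun m hm => ?_).trans ?_
    · obtain ⟨hmS, hm⟩ := Finset.mem_filter.1 hm
      have hm1 : (1 : ℝ) ≤ m := by exact_mod_cast hS m hmS
      have key : ∀ p q : ℝ, 1 ≤ p → 1 ≤ q → p - q ≤ p * (Real.log p - Real.log q) := by
        intro p q hp hq
        have := Real.add_one_le_exp (Real.log q - Real.log p)
        rw [Real.exp_sub, Real.exp_log (by linarith), Real.exp_log (by linarith),
          le_div_iff₀ (by linarith)] at this
        nlinarith
      have hl : |Real.log m - Real.log n| ≤ 2 * B / T := by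
        rw [le_div_iff₀ hT0, mul_comm, ← abs_of_pos hT0, ← abs_mul, mul_sub]
        exact hm
      obtain ⟨l1, l2⟩ := abs_le.1 hl
      have hmn : (m : ℝ) ≤ n * Real.exp (2 * B) := by
        rw [← Real.exp_log (show (0:ℝ) < m by linarith)]
        nth_rw 1 [← Real.exp_log (show (0:ℝ) < n by linarith)]
        rw [← Real.exp_add]
        apply Real.exp_le_exp.2
        have : 2 * B / T ≤ 2 * B := div_le_self (by linarith) hT
        linarith
      have he : 1 ≤ Real.exp (2 * B) := Real.one_le_exp (by linarith)
      have e1 : K * (n / T) = n * Real.exp (2 * B) * (2 * B / T) := by rw [hK]; ring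
      rw [e1, abs_le]
      have hq : 0 ≤ 2 * B / T := by positivity
      constructor
      · have := key n m hn1 hm1
        have h3 : (n : ℝ) * (Real.log n - Real.log m) ≤ n * Real.exp (2 * B) * (2 * B / T) :=
          (mul_le_mul_of_nonneg_left (by linarith) (by linarith)).trans
            (mul_le_mul_of_nonneg_right (le_mul_of_one_le_right (by linarith) he) hq)
        linarith
      · have := key m n hm1 hn1
        have h3 : (m : ℝ) * (Real.log m - Real.log n) ≤ m * (2 * B / T) :=
          mul_le_mul_of_nonneg_left l2 (by linarith)
        have h4 := mul_le_mul_of_nonneg_right hmn hq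
        linarith
    · rw [add_div, div_self hT0.ne']
      have : 0 ≤ (n : ℝ) / T := by positivity
      nlinarith
  calc T * (2 * Real.pi * ∫ u, ‖∑ n ∈ S, c n * (φ (u - lam n) : ℂ)‖ ^ 2)
      ≤ T * (2 * Real.pi * ∑ n ∈ S, ‖c n‖ ^ 2 *
          ((M ^ 2 * (2 * B)) * ((1 + 2 * K) * ((T + n) / T)))) := by
        gcongr
        refine hint.trans (Finset.sum_le_sum fun n hn => ?_)
        rw [← Finset.mul_sum]
        gcongr
        exact (Finset.sum_le_sum fun m _ => hpair n m).trans (hcnt n hn)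
    _ = _ := by
        simp only [Finset.mul_sum]
        refine Finset.sum_congr rfl fun n _ => ?_
        field_simp

theorem mvt : ∃ C, 0 < C ∧ ∀ T : ℝ, 1 ≤ T →
    ∀ (S : Finset ℕ) (c : ℕ → ℂ), (∀ n ∈ S, 1 ≤ n) →
    ∫ t in Set.Icc (-T) T, ‖∑ n ∈ S, c n * E t n‖ ^ 2 ≤ C * ∑ n ∈ S, (T + n) * ‖c n‖ ^ 2 := by
  obtain ⟨φ, h, h0, h1⟩ := exists_phi
  obtain ⟨C, hC, hm⟩ := mvt_phi h
  refine ⟨4 * C, by positivity, fun T hT S c hS => ?_⟩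
  have hw : ∀ t, |t| ≤ 1 → 1 / 2 ≤ ‖wh φ t‖ := by
    intro t ht
    refine le_trans ?_ (Complex.re_le_norm _)
    have hre : (wh φ t).re = ∫ u, Real.cos (t * u) * φ u := by
      rw [wh_eq, ← reCLM_apply, ← ContinuousLinearMap.integral_comp_comm]
      · congr 1; ext u
        rw [reCLM_apply, re_mul_ofReal, ← ofReal_neg, exp_ofReal_mul_I_re, Real.cos_neg]
      · refine h.w_int.bdd_mul (c := 1) (by fun_prop) (ae_of_all _ fun u => ?_)
        rw [← ofReal_neg, norm_exp_ofReal_mul_I]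
    have hφi : Integrable φ := by simpa using! h.w_int.re
    rw [hre]
    calc (1 / 2 : ℝ) = ∫ u, 1 / 2 * φ u := by rw [integral_const_mul, h1, mul_one]
      _ ≤ _ := by
        refine integral_mono (hφi.const_mul _) (hφi.bdd_mul (c := 1) (by fun_prop)
          (ae_of_all _ fun u => by simpa using Real.abs_cos_le_one _)) fun u => ?_
        by_cases hu : 1 < |u|
        · simp [h.supp u hu]
        · refine mul_le_mul_of_nonneg_right ?_ (h0 u)
          have := Real.one_sub_sq_div_two_le_cos (x := t * u)
          have h5 : (t * u) ^ 2 ≤ 1 := by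
            rw [← sq_abs, abs_mul]; exact pow_le_one₀ (by positivity)
              (mul_le_one₀ ht (abs_nonneg _) (not_lt.1 hu))
          linarith
  have hcont : Continuous fun t => ‖∑ n ∈ S, c n * E t n‖ ^ 2 := by fun_prop
  have hwi : Integrable fun t => ‖wh φ (t / T)‖ ^ 2 := by
    have hi := h.wh_int.comp_div (R := T) (by linarith)
    obtain ⟨M, hM⟩ : ∃ M, ∀ t, ‖wh φ t‖ ≤ M := ⟨∫ u, ‖(φ u : ℂ)‖, fun t => by
      rw [wh_eq]; refine (norm_integral_le_integral_norm _).trans (le_of_eq ?_)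
      congr 1; ext u; rw [norm_mul, ← ofReal_neg, norm_exp_ofReal_mul_I, one_mul]⟩
    refine (hi.norm.bdd_mul (c := M) (f := fun t => ‖wh φ (t / T)‖) ?_
      (ae_of_all _ fun t => by simpa using hM _)).congr (ae_of_all _ fun t => (sq _).symm)
    exact hi.1.norm
  have hI : Integrable fun t => ‖∑ n ∈ S, c n * E t n‖ ^ 2 * ‖wh φ (t / T)‖ ^ 2 := by
    refine hwi.bdd_mul (c := (∑ n ∈ S, ‖c n‖) ^ 2) hcont.aestronglyMeasurable
      (ae_of_all _ fun t => ?_)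
    rw [Real.norm_of_nonneg (by positivity)]
    gcongr
    exact (norm_sum_le _ _).trans (le_of_eq (by simp))
  calc ∫ t in Set.Icc (-T) T, ‖∑ n ∈ S, c n * E t n‖ ^ 2
      ≤ ∫ t in Set.Icc (-T) T, 4 * (‖∑ n ∈ S, c n * E t n‖ ^ 2 * ‖wh φ (t / T)‖ ^ 2) := by
        refine setIntegral_mono_on (hcont.integrableOn_Icc) (hI.const_mul 4).integrableOn
          measurableSet_Icc fun t ht => ?_
        have := hw (t / T) (by
          rw [abs_div, abs_of_pos (by linarith : 0 < T)]
          exact div_le_one_of_le₀ (abs_le.2 ht) (by linarith))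
        have h6 : 1 / 4 ≤ ‖wh φ (t / T)‖ ^ 2 := by nlinarith
        nlinarith [sq_nonneg ‖∑ n ∈ S, c n * E t n‖]
    _ ≤ ∫ t, 4 * (‖∑ n ∈ S, c n * E t n‖ ^ 2 * ‖wh φ (t / T)‖ ^ 2) :=
        setIntegral_le_integral (hI.const_mul 4) (ae_of_all _ fun t => by positivity)
    _ ≤ _ := by
        rw [integral_const_mul, mul_assoc]
        exact mul_le_mul_of_nonneg_left (hm T hT S c hS) (by norm_num)
end MR
namespace MR
open Real

noncomputable def PR (a b : ℝ) : Finset ℕ :=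
  (Finset.range ⌈exp b⌉₊).filter fun p => p.Prime ∧ a ≤ log p ∧ log p < b

theorem mem_PR {a b : ℝ} {p : ℕ} : p ∈ PR a b ↔ p.Prime ∧ a ≤ log p ∧ log p < b := by
  rw [PR, Finset.mem_filter, Finset.mem_range]
  refine ⟨fun h => h.2, fun h => ⟨?_, h⟩⟩
  have : (0 : ℝ) < p := by exact_mod_cast h.1.pos
  have h2 : (p : ℝ) < exp b := by rw [← exp_log this]; exact exp_lt_exp.2 h.2.2
  exact_mod_cast h2.trans_le (Nat.le_ceil _)

theorem prime_upper {a : ℝ} (ha : 0 < a) : ∑ p ∈ PR a (a + 1), (1 / p : ℝ) ≤ 4 / a := by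
  have h1 : ∑ p ∈ PR a (a + 1), log p ≤ log 4 * exp (a + 1) := by
    refine le_trans ?_ (Chebyshev.theta_le_log4_mul_x (exp_pos (a + 1)).le)
    rw [Chebyshev.theta_eq_sum_Icc]
    refine Finset.sum_le_sum_of_subset_of_nonneg (fun p hp => ?_) fun p _ _ =>
      log_natCast_nonneg p
    obtain ⟨h1, _, h3⟩ := mem_PR.1 hp
    have : (0 : ℝ) < p := by exact_mod_cast h1.pos
    simp only [Finset.mem_filter, Finset.mem_Icc, zero_le, true_and, h1, and_true]
    rw [Nat.le_floor_iff (exp_pos _).le, ← exp_log this]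
    exact exp_le_exp.2 h3.le
  have h2 : ∀ p ∈ PR a (a + 1), (1 / p : ℝ) ≤ log p * (1 / (a * exp a)) := by
    intro p hp
    obtain ⟨h1, h2, h3⟩ := mem_PR.1 hp
    have h0 : (0 : ℝ) < p := by exact_mod_cast h1.pos
    have : exp a ≤ p := by rw [← exp_log h0]; exact exp_le_exp.2 h2
    rw [mul_one_div, div_le_div_iff₀ h0 (by positivity), one_mul]
    exact mul_le_mul h2 this (exp_pos a).le (ha.le.trans h2)
  refine (Finset.sum_le_sum h2).trans ?_
  rw [← Finset.sum_mul]
  refine (mul_le_mul_of_nonneg_right h1 (by positivity)).trans ?_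
  rw [exp_add]
  have h4 : log 4 = 2 * log 2 := by rw [show (4 : ℝ) = 2 ^ 2 by norm_num, log_pow]; norm_num
  have h5 : log 4 * exp 1 ≤ 4 := by
    have := log_two_lt_d9; have := exp_one_lt_d9; have := exp_pos 1
    have := log_pos (show (1:ℝ) < 2 by norm_num)
    rw [h4]; nlinarith
  have := exp_pos a
  rw [show log 4 * (exp a * exp 1) * (1 / (a * exp a)) = log 4 * exp 1 / a by field_simp]
  gcongr

theorem theta_lower {x : ℝ} (hx : 30 ^ 4 ≤ x) : x / 3 ≤ Chebyshev.theta x := by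
  have hx0 : 0 < x := by linarith [show (0:ℝ) < 30 ^ 4 by norm_num]
  have hx1 : 1 ≤ x := by linarith [show (1:ℝ) ≤ 30 ^ 4 by norm_num]
  refine le_trans ?_ (Chebyshev.theta_ge' hx1)
  set z := x ^ (1 / 4 : ℝ) with hz
  have hz4 : z ^ 4 = x := by rw [hz, ← rpow_natCast, ← rpow_mul hx0.le]; norm_num
  have hz0 : 0 < z := rpow_pos_of_pos hx0 _
  have hz30 : 30 ≤ z := by
    by_contra hc; push Not at hc
    have := pow_lt_pow_left₀ hc hz0.le (n := 4) (by norm_num)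
    rw [hz4] at this; linarith
  have hl : log x ≤ 4 * z := by
    have := log_le_rpow_div hx0.le (ε := 1 / 4) (by norm_num)
    rw [← hz] at this; linarith
  have hl3 : log (x + 2) ≤ 2 + 4 * z := by
    have : log (x + 2) ≤ log (x * exp 2) := by
      apply log_le_log (by linarith)
      nlinarith [add_one_le_exp (2 : ℝ)]
    rw [log_mul hx0.ne' (exp_pos _).ne', log_exp] at this; linarith
  have hs : √x = z ^ 2 := by rw [← hz4, show z ^ 4 = (z ^ 2) ^ 2 by ring, sqrt_sq (by positivity)]
  rw [hs]
  have h2 := log_two_gt_d9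
  have h6 : 2 * z ^ 2 * log x ≤ 2 * z ^ 2 * (4 * z) := by gcongr
  have h7 : (x - 1) * 0.69 ≤ (x - 1) * log 2 := by
    apply mul_le_mul_of_nonneg_left <;> linarith
  have h8 : 30 * z ^ 3 ≤ x := by rw [← hz4]; nlinarith [pow_pos hz0 3]
  have h9 : 900 * z ≤ z ^ 3 := by nlinarith [mul_pos hz0 hz0]
  linarith

theorem prime_step {a : ℝ} (ha : 20 ≤ a) : 1 / (21 * (a + 3)) ≤ ∑ p ∈ PR a (a + 3), (1 / p : ℝ) := by
  set y := exp a with hy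
  have hy0 : 0 < y := exp_pos a
  have hyb : (30 : ℝ) ^ 4 ≤ 8 * y := by
    have h1 : (2 : ℝ) ^ 20 ≤ exp 1 ^ 20 := by
      gcongr; linarith [add_one_le_exp (1 : ℝ)]
    rw [← exp_nat_mul] at h1
    have : exp ((20 : ℕ) * 1) ≤ y := exp_le_exp.2 (by push_cast; linarith)
    norm_num at h1 this ⊢; linarith
  have h1 := theta_lower hyb
  have h2 := Chebyshev.theta_le_log4_mul_x hy0.le
  have h4 : log 4 = 2 * log 2 := by rw [show (4 : ℝ) = 2 ^ 2 by norm_num, log_pow]; norm_num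
  have hl2 := log_two_lt_d9
  have h3 : y ≤ Chebyshev.theta (8 * y) - Chebyshev.theta y := by
    rw [h4] at h2; nlinarith
  have h8 : (8 : ℝ) < exp 3 := by
    have : (2.7 : ℝ) ^ 3 ≤ exp 1 ^ 3 := by gcongr; linarith [exp_one_gt_d9]
    rw [← exp_nat_mul] at this; norm_num at this; linarith
  have h5 : Chebyshev.theta (8 * y) - Chebyshev.theta y ≤ ∑ p ∈ PR a (a + 3), log p := by
    rw [Chebyshev.theta_eq_sum_Icc, Chebyshev.theta_eq_sum_Icc, sub_le_iff_le_add]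
    refine le_trans ?_ (le_trans (le_add_of_nonneg_right (Finset.sum_nonneg fun p _ =>
      log_natCast_nonneg p)) (Finset.sum_union_inter (f := fun p : ℕ => log p)).le)
    refine Finset.sum_le_sum_of_subset_of_nonneg (fun p hp => ?_) fun p _ _ =>
      log_natCast_nonneg p
    simp only [Finset.mem_filter, Finset.mem_Icc, zero_le, true_and, Finset.mem_union, mem_PR]
      at hp ⊢
    obtain ⟨hp1, hp2⟩ := hp
    have h0 : (0 : ℝ) < p := by exact_mod_cast hp2.pos
    by_cases hc : p ≤ ⌊y⌋₊
    · exact Or.inr ⟨hc, hp2⟩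
    · refine Or.inl ⟨hp2, ?_, ?_⟩
      · rw [not_le, Nat.floor_lt hy0.le] at hc
        rw [← log_exp a]; exact log_le_log hy0 hc.le
      · rw [Nat.le_floor_iff (by positivity)] at hp1
        rw [log_lt_iff_lt_exp h0, exp_add]
        nlinarith
  have h6 : ∀ p ∈ PR a (a + 3), log p * (1 / (21 * y * (a + 3))) ≤ (1 / p : ℝ) := by
    intro p hp
    obtain ⟨h1, h2, h3⟩ := mem_PR.1 hp
    have h0 : (0 : ℝ) < p := by exact_mod_cast h1.pos
    have h7 : exp 3 ≤ 21 := by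
      have : exp 1 ^ 3 ≤ (2.72 : ℝ) ^ 3 := by gcongr; linarith [exp_one_lt_d9]
      rw [← exp_nat_mul] at this; norm_num at this; linarith
    have : (p : ℝ) ≤ 21 * y := by
      rw [log_lt_iff_lt_exp h0, exp_add] at h3; nlinarith
    rw [mul_one_div, div_le_div_iff₀ (by positivity) h0, one_mul, mul_comm]
    exact mul_le_mul this h3.le (by linarith) (by positivity)
  refine le_trans ?_ (Finset.sum_le_sum h6)
  rw [← Finset.sum_mul]
  refine le_trans (le_of_eq ?_) (mul_le_mul_of_nonneg_right (h3.trans h5) (by positivity))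
  field_simp

theorem prime_lower_nat {m : ℕ} (hm : 7 ≤ m) (n : ℕ) (hn : m ≤ n) :
    1 / 63 * log ((n + 1) / (m + 1)) ≤ ∑ p ∈ PR (3 * m) (3 * n), (1 / p : ℝ) := by
  induction n, hn using Nat.le_induction with
  | base => rw [div_self (by positivity), log_one, mul_zero]; positivity
  | succ n hn ih =>
    have h1 : PR (3 * m) (3 * (n + 1 : ℕ)) = PR (3 * m) (3 * n) ∪ PR (3 * n) (3 * n + 3) := by
      ext p
      have : (m : ℝ) ≤ n := by exact_mod_cast hn
      simp only [Finset.mem_union, mem_PR]; push_cast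
      constructor
      · rintro ⟨a, b, c⟩
        by_cases hc : log p < 3 * n
        · exact Or.inl ⟨a, b, hc⟩
        · exact Or.inr ⟨a, not_lt.1 hc, by linarith⟩
      · rintro (⟨a, b, c⟩ | ⟨a, b, c⟩)
        · exact ⟨a, b, by linarith⟩
        · exact ⟨a, by linarith, by linarith⟩
    have h7 : (7 : ℝ) ≤ n := by exact_mod_cast hm.trans hn
    have h2 := prime_step (a := 3 * n) (by linarith)
    rw [h1, Finset.sum_union]
    · have h3 : log (((n + 1 : ℕ) + 1) / (m + 1)) ≤ log ((n + 1) / (m + 1)) + 1 / (n + 1) := by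
        have hp := log_le_sub_one_of_pos (show (0:ℝ) < (n + 2) / (n + 1) by positivity)
        have e1 : ((n + 1 : ℕ) + 1 : ℝ) / (m + 1) = (n + 1) / (m + 1) * ((n + 2) / (n + 1)) := by
          push_cast; field_simp; ring
        rw [e1, log_mul (by positivity) (by positivity)]
        have : ((n : ℝ) + 2) / (n + 1) - 1 = 1 / (n + 1) := by field_simp; ring
        linarith
      have h4 : 1 / (21 * (3 * (n : ℝ) + 3)) = 1 / 63 * (1 / (n + 1)) := by field_simp; ring
      linarith
    · rw [Finset.disjoint_left]
      intro p hp hp'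
      have := (mem_PR.1 hp).2.2; have := (mem_PR.1 hp').2.1
      linarith

theorem prime_lower {a b : ℝ} (ha : 21 ≤ a) (hab : a ≤ b) :
    1 / 63 * (log (b / a) - 2) ≤ ∑ p ∈ PR a b, (1 / p : ℝ) := by
  have ha0 : 0 < a := by linarith
  have hb0 : 0 < b := by linarith
  by_cases hc : ⌈a / 3⌉₊ ≤ ⌊b / 3⌋₊
  · have hm : 7 ≤ ⌈a / 3⌉₊ := by
      have : (7 : ℝ) ≤ ⌈a / 3⌉₊ := le_trans (by linarith) (Nat.le_ceil (a / 3))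
      exact_mod_cast this
    have h1 := prime_lower_nat hm _ hc
    have h2 : (⌈a / 3⌉₊ : ℝ) < a / 3 + 1 := Nat.ceil_lt_add_one (by linarith)
    have h3 : a / 3 ≤ ⌈a / 3⌉₊ := Nat.le_ceil _
    have h4 : (⌊b / 3⌋₊ : ℝ) ≤ b / 3 := Nat.floor_le (by linarith)
    have h5 : b / 3 < ⌊b / 3⌋₊ + 1 := Nat.lt_floor_add_one _
    refine le_trans ?_ (h1.trans ?_)
    · gcongr
      have e3 : log (b / a) - 2 ≤ log (b / a / 3) := by
        rw [log_div (show b / a ≠ 0 by positivity) (by norm_num)]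
        have : log 3 ≤ 2 := by linarith [log_le_sub_one_of_pos (show (0:ℝ) < 3 by norm_num)]
        linarith
      refine e3.trans (log_le_log (by positivity) ?_)
      rw [div_div, div_le_div_iff₀ (by positivity) (by positivity)]
      nlinarith
    · refine Finset.sum_le_sum_of_subset_of_nonneg (fun p hp => ?_) fun p _ _ => by positivity
      obtain ⟨u1, u2, u3⟩ := mem_PR.1 hp
      exact mem_PR.2 ⟨u1, by linarith, by linarith⟩
  · have : log (b / a) ≤ 2 := by
      have h2 : (⌈a / 3⌉₊ : ℝ) < a / 3 + 1 := Nat.ceil_lt_add_one (by linarith)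
      have h5 : b / 3 < ⌊b / 3⌋₊ + 1 := Nat.lt_floor_add_one _
      have h6 : (⌊b / 3⌋₊ : ℝ) + 1 ≤ ⌈a / 3⌉₊ := by exact_mod_cast not_le.1 hc
      have h7 : b / a ≤ 2 := by rw [div_le_iff₀ (by linarith)]; linarith
      linarith [log_le_sub_one_of_pos (show 0 < b / a by apply div_pos <;> linarith)]
    have h0 : 0 ≤ ∑ p ∈ PR a b, (1 / p : ℝ) := by positivity
    linarith

theorem vonMangoldt_window (B : ℝ) (S : Finset ℕ) (s : ℝ)
    (hS : ∀ n ∈ S, 1 ≤ n → |log n - s| ≤ B) :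
    ∑ n ∈ S, ArithmeticFunction.vonMangoldt n / n ≤ 6 * exp (2 * B) := by
  have h1 : ∀ n ∈ S, ArithmeticFunction.vonMangoldt n / n ≤
      (if n ∈ Finset.Icc 0 ⌊exp (s + B)⌋₊ then ArithmeticFunction.vonMangoldt n else 0) *
        exp (B - s) := by
    intro n hn
    rcases Nat.eq_zero_or_pos n with rfl | h0
    · simp
    have h0' : (0 : ℝ) < n := by exact_mod_cast h0
    have h2 := abs_le.1 (hS n hn h0)
    rw [if_pos]
    · rw [div_eq_mul_inv]
      refine mul_le_mul_of_nonneg_left ?_ ArithmeticFunction.vonMangoldt_nonneg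
      rw [inv_eq_one_div, div_le_iff₀ h0']
      rw [← exp_log h0', ← exp_add]; exact one_le_exp (by linarith)
    · simp only [Finset.mem_Icc, zero_le, true_and]
      rw [Nat.le_floor_iff (exp_pos _).le, ← exp_log h0']
      exact exp_le_exp.2 (by linarith)
  refine (Finset.sum_le_sum h1).trans ?_
  rw [← Finset.sum_mul, ← Finset.sum_filter]
  have h2 : ∑ n ∈ S with n ∈ Finset.Icc 0 ⌊exp (s + B)⌋₊, ArithmeticFunction.vonMangoldt n ≤
      (log 4 + 4) * exp (s + B) := by
    refine le_trans ?_ (Chebyshev.psi_le_const_mul_self (exp_pos _).le)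
    rw [Chebyshev.psi_eq_sum_Icc]
    exact Finset.sum_le_sum_of_subset_of_nonneg (fun p hp => (Finset.mem_filter.1 hp).2)
      fun p _ _ => ArithmeticFunction.vonMangoldt_nonneg
  refine (mul_le_mul_of_nonneg_right h2 (exp_pos _).le).trans ?_
  rw [mul_assoc, ← exp_add, show s + B + (B - s) = 2 * B by ring]
  have h4 : log 4 = 2 * log 2 := by rw [show (4 : ℝ) = 2 ^ 2 by norm_num, log_pow]; norm_num
  have hl2 := log_two_lt_d9
  gcongr; linarith
end MR
namespace MR
open Real

theorem KL (z : ℕ → ℂ) (θ : ℕ → ℝ) (δ : ℝ) (N : ℕ) (hδ : 0 < δ) (hz : ∀ n ≤ N, ‖z n‖ ≤ 1)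
    (hs : ∀ n < N, z (n + 1) = z n * Complex.exp (θ n * Complex.I))
    (hm : ∀ n < N, θ (n + 1) ≤ θ n) (hl : ∀ n ≤ N, δ ≤ θ n) (hu : ∀ n ≤ N, θ n ≤ 1) :
    ‖∑ n ∈ Finset.range N, z n‖ ≤ 8 / δ := by
  set e : ℕ → ℂ := fun n => Complex.exp (θ n * Complex.I) with he
  set q : ℕ → ℂ := fun n => (1 - e n)⁻¹ with hq
  have hlow : ∀ n ≤ N, θ n / 2 ≤ ‖1 - e n‖ := by
    intro n hn
    have h1 := Complex.abs_im_le_norm (1 - e n)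
    have h2 : (1 - e n).im = - sin (θ n) := by simp [he, Complex.exp_ofReal_mul_I_im]
    rw [h2, abs_neg] at h1
    have h3 := mul_le_sin (x := θ n) (by linarith [hl n hn]) (by linarith [hu n hn, pi_gt_three])
    have h4 : 1 / 2 ≤ 2 / π := by
      rw [div_le_div_iff₀ (by norm_num) pi_pos]; linarith [pi_lt_four]
    have h5 : 1 / 2 * θ n ≤ 2 / π * θ n :=
      mul_le_mul_of_nonneg_right h4 (by linarith [hl n hn])
    linarith [le_abs_self (sin (θ n))]
  have hne : ∀ n ≤ N, (1 - e n) ≠ 0 := fun n hn => norm_pos_iff.1 (by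
    have := hlow n hn; have := hl n hn; linarith)
  have hqn : ∀ n ≤ N, ‖q n‖ ≤ 2 / θ n := fun n hn => by
    have h0 : 0 < θ n := by have := hl n hn; linarith
    rw [hq, norm_inv, show (2 : ℝ) / θ n = (θ n / 2)⁻¹ by rw [inv_div]]
    exact inv_anti₀ (by positivity) (hlow n hn)
  have hqd : ∀ n < N, ‖q (n + 1) - q n‖ ≤ 4 * (1 / θ (n + 1) - 1 / θ n) := fun n hn => by
    have a1 := hl n hn.le
    have a2 := hl (n + 1) hn
    have h0 : 0 < θ n := by linarith
    have h1 : 0 < θ (n + 1) := by linarith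
    have e1 : q (n + 1) - q n = q (n + 1) * q n * (e (n + 1) - e n) := by
      simp only [hq]; field_simp [hne n hn.le, hne (n + 1) hn]; ring
    have e2 : ‖e (n + 1) - e n‖ ≤ θ n - θ (n + 1) := by
      have : e (n + 1) - e n = - (e (n + 1) *
          (Complex.exp ((θ n - θ (n + 1) : ℝ) * Complex.I) - 1)) := by
        simp only [he]; rw [mul_sub, ← Complex.exp_add]; push_cast; ring_nf
      rw [this, norm_neg, norm_mul]
      simp only [he]
      rw [Complex.norm_exp_ofReal_mul_I, one_mul]
      have := norm_exp_I_mul_ofReal_sub_one_le (x := θ n - θ (n + 1))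
      rw [mul_comm] at this
      exact this.trans (by rw [norm_eq_abs, abs_of_nonneg (by linarith [hm n hn])])
    rw [e1, norm_mul, norm_mul]
    calc ‖q (n + 1)‖ * ‖q n‖ * ‖e (n + 1) - e n‖
        ≤ (2 / θ (n + 1)) * (2 / θ n) * (θ n - θ (n + 1)) := by
          gcongr
          · exact hqn _ hn
          · exact hqn _ hn.le
      _ = _ := by field_simp; ring
  have main : ∀ n ≤ N, ‖(∑ i ∈ Finset.range n, z i) + q n * z n - q 0 * z 0‖ ≤
      4 * (1 / θ n - 1 / θ 0) := by
    intro n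
    induction n with
    | zero => intro _; simp
    | succ n ih =>
      intro hn
      have hn' : n < N := hn
      have e1 : z n - q n * z n = - (q n * z (n + 1)) := by
        rw [hs n hn']
        have := hne n hn'.le
        simp only [hq]
        field_simp
        simp only [he]; ring
      have e2 : (∑ i ∈ Finset.range (n + 1), z i) + q (n + 1) * z (n + 1) - q 0 * z 0 =
          ((∑ i ∈ Finset.range n, z i) + q n * z n - q 0 * z 0) + (q (n + 1) - q n) * z (n + 1) := by
        rw [Finset.sum_range_succ]; linear_combination e1
      rw [e2]
      refine (norm_add_le _ _).trans ?_
      have h1 := ih hn'.le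
      have h2 : ‖(q (n + 1) - q n) * z (n + 1)‖ ≤ 4 * (1 / θ (n + 1) - 1 / θ n) := by
        rw [norm_mul]
        exact (mul_le_of_le_one_right (norm_nonneg _) (hz _ hn)).trans (hqd n hn')
      linarith
  have h1 := main N le_rfl
  have hd : ∀ n ≤ N, 1 / θ n ≤ 1 / δ := fun n hn => one_div_le_one_div_of_le hδ (hl n hn)
  have hqz : ∀ n ≤ N, ‖q n * z n‖ ≤ 2 * (1 / δ) := fun n hn => by
    rw [norm_mul]
    refine (mul_le_of_le_one_right (norm_nonneg _) (hz _ hn)).trans ((hqn n hn).trans ?_)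
    rw [show (2 : ℝ) / θ n = 2 * (1 / θ n) by ring]; linarith [hd n hn]
  have e3 : ∑ i ∈ Finset.range N, z i = ((∑ i ∈ Finset.range N, z i) + q N * z N - q 0 * z 0) -
    q N * z N + q 0 * z 0 := by ring
  rw [e3, show (8 : ℝ) / δ = 8 * (1 / δ) by ring]
  refine (norm_add_le _ _).trans ((add_le_add (norm_sub_le _ _) le_rfl).trans ?_)
  have h00 : 0 < θ 0 := by have := hl 0 (Nat.zero_le _); linarith
  have : 0 < 1 / θ 0 := by positivity
  linarith [hqz N le_rfl, hqz 0 (Nat.zero_le _), hd N le_rfl]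

open ComplexConjugate in
theorem vdc (z : ℕ → ℂ) (H M : ℕ) (hH : 1 ≤ H) (hz : ∀ n, ‖z n‖ ≤ 1)
    (h0 : ∀ n, n < H ∨ M ≤ n → z n = 0) : ‖∑ n ∈ Finset.range M, z n‖ ^ 2 ≤ M ^ 2 / H +
      2 * M / H * ∑ d ∈ Finset.Ico 1 H, ‖∑ n ∈ Finset.range M, z n * conj (z (n + d))‖ := by
  have hsh : ∀ (y : ℕ → ℂ), (∀ n, n < H ∨ M ≤ n → y n = 0) → ∀ h < H,
      ∑ m ∈ Finset.range M, y (m + h) = ∑ n ∈ Finset.range M, y n := by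
    intro y hy h hh
    have h1 : ∑ m ∈ Finset.range M, y (m + h) = ∑ n ∈ Finset.range (M + h), y n := by
      rw [add_comm M h, Finset.sum_range_add]
      rw [Finset.sum_eq_zero (s := Finset.range h), zero_add]
      · simp only [add_comm]
      · intro n hn; exact hy n (Or.inl ((Finset.mem_range.1 hn).trans hh))
    rw [h1, Finset.sum_range_add]
    simp only [add_eq_left]
    exact Finset.sum_eq_zero fun n _ => hy _ (Or.inr (by omega))
  set c : ℕ → ℝ := fun d => ‖∑ n ∈ Finset.range M, z n * conj (z (n + d))‖ with hc
  have hc0 : c 0 ≤ M := by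
    refine (norm_sum_le _ _).trans ?_
    refine (Finset.sum_le_card_nsmul _ _ 1 fun n _ => ?_).trans (by simp)
    simp only [add_zero, norm_mul, RCLike.norm_conj]
    exact mul_le_one₀ (hz n) (norm_nonneg _) (hz n)
  have hpair : ∀ h < H, ∀ h' < H, h ≤ h' →
      ∑ m ∈ Finset.range M, z (m + h) * conj (z (m + h')) =
        ∑ n ∈ Finset.range M, z n * conj (z (n + (h' - h))) := by
    intro h hh h' hh' hle
    rw [← hsh (fun n => z n * conj (z (n + (h' - h)))) (fun n hn => by simp [h0 n hn]) h hh]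
    refine Finset.sum_congr rfl fun m _ => ?_
    rw [show m + h + (h' - h) = m + h' by omega]
  have hpair' : ∀ h < H, ∀ h' < H, ‖∑ m ∈ Finset.range M, z (m + h) * conj (z (m + h'))‖ ≤
      (if h < h' then c (h' - h) else 0) + (if h' < h then c (h - h') else 0) +
        (if h = h' then c 0 else 0) := by
    intro h hh h' hh'
    rcases lt_trichotomy h h' with hl | rfl | hl
    · rw [hpair h hh h' hh' hl.le]; simp [hl, hl.ne, hl.le.not_gt, hc]
    · rw [hpair h hh h hh' le_rfl]; simp [hc]
    · have := hpair h' hh' h hh hl.le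
      have e : ∑ m ∈ Finset.range M, z (m + h) * conj (z (m + h')) =
          conj (∑ m ∈ Finset.range M, z (m + h') * conj (z (m + h))) := by
        rw [map_sum]; refine Finset.sum_congr rfl fun m _ => ?_
        rw [map_mul, Complex.conj_conj, mul_comm]
      rw [e, RCLike.norm_conj, this]; simp [hl, hl.ne', hl.le.not_gt, hc]
  have hcn : ∀ d, 0 ≤ c d := fun d => norm_nonneg _
  set s : ℝ := ∑ d ∈ Finset.Ico 1 H, c d with hs
  have hrow : ∀ h < H, ∑ h' ∈ Finset.range H, ‖∑ m ∈ Finset.range M, z (m + h) * conj (z (m + h'))‖ ≤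
      M + 2 * s := by
    intro h hh
    refine (Finset.sum_le_sum fun h' hh' => hpair' h hh h' (Finset.mem_range.1 hh')).trans ?_
    rw [Finset.sum_add_distrib, Finset.sum_add_distrib]
    have r1 : ∑ h' ∈ Finset.range H, (if h < h' then c (h' - h) else 0) ≤ s := by
      rw [← Finset.sum_filter]
      have : ∑ a ∈ Finset.range H with h < a, c (a - h) =
          ∑ d ∈ Finset.Ico 1 (H - h), c d := by
        refine Finset.sum_nbij' (fun a => a - h) (fun d => d + h) ?_ ?_ ?_ ?_ ?_ <;>
          simp <;> intros <;> omega
      rw [this]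
      exact Finset.sum_le_sum_of_subset_of_nonneg
        (Finset.Ico_subset_Ico le_rfl (by omega)) fun _ _ _ => hcn _
    have r2 : ∑ h' ∈ Finset.range H, (if h' < h then c (h - h') else 0) ≤ s := by
      rw [← Finset.sum_filter]
      have : ∑ a ∈ Finset.range H with a < h, c (h - a) =
          ∑ d ∈ Finset.Ico 1 (h + 1), c d := by
        refine Finset.sum_nbij' (fun a => h - a) (fun d => h - d) ?_ ?_ ?_ ?_ ?_ <;>
          simp <;> intros <;> omega
      rw [this]
      exact Finset.sum_le_sum_of_subset_of_nonneg
        (Finset.Ico_subset_Ico le_rfl (by omega)) fun _ _ _ => hcn _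
    have r3 : ∑ h' ∈ Finset.range H, (if h = h' then c 0 else 0) ≤ M := by
      rw [Finset.sum_ite_eq]; simp [hh, hc0]
    linarith
  have hS : (H : ℂ) * ∑ n ∈ Finset.range M, z n =
      ∑ m ∈ Finset.range M, ∑ h ∈ Finset.range H, z (m + h) := by
    rw [Finset.sum_comm, Finset.sum_congr rfl fun h hh => hsh z h0 h (Finset.mem_range.1 hh)]
    simp
  have hsq : ∑ m ∈ Finset.range M, ‖∑ h ∈ Finset.range H, z (m + h)‖ ^ 2 ≤ H * (M + 2 * s) := by
    have e1 : ((∑ m ∈ Finset.range M, ‖∑ h ∈ Finset.range H, z (m + h)‖ ^ 2 : ℝ) : ℂ) =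
        ∑ h ∈ Finset.range H, ∑ h' ∈ Finset.range H, ∑ m ∈ Finset.range M,
          z (m + h) * conj (z (m + h')) := by
      push_cast
      simp_rw [← Complex.mul_conj', map_sum, Finset.sum_mul_sum]
      rw [Finset.sum_comm]
      refine Finset.sum_congr rfl fun h _ => ?_
      rw [Finset.sum_comm]
    have e2 : ∑ m ∈ Finset.range M, ‖∑ h ∈ Finset.range H, z (m + h)‖ ^ 2 =
      ‖((∑ m ∈ Finset.range M, ‖∑ h ∈ Finset.range H, z (m + h)‖ ^ 2 : ℝ) : ℂ)‖ := by
      rw [Complex.norm_real, norm_of_nonneg (Finset.sum_nonneg fun _ _ => by positivity)]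
    rw [e2, e1]
    refine (norm_sum_le _ _).trans ?_
    refine (Finset.sum_le_card_nsmul _ _ (M + 2 * s) fun h hh => ?_).trans (by simp [mul_add])
    exact (norm_sum_le _ _).trans (hrow h (Finset.mem_range.1 hh))
  have hcs : (H * ‖∑ n ∈ Finset.range M, z n‖) ^ 2 ≤ M * (H * (M + 2 * s)) := by
    have : H * ‖∑ n ∈ Finset.range M, z n‖ ≤
        ∑ m ∈ Finset.range M, ‖∑ h ∈ Finset.range H, z (m + h)‖ := by
      rw [← RCLike.norm_natCast (K := ℂ) H, ← norm_mul, hS]; exact norm_sum_le _ _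
    calc _ ≤ (∑ m ∈ Finset.range M, ‖∑ h ∈ Finset.range H, z (m + h)‖) ^ 2 := by gcongr
      _ ≤ M * ∑ m ∈ Finset.range M, ‖∑ h ∈ Finset.range H, z (m + h)‖ ^ 2 := by
        have := sq_sum_le_card_mul_sum_sq (s := Finset.range M)
          (f := fun m => ‖∑ h ∈ Finset.range H, z (m + h)‖)
        simpa using this
      _ ≤ _ := by gcongr
  have hH0 : (0 : ℝ) < H := by exact_mod_cast hH
  have : (M : ℝ) ^ 2 / H + 2 * M / H * s = (M * (H * (M + 2 * s))) / H ^ 2 := by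
    field_simp
  rw [this, le_div_iff₀ (by positivity)]
  linarith [hcs]

open ComplexConjugate in
def Zl : List ℕ → (ℕ → ℂ) → ℕ → ℂ
  | [], z => z
  | d :: l, z => Zl l (fun n => z n * conj (z (n + d)))

theorem vdc_iter (j : ℕ) : ∃ C, 0 < C ∧ ∀ (H M : ℕ) (z : ℕ → ℂ) (β : ℝ), 1 ≤ H → H ≤ M → 0 ≤ β →
    (∀ n, ‖z n‖ ≤ 1) → (∀ n, n < H ∨ M ≤ n → z n = 0) →
    (∀ l : List ℕ, l.length = j → (∀ d ∈ l, 1 ≤ d ∧ d < H) →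
      ‖∑ n ∈ Finset.range M, Zl l z n‖ ≤ M * β / l.prod) →
    (‖∑ n ∈ Finset.range M, z n‖ / M) ^ 2 ^ j ≤ C * (1 / H + β * ((1 + Real.log H) / H) ^ j) := by
  induction j with
  | zero =>
    refine ⟨1, one_pos, ?_⟩
    intro H M z β hH hM hβ hz h0 hl
    have hM0 : (0 : ℝ) < M := by exact_mod_cast hH.trans hM
    have := hl [] rfl (by simp)
    simp only [Zl, List.prod_nil, Nat.cast_one, div_one] at this
    simp only [pow_zero, pow_one, mul_one, one_mul]
    rw [div_le_iff₀ hM0]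
    have : 0 ≤ (1 : ℝ) / H * M := by positivity
    nlinarith
  | succ j ih =>
    obtain ⟨C, hC, ih⟩ := ih
    refine ⟨2 ^ 2 ^ j * (1 + 2 ^ 2 ^ j * C), by positivity, ?_⟩
    intro H M z β hH hM hβ hz h0 hl
    have hM0 : (0 : ℝ) < M := by exact_mod_cast hH.trans hM
    have hH0 : (0 : ℝ) < H := by exact_mod_cast hH
    have hH1 : (1 : ℝ) ≤ H := by exact_mod_cast hH
    have hlog : 0 ≤ Real.log H := Real.log_nonneg hH1
    set G := (1 + Real.log H) / H with hG
    have hG0 : 0 ≤ G := by positivity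
    set c : ℕ → ℝ := fun d => ‖∑ n ∈ Finset.range M, z n * (starRingEnd ℂ) (z (n + d))‖ with hc
    have hv := vdc z H M hH hz h0
    have hcd : ∀ d ∈ Finset.Ico 1 H, (c d / M) ^ 2 ^ j ≤ C * (1 / H + β / d * G ^ j) := by
      intro d hd
      rw [Finset.mem_Ico] at hd
      have hd0 : (0 : ℝ) < d := by exact_mod_cast hd.1
      refine ih H M _ (β / d) hH hM (by positivity) ?_ ?_ ?_
      · intro n; rw [norm_mul, RCLike.norm_conj]
        exact mul_le_one₀ (hz n) (norm_nonneg _) (hz _)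
      · intro n hn; simp [h0 n hn]
      · intro l hl1 hl2
        have := hl (d :: l) (by simp [hl1]) (by
          intro e he; rcases List.mem_cons.1 he with rfl | he
          · exact hd
          · exact hl2 e he)
        simp only [Zl, List.prod_cons, Nat.cast_mul] at this
        refine this.trans (le_of_eq ?_)
        field_simp
    have hharm : ∑ d ∈ Finset.Ico 1 H, (1 / d : ℝ) ≤ 1 + Real.log H := by
      have h1 := harmonic_le_one_add_log H
      rw [harmonic_eq_sum_Icc] at h1
      push_cast at h1
      refine le_trans ?_ h1
      simp only [one_div]
      exact Finset.sum_le_sum_of_subset_of_nonneg Finset.Ico_subset_Icc_self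
        fun _ _ _ => by positivity
    set A := (∑ d ∈ Finset.Ico 1 H, c d / M) / H with hA
    have hA0 : 0 ≤ A := div_nonneg (Finset.sum_nonneg fun _ _ => by positivity) hH0.le
    have h1 : (‖∑ n ∈ Finset.range M, z n‖ / M) ^ 2 ≤ 1 / H + 2 * A := by
      rw [div_pow, div_le_iff₀ (by positivity)]
      refine hv.trans (le_of_eq ?_)
      rw [hA, ← Finset.sum_div]; field_simp; rfl
    have hApow : A ^ 2 ^ j ≤ C * (1 / H + β * G ^ (j + 1)) := by
      have h2 : A ^ 2 ^ j ≤ (∑ d ∈ Finset.Ico 1 H, (c d / M) ^ 2 ^ j) / H := by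
        have h4 := Real.pow_arith_mean_le_arith_mean_pow (Finset.range H) (fun _ => (1 / H : ℝ))
          (fun d => if 1 ≤ d then c d / M else 0) (fun _ _ => by positivity)
          (by simp [hH0.ne']) (fun d _ => by split_ifs <;> positivity) (2 ^ j)
        have e : ∀ f : ℕ → ℝ, f 0 = 0 → ∑ d ∈ Finset.range H, f d = ∑ d ∈ Finset.Ico 1 H, f d := by
          intro f hf
          rw [Finset.range_eq_Ico, Finset.sum_eq_sum_Ico_succ_bot (by omega), hf, zero_add]
        rw [e _ (by simp), e _ (by simp)] at h4
        have e2 : A = ∑ k ∈ Finset.Ico 1 H, 1 / (H : ℝ) * (if 1 ≤ k then c k / M else 0) := by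
          rw [hA, Finset.sum_div]
          refine Finset.sum_congr rfl fun d hd => ?_
          rw [if_pos (Finset.mem_Ico.1 hd).1]; ring
        rw [e2]
        refine h4.trans (le_of_eq ?_)
        rw [Finset.sum_div]
        refine Finset.sum_congr rfl fun d hd => ?_
        rw [if_pos (Finset.mem_Ico.1 hd).1]; ring
      refine h2.trans ?_
      rw [div_le_iff₀ hH0]
      refine (Finset.sum_le_sum hcd).trans ?_
      rw [← Finset.mul_sum, Finset.sum_add_distrib, ← Finset.sum_mul, mul_assoc]
      refine mul_le_mul_of_nonneg_left ?_ hC.le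
      rw [add_mul]
      refine add_le_add ?_ ?_
      · simp only [Finset.sum_const, Nat.card_Ico, nsmul_eq_mul]
        rw [Nat.cast_sub hH, div_mul_cancel₀ _ hH0.ne', mul_one_div, div_le_one hH0]
        simp
      · have : ∑ d ∈ Finset.Ico 1 H, β / d = β * ∑ d ∈ Finset.Ico 1 H, (1 / d : ℝ) := by
          rw [Finset.mul_sum]; simp [div_eq_mul_inv]
        rw [this]
        calc _ ≤ β * (1 + Real.log H) * G ^ j := by gcongr
          _ = _ := by rw [pow_succ, hG]; field_simp
    have h3 : (‖∑ n ∈ Finset.range M, z n‖ / M) ^ 2 ^ (j + 1) ≤ (1 / H + 2 * A) ^ 2 ^ j := by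
      rw [show 2 ^ (j + 1) = 2 * 2 ^ j by ring, pow_mul]
      gcongr
    refine h3.trans ?_
    have h4 : (1 / H + 2 * A) ^ 2 ^ j ≤ 2 ^ 2 ^ j * ((1 / H : ℝ) ^ 2 ^ j + (2 * A) ^ 2 ^ j) := by
      have a1 : 1 / H + 2 * A ≤ 2 * max (1 / H : ℝ) (2 * A) := by
        linarith [le_max_left (1 / H : ℝ) (2 * A), le_max_right (1 / H : ℝ) (2 * A)]
      refine (pow_le_pow_left₀ (by positivity) a1 _).trans ?_
      rw [mul_pow]
      gcongr
      rcases max_cases (1 / H : ℝ) (2 * A) with h | h <;> rw [h.1]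
      · have : 0 ≤ (2 * A) ^ 2 ^ j := by positivity
        linarith
      · have : 0 ≤ (1 / H : ℝ) ^ 2 ^ j := by positivity
        linarith
    refine h4.trans ?_
    have h5 : (1 / H : ℝ) ^ 2 ^ j ≤ 1 / H := by
      refine pow_le_of_le_one (by positivity) ?_ (by positivity)
      rw [div_le_one hH0]; exact hH1
    rw [mul_pow, mul_assoc]
    have h6 : 0 ≤ β * G ^ (j + 1) := by positivity
    have h7 : (2 : ℝ) ^ 2 ^ j * A ^ 2 ^ j ≤ 2 ^ 2 ^ j * (C * (1 / H + β * G ^ (j + 1))) := by gcongr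
    gcongr
    nlinarith
end MR
namespace MR
open Real

def Dl : List ℕ → (ℝ → ℝ) → ℝ → ℝ
  | [], f => f
  | d :: l, f => Dl l (fun x => f x - f (x + d))

theorem Dl_sub (l : List ℕ) : ∀ (f : ℝ → ℝ) (h : ℝ) (x : ℝ),
    Dl l (fun x => f x - f (x + h)) x = Dl l f x - Dl l f (x + h) := by
  induction l with
  | nil => intro f h x; rfl
  | cons d l ih =>
    intro f h x
    simp only [Dl]
    rw [← ih (fun x => f x - f (x + d)) h x]
    congr 1
    funext y
    rw [show y + h + (d : ℝ) = y + d + h by ring]; ring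

theorem Dl_mul (l : List ℕ) : ∀ (f : ℝ → ℝ) (c : ℝ) (x : ℝ),
    Dl l (fun x => c * f x) x = c * Dl l f x := by
  induction l with
  | nil => intro f h x; rfl
  | cons d l ih =>
    intro f c x
    simp only [Dl]
    rw [← ih]
    congr 1
    funext y; ring

theorem Dl_deriv (l : List ℕ) : ∀ (f f' : ℝ → ℝ), (∀ x > 0, HasDerivAt f (f' x) x) →
    ∀ x > 0, HasDerivAt (Dl l f) (Dl l f' x) x := by
  induction l with
  | nil => intro f f' h x hx; exact h x hx
  | cons d l ih =>
    intro f f' h x hx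
    simp only [Dl]
    refine ih _ _ (fun y hy => ?_) x hx
    exact (h y hy).sub (HasDerivAt.comp_add_const y (d : ℝ) (h (y + d) (by positivity)))

theorem Dl_bounds (l : List ℕ) : ∀ (j : ℕ) (x : ℝ), 0 < x →
    (l.prod : ℝ) * (j + 1).ascFactorial l.length * ((x + l.sum) ^ (j + 1 + l.length))⁻¹ ≤
      Dl l (fun x => (x ^ (j + 1))⁻¹) x ∧
    Dl l (fun x => (x ^ (j + 1))⁻¹) x ≤
      (l.prod : ℝ) * (j + 1).ascFactorial l.length * (x ^ (j + 1 + l.length))⁻¹ := by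
  induction l with
  | nil => intro j x hx; simp [Dl]
  | cons d l ih =>
    intro j x hx
    simp only [Dl]
    rw [Dl_sub]
    have hd : ∀ y > 0, HasDerivAt (Dl l (fun x => (x ^ (j + 1))⁻¹))
        (-((j + 1 : ℝ) * Dl l (fun x => (x ^ (j + 2))⁻¹) y)) y := by
      intro y hy
      have := Dl_deriv l (fun x => (x ^ (j + 1))⁻¹) (fun x => (-(j + 1 : ℝ)) * (x ^ (j + 2))⁻¹) (by
        intro z hz
        have := (hasDerivAt_pow (j + 1) z).inv (by positivity)
        refine this.congr_deriv ?_
        have : z ≠ 0 := ne_of_gt hz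
        have e : (z ^ (j + 1)) ^ 2 = z ^ j * z ^ (j + 2) := by ring
        rw [e]; simp only [Nat.add_sub_cancel]; push_cast
        field_simp) y hy
      rw [Dl_mul] at this
      convert this using 1; ring
    have hasc : (((j + 1).ascFactorial (l.length + 1) : ℕ) : ℝ) =
        (j + 1) * ((j + 1 + 1).ascFactorial l.length : ℕ) := by
      have := Nat.succ_ascFactorial (j + 1) l.length
      rw [Nat.ascFactorial_succ]
      exact_mod_cast this.symm
    rcases Nat.eq_zero_or_pos d with rfl | hdp
    · simp
    have hd0 : (0 : ℝ) < d := by exact_mod_cast hdp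
    obtain ⟨ξ, hξ, he⟩ := exists_hasDerivAt_eq_slope (Dl l (fun x => (x ^ (j + 1))⁻¹))
      (fun y => -((j + 1 : ℝ) * Dl l (fun x => (x ^ (j + 2))⁻¹) y)) (a := x) (b := x + d)
      (by linarith) (fun y hy => (hd y (hx.trans_le hy.1)).continuousAt.continuousWithinAt)
      (fun y hy => hd y (hx.trans hy.1))
    rw [eq_div_iff (by linarith)] at he
    have hξ0 : 0 < ξ := hx.trans hξ.1
    obtain ⟨i1, i2⟩ := ih (j + 1) ξ hξ0
    have e : Dl l (fun x => (x ^ (j + 1))⁻¹) x - Dl l (fun x => (x ^ (j + 1))⁻¹) (x + d) =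
      d * (j + 1) * Dl l (fun x => (x ^ (j + 2))⁻¹) ξ := by linear_combination he
    rw [e, List.prod_cons, List.length_cons, hasc, List.sum_cons]
    simp only [Nat.cast_mul, Nat.cast_add]
    have hp : j + 1 + (l.length + 1) = j + 1 + 1 + l.length := by ring
    rw [hp]
    constructor
    · refine le_trans ?_ (mul_le_mul_of_nonneg_left i1 (by positivity))
      have : ((x + (d + (l.sum : ℝ))) ^ (j + 1 + 1 + l.length))⁻¹ ≤
          ((ξ + (l.sum : ℝ)) ^ (j + 1 + 1 + l.length))⁻¹ := by
        apply inv_anti₀ (by positivity)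
        apply pow_le_pow_left₀ (by positivity)
        linarith [hξ.2]
      calc _ = (d : ℝ) * (j + 1) * (l.prod * ((j + 1 + 1).ascFactorial l.length : ℕ) *
            ((x + (d + (l.sum : ℝ))) ^ (j + 1 + 1 + l.length))⁻¹) := by ring
        _ ≤ _ := by gcongr
    · refine (mul_le_mul_of_nonneg_left i2 (by positivity)).trans ?_
      have : (ξ ^ (j + 1 + 1 + l.length))⁻¹ ≤ (x ^ (j + 1 + 1 + l.length))⁻¹ := by
        apply inv_anti₀ (by positivity)
        exact pow_le_pow_left₀ (by positivity) hξ.1.le _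
      calc _ ≤ (d : ℝ) * (j + 1) * (l.prod * ((j + 1 + 1).ascFactorial l.length : ℕ) *
            (x ^ (j + 1 + 1 + l.length))⁻¹) := by gcongr
        _ = _ := by ring

theorem Zl_exp (l : List ℕ) : ∀ (f : ℝ → ℝ) (a b n : ℕ),
    Zl l (fun n : ℕ => if a ≤ n ∧ n < b then Complex.exp (f n * Complex.I) else 0) n =
      if a ≤ n ∧ n + l.sum < b then Complex.exp (Dl l f n * Complex.I) else 0 := by
  induction l with
  | nil => intro f a b n; simp [Zl, Dl]
  | cons d l ih =>
    intro f a b n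
    have := ih (fun x => f x - f (x + d)) a (b - d) n
    simp only [Zl, Dl, List.sum_cons]
    have c : (a ≤ n ∧ n + (d + l.sum) < b) ↔ (a ≤ n ∧ n + l.sum < b - d) := by omega
    simp only [c]
    rw [← this]
    congr 1
    funext m
    by_cases h1 : a ≤ m ∧ m < b - d
    · rw [if_pos (by omega), if_pos (by omega), if_pos h1, ← Complex.exp_conj, ← Complex.exp_add]
      congr 1
      simp only [map_mul, Complex.conj_ofReal, Complex.conj_I]
      push_cast; ring
    · rw [if_neg h1]
      by_cases h2 : a ≤ m ∧ m < b
      · rw [if_neg (c := a ≤ m + d ∧ _) (by omega)]; simp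
      · rw [if_neg h2, zero_mul]

theorem Dl_KL (l : List ℕ) (hl : ∀ d ∈ l, 1 ≤ d) (t Y : ℝ) (ht : 0 < t) (hY : 1 ≤ Y) (a b : ℕ)
    (ha : Y ≤ a)
    (hu : t * l.prod * l.length.factorial ≤ Y ^ (l.length + 1)) :
    ‖∑ n ∈ Finset.range b, Zl l (fun n : ℕ => if a ≤ n ∧ n < b then
      Complex.exp ((t * log n : ℝ) * Complex.I) else 0) n‖ ≤
      8 * (b + 1 : ℝ) ^ (l.length + 1) / (t * l.prod * l.length.factorial) := by
  have hprod : (0 : ℝ) < l.prod := by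
    have : 0 < l.prod := List.prod_pos fun d hd => hl d hd
    exact_mod_cast this
  have hf : (0 : ℝ) < l.length.factorial := by exact_mod_cast Nat.factorial_pos _
  rw [Finset.sum_congr rfl fun n _ => Zl_exp l (fun x => t * log x) a b n]
  by_cases hab : b ≤ a + l.sum
  · rw [Finset.sum_eq_zero]
    · rw [norm_zero]; positivity
    · intro n _; rw [if_neg (by omega)]
  push Not at hab
  set N := b - l.sum - a with hN
  have e1 : ∑ n ∈ Finset.range b, (if a ≤ n ∧ n + l.sum < b then
      Complex.exp ((Dl l (fun x => t * log x) n : ℝ) * Complex.I) else 0) =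
      ∑ m ∈ Finset.range N, Complex.exp ((Dl l (fun x => t * log x) (a + m : ℕ) : ℝ) * Complex.I) := by
    rw [← Finset.sum_filter]
    refine Finset.sum_nbij' (fun n => n - a) (fun m => a + m) ?_ ?_ ?_ ?_ ?_ <;>
      simp <;> intros <;> try omega
    rename_i h1 h2
    rw [Nat.cast_sub h1]; simp
  rw [e1]
  set G := Dl l log with hG
  have hdG : ∀ x > 0, HasDerivAt G (Dl l (fun x => (x ^ (0 + 1))⁻¹) x) x := by
    intro x hx
    refine Dl_deriv l _ _ (fun y hy => ?_) x hx
    simpa using hasDerivAt_log hy.ne'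
  have hfac : (0 + 1).ascFactorial l.length = l.length.factorial := by
    rw [zero_add, Nat.one_ascFactorial]
  simp only [Dl_mul]
  have hn0 : ∀ m : ℕ, 0 < ((a + m : ℕ) : ℝ) := fun m => by push_cast; linarith [Nat.cast_nonneg (α := ℝ) m]
  have hθ : ∀ m ≤ N, t * l.prod * l.length.factorial / (b + 1 : ℝ) ^ (l.length + 1) ≤
      t * (G (a + m + 1 : ℕ) - G (a + m : ℕ)) ∧ t * (G (a + m + 1 : ℕ) - G (a + m : ℕ)) ≤ 1 := by
    intro m hm
    obtain ⟨ξ, hξ, he⟩ := exists_hasDerivAt_eq_slope G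
      (fun y => Dl l (fun x => (x ^ (0 + 1))⁻¹) y) (a := (a + m : ℕ)) (b := (a + m + 1 : ℕ))
      (by push_cast; linarith)
      (fun y hy => (hdG y ((hn0 m).trans_le hy.1)).continuousAt.continuousWithinAt)
      (fun y hy => hdG y ((hn0 m).trans hy.1))
    have hd1 : ((a + m + 1 : ℕ) : ℝ) - (a + m : ℕ) = 1 := by push_cast; ring
    rw [hd1, div_one] at he
    obtain ⟨i1, i2⟩ := Dl_bounds l 0 ξ ((hn0 m).trans hξ.1)
    rw [hfac, zero_add, add_comm 1] at i1 i2
    rw [← he]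
    have hξ1 : Y ≤ ξ := by
      have := hξ.1; push_cast at this; linarith [Nat.cast_nonneg (α := ℝ) m]
    have hξ2 : ξ + l.sum ≤ b + 1 := by
      have h1 := hξ.2
      have : (a + m + 1) + l.sum ≤ b + 1 := by omega
      have : (((a + m + 1 : ℕ) : ℝ)) + l.sum ≤ b + 1 := by exact_mod_cast this
      linarith
    have hξ0 : 0 < ξ := by linarith
    constructor
    · calc _ = t * (l.prod * l.length.factorial * ((b + 1 : ℝ) ^ (l.length + 1))⁻¹) := by
            rw [div_eq_mul_inv]; ring
        _ ≤ t * (l.prod * l.length.factorial * ((ξ + l.sum) ^ (l.length + 1))⁻¹) := by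
          gcongr
        _ ≤ _ := by gcongr
    · calc _ ≤ t * (l.prod * l.length.factorial * (ξ ^ (l.length + 1))⁻¹) := by gcongr
        _ ≤ t * (l.prod * l.length.factorial * (Y ^ (l.length + 1))⁻¹) := by gcongr
        _ = (t * l.prod * l.length.factorial) / Y ^ (l.length + 1) := by rw [div_eq_mul_inv]; ring
        _ ≤ 1 := by rw [div_le_one (by positivity)]; exact hu
  have hb : (0 : ℝ) < (b + 1 : ℝ) ^ (l.length + 1) := by positivity
  have := KL (fun m => Complex.exp ((t * G (a + m : ℕ) : ℝ) * Complex.I))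
    (fun m => t * (G (a + m + 1 : ℕ) - G (a + m : ℕ)))
    (t * l.prod * l.length.factorial / (b + 1 : ℝ) ^ (l.length + 1)) N (by positivity)
    (fun n _ => by rw [Complex.norm_exp_ofReal_mul_I])
    (fun n _ => by
      rw [← Complex.exp_add]; congr 1
      rw [show a + (n + 1) = a + n + 1 by ring]
      push_cast; ring)
    (fun n _ => by
      refine mul_le_mul_of_nonneg_left ?_ ht.le
      have hmono : MonotoneOn (fun x => G x - G (x + 1)) (Set.Ioi 0) := by
        have hdd : ∀ x > 0, HasDerivAt (fun x => G x - G (x + 1))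
            (Dl (1 :: l) (fun x => (x ^ (0 + 1))⁻¹) x) x := by
          intro x hx
          simp only [Dl]
          rw [Dl_sub]
          have := (hdG x hx).sub (HasDerivAt.comp_add_const x 1 (hdG (x + 1) (by positivity)))
          rw [Nat.cast_one]; exact this
        refine monotoneOn_of_deriv_nonneg (convex_Ioi 0)
          (fun x hx => (hdd x hx).continuousAt.continuousWithinAt)
          (fun x hx => by
            rw [interior_Ioi] at hx
            exact (hdd x hx).differentiableAt.differentiableWithinAt) ?_
        intro x hx
        rw [interior_Ioi] at hx
        rw [(hdd x hx).deriv]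
        refine le_trans ?_ (Dl_bounds (1 :: l) 0 x hx).1
        have : (0 : ℝ) < x := hx
        positivity
      have := hmono (a := (a + n : ℕ)) (b := (a + (n + 1) : ℕ)) (hn0 n) (hn0 (n + 1)) (by push_cast; linarith)
      simp only [Nat.cast_add, Nat.cast_one, ← add_assoc] at this ⊢
      linarith)
    (fun n hn => (hθ n hn).1) (fun n hn => (hθ n hn).2)
  refine this.trans (le_of_eq ?_)
  rw [div_div_eq_mul_div]
end MR
namespace MR
open Real

theorem weyl_pos (j : ℕ) (hj : 1 ≤ j) (B : ℝ) (hB : 1 ≤ B) : ∃ C c, 0 < C ∧ 0 < c ∧ ∀ y ≥ 0,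
    ∀ a b : ℕ, exp y ≤ a → b ≤ B * exp y → ∀ t, exp (y / 2) ≤ t → t ≤ exp (j * y) →
    ‖∑ n ∈ Finset.Ico a b, Complex.exp ((t * log n : ℝ) * Complex.I)‖ ≤ C * exp (y - c * y) := by
  obtain ⟨C1, hC1, hv⟩ := vdc_iter j
  have hj0 : (0 : ℝ) < j := by exact_mod_cast hj
  have hj1 : (1 : ℝ) ≤ j := by exact_mod_cast hj
  set C3 := C1 * (2 + 8 * (2 * B) ^ (j + 1) * 2 ^ j * (4 * j) ^ j) with hC3
  have hC30 : 0 < C3 := by positivity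
  set c := 1 / (4 * j) / (2 : ℝ) ^ j with hc
  have hc0 : 0 < c := by positivity
  set y0 := 2 * log j.factorial with hy0
  refine ⟨B * exp (c * y0) + (1 + C3) * B, c, by positivity, hc0, ?_⟩
  intro y hy a b ha hb t ht1 ht2
  have htriv : ‖∑ n ∈ Finset.Ico a b, Complex.exp ((t * log n : ℝ) * Complex.I)‖ ≤ b := by
    refine (norm_sum_le _ _).trans ?_
    simp only [Complex.norm_exp_ofReal_mul_I, Finset.sum_const, Nat.card_Ico, nsmul_eq_mul, mul_one]
    exact_mod_cast Nat.sub_le _ _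
  rcases lt_or_ge y y0 with hlt | hge
  · refine htriv.trans (hb.trans ?_)
    have : exp y ≤ exp (c * y0) * exp (y - c * y) := by
      rw [← exp_add]; apply exp_le_exp.2; nlinarith
    calc B * exp y ≤ B * (exp (c * y0) * exp (y - c * y)) := by gcongr
      _ = B * exp (c * y0) * exp (y - c * y) := by ring
      _ ≤ _ := by gcongr; linarith [show 0 ≤ (1 + C3) * B by positivity]
  rcases Nat.le_or_ge b a with hba | hab
  · rw [Finset.Ico_eq_empty_of_le hba]; simp; positivity
  have ht0 : 0 < t := (exp_pos _).trans_le ht1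
  have hY1 : 1 ≤ exp y := one_le_exp hy
  have hlt1 : y / 2 ≤ log t := (le_log_iff_exp_le ht0).2 ht1
  have hlt2 : log t ≤ j * y := (log_le_iff_le_exp ht0).2 ht2
  set h := ((j + 1 / 2) * y - log t) / j with hh
  have hjh : j * h = (j + 1 / 2) * y - log t := by rw [hh]; field_simp
  have hh1 : y / (2 * j) ≤ h := by
    rw [hh, div_le_div_iff₀ (by positivity) hj0]; nlinarith
  have hh2 : h ≤ y := by rw [hh, div_le_iff₀ hj0]; nlinarith
  have hh0 : 0 ≤ h := le_trans (by positivity) hh1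
  set H := ⌊exp h⌋₊ with hH
  have hH1 : 1 ≤ H := Nat.le_floor (by simpa using hh0)
  have hH1' : (1 : ℝ) ≤ H := by exact_mod_cast hH1
  have hHle : (H : ℝ) ≤ exp h := Nat.floor_le (exp_pos _).le
  have hHge : exp h ≤ 2 * H := by linarith [Nat.lt_floor_add_one (exp h)]
  have hHa : H ≤ a := by
    have : (H : ℝ) ≤ a := hHle.trans ((exp_le_exp.2 hh2).trans ha)
    exact_mod_cast this
  have hb1 : exp y ≤ b := ha.trans (by exact_mod_cast hab)
  have hb0 : (0 : ℝ) < b := (exp_pos y).trans_le hb1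
  have hfac : (1 : ℝ) ≤ j.factorial := by exact_mod_cast Nat.factorial_pos _
  set z : ℕ → ℂ := fun n : ℕ => if a ≤ n ∧ n < b then Complex.exp ((t * log n : ℝ) * Complex.I) else 0 with hz
  set β := 8 * (b + 1 : ℝ) ^ (j + 1) / (t * j.factorial * b) with hβ
  have hsum : ∑ n ∈ Finset.range b, z n = ∑ n ∈ Finset.Ico a b, Complex.exp ((t * log n : ℝ) * Complex.I) := by
    rw [hz, ← Finset.sum_filter]
    refine Finset.sum_congr ?_ fun _ _ => rfl
    ext n; simp only [Finset.mem_filter, Finset.mem_range, Finset.mem_Ico]; omega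
  have hmain := hv H b z β hH1 (hHa.trans hab) (by positivity) (by
    intro n; simp only [hz]; split_ifs
    · rw [Complex.norm_exp_ofReal_mul_I]
    · simp) (by
    intro n hn; simp only [hz]; rw [if_neg (by omega)]) (by
    intro l hl1 hl2
    have hp : (l.prod : ℝ) ≤ exp h ^ j := by
      have h1 : l.prod ≤ H ^ l.length := List.prod_le_pow_card l H fun d hd => (hl2 d hd).2.le
      rw [hl1] at h1
      calc (l.prod : ℝ) ≤ (H : ℝ) ^ j := by exact_mod_cast h1
        _ ≤ _ := by gcongr
    have hp0 : (0 : ℝ) < l.prod := by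
      have : 0 < l.prod := List.prod_pos fun d hd => (hl2 d hd).1
      exact_mod_cast this
    have := Dl_KL l (fun d hd => (hl2 d hd).1) t (exp y) ht0 hY1 a b ha (by
      rw [hl1]
      have e1 : t * exp h ^ j = exp ((j + 1 / 2) * y) := by
        rw [← exp_nat_mul, hjh, exp_sub, exp_log ht0]; field_simp
      have e2 : (j.factorial : ℝ) ≤ exp (y / 2) := by
        rw [← log_le_iff_le_exp (by positivity)]; linarith
      calc t * l.prod * j.factorial ≤ t * exp h ^ j * exp (y / 2) := by gcongr
        _ = _ := by rw [e1, ← exp_add, ← exp_nat_mul]; congr 1; push_cast; ring)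
    rw [hl1] at this
    refine this.trans (le_of_eq ?_)
    rw [hβ]; field_simp)
  rw [hsum] at hmain
  set S := ∑ n ∈ Finset.Ico a b, Complex.exp ((t * log n : ℝ) * Complex.I) with hS
  have b1 : (1 : ℝ) / H ≤ 2 * exp (-(1 / (4 * j) * y)) := by
    calc (1 : ℝ) / H ≤ 2 * exp (-h) := by
          rw [exp_neg, div_le_iff₀ (by positivity), mul_assoc, inv_mul_eq_div, mul_div_assoc',
            le_div_iff₀ (exp_pos _)]; linarith
      _ ≤ _ := by
        gcongr
        refine le_trans (le_of_eq ?_) (le_trans (mul_le_mul_of_nonneg_left hh1 (by norm_num : (0 : ℝ) ≤ 1 / 2)) (by linarith))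
        field_simp; ring
  have b2 : β ≤ 8 * (2 * B) ^ (j + 1) * exp (j * y) / t := by
    have hb2 : (b + 1 : ℝ) ≤ 2 * B * exp y := by nlinarith
    calc β ≤ 8 * (2 * B * exp y) ^ (j + 1) / (t * 1 * exp y) := by rw [hβ]; gcongr
      _ = _ := by rw [mul_pow, pow_succ (exp y), exp_nat_mul]; field_simp
  have b3 : ((1 + log H) / H) ^ j ≤ 2 ^ j * (4 * j) ^ j * exp (y / 4) * (t * exp (-((j + 1 / 2) * y))) := by
    have l1 : 1 + log H ≤ 4 * j * exp (y / (4 * j)) := by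
      have : log H ≤ y := (log_le_iff_le_exp (by positivity)).2 (hHle.trans (exp_le_exp.2 hh2))
      have h2 := add_one_le_exp (y / (4 * j))
      have h3 : 4 * j * (y / (4 * j) + 1) ≤ 4 * j * exp (y / (4 * j)) := by gcongr
      have h4 : 4 * j * (y / (4 * j) + 1) = y + 4 * j := by field_simp
      linarith
    have l2 : (1 + log H) / H ≤ 2 * (4 * j * exp (y / (4 * j))) * exp (-h) := by
      rw [exp_neg, ← div_eq_mul_inv, div_le_div_iff₀ (by positivity) (exp_pos _)]
      have : 0 ≤ log H := log_nonneg hH1'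
      calc (1 + log H) * exp h ≤ (4 * j * exp (y / (4 * j))) * (2 * H) := by gcongr
        _ = _ := by ring
    have : 0 ≤ log H := log_nonneg hH1'
    refine (pow_le_pow_left₀ (by positivity) l2 j).trans (le_of_eq ?_)
    rw [mul_pow, mul_pow, mul_pow, ← exp_nat_mul, ← exp_nat_mul, show (j : ℝ) * (y / (4 * j)) = y / 4 by field_simp,
      show (j : ℝ) * -h = log t + -((j + 1 / 2) * y) by linear_combination -hjh, exp_add, exp_log ht0]
    ring
  have b4 : β * ((1 + log H) / H) ^ j ≤ 8 * (2 * B) ^ (j + 1) * 2 ^ j * (4 * j) ^ j * exp (-(1 / (4 * j) * y)) := by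
    have : 0 ≤ log H := log_nonneg hH1'
    calc _ ≤ (8 * (2 * B) ^ (j + 1) * exp (j * y) / t) *
          (2 ^ j * (4 * j) ^ j * exp (y / 4) * (t * exp (-((j + 1 / 2) * y)))) := by gcongr
      _ = 8 * (2 * B) ^ (j + 1) * 2 ^ j * (4 * j) ^ j *
          (exp (j * y) * exp (y / 4) * exp (-((j + 1 / 2) * y))) := by field_simp
      _ ≤ _ := by
        rw [← exp_add, ← exp_add]
        gcongr
        have : 1 / (4 * (j : ℝ)) * y ≤ 1 / 4 * y := by
          gcongr; linarith
        linarith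
  have b5 : (‖S‖ / b) ^ 2 ^ j ≤ ((1 + C3) * exp (-(c * y))) ^ 2 ^ j := by
    calc _ ≤ C1 * (1 / H + β * ((1 + log H) / H) ^ j) := hmain
      _ ≤ C1 * (2 * exp (-(1 / (4 * j) * y)) +
          8 * (2 * B) ^ (j + 1) * 2 ^ j * (4 * j) ^ j * exp (-(1 / (4 * j) * y))) := by gcongr
      _ = C3 * exp (-(1 / (4 * j) * y)) := by rw [hC3]; ring
      _ ≤ _ := by
        rw [mul_pow, ← exp_nat_mul]
        have e : ((2 ^ j : ℕ) : ℝ) * -(c * y) = -(1 / (4 * j) * y) := by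
          rw [hc]; push_cast; field_simp
        rw [e]
        gcongr
        have : 1 + C3 ≤ (1 + C3) ^ 2 ^ j := le_self_pow₀ (by linarith) (by positivity)
        linarith
  have b6 := le_of_pow_le_pow_left₀ (by positivity) (by positivity) b5
  rw [div_le_iff₀ hb0] at b6
  calc ‖S‖ ≤ (1 + C3) * exp (-(c * y)) * b := b6
    _ ≤ (1 + C3) * exp (-(c * y)) * (B * exp y) := by gcongr
    _ = (1 + C3) * B * exp (y - c * y) := by rw [sub_eq_neg_add, exp_add]; ring
    _ ≤ _ := by gcongr; linarith [show 0 ≤ B * exp (c * y0) by positivity]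

theorem weyl (j : ℕ) (hj : 1 ≤ j) (B : ℝ) (hB : 1 ≤ B) : ∃ C c, 0 < C ∧ 0 < c ∧ ∀ y ≥ 0,
    ∀ a b : ℕ, exp y ≤ a → b ≤ B * exp y → ∀ t : ℝ, exp (y / 2) ≤ |t| → |t| ≤ exp (j * y) →
    ‖∑ n ∈ Finset.Ico a b, E t n‖ ≤ C * exp (y - c * y) := by
  obtain ⟨C, c, hC, hc, h⟩ := weyl_pos j hj B hB
  refine ⟨C, c, hC, hc, fun y hy a b ha hb t h1 h2 => ?_⟩
  have h3 := h y hy a b ha hb |t| h1 h2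
  rcases le_total 0 t with ht | ht
  · rw [abs_of_nonneg ht, ← RCLike.norm_conj, map_sum] at h3
    refine le_trans (le_of_eq ?_) h3
    congr 1
    refine Finset.sum_congr rfl fun n _ => ?_
    simp only [E]
    rw [← Complex.exp_conj, map_mul, Complex.conj_ofReal, Complex.conj_I]
    congr 1; push_cast; ring
  · rw [abs_of_nonpos ht] at h3
    refine le_trans (le_of_eq ?_) h3
    congr 1
    refine Finset.sum_congr rfl fun n _ => ?_
    simp only [E]; push_cast; ring_nf
end MR
namespace MR
open Real MeasureTheory
open scoped FourierTransform

theorem Bump.decay {w : ℝ → ℝ} {B : ℝ} (h : Bump w B) (k : ℕ) :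
    ∃ C, 0 < C ∧ ∀ t, |t| ^ k * ‖wh w t‖ ≤ C := by
  obtain ⟨C, hC, hb⟩ := (𝓕 (h.compact.toSchwartzMap h.smc) : SchwartzMap ℝ ℂ).decay k 0
  rw [SchwartzMap.fourier_coe] at hb
  refine ⟨(2 * π) ^ k * C, by positivity, fun t => ?_⟩
  have := hb (t / (2 * π))
  rw [norm_iteratedFDeriv_zero, norm_div, norm_eq_abs, norm_eq_abs, abs_of_pos (by positivity : 0 < 2 * π), div_pow,
    div_mul_eq_mul_div, div_le_iff₀ (by positivity)] at this
  rw [mul_comm _ C]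
  exact this

theorem Bump.compactR {w : ℝ → ℝ} {B : ℝ} (h : Bump w B) : HasCompactSupport w := by
  refine HasCompactSupport.intro (isCompact_Icc (a := -B) (b := B)) fun x hx => h.supp x ?_
  by_contra hc
  exact hx (abs_le.1 (not_lt.1 hc))

theorem Bump.lip {w : ℝ → ℝ} {B : ℝ} (h : Bump w B) :
    ∃ C, 0 < C ∧ ∀ u v, |w u - w v| ≤ C * |u - v| := by
  obtain ⟨C, hC⟩ := h.sm.lipschitzWith_of_hasCompactSupport h.compactR (by norm_num)
  refine ⟨C + 1, by positivity, fun u v => ?_⟩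
  have := hC.dist_le_mul u v
  rw [dist_eq, dist_eq] at this
  nlinarith [abs_nonneg (u - v)]

noncomputable def Dw (a : ℕ → ℂ) (w : ℝ → ℝ) (x t : ℝ) : ℂ :=
  ∑' n : ℕ, a n * ((w (log n - x) / n : ℝ) : ℂ) * E t n

noncomputable def Wn (B x : ℝ) : Finset ℕ :=
  (Finset.Icc 1 ⌊exp (x + B)⌋₊).filter fun n => |log n - x| ≤ B

theorem mem_Wn {B x : ℝ} {n : ℕ} : n ∈ Wn B x ↔ 1 ≤ n ∧ |log n - x| ≤ B := by
  rw [Wn, Finset.mem_filter, Finset.mem_Icc]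
  refine ⟨fun h => ⟨h.1.1, h.2⟩, fun h => ⟨⟨h.1, Nat.le_floor ?_⟩, h.2⟩⟩
  rw [← log_le_iff_le_exp (by exact_mod_cast h.1)]
  linarith [(abs_le.1 h.2).2]

theorem Dw_eq {w : ℝ → ℝ} {B : ℝ} (h : Bump w B) (a : ℕ → ℂ) (x t : ℝ) (S : Finset ℕ)
    (hS : Wn B x ⊆ S) : Dw a w x t = ∑ n ∈ S, a n * ((w (log n - x) / n : ℝ) : ℂ) * E t n := by
  rw [Dw, tsum_eq_sum]
  intro n hn
  rcases Nat.eq_zero_or_pos n with rfl | hn0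
  · simp
  have : ¬ |log n - x| ≤ B := fun hc => hn (hS (mem_Wn.2 ⟨hn0, hc⟩))
  rw [h.supp _ (not_le.1 this)]; simp

theorem Wn_lower {B x : ℝ} {n : ℕ} (h : n ∈ Wn B x) : exp (x - B) ≤ n := by
  obtain ⟨h1, h2⟩ := mem_Wn.1 h
  rw [← le_log_iff_exp_le (by exact_mod_cast h1)]
  linarith [(abs_le.1 h2).1]

theorem Wn_upper {B x : ℝ} {n : ℕ} (h : n ∈ Wn B x) : n ≤ exp (x + B) := by
  obtain ⟨h1, h2⟩ := mem_Wn.1 h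
  rw [← log_le_iff_le_exp (by exact_mod_cast h1)]
  linarith [(abs_le.1 h2).2]

theorem Wn_card (B x : ℝ) : ((Wn B x).card : ℝ) ≤ exp (x + B) := by
  have : (Wn B x).card ≤ ⌊exp (x + B)⌋₊ := by
    refine (Finset.card_filter_le _ _).trans ?_
    simp
  exact (Nat.cast_le.2 this).trans (Nat.floor_le (exp_pos _).le)

theorem Wn_sum (B x : ℝ) : ∑ n ∈ Wn B x, (1 / n : ℝ) ≤ exp (2 * B) := by
  calc _ ≤ ∑ n ∈ Wn B x, 1 / exp (x - B) := Finset.sum_le_sum fun n hn =>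
        one_div_le_one_div_of_le (exp_pos _) (Wn_lower hn)
    _ = (Wn B x).card * (1 / exp (x - B)) := by rw [Finset.sum_const, nsmul_eq_mul]
    _ ≤ exp (x + B) * (1 / exp (x - B)) := by gcongr; exact Wn_card B x
    _ = _ := by rw [one_div, ← exp_neg, ← exp_add]; ring_nf

theorem Dw_triv {w : ℝ → ℝ} {B : ℝ} (h : Bump w B) : ∃ C, 0 < C ∧ ∀ a : ℕ → ℂ, (∀ n, ‖a n‖ ≤ 1) →
    ∀ x t, ‖Dw a w x t‖ ≤ C := by
  obtain ⟨C, hC, hw⟩ := h.bdd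
  refine ⟨C * exp (2 * B), by positivity, fun a ha x t => ?_⟩
  rw [Dw_eq h a x t _ subset_rfl]
  refine (norm_sum_le _ _).trans ?_
  refine le_trans ?_ (mul_le_mul_of_nonneg_left (Wn_sum B x) hC.le)
  rw [Finset.mul_sum]
  refine Finset.sum_le_sum fun n _ => ?_
  rw [norm_mul, norm_mul, norm_E, mul_one, Complex.norm_real, norm_div, RCLike.norm_natCast, norm_eq_abs, mul_one_div]
  have := hw (log n - x)
  calc _ ≤ 1 * (|w (log n - x)| / n) := by gcongr; exact ha n
    _ ≤ _ := by rw [one_mul]; gcongr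

theorem abel (g : ℕ → ℝ) (z : ℕ → ℂ) (a m : ℕ) (ham : a ≤ m) :
    ∑ n ∈ Finset.Ico a m, (g n : ℂ) * z n = g m * (∑ n ∈ Finset.Ico a m, z n) -
      ∑ n ∈ Finset.Ico a m, ((g (n + 1) : ℂ) - g n) * ∑ i ∈ Finset.Ico a (n + 1), z i := by
  induction m, ham using Nat.le_induction with
  | base => simp
  | succ m hm ih =>
    rw [Finset.sum_Ico_succ_top hm, Finset.sum_Ico_succ_top hm, ih,
      Finset.sum_Ico_succ_top hm (fun n => ((g (n + 1) : ℂ) - g n) * ∑ i ∈ Finset.Ico a (n + 1), z i),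
      Finset.sum_Ico_succ_top hm]
    ring

theorem log_succ_bds (n : ℕ) (hn : 1 ≤ n) : 0 ≤ log (n + 1 : ℕ) - log n ∧ log (n + 1 : ℕ) - log n ≤ 1 / n ∧
    1 / n - 1 / n ^ 2 ≤ log (n + 1 : ℕ) - log n := by
  have h0 : (0 : ℝ) < n := by exact_mod_cast hn
  rw [← log_div (by positivity) (by positivity)]
  have e : ((n + 1 : ℕ) : ℝ) / n = 1 + 1 / n := by push_cast; field_simp
  rw [e]
  have h1 : (0 : ℝ) < 1 / n := by positivity
  refine ⟨log_nonneg (by linarith), by linarith [log_le_sub_one_of_pos (show 0 < 1 + 1 / (n : ℝ) by linarith)], ?_⟩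
  refine le_trans ?_ (one_sub_inv_le_log_of_pos (by linarith))
  have : 1 - (1 + 1 / (n : ℝ))⁻¹ = 1 / (n + 1) := by field_simp; ring
  rw [this]
  have e3 : 1 / (n : ℝ) - 1 / n ^ 2 = (n - 1) / n ^ 2 := by field_simp
  rw [e3, div_le_div_iff₀ (by positivity) (by positivity)]; nlinarith

theorem G_lip {w : ℝ → ℝ} {B : ℝ} (h : Bump w B) : ∃ C, 0 < C ∧ ∀ t u v : ℝ,
    ‖(w u : ℂ) * Complex.exp (-(t * u : ℝ) * Complex.I) - (w v : ℂ) * Complex.exp (-(t * v : ℝ) * Complex.I)‖ ≤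
      C * (1 + |t|) * |u - v| := by
  obtain ⟨C, hC, hw⟩ := h.bdd
  obtain ⟨L, hL, hl⟩ := h.lip
  refine ⟨C + L, by positivity, fun t u v => ?_⟩
  have e : (w u : ℂ) * Complex.exp (-(t * u : ℝ) * Complex.I) - (w v : ℂ) * Complex.exp (-(t * v : ℝ) * Complex.I)
      = ((w u - w v : ℝ) : ℂ) * Complex.exp ((-(t * u) : ℝ) * Complex.I) + (w v : ℂ) *
        (Complex.exp ((-(t * v) : ℝ) * Complex.I) * (Complex.exp (Complex.I * (-(t * (u - v)) : ℝ)) - 1)) := by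
    rw [mul_sub (Complex.exp _), ← Complex.exp_add]; push_cast; ring_nf
  rw [e]
  refine (norm_add_le _ _).trans ?_
  rw [norm_mul, norm_mul, norm_mul, Complex.norm_exp_ofReal_mul_I, Complex.norm_exp_ofReal_mul_I, Complex.norm_real,
    Complex.norm_real, mul_one, one_mul]
  have h1 := norm_exp_I_mul_ofReal_sub_one_le (x := -(t * (u - v)))
  rw [norm_neg, norm_eq_abs, abs_mul] at h1
  have h2 : ‖w v‖ * ‖Complex.exp (Complex.I * (-(t * (u - v)) : ℝ)) - 1‖ ≤ C * (|t| * |u - v|) :=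
    mul_le_mul (hw v) h1 (norm_nonneg _) hC.le
  have h3 := hl u v
  rw [norm_eq_abs]
  nlinarith [abs_nonneg t, abs_nonneg (u - v), mul_nonneg hL.le (mul_nonneg (abs_nonneg t) (abs_nonneg (u - v))),
    mul_nonneg hC.le (abs_nonneg (u - v))]

theorem kernel_small {w : ℝ → ℝ} {B : ℝ} (h : Bump w B) : ∃ C, 0 < C ∧ ∀ (y t : ℝ) (N0 N1 : ℕ),
    1 ≤ N0 → N0 ≤ N1 → log N0 < y - B → y + B < log N1 →
    ‖∑ n ∈ Finset.Ico N0 N1, 1 * ((w (log n - y) / n : ℝ) : ℂ) * E t n -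
      Complex.exp (-(t * y : ℝ) * Complex.I) * wh w t‖ ≤
      C * (1 + |t|) * ∑ n ∈ Finset.Ico N0 N1, (1 / n ^ 2 : ℝ) := by
  obtain ⟨Cw, hCw, hw⟩ := h.bdd
  obtain ⟨G, hG, hGl⟩ := G_lip h
  refine ⟨G + Cw, by positivity, fun y t N0 N1 hN01 hN01' hlo hhi => ?_⟩
  have hnE : ∀ s : ℝ, ‖Complex.exp (-(s : ℝ) * Complex.I)‖ = 1 := fun s => by
    rw [← Complex.ofReal_neg, Complex.norm_exp_ofReal_mul_I]
  have hn1 : ∀ n ∈ Finset.Ico N0 N1, 1 ≤ n := fun n hn => hN01.trans (Finset.mem_Ico.1 hn).1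
  set F : ℝ → ℂ := fun v => (w (v - y) : ℂ) * Complex.exp (-(t * v : ℝ) * Complex.I) with hF
  have hFc : Continuous F := by
    have := h.sm.continuous
    fun_prop
  have hint : Complex.exp (-(t * y : ℝ) * Complex.I) * wh w t = ∑ n ∈ Finset.Ico N0 N1, ∫ v in (log n)..(log (n + 1 : ℕ)), F v := by
    rw [intervalIntegral.sum_integral_adjacent_intervals_Ico (a := fun n : ℕ => log n) hN01' (fun k _ => hFc.intervalIntegrable _ _)]
    rw [intervalIntegral.integral_eq_integral_of_support_subset]
    · rw [wh_eq, ← integral_const_mul, ← integral_sub_right_eq_self _ y]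
      congr 1; ext v
      rw [hF]; simp only
      rw [← mul_assoc, ← Complex.exp_add, mul_comm]
      congr 2; push_cast; ring
    · intro v hv
      have hv1 : |v - y| ≤ B := by
        by_contra hc
        exact hv (by simp only [hF]; rw [h.supp _ (not_le.1 hc)]; simp)
      obtain ⟨v1, v2⟩ := abs_le.1 hv1
      exact ⟨by linarith, by linarith⟩
  rw [hint, ← Finset.sum_sub_distrib]
  refine (norm_sum_le _ _).trans ?_
  have hterm : ∀ n ∈ Finset.Ico N0 N1, ‖1 * ((w (log n - y) / n : ℝ) : ℂ) * E t n -
      ∫ v in (log n)..(log (n + 1 : ℕ)), F v‖ ≤ ((G + Cw) * (1 + |t|)) * (1 / n ^ 2) := by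
    intro n hn
    have hn0 : (0 : ℝ) < n := by exact_mod_cast hn1 n hn
    obtain ⟨l1, l2, l3⟩ := log_succ_bds n (hn1 n hn)
    set δ := log (n + 1 : ℕ) - log n with hδ
    have e1 : 1 * ((w (log n - y) / n : ℝ) : ℂ) * E t n = ((1 / n - δ : ℝ) : ℂ) * F (log n) +
        ∫ v in (log n)..(log (n + 1 : ℕ)), F (log n) := by
      rw [intervalIntegral.integral_const, ← hδ, Complex.real_smul, ← add_mul]
      simp only [hF, E]; push_cast; ring
    rw [e1, add_sub_assoc, ← intervalIntegral.integral_sub (by simp) (hFc.intervalIntegrable _ _)]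
    refine (norm_add_le _ _).trans ?_
    have p1 : ‖((1 / n - δ : ℝ) : ℂ) * F (log n)‖ ≤ (1 / n ^ 2) * Cw := by
      rw [norm_mul, Complex.norm_real, norm_eq_abs, abs_of_nonneg (by linarith)]
      simp only [hF]
      rw [norm_mul, hnE, mul_one, Complex.norm_real]
      exact mul_le_mul (by linarith) (hw _) (norm_nonneg _) (by positivity)
    have p2 : ‖∫ v in (log n)..(log (n + 1 : ℕ)), (F (log n) - F v)‖ ≤ (G * (1 + |t|) * (1 / n)) * (1 / n) := by
      have := intervalIntegral.norm_integral_le_of_norm_le_const (a := log n) (b := log (n + 1 : ℕ))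
        (f := fun v => F (log n) - F v) (C := G * (1 + |t|) * (1 / n)) (by
        intro v hv
        rw [Set.uIoc_of_le (by linarith)] at hv
        have e2 : F (log n) - F v = Complex.exp (-(t * y : ℝ) * Complex.I) *
          ((w (log n - y) : ℂ) * Complex.exp (-(t * (log n - y) : ℝ) * Complex.I) -
            (w (v - y) : ℂ) * Complex.exp (-(t * (v - y) : ℝ) * Complex.I)) := by
          simp only [hF]
          rw [mul_sub, mul_left_comm, mul_left_comm _ (w (v - y) : ℂ), ← Complex.exp_add, ← Complex.exp_add]
          congr 3 <;> congr 1 <;> push_cast <;> ring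
        rw [e2, norm_mul, hnE, one_mul]
        refine (hGl t (log n - y) (v - y)).trans ?_
        gcongr
        rw [abs_le]; constructor <;> linarith [hv.1, hv.2])
      refine this.trans ?_
      rw [abs_of_nonneg l1]
      gcongr
    have : 0 ≤ Cw * |t| * (1 / n ^ 2) := by positivity
    calc _ ≤ (1 / n ^ 2) * Cw + (G * (1 + |t|) * (1 / n)) * (1 / n) := add_le_add p1 p2
      _ = (G * (1 + |t|) + Cw) * (1 / n ^ 2) := by ring
      _ ≤ _ := by linarith
  rw [Finset.mul_sum]
  exact Finset.sum_le_sum hterm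

set_option maxHeartbeats 1000000 in
theorem kernel {w : ℝ → ℝ} {B : ℝ} (h : Bump w B) (k : ℕ) (hk : 1 ≤ k) : ∃ C c, 0 < C ∧ 0 < c ∧
    ∀ y ≥ 0, ∀ t : ℝ, |t| ≤ exp (k * y) →
    ‖Dw (fun _ => 1) w y t - Complex.exp (-(t * y : ℝ) * Complex.I) * wh w t‖ ≤ C * exp (-(c * y)) := by
  have hB := h.hB
  obtain ⟨C0, hC0, htriv⟩ := Dw_triv h
  obtain ⟨C1, hC1, hd0⟩ := h.decay 0
  obtain ⟨C2, hC2, hd1⟩ := h.decay 1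
  obtain ⟨Cw, hCw, hw⟩ := h.bdd
  obtain ⟨L, hL, hl⟩ := h.lip
  obtain ⟨G, hG0, hG⟩ := kernel_small h
  set B' := 3 * exp (3 * B) with hB'
  have hB'1 : 1 ≤ B' := by have := one_le_exp (show 0 ≤ 3 * B by linarith); linarith
  obtain ⟨C3, c3, hC3, hc3, hW⟩ := weyl (2 * k) (by omega) B' hB'1
  set c := min c3 (1 / 2) / 2 with hc
  have hc0 : 0 < c := by positivity
  have hcc : c ≤ c3 / 2 := by rw [hc]; linarith [min_le_left c3 (1 / 2)]
  have hcc' : c ≤ 1 / 4 := by rw [hc]; linarith [min_le_right c3 (1 / 2)]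
  set K1 := (C0 + C1) * exp (c * (4 * B)) with hK1
  set K2 := (L + Cw) * B' * C3 + C2 with hK2
  set K3 := G * B' * 2 with hK3
  refine ⟨K1 + K2 + K3, c, by positivity, hc0, fun y hy t ht => ?_⟩
  have hnE : ∀ s : ℝ, ‖Complex.exp (-(s : ℝ) * Complex.I)‖ = 1 := fun s => by
    rw [← Complex.ofReal_neg, Complex.norm_exp_ofReal_mul_I]
  rcases lt_or_ge y (4 * B) with hlt | hge
  · have h1 : ‖Dw (fun _ => 1) w y t - Complex.exp (-(t * y : ℝ) * Complex.I) * wh w t‖ ≤ C0 + C1 := by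
      refine (norm_sub_le _ _).trans (add_le_add (htriv _ (by simp) y t) ?_)
      rw [norm_mul, hnE, one_mul]; simpa using hd0 t
    refine h1.trans ?_
    have : 1 ≤ exp (c * (4 * B)) * exp (-(c * y)) := by
      rw [← exp_add]; apply one_le_exp; nlinarith
    calc C0 + C1 ≤ (C0 + C1) * (exp (c * (4 * B)) * exp (-(c * y))) := le_mul_of_one_le_right (by positivity) this
      _ = K1 * exp (-(c * y)) := by ring
      _ ≤ _ := by gcongr; linarith [show 0 < K2 by positivity, show 0 < K3 by positivity]
  set y' := y - 2 * B with hy'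
  have hy'2 : y / 2 ≤ y' := by linarith
  have hy'0 : 0 ≤ y' := by linarith
  set N0 := ⌈exp (y - B)⌉₊ - 1 with hN0
  have hN0c : N0 + 1 = ⌈exp (y - B)⌉₊ := by
    have : 0 < ⌈exp (y - B)⌉₊ := Nat.ceil_pos.2 (exp_pos _)
    omega
  have hN0c' : (N0 + 1 : ℝ) = ⌈exp (y - B)⌉₊ := by exact_mod_cast hN0c
  have hN0l : (N0 : ℝ) < exp (y - B) := by linarith [Nat.ceil_lt_add_one (exp_pos (y - B)).le]
  set N1 := ⌈exp (y + B)⌉₊ + 1 with hN1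
  have hN0y : exp y' ≤ N0 := by
    have h1 := Nat.le_ceil (exp (y - B))
    rw [← hN0c'] at h1
    have h2 : exp (y - B) = exp y' * exp B := by rw [← exp_add]; congr 1; rw [hy']; ring
    have h3 := add_one_le_exp B
    have h4 := one_le_exp hy'0
    have h5 : exp y' * 2 ≤ exp y' * exp B := mul_le_mul_of_nonneg_left (by linarith) (exp_pos _).le
    linarith
  have hN01 : 1 ≤ N0 := by
    have : (1 : ℝ) ≤ N0 := (one_le_exp hy'0).trans hN0y
    exact_mod_cast this
  have hN1y : N1 ≤ B' * exp y' := by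
    have h1 := Nat.ceil_lt_add_one (exp_pos (y + B)).le
    have h2 : exp (y + B) = exp (3 * B) * exp y' := by rw [← exp_add]; congr 1; rw [hy']; ring
    have h4 := one_le_exp (show 0 ≤ y + B by linarith)
    rw [hN1, hB', mul_assoc, ← h2]; push_cast; linarith
  have hN01' : N0 ≤ N1 := by
    have : (N0 : ℝ) ≤ N1 := by
      rw [hN1]; push_cast
      exact hN0l.le.trans ((exp_le_exp.2 (by linarith)).trans ((Nat.le_ceil (exp (y + B))).trans (by linarith)))
    exact_mod_cast this
  have hsub : Wn B y ⊆ Finset.Ico N0 N1 := by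
    intro n hn
    rw [Finset.mem_Ico]
    refine ⟨?_, ?_⟩
    · have := hN0l.le.trans (Wn_lower hn)
      exact_mod_cast this
    · have : n ≤ ⌈exp (y + B)⌉₊ := by
        have := (Wn_upper hn).trans (Nat.le_ceil (exp (y + B)))
        exact_mod_cast this
      omega
  have hsumsq : ∑ n ∈ Finset.Ico N0 N1, (1 / n ^ 2 : ℝ) ≤ B' * exp (-y') := by
    have hp := exp_pos y'
    calc _ ≤ ∑ n ∈ Finset.Ico N0 N1, 1 / exp y' ^ 2 := Finset.sum_le_sum fun n hn => by
          have : exp y' ≤ n := hN0y.trans (by exact_mod_cast (Finset.mem_Ico.1 hn).1)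
          gcongr
      _ = ((N1 - N0 : ℕ) : ℝ) * (1 / exp y' ^ 2) := by simp
      _ ≤ (B' * exp y') * (1 / exp y' ^ 2) := by
        gcongr
        exact le_trans (by exact_mod_cast Nat.sub_le _ _) hN1y
      _ = _ := by rw [exp_neg]; field_simp
  rw [Dw_eq h _ y t _ hsub]
  have hn1 : ∀ n ∈ Finset.Ico N0 N1, 1 ≤ n := fun n hn => hN01.trans (Finset.mem_Ico.1 hn).1
  have hhi : y + B < log N1 := by
    rw [lt_log_iff_exp_lt (by rw [hN1]; positivity), hN1]
    push_cast; linarith [Nat.le_ceil (exp (y + B))]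
  have hlo : log N0 < y - B := by
    rwa [log_lt_iff_lt_exp (by exact_mod_cast hN01)]
  have hout : w (log N1 - y) = 0 := by
    apply h.supp
    exact (show B < log N1 - y by linarith).trans_le (le_abs_self _)
  rcases le_or_gt (exp (y' / 2)) |t| with hbig | hsmall
  · have hWb : ∀ b ≤ N1, ‖∑ n ∈ Finset.Ico N0 b, E t n‖ ≤ C3 * exp (y' - c3 * y') := by
      intro b hb
      refine hW y' hy'0 N0 b hN0y (le_trans (by exact_mod_cast hb) hN1y) t hbig (ht.trans (exp_le_exp.2 ?_))
      push_cast
      have := mul_le_mul_of_nonneg_left hy'2 (Nat.cast_nonneg (α := ℝ) k)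
      linarith
    have hS : ‖∑ n ∈ Finset.Ico N0 N1, 1 * ((w (log n - y) / n : ℝ) : ℂ) * E t n‖ ≤
        (L + Cw) * B' * C3 * exp (-(c3 * y')) := by
      simp only [one_mul]
      rw [abel (fun n => w (log n - y) / n) (fun n => E t n) N0 N1 hN01', hout]
      simp only [zero_div, Complex.ofReal_zero, zero_mul, zero_sub, norm_neg]
      refine (norm_sum_le _ _).trans ?_
      have hterm : ∀ n ∈ Finset.Ico N0 N1, ‖(((w (log (n + 1 : ℕ) - y) / (n + 1 : ℕ) : ℝ) : ℂ) -
          ((w (log n - y) / n : ℝ) : ℂ)) * ∑ i ∈ Finset.Ico N0 (n + 1), E t i‖ ≤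
          ((L + Cw) * (1 / n ^ 2)) * (C3 * exp (y' - c3 * y')) := by
        intro n hn
        rw [norm_mul]
        have hn0 : (0 : ℝ) < n := by exact_mod_cast hn1 n hn
        refine mul_le_mul ?_ (hWb (n + 1) (Finset.mem_Ico.1 hn).2) (norm_nonneg _) (by positivity)
        rw [← Complex.ofReal_sub, Complex.norm_real, norm_eq_abs]
        obtain ⟨l1, l2, l3⟩ := log_succ_bds n (hn1 n hn)
        have e : w (log (n + 1 : ℕ) - y) / (n + 1 : ℕ) - w (log n - y) / n =
          (w (log (n + 1 : ℕ) - y) - w (log n - y)) * (1 / (n + 1 : ℕ)) +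
            w (log n - y) * (1 / (n + 1 : ℕ) - 1 / n) := by ring
        rw [e]
        refine (abs_add_le _ _).trans ?_
        rw [abs_mul, abs_mul, add_mul]
        have hle : (1 : ℝ) / (n + 1 : ℕ) ≤ 1 / n := by
          push_cast; apply one_div_le_one_div_of_le hn0; linarith
        refine add_le_add ?_ ?_
        · have h1 := hl (log (n + 1 : ℕ) - y) (log n - y)
          rw [show log (n + 1 : ℕ) - y - (log n - y) = log (n + 1 : ℕ) - log n by ring, abs_of_nonneg l1] at h1
          rw [abs_of_nonneg (by positivity : (0 : ℝ) ≤ 1 / (n + 1 : ℕ))]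
          calc _ ≤ (L * (1 / n)) * (1 / n) := by gcongr; exact h1.trans (by gcongr)
            _ = _ := by ring
        · refine mul_le_mul (hw _) ?_ (abs_nonneg _) hCw.le
          rw [abs_of_nonpos (by linarith)]
          have : -(1 / ((n + 1 : ℕ) : ℝ) - 1 / n) = 1 / (n * (n + 1)) := by push_cast; field_simp; ring
          rw [this, sq]
          gcongr; linarith
      refine (Finset.sum_le_sum hterm).trans ?_
      rw [← Finset.sum_mul, ← Finset.mul_sum]
      calc _ ≤ (L + Cw) * (B' * exp (-y')) * (C3 * exp (y' - c3 * y')) := by gcongr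
        _ = (L + Cw) * B' * C3 * (exp (-y') * exp (y' - c3 * y')) := by ring
        _ = _ := by rw [← exp_add]; ring_nf
    have hwh : ‖Complex.exp (-(t * y : ℝ) * Complex.I) * wh w t‖ ≤ C2 * exp (-(y' / 2)) := by
      rw [norm_mul, hnE, one_mul, exp_neg, ← div_eq_mul_inv, le_div_iff₀ (exp_pos _)]
      have := hd1 t
      rw [pow_one] at this
      exact (mul_le_mul_of_nonneg_left hbig (norm_nonneg _)).trans (by linarith)
    refine (norm_sub_le _ _).trans ((add_le_add hS hwh).trans ?_)
    have e1 : exp (-(c3 * y')) ≤ exp (-(c * y)) := by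
      apply exp_le_exp.2
      linarith [mul_le_mul_of_nonneg_right hcc hy, mul_le_mul_of_nonneg_left hy'2 hc3.le]
    have e2 : exp (-(y' / 2)) ≤ exp (-(c * y)) := by
      apply exp_le_exp.2; linarith [mul_le_mul_of_nonneg_right hcc' hy]
    calc _ ≤ (L + Cw) * B' * C3 * exp (-(c * y)) + C2 * exp (-(c * y)) := by gcongr
      _ = K2 * exp (-(c * y)) := by rw [hK2]; ring
      _ ≤ _ := by gcongr; linarith [show 0 < K1 by positivity, show 0 < K3 by positivity]
  · refine (hG y t N0 N1 hN01 hN01' hlo hhi).trans ?_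
    have h1 := one_le_exp (show 0 ≤ y' / 2 by linarith)
    calc _ ≤ (G * (exp (y' / 2) + exp (y' / 2))) * (B' * exp (-y')) := by gcongr
      _ = K3 * (exp (y' / 2) * exp (-y')) := by rw [hK3]; ring
      _ = K3 * exp (-(y' / 2)) := by rw [← exp_add]; congr 2; ring
      _ ≤ K3 * exp (-(c * y)) := by gcongr; linarith [mul_le_mul_of_nonneg_right hcc' hy]
      _ ≤ _ := by gcongr; linarith [show 0 < K1 by positivity, show 0 < K2 by positivity]
end MR
namespace MR
open Real MeasureTheory

theorem cpow_E (σ t : ℝ) (n : ℕ) (hn : n ≠ 0) :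
    1 / (n : ℂ) ^ ((σ : ℂ) + t * Complex.I) = ((exp (-(σ * log n)) : ℝ) : ℂ) * E t n := by
  rw [one_div, ← Complex.cpow_neg, Complex.cpow_def_of_ne_zero (by exact_mod_cast hn), E,
    ← Complex.natCast_log, Complex.ofReal_exp, ← Complex.exp_add]
  congr 1; push_cast; ring

theorem log_pow_sum (σ : ℝ) (hσ : 1 < σ) : Summable fun n : ℕ => if n = 0 then 0 else exp (-(σ * log n)) := by
  have := Real.summable_nat_rpow_inv.2 hσ
  refine this.congr fun n => ?_
  split_ifs with h
  · subst h; rw [Nat.cast_zero, zero_rpow (by linarith), inv_zero]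
  · rw [rpow_def_of_pos (by positivity), exp_neg, mul_comm]

noncomputable def zt (σ : ℝ) (n : ℕ) : ℝ := if n = 0 then 0 else exp (-(σ * log n))

theorem zt_nonneg (σ : ℝ) (n : ℕ) : 0 ≤ zt σ n := by unfold zt; split_ifs <;> positivity

theorem zt_sum_le (u : ℝ) (hu : 1 ≤ u) : ∑' n, zt (1 + 1 / u) n ≤ 1 + u := by
  have hu0 : 0 < u := by linarith
  have key : ∀ N : ℕ, ∑ n ∈ Finset.range (N + 2), zt (1 + 1 / u) n ≤ 1 + u * (1 - exp (-(1 / u * log (N + 1)))) := by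
    intro N
    induction N with
    | zero => simp [Finset.sum_range_succ, zt]
    | succ N ih =>
      rw [Finset.sum_range_succ]
      have e1 : zt (1 + 1 / u) (N + 2) = exp (-(1 / u * log (N + 2))) * (1 / (N + 2)) := by
        rw [zt, if_neg (by omega)]
        push_cast
        rw [add_mul, one_mul, neg_add, exp_add, exp_neg (log _), exp_log (by positivity), mul_comm, one_div ((N : ℝ) + 2)]
      have e2 : exp (-(1 / u * log (N + 2))) * (1 + 1 / u * (1 / (N + 2))) ≤ exp (-(1 / u * log (N + 1))) := by
        have h1 : 1 / ((N : ℝ) + 2) ≤ log (N + 2) - log (N + 1) := by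
          have := one_sub_inv_le_log_of_pos (x := ((N : ℝ) + 2) / (N + 1)) (by positivity)
          rw [log_div (by positivity) (by positivity)] at this
          refine le_trans (le_of_eq ?_) this
          field_simp; ring
        have h2 : -(1 / u * log (N + 1)) = -(1 / u * log (N + 2)) + 1 / u * (log ((N : ℝ) + 2) - log (N + 1)) := by ring
        rw [h2, exp_add]
        refine mul_le_mul_of_nonneg_left ?_ (exp_pos _).le
        have := add_one_le_exp (1 / u * (log ((N : ℝ) + 2) - log (N + 1)))
        have h3 : 1 / u * (1 / ((N : ℝ) + 2)) ≤ 1 / u * (log (N + 2) - log (N + 1)) :=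
          mul_le_mul_of_nonneg_left h1 (by positivity)
        linarith
      have e3 := mul_le_mul_of_nonneg_left e2 hu0.le
      have e4 : u * (exp (-(1 / u * log (N + 2))) * (1 + 1 / u * (1 / (N + 2)))) =
          u * exp (-(1 / u * log (N + 2))) + exp (-(1 / u * log (N + 2))) * (1 / ((N : ℝ) + 2)) := by field_simp
      rw [e1]
      push_cast
      have e5 : (N : ℝ) + 1 + 1 = N + 2 := by ring
      rw [e5]
      linarith
  refine Real.tsum_le_of_sum_range_le (zt_nonneg _) fun N => ?_
  refine (Finset.sum_le_sum_of_subset_of_nonneg (Finset.range_mono (by omega : N ≤ N + 2)) fun i _ _ => zt_nonneg _ _).trans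
    ((key N).trans ?_)
  have : 0 ≤ u * exp (-(1 / u * log (N + 1))) := by positivity
  linarith

theorem zeta_small (A ε : ℝ) (hA : 1 ≤ A) (hε : 0 < ε) : ∃ T0 u0 : ℝ, 1 ≤ T0 ∧ 1 ≤ u0 ∧ ∀ u ≥ u0, ∀ t : ℝ,
    T0 ≤ |t| → |t| ≤ exp (A * u) → ‖riemannZeta ((1 + 1 / u : ℝ) + t * Complex.I)‖ ≤ ε * u := by
  obtain ⟨φ, hφ, hφ0, hφ1⟩ := exists_phi
  obtain ⟨C0, hC0, htriv⟩ := Dw_triv hφ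
  obtain ⟨C2, hC2, hd⟩ := hφ.decay 1
  set ε' := ε * exp (-1) / 4 with hε'
  have hε'0 : 0 < ε' := by positivity
  set k := ⌈C0 * exp 1 * A / ε'⌉₊ + 1 with hk
  obtain ⟨C, c, hC, hc, hker⟩ := kernel hφ k (by omega)
  refine ⟨max 1 (C2 / ε'), max 1 ((C0 * exp 1 + C / c) / ε'), le_max_left _ _, le_max_left _ _, fun u hu t ht1 ht2 => ?_⟩
  have hu1 : 1 ≤ u := (le_max_left _ _).trans hu
  have hu2 : (C0 * exp 1 + C / c) / ε' ≤ u := (le_max_right _ _).trans hu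
  have ht0 : 1 ≤ |t| := (le_max_left _ _).trans ht1
  have ht3 : C2 / ε' ≤ |t| := (le_max_right _ _).trans ht1
  have hu0 : 0 < u := by linarith
  set σ : ℝ := 1 + 1 / u with hσ
  have hσ1 : 1 < σ := by have : 0 < 1 / u := by positivity
                         linarith
  have hφc := hφ.sm.continuous
  set cu := ∫ v, exp (v / u) * φ v with hcu
  have hcui : Integrable (fun v => exp (v / u) * φ v) := by
    refine Continuous.integrable_of_hasCompactSupport (by fun_prop) ?_
    exact hφ.compactR.mul_left
  have hφi : Integrable φ := hφc.integrable_of_hasCompactSupport hφ.compactR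
  have hcu1 : exp (-1) ≤ cu := by
    have : exp (-1) = ∫ v, exp (-1) * φ v := by rw [integral_const_mul, hφ1, mul_one]
    rw [this]
    refine integral_mono (hφi.const_mul _) hcui fun v => ?_
    by_cases hv : |v| ≤ 1
    · refine mul_le_mul_of_nonneg_right (exp_le_exp.2 ?_) (hφ0 v)
      rw [le_div_iff₀ hu0]; linarith [(abs_le.1 hv).1]
    · simp [hφ.supp v (not_le.1 hv)]
  set F : ℕ → ℝ → ℂ := fun n y => ((exp (-(y / u)) : ℝ) : ℂ) * (1 * ((φ (log n - y) / n : ℝ) : ℂ) * E t n) with hF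
  have hFint : ∀ (n : ℕ), n ≠ 0 → ∫ y, exp (-(y / u)) * φ (log n - y) = exp (-(1 / u * log n)) * cu := by
    intro n hn
    rw [← integral_sub_left_eq_self _ _ (log n), hcu, ← integral_const_mul]
    congr 1; ext v
    rw [sub_sub_cancel, ← mul_assoc, ← exp_add]
    congr 2; ring
  have hFi : ∀ n, Integrable (F n) := by
    intro n
    refine Continuous.integrable_of_hasCompactSupport (by simp only [hF]; fun_prop) ?_
    refine HasCompactSupport.intro (isCompact_Icc (a := log n - 1) (b := log n + 1)) fun y hy => ?_
    have : φ (log n - y) = 0 := by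
      refine hφ.supp _ ?_
      by_contra hc
      rw [not_lt, abs_le] at hc
      exact hy ⟨by linarith, by linarith⟩
    simp [hF, this]
  have hFn : ∀ n, ∫ y, ‖F n y‖ = (if n = 0 then 0 else exp (-(σ * log n))) * cu := by
    intro n
    split_ifs with hn
    · simp [hF, hn]
    · have : ∀ y, ‖F n y‖ = (1 / n) * (exp (-(y / u)) * φ (log n - y)) := by
        intro y
        simp only [hF]
        rw [norm_mul, norm_mul, norm_E, one_mul, Complex.norm_real, Complex.norm_real, norm_of_nonneg (exp_pos _).le,
          norm_of_nonneg (by have := hφ0 (log n - y); positivity)]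
        ring
      simp only [this]
      rw [integral_const_mul, hFint n hn, ← mul_assoc]
      congr 1
      rw [hσ, add_mul, one_mul, neg_add, exp_add, exp_neg (log n), exp_log (by positivity), one_div]
  have hFc : ∀ n, ∫ y, F n y = (1 / (n : ℂ) ^ ((σ : ℂ) + t * Complex.I)) * cu := by
    intro n
    rcases eq_or_ne n 0 with rfl | hn
    · have : (σ : ℂ) + t * Complex.I ≠ 0 := by
        intro h; have := congrArg Complex.re h; simp at this; linarith
      simp [hF, Complex.zero_cpow this]
    · have : ∀ y, F n y = (((exp (-(y / u)) * φ (log n - y)) : ℝ) : ℂ) * ((1 / n) * E t n) := by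
        intro y
        simp only [hF]; push_cast; ring
      simp only [this]
      rw [integral_mul_const, integral_complex_ofReal, hFint n hn, cpow_E σ t n hn]
      have e : ((exp (-(σ * log n)) : ℝ) : ℂ) = ((exp (-(1 / u * log n)) : ℝ) : ℂ) * (1 / n) := by
        rw [hσ, add_mul, one_mul, neg_add, exp_add, exp_neg (log n), exp_log (by positivity)]; push_cast; ring
      rw [e]; push_cast; ring
  have hz : riemannZeta ((σ : ℂ) + t * Complex.I) * cu = ∫ y, ((exp (-(y / u)) : ℝ) : ℂ) * Dw (fun _ => 1) φ y t := by
    rw [zeta_eq_tsum_one_div_nat_cpow (by simpa using hσ1), ← tsum_mul_right]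
    rw [← tsum_congr hFc]
    rw [integral_tsum_of_summable_integral_norm hFi]
    · congr 1; ext y
      rw [Dw, ← tsum_mul_left]
    · simp only [hFn]
      exact (log_pow_sum σ hσ1).mul_right _
  set y1 := log |t| / k with hy1
  have hk0 : (0 : ℝ) < k := by rw [hk]; positivity
  have hy10 : 0 ≤ y1 := div_nonneg (log_nonneg ht0) hk0.le
  have hy1b : C0 * exp 1 * y1 ≤ ε' * u := by
    have h1 : log |t| ≤ A * u := (log_le_iff_le_exp (by linarith)).2 ht2
    have h2 : C0 * exp 1 * A / ε' ≤ k := by rw [hk]; push_cast; linarith [Nat.le_ceil (C0 * exp 1 * A / ε')]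
    rw [div_le_iff₀ hε'0] at h2
    rw [hy1, mul_div_assoc', div_le_iff₀ hk0]
    calc C0 * exp 1 * log |t| ≤ C0 * exp 1 * (A * u) := by gcongr
      _ = C0 * exp 1 * A * u := by ring
      _ ≤ k * ε' * u := by gcongr
      _ = _ := by ring
  set f : ℝ → ℝ := fun y => (Set.Icc (-1) y1).indicator (fun _ => C0 * exp 1) y with hf
  set g : ℝ → ℝ := fun y => (Set.Ioi 0).indicator (fun y => C * exp (-(c * y)) + C2 / |t| * exp (-(1 / u * y))) y with hg
  have hDn : ∀ y, ‖((exp (-(y / u)) : ℝ) : ℂ) * Dw (fun _ => 1) φ y t‖ = exp (-(y / u)) * ‖Dw (fun _ => 1) φ y t‖ := by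
    intro y; rw [norm_mul, Complex.norm_real, norm_of_nonneg (exp_pos _).le]
  have ht00 : 0 < |t| := by linarith
  have hpt : ∀ y, ‖((exp (-(y / u)) : ℝ) : ℂ) * Dw (fun _ => 1) φ y t‖ ≤ f y + g y := by
    intro y
    rw [hDn]
    have hf0 : 0 ≤ f y := Set.indicator_nonneg (fun _ _ => by positivity) _
    have hg0 : 0 ≤ g y := Set.indicator_nonneg (fun _ _ => by positivity) _
    rcases lt_or_ge y (-1) with h1 | h1
    · have : Dw (fun _ => 1) φ y t = 0 := by
        rw [Dw_eq hφ _ y t _ subset_rfl, Finset.sum_eq_zero]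
        intro n hn
        have hn := mem_Wn.1 hn
        have := (abs_le.1 hn.2).2
        have h3 : 0 ≤ log (n : ℝ) := log_nonneg (by exact_mod_cast hn.1)
        linarith
      rw [this, norm_zero, mul_zero]; positivity
    rcases le_or_gt y y1 with h2 | h2
    · have : f y = C0 * exp 1 := Set.indicator_of_mem (Set.mem_Icc.2 ⟨h1, h2⟩) _
      have h3 : exp (-(y / u)) ≤ exp 1 := by
        refine exp_le_exp.2 ?_
        rw [← neg_div, div_le_iff₀ hu0]; linarith
      have h4 := htriv (fun _ => 1) (by simp) y t
      have h5 := mul_le_mul h3 h4 (norm_nonneg _) (exp_pos _).le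
      rw [this]; linarith
    · have hy0 : 0 < y := by linarith
      have : g y = C * exp (-(c * y)) + C2 / |t| * exp (-(1 / u * y)) := Set.indicator_of_mem hy0 _
      have hty : |t| ≤ exp (k * y) := by
        rw [← log_le_iff_le_exp ht00]
        rw [hy1, div_lt_iff₀ hk0] at h2
        linarith
      have h3 := hker y hy0.le t hty
      have h4 : ‖Dw (fun _ => 1) φ y t‖ ≤ C * exp (-(c * y)) + C2 / |t| := by
        have h5 := hd t
        rw [pow_one, mul_comm, ← le_div_iff₀ ht00] at h5
        have h6 := norm_le_norm_add_norm_sub' (Dw (fun _ => 1) φ y t) (Complex.exp (-(t * y : ℝ) * Complex.I) * wh φ t)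
        have h7 : ‖Complex.exp (-(t * y : ℝ) * Complex.I) * wh φ t‖ = ‖wh φ t‖ := by
          rw [norm_mul, ← Complex.ofReal_neg, Complex.norm_exp_ofReal_mul_I, one_mul]
        linarith
      have h8 : exp (-(y / u)) ≤ 1 := exp_le_one_iff.2 (by have : 0 ≤ y / u := by positivity
                                                           linarith)
      have h9 : exp (-(y / u)) * ‖Dw (fun _ => 1) φ y t‖ ≤ exp (-(y / u)) * (C * exp (-(c * y)) + C2 / |t|) :=
        mul_le_mul_of_nonneg_left h4 (exp_pos _).le
      have h10 : exp (-(y / u)) * (C * exp (-(c * y))) ≤ 1 * (C * exp (-(c * y))) :=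
        mul_le_mul_of_nonneg_right h8 (by positivity)
      have h11 : (1 / u * y) = y / u := by ring
      rw [this, h11]; linarith
  have e1 : ∀ a : ℝ, 0 < a → IntegrableOn (fun y => exp (-(a * y))) (Set.Ioi 0) ∧ ∫ y in Set.Ioi 0, exp (-(a * y)) = 1 / a := by
    intro a ha
    have h1 := integrableOn_exp_mul_Ioi (a := -a) (by linarith) 0
    have h2 := integral_exp_mul_Ioi (a := -a) (by linarith) 0
    simp only [neg_mul] at h1 h2
    refine ⟨h1, h2.trans ?_⟩
    rw [mul_zero, neg_zero, exp_zero, neg_div_neg_eq]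
  have hfi : Integrable f := by
    rw [hf, integrable_indicator_iff measurableSet_Icc]
    exact integrableOn_const (by simp)
  have hgi : Integrable g := by
    rw [hg, integrable_indicator_iff measurableSet_Ioi]
    exact ((e1 c hc).1.const_mul C).add ((e1 _ (by positivity)).1.const_mul _)
  have hfI : ∫ y, f y = C0 * exp 1 * (y1 + 1) := by
    rw [hf, integral_indicator measurableSet_Icc, setIntegral_const, smul_eq_mul, measureReal_def, volume_Icc,
      ENNReal.toReal_ofReal (by linarith)]
    ring
  have hgI : ∫ y, g y = C / c + C2 / |t| * u := by
    rw [hg, integral_indicator measurableSet_Ioi, integral_add ((e1 c hc).1.const_mul C) ((e1 _ (by positivity)).1.const_mul _),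
      integral_const_mul, integral_const_mul, (e1 c hc).2, (e1 _ (by positivity)).2]
    field_simp
  have hfin := norm_integral_le_of_norm_le (hfi.add hgi) (Eventually.of_forall hpt)
  simp only [Pi.add_apply] at hfin
  rw [integral_add hfi hgi, hfI, hgI, ← hz, norm_mul, Complex.norm_real, norm_of_nonneg (by linarith [exp_pos (-1)])] at hfin
  have h1 : C2 / |t| * u ≤ ε' * u := by
    refine mul_le_mul_of_nonneg_right ?_ hu0.le
    rw [div_le_iff₀ hε'0] at ht3
    rw [div_le_iff₀ ht00]; linarith
  rw [div_le_iff₀ hε'0] at hu2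
  have h2 : ‖riemannZeta ((σ : ℂ) + t * Complex.I)‖ * exp (-1) ≤ ε * exp (-1) * u := by
    refine (mul_le_mul_of_nonneg_left hcu1 (norm_nonneg _)).trans (hfin.trans ?_)
    have : 4 * ε' * u = ε * exp (-1) * u := by rw [hε']; ring
    linarith [mul_pos hε'0 hu0]
  have h3 : ε * exp (-1) * u = ε * u * exp (-1) := by ring
  rw [h3] at h2
  exact le_of_mul_le_mul_right h2 (exp_pos _)
end MR
namespace MR
open Real MeasureTheory

theorem zeta_norm_le (u t : ℝ) (hu : 1 ≤ u) : ‖riemannZeta ((1 + 1 / u : ℝ) + t * Complex.I)‖ ≤ 1 + u := by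
  have h1 : 1 < 1 + 1 / u := by have : 0 < 1 / u := by positivity
                                linarith
  rw [zeta_eq_tsum_one_div_nat_cpow (by simpa using by positivity)]
  refine le_trans ?_ (zt_sum_le u hu)
  refine tsum_of_norm_bounded (log_pow_sum (1 + 1 / u) h1).hasSum fun n => ?_
  split_ifs with hn
  · subst hn
    rw [Nat.cast_zero, Complex.zero_cpow]
    · simp
    · intro h; have := congrArg Complex.re h; simp at this; linarith [one_div u]
  · rw [cpow_E _ _ _ hn, norm_mul, norm_E, mul_one, Complex.norm_real, norm_of_nonneg (exp_pos _).le]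

theorem zeta_inv_small (T0 : ℝ) : ∃ C : ℝ, 0 < C ∧ ∀ u ≥ (1 : ℝ), ∀ t : ℝ, |t| ≤ T0 →
    ‖(riemannZeta ((1 + 1 / u : ℝ) + t * Complex.I))⁻¹‖ ≤ C := by
  set g : ℂ → ℂ := Function.update (fun s => (s - 1) * riemannZeta s) 1 1 with hg
  have hgc : Continuous g := by
    rw [continuous_iff_continuousAt]
    intro s
    rcases eq_or_ne s 1 with rfl | hs
    · rw [hg, continuousAt_update_same]; exact riemannZeta_residue_one
    · rw [hg, continuousAt_update_of_ne hs]
      exact (by fun_prop : ContinuousAt (fun s : ℂ => s - 1) s).mul (differentiableAt_riemannZeta hs).continuousAt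
  set K : Set ℂ := (Set.Icc 1 2) ×ℂ (Set.Icc (-T0) T0) with hK
  have hKc : IsCompact K := isCompact_Icc.reProdIm isCompact_Icc
  have hg0 : ∀ s ∈ K, g s ≠ 0 := by
    intro s hs
    rcases eq_or_ne s 1 with rfl | h1
    · simp [hg]
    · rw [hg, Function.update_of_ne h1]
      exact mul_ne_zero (sub_ne_zero.2 h1) (riemannZeta_ne_zero_of_one_le_re hs.1.1)
  obtain ⟨C, hC⟩ := hKc.exists_bound_of_continuousOn (f := fun s => (s - 1) * (g s)⁻¹)
    (((continuous_id.sub continuous_const).continuousOn).mul (hgc.continuousOn.inv₀ hg0))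
  refine ⟨|C| + 1, by positivity, fun u hu t ht => ?_⟩
  have hu0 : 0 < u := by linarith
  have h1 : 0 < 1 / u := by positivity
  have h2 : 1 / u ≤ 1 := by rw [div_le_one hu0]; exact hu
  set s : ℂ := (1 + 1 / u : ℝ) + t * Complex.I with hs
  have hre : s.re = 1 + 1 / u := by simp [hs]
  have him : s.im = t := by simp [hs]
  have hs1 : s ≠ 1 := by
    intro h; have := congrArg Complex.re h; rw [hre, Complex.one_re] at this; linarith
  have := hC s ⟨by rw [Set.mem_preimage, hre]; exact ⟨by linarith, by linarith⟩, by
    rw [Set.mem_preimage, him]; exact abs_le.1 ht⟩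
  simp only [hg, Function.update_of_ne hs1] at this
  rw [mul_inv, ← mul_assoc, mul_inv_cancel₀ (sub_ne_zero.2 hs1), one_mul] at this
  linarith [le_abs_self C]

theorem zeta_inv (A ε : ℝ) (hA : 1 ≤ A) (hε : 0 < ε) : ∃ u0 : ℝ, 1 ≤ u0 ∧ ∀ u ≥ u0, ∀ t : ℝ,
    |t| ≤ exp (A * u) → ‖(riemannZeta ((1 + 1 / u : ℝ) + t * Complex.I))⁻¹‖ ≤ ε * u := by
  obtain ⟨T0, u1, hT0, hu1, h1⟩ := zeta_small (A + 1) (ε ^ 4 / 8) (by linarith) (by positivity)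
  obtain ⟨C, hC, h2⟩ := zeta_inv_small T0
  refine ⟨max u1 (C / ε), hu1.trans (le_max_left _ _), fun u hu t ht => ?_⟩
  have hu2 : u1 ≤ u := (le_max_left _ _).trans hu
  have hu3 : C / ε ≤ u := (le_max_right _ _).trans hu
  have hu4 : 1 ≤ u := hu1.trans hu2
  have hu0 : 0 < u := by linarith
  rcases le_total |t| T0 with h | h
  · refine (h2 u hu4 t h).trans ?_
    rw [div_le_iff₀ hε] at hu3; linarith
  have h2t : |2 * t| = 2 * |t| := by rw [abs_mul, abs_two]
  have h3 := h1 u hu2 (2 * t) (by rw [h2t]; linarith) (by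
    rw [h2t, add_mul, one_mul, exp_add, mul_comm 2]
    exact mul_le_mul ht (by linarith [add_one_le_exp u]) (by norm_num) (exp_pos _).le)
  have h4 := zeta_norm_le u 0 hu4
  have h5 := DirichletCharacter.norm_LFunction_product_ge_one (N := 1) 1 (x := 1 / u) (by positivity) t
  simp only [DirichletCharacter.LFunctionTrivChar, DirichletCharacter.LFunction_modOne_eq, one_pow] at h5
  have e1 : (1 : ℂ) + ((1 / u : ℝ) : ℂ) = (1 + 1 / u : ℝ) + (0 : ℝ) * Complex.I := by push_cast; ring
  have e2 : (1 : ℂ) + ((1 / u : ℝ) : ℂ) + Complex.I * t = (1 + 1 / u : ℝ) + t * Complex.I := by push_cast; ring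
  have e3 : (1 : ℂ) + ((1 / u : ℝ) : ℂ) + 2 * Complex.I * t = (1 + 1 / u : ℝ) + (2 * t : ℝ) * Complex.I := by push_cast; ring
  rw [e3, e2, e1, norm_mul, norm_mul, norm_pow, norm_pow] at h5
  set a := ‖riemannZeta ((1 + 1 / u : ℝ) + (0 : ℝ) * Complex.I)‖
  set z := ‖riemannZeta ((1 + 1 / u : ℝ) + t * Complex.I)‖ with hz
  set b := ‖riemannZeta ((1 + 1 / u : ℝ) + (2 * t : ℝ) * Complex.I)‖
  have ha : a ^ 3 ≤ (2 * u) ^ 3 := pow_le_pow_left₀ (norm_nonneg _) (by linarith) 3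
  have hz0 : 0 < z := by
    rcases (norm_nonneg (riemannZeta ((1 + 1 / u : ℝ) + t * Complex.I))).eq_or_lt with h | h
    · rw [← hz] at h; rw [← h] at h5; norm_num at h5
    · exact h
  have h6 : 1 ≤ (2 * u) ^ 3 * z ^ 4 * (ε ^ 4 / 8 * u) := h5.trans (by gcongr)
  have h7 : 1 ≤ (ε * u * z) ^ 4 := h6.trans (le_of_eq (by ring))
  have h8 : 1 ≤ ε * u * z := by
    by_contra hcon
    exact absurd h7 (not_le.2 (pow_lt_one₀ (by positivity) (not_le.1 hcon) (by norm_num)))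
  rw [norm_inv, inv_le_iff_one_le_mul₀ hz0]
  exact h8
end MR
namespace MR
open Real MeasureTheory ContDiff

theorem Bump.der {w : ℝ → ℝ} {B : ℝ} (h : Bump w B) : Bump (deriv w) B := by
  refine ⟨(contDiff_infty_iff_deriv.1 h.sm).2, fun y hy => ?_, h.hB⟩
  have : w =ᶠ[𝓝 y] fun _ => 0 := by
    filter_upwards [(isOpen_lt continuous_const continuous_abs).mem_nhds hy] with z hz
    exact h.supp z hz
  rw [this.deriv_eq, deriv_const]

theorem Bump.wh_der {w : ℝ → ℝ} {B : ℝ} (h : Bump w B) (t : ℝ) : ‖wh (deriv w) t‖ = |t| * ‖wh w t‖ := by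
  have hd : Differentiable ℝ w := h.sm.differentiable (by simp)
  have hd' : deriv (fun u => (w u : ℂ)) = fun u => ((deriv w u : ℝ) : ℂ) := by
    ext u; exact (hd u).hasDerivAt.ofReal_comp.deriv
  have := Real.fourier_deriv h.w_int (h.smc.differentiable (by simp)) (by rw [hd']; exact h.der.w_int)
  rw [hd'] at this
  rw [wh, this, wh]
  simp only [norm_smul, norm_mul, Complex.norm_I, Complex.norm_real, norm_eq_abs, Complex.norm_two, abs_div,
    abs_of_pos pi_pos, abs_two]
  have := pi_pos
  rw [mul_one, mul_div_assoc', mul_comm (2 * π), mul_div_assoc, abs_mul, abs_two, abs_of_pos pi_pos,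
    div_self (by positivity), mul_one]

theorem Bump.mulX {w : ℝ → ℝ} {B : ℝ} (h : Bump w B) : Bump (fun y => y * w y) B :=
  ⟨contDiff_id.mul h.sm, fun y hy => by rw [h.supp y hy, mul_zero], h.hB⟩

theorem Bump.tilt {w : ℝ → ℝ} {B : ℝ} (h : Bump w B) (u : ℝ) : Bump (fun y => exp (-(y / u)) * w (-y)) B :=
  ⟨by have := h.sm; fun_prop, fun y hy => by rw [h.supp (-y) (by rwa [abs_neg]), mul_zero], h.hB⟩

theorem Bump.tilt_bdd {w : ℝ → ℝ} {B : ℝ} (h : Bump w B) : ∃ M, 0 < M ∧ ∀ u ≥ (1 : ℝ), ∀ y,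
    |exp (-(y / u)) * w (-y)| ≤ M ∧ |deriv (fun y => exp (-(y / u)) * w (-y)) y| ≤ M := by
  obtain ⟨C1, hC1, h1⟩ := h.bdd
  obtain ⟨C2, hC2, h2⟩ := h.der.bdd
  refine ⟨exp B * (C1 + C2), by positivity, fun u hu y => ?_⟩
  have hu0 : 0 < u := by linarith
  rcases lt_or_ge B |y| with hy | hy
  · rw [(h.tilt u).supp y hy, (h.tilt u).der.supp y hy, abs_zero]
    exact ⟨by positivity, by positivity⟩
  · have he : exp (-(y / u)) ≤ exp B := by
      refine exp_le_exp.2 ?_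
      rw [← neg_div, div_le_iff₀ hu0]
      have := (abs_le.1 hy).1
      have := h.hB
      have : B * 1 ≤ B * u := mul_le_mul_of_nonneg_left hu (by linarith)
      linarith
    have hd : HasDerivAt (fun y => exp (-(y / u)) * w (-y))
        (exp (-(y / u)) * (-(1 / u)) * w (-y) + exp (-(y / u)) * (deriv w (-y) * (-1))) y := by
      have hw : HasDerivAt w (deriv w (-y)) (-y) := ((h.sm.differentiable (by simp)) (-y)).hasDerivAt
      exact (((hasDerivAt_id y).div_const u).neg.exp).mul (hw.comp y (hasDerivAt_neg y))
    have a1 := h1 (-y)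
    have a2 := h2 (-y)
    have e0 := exp_pos (-(y / u))
    constructor
    · rw [abs_mul, abs_of_pos e0]
      exact mul_le_mul he (by linarith) (abs_nonneg _) (exp_pos _).le
    · rw [hd.deriv]
      have : exp (-(y / u)) * (-(1 / u)) * w (-y) + exp (-(y / u)) * (deriv w (-y) * (-1)) =
        exp (-(y / u)) * (-(1 / u * w (-y)) - deriv w (-y)) := by ring
      rw [this, abs_mul, abs_of_pos e0]
      refine mul_le_mul he ?_ (abs_nonneg _) (exp_pos _).le
      refine (abs_sub _ _).trans ?_
      rw [abs_neg, abs_mul, abs_of_pos (by positivity : 0 < 1 / u)]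
      have : 1 / u ≤ 1 := by rw [div_le_one hu0]; exact hu
      have : 1 / u * |w (-y)| ≤ 1 * |w (-y)| := mul_le_mul_of_nonneg_right this (abs_nonneg _)
      linarith

noncomputable def Ls (f : ℕ → ℂ) (σ t : ℝ) : ℂ := ∑' n, f n * zt σ n * E t n

theorem term_eq (f : ℕ → ℂ) (σ t : ℝ) (n : ℕ) : LSeries.term f (σ + t * Complex.I) n = f n * zt σ n * E t n := by
  rw [LSeries.term_def, zt]
  split_ifs with h
  · simp
  · rw [div_eq_mul_one_div, cpow_E _ _ _ h, mul_assoc]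

theorem Ls_eq (f : ℕ → ℂ) (σ t : ℝ) : LSeries f (σ + t * Complex.I) = Ls f σ t := by
  rw [LSeries, Ls]; exact tsum_congr fun n => term_eq f σ t n

theorem Ls_summable {f : ℕ → ℂ} {σ : ℝ} (h : LSeriesSummable f σ) : Summable fun n => ‖f n * zt σ n‖ := by
  have h1 : Summable fun n => ‖LSeries.term f σ n‖ := h.norm
  refine h1.congr fun n => ?_
  have := term_eq f σ 0 n
  rw [Complex.ofReal_zero, zero_mul, add_zero] at this
  rw [this, norm_mul _ (E 0 n), norm_E, mul_one]

theorem E_add (t τ : ℝ) (n : ℕ) : E (t + τ) n = E t n * E τ n := by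
  rw [E, E, E, ← Complex.exp_add]; congr 1; push_cast; ring

theorem Ls_cont {f : ℕ → ℂ} {σ : ℝ} (h : LSeriesSummable f σ) (t : ℝ) : Continuous fun τ => Ls f σ (t + τ) := by
  refine continuous_tsum (u := fun n => ‖f n * zt σ n‖) (fun n => ?_) (Ls_summable h) fun n τ => ?_
  · have : Continuous fun τ => E τ n := E_cont n
    fun_prop
  · rw [norm_mul, norm_E, mul_one]

theorem Ls_dp {φ : ℝ → ℝ} {B : ℝ} (h : Bump φ B) {f : ℕ → ℂ} {σ : ℝ} (hf : LSeriesSummable f σ) (t : ℝ) :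
    2 * π * ∫ s, ‖∑' n, f n * zt σ n * E t n * (φ (s - log n) : ℂ)‖ ^ 2 =
      ∫ τ, ‖Ls f σ (t + τ)‖ ^ 2 * ‖wh φ τ‖ ^ 2 := by
  rw [dp h (fun n => f n * zt σ n * E t n) (by simpa using Ls_summable hf) (fun n => log n)]
  congr 1; ext τ; congr 3
  refine tsum_congr fun n => ?_
  rw [E_add, mul_assoc _ (E t n)]; rfl

theorem Ls_integrable {φ : ℝ → ℝ} {B : ℝ} (h : Bump φ B) {f : ℕ → ℂ} {σ : ℝ} (hf : LSeriesSummable f σ) (t : ℝ) :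
    Integrable fun τ => ‖Ls f σ (t + τ)‖ ^ 2 * ‖wh φ τ‖ ^ 2 := by
  obtain ⟨C, hC, hd⟩ := h.decay 0
  simp only [pow_zero, one_mul] at hd
  have h1 : Integrable fun τ => ‖wh φ τ‖ ^ 2 := by
    have := h.wh_int.norm.bdd_mul (c := C) (f := fun τ => ‖wh φ τ‖) h.wh_cont.norm.aestronglyMeasurable
      (Eventually.of_forall fun τ => by rw [norm_norm]; exact hd τ)
    simpa [pow_two] using this
  refine h1.bdd_mul (c := (∑' n, ‖f n * zt σ n‖) ^ 2) ((Ls_cont hf t).norm.pow 2).aestronglyMeasurable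
    (Eventually.of_forall fun τ => ?_)
  rw [norm_pow, norm_norm]
  refine pow_le_pow_left₀ (norm_nonneg _) ?_ 2
  refine tsum_of_norm_bounded (Ls_summable hf).hasSum fun n => ?_
  rw [norm_mul _ (E _ n), norm_E, mul_one]
end MR
namespace MR
open Real MeasureTheory
open ArithmeticFunction hiding log

noncomputable def La (n : ℕ) : ℂ := ((vonMangoldt n : ℝ) : ℂ)
noncomputable def Mu (n : ℕ) : ℂ := ((moebius n : ℤ) : ℂ)

theorem Mu_le (n : ℕ) : ‖Mu n‖ ≤ 1 := by
  rw [Mu, Complex.norm_intCast]; exact_mod_cast abs_moebius_le_one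

theorem sig_gt {u : ℝ} (hu : 1 ≤ u) : 1 < 1 + 1 / u := by
  have : 0 < 1 / u := by positivity
  linarith

theorem La_summable {u : ℝ} (hu : 1 ≤ u) : LSeriesSummable La ((1 + 1 / u : ℝ) : ℂ) := by
  refine LSeriesSummable_vonMangoldt ?_
  rw [Complex.ofReal_re]; exact sig_gt hu

theorem Mu_summable {u : ℝ} (hu : 1 ≤ u) : LSeriesSummable Mu ((1 + 1 / u : ℝ) : ℂ) := by
  refine LSeriesSummable_moebius_iff.2 ?_
  rw [Complex.ofReal_re]; exact sig_gt hu

theorem lam_L2 (B M : ℝ) (hB : 1 ≤ B) (hM : 0 < M) : ∃ C, 0 < C ∧ ∀ φ : ℝ → ℝ, Bump φ B → (∀ y, |φ y| ≤ M) →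
    ∀ u ≥ (1 : ℝ), ∀ t, ∫ τ, ‖Ls La (1 + 1 / u) (t + τ)‖ ^ 2 * ‖wh φ τ‖ ^ 2 ≤ C * u := by
  set D := M * (6 * exp (2 * B)) * exp (2 * B) with hD
  refine ⟨2 * π * D ^ 2, by positivity, fun φ hφ hφM u hu t => ?_⟩
  have hu0 : 0 < u := by linarith
  rw [← Ls_dp hφ (La_summable hu) t, mul_assoc (2 * π) (D ^ 2) u]
  refine mul_le_mul_of_nonneg_left ?_ (by positivity)
  have key : ∀ s : ℝ, ‖∑' n : ℕ, La n * zt (1 + 1 / u) n * E t n * (φ (s - log n) : ℂ)‖ ≤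
      if -B ≤ s then D * exp (-(1 / u * (s + B))) else 0 := by
    intro s
    have hsupp : ∀ n ∉ Wn B s, La n * zt (1 + 1 / u) n * E t n * (φ (s - log n) : ℂ) = 0 := by
      intro n hn
      rcases Nat.eq_zero_or_pos n with rfl | hn0
      · simp [zt]
      · rw [hφ.supp, Complex.ofReal_zero, mul_zero]
        by_contra hc
        exact hn (mem_Wn.2 ⟨hn0, by rw [abs_sub_comm]; exact not_lt.1 hc⟩)
    rw [tsum_eq_sum hsupp]
    split_ifs with hs
    · refine (norm_sum_le _ _).trans ?_
      have h1 : ∀ n ∈ Wn B s, ‖La n * zt (1 + 1 / u) n * E t n * (φ (s - log n) : ℂ)‖ ≤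
          (vonMangoldt n / n) * (M * exp (2 * B) * exp (-(1 / u * (s + B)))) := by
        intro n hn
        have hn1 := (mem_Wn.1 hn).1
        have hn2 := (abs_le.1 (mem_Wn.1 hn).2).1
        rw [norm_mul, norm_mul, norm_E, mul_one, norm_mul, La, Complex.norm_real, Complex.norm_real, Complex.norm_real,
          norm_of_nonneg vonMangoldt_nonneg, norm_of_nonneg (zt_nonneg _ _), norm_eq_abs, div_eq_mul_inv (vonMangoldt n) (n : ℝ), mul_assoc (vonMangoldt n), mul_assoc (vonMangoldt n)]
        refine mul_le_mul_of_nonneg_left ?_ vonMangoldt_nonneg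
        rw [zt, if_neg (by omega), add_mul, one_mul, neg_add, exp_add, exp_neg (log _), exp_log (by positivity), mul_assoc]
        refine mul_le_mul_of_nonneg_left ?_ (by positivity)
        rw [mul_comm]
        rw [mul_assoc, ← exp_add]
        refine mul_le_mul (hφM _) (exp_le_exp.2 ?_) (exp_pos _).le hM.le
        have h3 : 1 / u * (s - B) ≤ 1 / u * log n := mul_le_mul_of_nonneg_left (by linarith) (by positivity)
        have h4 : 1 / u * (2 * B) ≤ 1 * (2 * B) := mul_le_mul_of_nonneg_right (by rw [div_le_one hu0]; exact hu) (by linarith)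
        have h5 : 1 / u * (s + B) = 1 / u * (s - B) + 1 / u * (2 * B) := by ring
        linarith
      refine (Finset.sum_le_sum h1).trans ?_
      rw [← Finset.sum_mul]
      have := vonMangoldt_window B (Wn B s) s fun n hn _ => (mem_Wn.1 hn).2
      have := mul_le_mul_of_nonneg_right this (by positivity : 0 ≤ M * exp (2 * B) * exp (-(1 / u * (s + B))))
      refine this.trans (le_of_eq ?_)
      rw [hD]; ring
    · rw [Finset.sum_eq_zero, norm_zero]
      intro n hn
      have hn1 := (mem_Wn.1 hn)
      have hn2 := (abs_le.1 hn1.2).2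
      have h3 : 0 ≤ Real.log (n : ℝ) := Real.log_nonneg (by exact_mod_cast hn1.1)
      linarith
  have e1 := integrableOn_exp_mul_Ioi (a := -(2 / u)) (by have : 0 < 2 / u := by positivity
                                                          linarith) (-B)
  have e2 := integral_exp_mul_Ioi (a := -(2 / u)) (by have : 0 < 2 / u := by positivity
                                                      linarith) (-B)
  have h1 : Integrable fun s => (Set.Ioi (-B)).indicator (fun s => D ^ 2 * exp (-(2 / u) * B) * exp (-(2 / u) * s)) s := by
    rw [integrable_indicator_iff measurableSet_Ioi]
    exact e1.const_mul _
  refine (integral_mono_of_nonneg (Eventually.of_forall fun s => by positivity) h1 ?_).trans ?_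
  · have hne : ∀ᵐ s : ℝ, s ≠ -B := by simp [ae_iff]
    filter_upwards [hne] with s hs
    have := pow_le_pow_left₀ (norm_nonneg _) (key s) 2
    refine this.trans (le_of_eq ?_)
    by_cases h : -B < s
    · rw [if_pos h.le, Set.indicator_of_mem (Set.mem_Ioi.2 h), mul_pow, mul_assoc, ← exp_add, ← exp_nat_mul]
      congr 2; push_cast; ring
    · rw [if_neg (fun h' => h (lt_of_le_of_ne h' (Ne.symm hs))), Set.indicator_of_notMem (by simpa using h)]
      norm_num
  · rw [integral_indicator measurableSet_Ioi, integral_const_mul, e2]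
    have : exp (-(2 / u) * B) * exp (-(2 / u) * -B) = 1 := by rw [← exp_add, ← exp_zero]; congr 1; ring
    have h3 : D ^ 2 * exp (-(2 / u) * B) * (-exp (-(2 / u) * -B) / -(2 / u)) =
      D ^ 2 * (u / 2) * (exp (-(2 / u) * B) * exp (-(2 / u) * -B)) := by field_simp
    rw [h3, this]
    have : 0 ≤ D ^ 2 * u := by positivity
    linarith
end MR
namespace MR
open Real MeasureTheory
open ArithmeticFunction hiding log
open scoped LSeries.notation

noncomputable def Ml (n : ℕ) : ℂ := Mu n * ((log n : ℝ) : ℂ)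

theorem Ml_conv (n : ℕ) : Ml n = -∑ x ∈ n.divisorsAntidiagonal, La x.1 * Mu x.2 := by
  have h1 : pmul (moebius : ArithmeticFunction ℝ) ArithmeticFunction.log * (zeta : ArithmeticFunction ℝ) = -vonMangoldt := by
    ext m
    rw [coe_mul_zeta_apply]
    simp only [pmul_apply, intCoe_apply, log_apply]
    exact sum_moebius_mul_log_eq
  have h2 : pmul (moebius : ArithmeticFunction ℝ) ArithmeticFunction.log = -(vonMangoldt * (moebius : ArithmeticFunction ℝ)) := by
    have := congrArg (· * (moebius : ArithmeticFunction ℝ)) h1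
    simpa [mul_assoc, coe_zeta_mul_coe_moebius] using this
  have h3 := congrArg (fun f : ArithmeticFunction ℝ => ((f n : ℝ) : ℂ)) h2
  have h4 : (-(vonMangoldt * (moebius : ArithmeticFunction ℝ))) n = -((vonMangoldt * (moebius : ArithmeticFunction ℝ)) n) := rfl
  simp only [h4, pmul_apply, mul_apply, intCoe_apply, log_apply] at h3
  rw [Ml, Mu]
  simp only [La, Mu]
  rw [← Complex.ofReal_intCast, ← Complex.ofReal_mul, h3]
  push_cast; rfl

theorem Ls_Mu {u : ℝ} (hu : 1 ≤ u) (t : ℝ) : Ls Mu (1 + 1 / u) t = (riemannZeta ((1 + 1 / u : ℝ) + t * Complex.I))⁻¹ := by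
  have hre : 1 < ((1 + 1 / u : ℝ) + t * Complex.I : ℂ).re := by simpa using (by positivity : 0 < u)
  have := LSeries_zeta_mul_Lseries_moebius hre
  rw [LSeries_zeta_eq_riemannZeta hre] at this
  rw [← Ls_eq]
  exact eq_inv_of_mul_eq_one_right this

theorem Ml_L2 {w : ℝ → ℝ} {B : ℝ} (h : Bump w B) (A η : ℝ) (hA : 1 ≤ A) (hη : 0 < η) : ∃ u0 : ℝ, 1 ≤ u0 ∧ ∀ u ≥ u0, ∀ t : ℝ,
    |t| ≤ exp (A * u) → Integrable (fun s => exp (-(s / u)) ^ 2 * ‖Dw Ml w s t‖ ^ 2) ∧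
      ∫ s, exp (-(s / u)) ^ 2 * ‖Dw Ml w s t‖ ^ 2 ≤ η * u ^ 3 := by
  obtain ⟨M, hM, hb⟩ := h.tilt_bdd
  obtain ⟨C, hC, hL⟩ := lam_L2 B M h.hB hM
  set ε := sqrt (η / (2 * C)) with hε
  have hε0 : 0 < ε := by positivity
  have hε2 : ε ^ 2 * C = η / 2 := by rw [hε, sq_sqrt (by positivity)]; field_simp
  obtain ⟨u1, hu1, hz⟩ := zeta_inv (A + 1) ε (by linarith) hε0
  refine ⟨max u1 (8 * C / η), hu1.trans (le_max_left _ _), fun u hu t ht => ?_⟩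
  have hu2 : u1 ≤ u := (le_max_left _ _).trans hu
  have hu3 : 8 * C / η ≤ u := (le_max_right _ _).trans hu
  have hu4 : 1 ≤ u := hu1.trans hu2
  have hu0 : 0 < u := by linarith
  set φ : ℝ → ℝ := fun y => exp (-(y / u)) * w (-y) with hφ
  have hφb : Bump φ B := h.tilt u
  set f : ℕ → ℂ := La ⍟ Mu with hf
  have hfs : LSeriesSummable f ((1 + 1 / u : ℝ) : ℂ) := (La_summable hu4).convolution (Mu_summable hu4)
  have hfn : ∀ n, f n = -Ml n := by
    intro n
    rw [Ml_conv, neg_neg, hf, LSeries.convolution_def]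
  have hterm : ∀ s, ‖∑' n : ℕ, f n * zt (1 + 1 / u) n * E t n * (φ (s - log n) : ℂ)‖ ^ 2 = exp (-(s / u)) ^ 2 * ‖Dw Ml w s t‖ ^ 2 := by
    intro s
    rw [← mul_pow]
    congr 1
    have : exp (-(s / u)) * ‖Dw Ml w s t‖ = ‖((-exp (-(s / u)) : ℝ) : ℂ) * Dw Ml w s t‖ := by
      rw [norm_mul, Complex.norm_real, norm_neg, norm_of_nonneg (exp_pos _).le]
    rw [this, Dw, ← tsum_mul_left]
    congr 1
    refine tsum_congr fun n => ?_
    rcases Nat.eq_zero_or_pos n with rfl | hn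
    · simp [zt]
    · have : (zt (1 + 1 / u) n) * φ (s - log n) = exp (-(s / u)) * (w (log n - s) / n) := by
        have hn0 : (0 : ℝ) < n := by exact_mod_cast hn
        have e1 : exp (-(1 / u * log n)) * exp (-((s - log n) / u)) = exp (-(s / u)) := by
          rw [← exp_add]; congr 1; ring
        simp only [hφ]
        rw [zt, if_neg (by omega), add_mul, one_mul, neg_add, exp_add, exp_neg (log _), exp_log hn0, neg_sub, ← e1]
        ring
      have h2 : ((zt (1 + 1 / u) n : ℝ) : ℂ) * ((φ (s - log n) : ℝ) : ℂ) = ((exp (-(s / u)) : ℝ) : ℂ) * ((w (log n - s) / n : ℝ) : ℂ) := by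
        exact_mod_cast this
      rw [hfn]
      calc -Ml n * zt (1 + 1 / u) n * E t n * (φ (s - log n) : ℂ) = -Ml n * E t n * (zt (1 + 1 / u) n * (φ (s - log n) : ℂ)) := by ring
        _ = _ := by rw [h2]; push_cast; ring
  have hdp := Ls_dp hφb hfs t
  simp only [hterm] at hdp
  have hLs : ∀ τ, Ls f (1 + 1 / u) (t + τ) = Ls La (1 + 1 / u) (t + τ) * (riemannZeta ((1 + 1 / u : ℝ) + (t + τ : ℝ) * Complex.I))⁻¹ := by
    intro τ
    have hre : 1 < ((1 + 1 / u : ℝ) + (t + τ : ℝ) * Complex.I : ℂ).re := by simpa using hu0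
    rw [← Ls_Mu hu4, ← Ls_eq, ← Ls_eq, ← Ls_eq]
    exact LSeries_convolution' (LSeriesSummable_vonMangoldt hre) (LSeriesSummable_moebius_iff.2 hre)
  have hint1 := Ls_integrable hφb (La_summable hu4) t
  have hint2 := Ls_integrable hφb.der (La_summable hu4) t
  have hpt : ∀ τ, ‖Ls f (1 + 1 / u) (t + τ)‖ ^ 2 * ‖wh φ τ‖ ^ 2 ≤
      (ε * u) ^ 2 * (‖Ls La (1 + 1 / u) (t + τ)‖ ^ 2 * ‖wh φ τ‖ ^ 2) + 4 * (‖Ls La (1 + 1 / u) (t + τ)‖ ^ 2 * ‖wh (deriv φ) τ‖ ^ 2) := by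
    intro τ
    rw [hLs, norm_mul, mul_pow, hφb.wh_der, mul_pow]
    set l := ‖Ls La (1 + 1 / u) (t + τ)‖
    set z := ‖(riemannZeta ((1 + 1 / u : ℝ) + (t + τ : ℝ) * Complex.I))⁻¹‖ with hz'
    set p := ‖wh φ τ‖
    rcases le_total |τ| u with h1 | h1
    · have h2 : z ≤ ε * u := by
        refine hz u hu2 (t + τ) ?_
        have h3 := add_one_le_exp u
        have h4 : exp u * 1 ≤ exp u * exp (A * u) := mul_le_mul_of_nonneg_left (one_le_exp (by positivity)) (exp_pos _).le
        have h5 : 2 * exp (A * u) ≤ exp u * exp (A * u) := mul_le_mul_of_nonneg_right (by linarith) (exp_pos _).le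
        have h6 : exp u ≤ exp (A * u) := exp_le_exp.2 (le_mul_of_one_le_left hu0.le hA)
        rw [add_mul, one_mul, add_comm (A * u), exp_add]
        linarith [abs_add_le t τ]
      have h3 : z ^ 2 ≤ (ε * u) ^ 2 := pow_le_pow_left₀ (norm_nonneg _) h2 2
      have h4 : l ^ 2 * z ^ 2 * p ^ 2 ≤ l ^ 2 * (ε * u) ^ 2 * p ^ 2 := by gcongr
      have h5 : 0 ≤ 4 * (l ^ 2 * (|τ| ^ 2 * p ^ 2)) := by positivity
      linarith
    · have h2 : z ≤ 2 * |τ| := by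
        have hpos := zeta_norm_le u (t + τ) hu4
        rw [hz', ← Ls_Mu hu4]
        have : ‖Ls Mu (1 + 1 / u) (t + τ)‖ ≤ 1 + u := by
          refine le_trans ?_ (zt_sum_le u hu4)
          refine tsum_of_norm_bounded (log_pow_sum (1 + 1 / u) (sig_gt hu4)).hasSum fun n => ?_
          rw [norm_mul, norm_E, mul_one, norm_mul, Complex.norm_real, norm_of_nonneg (zt_nonneg _ _)]
          exact mul_le_of_le_one_left (zt_nonneg _ _) (Mu_le n)
        linarith
      have h3 : z ^ 2 ≤ (2 * |τ|) ^ 2 := pow_le_pow_left₀ (norm_nonneg _) h2 2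
      have h4 : l ^ 2 * z ^ 2 * p ^ 2 ≤ l ^ 2 * (2 * |τ|) ^ 2 * p ^ 2 := by gcongr
      have h5 : 0 ≤ (ε * u) ^ 2 * (l ^ 2 * p ^ 2) := by positivity
      linarith
  have hI1 := hL φ hφb (fun y => (hb u hu4 y).1) u hu4 t
  have hI2 := hL _ hφb.der (fun y => (hb u hu4 y).2) u hu4 t
  have hfin := integral_mono (Ls_integrable hφb hfs t) ((hint1.const_mul _).add (hint2.const_mul _)) hpt
  simp only [Pi.add_apply] at hfin
  rw [integral_add (hint1.const_mul _) (hint2.const_mul _), integral_const_mul, integral_const_mul, ← hdp] at hfin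
  have hnn : 0 ≤ ∫ s, exp (-(s / u)) ^ 2 * ‖Dw Ml w s t‖ ^ 2 := integral_nonneg fun s => by positivity
  constructor
  · have := (dp_aux hφb (fun n => f n * zt (1 + 1 / u) n * E t n) (by simpa using Ls_summable hfs) (fun n => log n)).2.2.2.2
    simpa only [hterm] using this
  · have h2pi : 1 ≤ 2 * π := by linarith [pi_gt_three]
    have h1 : ∫ s, exp (-(s / u)) ^ 2 * ‖Dw Ml w s t‖ ^ 2 ≤ 2 * π * ∫ s, exp (-(s / u)) ^ 2 * ‖Dw Ml w s t‖ ^ 2 :=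
      le_mul_of_one_le_left hnn h2pi
    have h2 : (ε * u) ^ 2 * ∫ τ, ‖Ls La (1 + 1 / u) (t + τ)‖ ^ 2 * ‖wh φ τ‖ ^ 2 ≤ (ε * u) ^ 2 * (C * u) :=
      mul_le_mul_of_nonneg_left hI1 (by positivity)
    have h3 : (ε * u) ^ 2 * (C * u) = η / 2 * u ^ 3 := by rw [← hε2]; ring
    have h4 : 4 * (C * u) ≤ η / 2 * u ^ 3 := by
      rw [div_le_iff₀ hη] at hu3
      have h5 : 4 * C ≤ η / 2 * u := by linarith
      have h6 : η / 2 * u * u * 1 ≤ η / 2 * u * u * u := mul_le_mul_of_nonneg_left hu4 (by positivity)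
      have h7 : 4 * C * u ≤ η / 2 * u * u := mul_le_mul_of_nonneg_right h5 hu0.le
      calc 4 * (C * u) = 4 * C * u := by ring
        _ ≤ _ := h7
        _ ≤ η / 2 * u * u * u := by linarith
        _ = _ := by ring
    linarith
end MR
namespace MR
open Real MeasureTheory
open ArithmeticFunction hiding log

theorem Ml_eq {w : ℝ → ℝ} {B : ℝ} (h : Bump w B) (u t : ℝ) :
    Dw Ml w u t = u * Dw Mu w u t + Dw Mu (fun y => y * w y) u t := by
  rw [Dw_eq h _ _ _ _ subset_rfl, Dw_eq h _ _ _ _ subset_rfl, Dw_eq h.mulX _ _ _ _ subset_rfl, Finset.mul_sum,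
    ← Finset.sum_add_distrib]
  refine Finset.sum_congr rfl fun n _ => ?_
  rw [Ml]; push_cast; ring

theorem Ml_conv_sum {w : ℝ → ℝ} {B : ℝ} (h : Bump w B) (u t : ℝ) (N : ℕ) (hN : N = ⌊exp (u + B)⌋₊) :
    Dw Ml w u t = -∑ a ∈ Finset.Ioc 0 N, La a / a * E t a * Dw Mu w (u - log a) t := by
  have hsub : ∀ x ≤ u, Wn B x ⊆ Finset.Ioc 0 N := by
    intro x hx n hn
    rw [Finset.mem_Ioc, hN]
    refine ⟨(mem_Wn.1 hn).1, Nat.le_floor ((Wn_upper hn).trans (exp_le_exp.2 (by linarith)))⟩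
  rw [Dw_eq h _ _ _ _ (hsub u le_rfl)]
  have h1 : ∀ a ∈ Finset.Ioc 0 N, La a / a * E t a * Dw Mu w (u - log a) t =
      ∑ b ∈ Finset.Ioc 0 N, La a * Mu b * ((w (log (a * b : ℕ) - u) / (a * b : ℕ) : ℝ) : ℂ) * E t (a * b) := by
    intro a ha
    have ha' := (Finset.mem_Ioc.1 ha).1
    have hl : 0 ≤ log (a : ℝ) := log_nonneg (by exact_mod_cast ha')
    rw [Dw_eq h _ _ _ _ (hsub (u - log a) (by linarith)), Finset.mul_sum]
    refine Finset.sum_congr rfl fun b hb => ?_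
    have hb' := (Finset.mem_Ioc.1 hb).1
    rw [E_mul t (by omega) (by omega), Nat.cast_mul, log_mul (by positivity) (by positivity)]
    have : log (a : ℝ) + log b - u = log b - (u - log a) := by ring
    rw [this]; push_cast; field_simp
  rw [Finset.sum_congr rfl h1, ← Finset.sum_product', ← Finset.sum_neg_distrib]
  have h2 : ∀ n ∈ Finset.Ioc 0 N, Ml n * ((w (log n - u) / n : ℝ) : ℂ) * E t n =
      ∑ x ∈ (Finset.Ioc 0 N ×ˢ Finset.Ioc 0 N).filter (fun x => x.1 * x.2 = n),
        -(La x.1 * Mu x.2 * ((w (log (x.1 * x.2 : ℕ) - u) / (x.1 * x.2 : ℕ) : ℝ) : ℂ) * E t (x.1 * x.2)) := by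
    intro n hn
    have hn' := Finset.mem_Ioc.1 hn
    rw [Ml_conv, neg_mul, neg_mul, Finset.sum_mul, Finset.sum_mul, ← Finset.sum_neg_distrib,
      Nat.divisorsAntidiagonal_eq_prod_filter_of_le (by omega) hn'.2]
    refine Finset.sum_congr rfl fun x hx => ?_
    rw [(Finset.mem_filter.1 hx).2]
  rw [Finset.sum_congr rfl h2]
  rw [← Finset.sum_filter_add_sum_filter_not (Finset.Ioc 0 N ×ˢ Finset.Ioc 0 N) (fun x => x.1 * x.2 ∈ Finset.Ioc 0 N)]
  rw [Finset.sum_eq_zero (s := Finset.filter (fun x : ℕ × ℕ => x.1 * x.2 ∉ Finset.Ioc 0 N) _), add_zero]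
  · rw [← Finset.sum_fiberwise_of_maps_to (s := Finset.filter (fun x : ℕ × ℕ => x.1 * x.2 ∈ Finset.Ioc 0 N) _) (t := Finset.Ioc 0 N)
      (g := fun x => x.1 * x.2) (fun x hx => (Finset.mem_filter.1 hx).2)]
    refine Finset.sum_congr rfl fun n hn => ?_
    rw [Finset.filter_filter]
    refine Finset.sum_congr (Finset.filter_congr fun x _ => ?_) fun _ _ => rfl
    constructor
    · rintro rfl; exact ⟨hn, rfl⟩
    · exact fun h => h.2
  · intro x hx
    obtain ⟨hx1, hx2⟩ := Finset.mem_filter.1 hx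
    rw [Finset.mem_product, Finset.mem_Ioc, Finset.mem_Ioc] at hx1
    have hpos : 0 < x.1 * x.2 := Nat.mul_pos hx1.1.1 hx1.2.1
    have : N < x.1 * x.2 := by
      by_contra hc; exact hx2 (Finset.mem_Ioc.2 ⟨hpos, by omega⟩)
    rw [hN, Nat.floor_lt (exp_pos _).le, ← lt_log_iff_exp_lt (by exact_mod_cast hpos)] at this
    rw [h.supp _ (lt_of_lt_of_le (by linarith) (le_abs_self _))]
    simp

theorem Dw_lip {w : ℝ → ℝ} {B : ℝ} (h : Bump w B) : ∃ C, 0 < C ∧ ∀ a : ℕ → ℂ, (∀ n, ‖a n‖ ≤ 1) → ∀ t s s', |s - s'| ≤ 1 →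
    ‖Dw a w s t - Dw a w s' t‖ ≤ C * |s - s'| := by
  obtain ⟨C, hC, hl⟩ := h.lip
  refine ⟨C * exp (2 * (B + 1)), by positivity, fun a ha t s s' hs => ?_⟩
  have h1 : Wn B s ⊆ Wn (B + 1) s := fun n hn => mem_Wn.2 ⟨(mem_Wn.1 hn).1, (mem_Wn.1 hn).2.trans (by linarith)⟩
  have h2 : Wn B s' ⊆ Wn (B + 1) s := fun n hn => mem_Wn.2 ⟨(mem_Wn.1 hn).1, by
    have := (mem_Wn.1 hn).2
    have e : log (n : ℝ) - s = (log n - s') + (s' - s) := by ring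
    rw [e]; rw [abs_sub_comm] at hs
    linarith [abs_add_le (log n - s') (s' - s)]⟩
  rw [Dw_eq h _ _ _ _ h1, Dw_eq h _ _ _ _ h2, ← Finset.sum_sub_distrib]
  refine (norm_sum_le _ _).trans ?_
  have h3 : ∀ n ∈ Wn (B + 1) s, ‖a n * ((w (log n - s) / n : ℝ) : ℂ) * E t n - a n * ((w (log n - s') / n : ℝ) : ℂ) * E t n‖ ≤
      (1 / n : ℝ) * (C * |s - s'|) := by
    intro n hn
    have e : a n * ((w (log n - s) / n : ℝ) : ℂ) * E t n - a n * ((w (log n - s') / n : ℝ) : ℂ) * E t n =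
      a n * ((1 / n * (w (log n - s) - w (log n - s')) : ℝ) : ℂ) * E t n := by push_cast; ring
    rw [e, norm_mul, norm_E, mul_one, norm_mul, Complex.norm_real, norm_mul, norm_of_nonneg (by positivity : (0 : ℝ) ≤ 1 / n), norm_eq_abs]
    have h4 := hl (log n - s) (log n - s')
    have e2 : log (n : ℝ) - s - (log n - s') = -(s - s') := by ring
    rw [e2, abs_neg] at h4
    calc ‖a n‖ * (1 / (n : ℝ) * |w (log n - s) - w (log n - s')|) ≤ 1 * (1 / (n : ℝ) * |w (log n - s) - w (log n - s')|) := by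
          gcongr; exact ha n
      _ ≤ _ := by rw [one_mul]; gcongr
  refine (Finset.sum_le_sum h3).trans ?_
  rw [← Finset.sum_mul]
  have := mul_le_mul_of_nonneg_right (Wn_sum (B + 1) s) (by positivity : 0 ≤ C * |s - s'|)
  refine this.trans (le_of_eq (by ring))

theorem Dw_cont {w : ℝ → ℝ} {B : ℝ} (h : Bump w B) (a : ℕ → ℂ) (ha : ∀ n, ‖a n‖ ≤ 1) (t : ℝ) : Continuous fun s => Dw a w s t := by
  obtain ⟨C, hC, hl⟩ := Dw_lip h
  rw [Metric.continuous_iff]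
  intro s ε hε
  refine ⟨min 1 (ε / C), by positivity, fun s' hs' => ?_⟩
  rw [dist_eq] at hs'
  rw [dist_eq_norm]
  refine (hl a ha t s' s (hs'.le.trans (min_le_left _ _))).trans_lt ?_
  have := hs'.trans_le (min_le_right _ _)
  rw [lt_div_iff₀ hC] at this
  linarith
end MR
namespace MR
open Real MeasureTheory
open ArithmeticFunction hiding log

theorem Mu_avg {w : ℝ → ℝ} {B : ℝ} (h : Bump w B) (A η : ℝ) (hA : 1 ≤ A) (hη : 0 < η) : ∃ u0 : ℝ, 1 ≤ u0 ∧ ∀ u ≥ u0, ∀ t : ℝ,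
    |t| ≤ exp (A * u) → ∫ s in Set.Icc (-B) u, ‖Dw Mu w s t‖ ≤ η * u := by
  obtain ⟨C0, hC0, h0⟩ := Dw_triv h
  obtain ⟨C1, hC1, h1⟩ := Dw_triv h.mulX
  have hB := h.hB
  set δ := η / (4 * C0 + η + 4) with hδ
  have hδ0 : 0 < δ := by positivity
  set κ := δ * η / 16 with hκ
  have hκ0 : 0 < κ := by positivity
  have hδη : C0 * δ ≤ η / 4 := by
    rw [hδ, mul_div_assoc', div_le_div_iff₀ (by positivity) (by norm_num)]
    have : 0 ≤ η * η := by positivity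
    linarith [mul_comm C0 η]
  obtain ⟨u1, hu1, hM⟩ := Ml_L2 h A (4 * κ * δ * (η / 4) / exp 2) hA (by positivity)
  refine ⟨max u1 (B * 4 * C0 / η + B + 8 * C1 * 2 / (δ * η)), hu1.trans (le_max_left _ _), fun u hu t ht => ?_⟩
  have hu2 : u1 ≤ u := (le_max_left _ _).trans hu
  have hu3 := (le_max_right _ _).trans hu
  have hu4 : 1 ≤ u := hu1.trans hu2
  have hu0 : 0 < u := by linarith
  obtain ⟨hi, hI⟩ := hM u hu2 t ht
  set G : ℝ → ℝ := fun s => exp (-(s / u)) ^ 2 * ‖Dw Ml w s t‖ ^ 2 with hG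
  set F : ℝ → ℝ := fun s => (Set.Icc (-B) (δ * u)).indicator (fun _ => C0) s + (κ * u + C1) / (δ * u) +
    exp 2 / (4 * κ * u) / (δ * u) * G s with hF
  have hpt : ∀ s ∈ Set.Icc (-B) u, ‖Dw Mu w s t‖ ≤ F s := by
    intro s hs
    have hi0 : 0 ≤ (Set.Icc (-B) (δ * u)).indicator (fun _ => C0) s := Set.indicator_nonneg (fun _ _ => hC0.le) _
    have hG0 : 0 ≤ G s := by positivity
    rcases le_or_gt s (δ * u) with h2 | h2
    · have e : (Set.Icc (-B) (δ * u)).indicator (fun _ => C0) s = C0 := Set.indicator_of_mem (Set.mem_Icc.2 ⟨hs.1, h2⟩) _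
      have e2 : 0 ≤ (κ * u + C1) / (δ * u) := by positivity
      have e3 : 0 ≤ exp 2 / (4 * κ * u) / (δ * u) * G s := by positivity
      simp only [hF]
      rw [e]
      linarith [h0 Mu Mu_le s t]
    · have hs0 : 0 < s := lt_trans (by positivity) h2
      have h3 : s * ‖Dw Mu w s t‖ ≤ ‖Dw Ml w s t‖ + C1 := by
        have e := Ml_eq h s t
        have e2 : (s : ℂ) * Dw Mu w s t = Dw Ml w s t - Dw Mu (fun y => y * w y) s t := by rw [e]; ring
        have e3 := norm_sub_le (Dw Ml w s t) (Dw Mu (fun y => y * w y) s t)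
        rw [← e2, norm_mul, Complex.norm_real, norm_of_nonneg hs0.le] at e3
        linarith [h1 Mu Mu_le s t]
      have h4 : δ * u * ‖Dw Mu w s t‖ ≤ s * ‖Dw Mu w s t‖ := mul_le_mul_of_nonneg_right h2.le (norm_nonneg _)
      set d := ‖Dw Ml w s t‖
      have h5 : d ^ 2 ≤ exp 2 * G s := by
        have : 1 ≤ exp 2 * exp (-(s / u)) ^ 2 := by
          rw [← exp_nat_mul, ← exp_add]
          refine one_le_exp ?_
          have : s / u ≤ 1 := by rw [div_le_one hu0]; exact hs.2
          push_cast; linarith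
        have := mul_le_mul_of_nonneg_right this (sq_nonneg d)
        rw [hG]; linarith
      have h6 : d ≤ κ * u + d ^ 2 / (4 * κ * u) := by
        rw [← sub_le_iff_le_add', le_div_iff₀ (by positivity)]
        nlinarith [sq_nonneg (d - 2 * (κ * u))]
      have h7 : d ^ 2 / (4 * κ * u) ≤ exp 2 * G s / (4 * κ * u) := div_le_div_of_nonneg_right h5 (by positivity)
      have h8 : ‖Dw Mu w s t‖ ≤ (κ * u + C1 + exp 2 * G s / (4 * κ * u)) / (δ * u) := by
        rw [le_div_iff₀ (by positivity)]; linarith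
      have h9 : (κ * u + C1 + exp 2 * G s / (4 * κ * u)) / (δ * u) =
        (κ * u + C1) / (δ * u) + exp 2 / (4 * κ * u) / (δ * u) * G s := by ring
      simp only [hF]
      linarith
  have i1 : IntegrableOn (fun s => (Set.Icc (-B) (δ * u)).indicator (fun _ => C0) s) (Set.Icc (-B) u) := by
    refine Integrable.integrableOn ?_
    rw [integrable_indicator_iff measurableSet_Icc]
    exact integrableOn_const (by simp)
  have i2 : IntegrableOn (fun s => (κ * u + C1) / (δ * u)) (Set.Icc (-B) u) := integrableOn_const (by simp)
  have i3 : IntegrableOn (fun s => exp 2 / (4 * κ * u) / (δ * u) * G s) (Set.Icc (-B) u) := (hi.const_mul _).integrableOn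
  refine (setIntegral_mono_on ?_ ((i1.add i2).add i3) measurableSet_Icc hpt).trans ?_
  · exact (Dw_cont h Mu Mu_le t).norm.integrableOn_Icc
  have i12 : IntegrableOn (fun s => (Set.Icc (-B) (δ * u)).indicator (fun _ => C0) s + (κ * u + C1) / (δ * u)) (Set.Icc (-B) u) :=
    i1.add i2
  simp only [Pi.add_apply]
  rw [integral_add i12 i3, integral_add i1 i2, integral_const_mul]
  have e1 : ∫ s in Set.Icc (-B) u, (Set.Icc (-B) (δ * u)).indicator (fun _ => C0) s ≤ C0 * (δ * u + B) := by
    refine (setIntegral_le_integral ?_ ?_).trans (le_of_eq ?_)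
    · rw [integrable_indicator_iff measurableSet_Icc]
      exact integrableOn_const (by simp)
    · exact Eventually.of_forall fun s => Set.indicator_nonneg (fun _ _ => hC0.le) _
    · rw [integral_indicator measurableSet_Icc, setIntegral_const, smul_eq_mul, measureReal_def, volume_Icc,
        ENNReal.toReal_ofReal (by have : 0 < δ * u := by positivity
                                  linarith)]
      ring
  have e2 : ∫ s in Set.Icc (-B) u, (κ * u + C1) / (δ * u) = (κ * u + C1) / (δ * u) * (u + B) := by
    rw [setIntegral_const, smul_eq_mul, measureReal_def, volume_Icc, ENNReal.toReal_ofReal (by linarith)]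
    ring
  have e3 : ∫ s in Set.Icc (-B) u, G s ≤ 4 * κ * δ * (η / 4) / exp 2 * u ^ 3 :=
    (setIntegral_le_integral hi (Eventually.of_forall fun s => by positivity)).trans hI
  have e4 : exp 2 / (4 * κ * u) / (δ * u) * ∫ s in Set.Icc (-B) u, G s ≤ η / 4 * u := by
    refine (mul_le_mul_of_nonneg_left e3 (by positivity)).trans (le_of_eq ?_)
    field_simp
  have p1 : 0 ≤ B * 4 * C0 / η := by positivity
  have p2 : 0 ≤ 8 * C1 * 2 / (δ * η) := by positivity
  have e5 : C0 * B ≤ η / 4 * u := by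
    have : B * 4 * C0 / η ≤ u := by linarith
    rw [div_le_iff₀ hη] at this
    linarith
  have e6 : (κ * u + C1) / (δ * u) * (u + B) ≤ η / 8 * u + 2 * C1 / δ := by
    have h1 : (κ * u + C1) / (δ * u) * (u + B) ≤ (κ * u + C1) / (δ * u) * (2 * u) :=
      mul_le_mul_of_nonneg_left (by linarith) (by positivity)
    refine h1.trans (le_of_eq ?_)
    rw [hκ]; field_simp; ring
  have e7 : 2 * C1 / δ ≤ η / 8 * u := by
    have : 8 * C1 * 2 / (δ * η) ≤ u := by linarith
    rw [div_le_iff₀ (by positivity)] at this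
    rw [div_le_iff₀ hδ0]; linarith
  have e8 : C0 * (δ * u + B) ≤ η / 4 * u + η / 4 * u := by
    have := mul_le_mul_of_nonneg_right hδη hu0.le
    linarith
  rw [e2]
  linarith

theorem Mu_ptwise {w : ℝ → ℝ} {B : ℝ} (h : Bump w B) (A ε : ℝ) (hA : 1 ≤ A) (hε : 0 < ε) : ∃ u0 : ℝ, 1 ≤ u0 ∧ ∀ u ≥ u0, ∀ t : ℝ,
    |t| ≤ exp (A * u) → ‖Dw Mu w u t‖ ≤ ε := by
  obtain ⟨C1, hC1, h1⟩ := Dw_triv h.mulX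
  obtain ⟨Cl, hCl, hl⟩ := Dw_lip h
  have hB := h.hB
  set V := 6 * exp (2 * 1) with hV
  have hV0 : 0 < V := by positivity
  set δ := min 1 (ε / (12 * V * Cl)) with hδ
  have hδ0 : 0 < δ := by positivity
  have hδ1 : δ ≤ 1 := min_le_left _ _
  have hδ2 : 12 * V * Cl * δ ≤ ε := by
    have : δ ≤ ε / (12 * V * Cl) := min_le_right _ _
    rw [le_div_iff₀ (by positivity)] at this; linarith
  obtain ⟨u1, hu1, hM⟩ := Mu_avg h A (δ * ε / (8 * V)) hA (by positivity)
  refine ⟨max u1 (B + 1 + 4 * C1 / ε), hu1.trans (le_max_left _ _), fun u hu t ht => ?_⟩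
  have hu2 : u1 ≤ u := (le_max_left _ _).trans hu
  have hu3 := (le_max_right _ _).trans hu
  have hu4 : 1 ≤ u := hu1.trans hu2
  have hu0 : 0 < u := by linarith
  have hav := hM (u + 1) (by linarith) t (ht.trans (exp_le_exp.2 (by
    have : 0 ≤ A * 1 := by linarith
    rw [mul_add]; linarith)))
  set m : ℝ → ℂ := fun s => Dw Mu w s t with hm
  have hmc : Continuous m := Dw_cont h Mu Mu_le t
  set k : ℝ → ℝ := fun s => 1 / δ * ‖m s‖ + Cl * δ with hk
  have hkc : Continuous k := by fun_prop
  have hk0 : ∀ s, 0 ≤ k s := fun s => by positivity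
  have hi1 : ∀ a b, IntegrableOn (fun r => 1 / δ * ‖m r‖) (Set.Icc a b) := fun a b => (by fun_prop : Continuous fun r => 1 / δ * ‖m r‖).integrableOn_Icc
  have hi2 : ∀ (c a b : ℝ), IntegrableOn (fun _ : ℝ => c) (Set.Icc a b) := fun c a b => integrableOn_const (by simp)
  have hmk : ∀ s, ‖m s‖ ≤ ∫ r in Set.Icc s (s + 1), k r := by
    intro s
    have a1 : ∫ r in Set.Icc s (s + δ), 1 / δ * ‖m s‖ = ‖m s‖ := by
      rw [setIntegral_const, smul_eq_mul, measureReal_def, volume_Icc, ENNReal.toReal_ofReal (by linarith)]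
      field_simp; ring
    have a2 : ∫ r in Set.Icc s (s + δ), 1 / δ * ‖m s‖ ≤ ∫ r in Set.Icc s (s + δ), (1 / δ * ‖m r‖ + Cl) := by
      refine setIntegral_mono_on (integrableOn_const (by simp)) (by
        exact (by fun_prop : Continuous fun r => 1 / δ * ‖m r‖ + Cl).integrableOn_Icc) measurableSet_Icc fun r hr => ?_
      have b1 : |s - r| ≤ δ := by rw [abs_le]; constructor <;> linarith [hr.1, hr.2]
      have b2 := hl Mu Mu_le t s r (by linarith)
      have b3 : ‖m s‖ ≤ ‖m r‖ + ‖m s - m r‖ := norm_le_norm_add_norm_sub' _ _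
      have b4 : Cl * |s - r| ≤ Cl * δ := mul_le_mul_of_nonneg_left b1 hCl.le
      have b5 : ‖m s‖ ≤ ‖m r‖ + Cl * δ := by linarith
      have b6 := mul_le_mul_of_nonneg_left b5 (by positivity : 0 ≤ 1 / δ)
      refine b6.trans (le_of_eq ?_)
      field_simp
    have a3 : ∫ r in Set.Icc s (s + δ), (1 / δ * ‖m r‖ + Cl) = (∫ r in Set.Icc s (s + δ), 1 / δ * ‖m r‖) + Cl * δ := by
      rw [integral_add (hi1 _ _) (hi2 _ _ _),
        setIntegral_const, smul_eq_mul, measureReal_def, volume_Icc, ENNReal.toReal_ofReal (by linarith)]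
      ring
    have a4 : ∫ r in Set.Icc s (s + 1), k r = (∫ r in Set.Icc s (s + 1), 1 / δ * ‖m r‖) + Cl * δ := by
      rw [hk, integral_add (hi1 _ _) (hi2 _ _ _),
        setIntegral_const, smul_eq_mul, measureReal_def, volume_Icc, ENNReal.toReal_ofReal (by linarith)]
      ring
    have a5 : ∫ r in Set.Icc s (s + δ), 1 / δ * ‖m r‖ ≤ ∫ r in Set.Icc s (s + 1), 1 / δ * ‖m r‖ := by
      refine setIntegral_mono_set (by exact (by fun_prop : Continuous fun r => 1 / δ * ‖m r‖).integrableOn_Icc)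
        (Eventually.of_forall fun r => by positivity) (HasSubset.Subset.eventuallyLE (Set.Icc_subset_Icc_right (by linarith)))
    linarith
  set N := ⌊exp (u + B)⌋₊ with hN
  have hconv := Ml_conv_sum h u t N hN
  have hl0 : ∀ a ∈ Finset.Ioc 0 N, 0 ≤ log (a : ℝ) ∧ log (a : ℝ) ≤ u + B := by
    intro a ha
    have ha' := Finset.mem_Ioc.1 ha
    refine ⟨log_nonneg (by exact_mod_cast ha'.1), ?_⟩
    rw [log_le_iff_le_exp (by exact_mod_cast ha'.1)]
    exact (Nat.le_floor_iff (exp_pos _).le).1 ha'.2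
  have hb1 : ‖Dw Ml w u t‖ ≤ ∑ a ∈ Finset.Ioc 0 N, vonMangoldt a / a * ∫ r in Set.Icc (-B) (u + 1),
      (Set.Icc (u - log a) (u - log a + 1)).indicator k r := by
    rw [hconv, norm_neg]
    refine (norm_sum_le _ _).trans (Finset.sum_le_sum fun a ha => ?_)
    rw [norm_mul, norm_mul, norm_E, mul_one, norm_div, La, Complex.norm_real, norm_of_nonneg vonMangoldt_nonneg, RCLike.norm_natCast]
    refine mul_le_mul_of_nonneg_left ((hmk _).trans (le_of_eq ?_)) (div_nonneg vonMangoldt_nonneg (Nat.cast_nonneg _))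
    rw [setIntegral_indicator measurableSet_Icc, Set.inter_eq_right.2]
    exact Set.Icc_subset_Icc (by linarith [(hl0 a ha).2]) (by linarith [(hl0 a ha).1])
  have hii : ∀ a : ℕ, IntegrableOn (fun r => vonMangoldt a / a * (Set.Icc (u - log a) (u - log a + 1)).indicator k r) (Set.Icc (-B) (u + 1)) := by
    intro a
    refine Integrable.const_mul ?_ _
    refine Integrable.integrableOn ?_
    rw [integrable_indicator_iff measurableSet_Icc]
    exact hkc.integrableOn_Icc
  have hb2 : ‖Dw Ml w u t‖ ≤ ∫ r in Set.Icc (-B) (u + 1), V * k r := by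
    refine hb1.trans ?_
    simp only [← integral_const_mul]
    rw [← integral_finsetSum _ fun a _ => hii a]
    refine setIntegral_mono_on (integrable_finsetSum _ fun a _ => hii a) (by exact (by fun_prop : Continuous fun r => V * k r).integrableOn_Icc)
      measurableSet_Icc fun r _ => ?_
    have hw := vonMangoldt_window 1 ((Finset.Ioc 0 N).filter fun a => |log (a : ℝ) - (u - r)| ≤ 1) (u - r)
      fun n hn _ => (Finset.mem_filter.1 hn).2
    refine le_trans ?_ (mul_le_mul_of_nonneg_right hw (hk0 r))
    rw [Finset.sum_filter, Finset.sum_mul]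
    refine Finset.sum_le_sum fun a _ => ?_
    have h0 : 0 ≤ vonMangoldt a / (a : ℝ) := div_nonneg vonMangoldt_nonneg (Nat.cast_nonneg _)
    by_cases hr : r ∈ Set.Icc (u - log a) (u - log a + 1)
    · rw [Set.indicator_of_mem hr, if_pos]
      rw [abs_le]; constructor <;> linarith [hr.1, hr.2]
    · rw [Set.indicator_of_notMem hr, mul_zero]
      split_ifs
      · exact mul_nonneg h0 (hk0 r)
      · simp
  have hb3 : ∫ r in Set.Icc (-B) (u + 1), V * k r = V / δ * (∫ r in Set.Icc (-B) (u + 1), ‖m r‖) + V * Cl * δ * (u + 1 + B) := by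
    rw [integral_const_mul, hk, integral_add (hi1 _ _) (hi2 _ _ _),
        setIntegral_const, smul_eq_mul, measureReal_def, volume_Icc, ENNReal.toReal_ofReal (by linarith), integral_const_mul]
    ring
  have hb4 : V / δ * (∫ r in Set.Icc (-B) (u + 1), ‖m r‖) ≤ ε / 4 * u := by
    refine (mul_le_mul_of_nonneg_left hav (by positivity)).trans ?_
    have : V / δ * (δ * ε / (8 * V) * (u + 1)) = ε / 8 * (u + 1) := by field_simp
    rw [this]
    have : ε * 1 ≤ ε * u := mul_le_mul_of_nonneg_left hu4 hε.le
    linarith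
  have q1 : 0 ≤ 4 * C1 / ε := by positivity
  have hb5 : V * Cl * δ * (u + 1 + B) ≤ ε / 4 * u := by
    have : V * Cl * δ * (u + 1 + B) ≤ V * Cl * δ * (3 * u) := mul_le_mul_of_nonneg_left (by linarith) (by positivity)
    have := mul_le_mul_of_nonneg_right hδ2 hu0.le
    linarith
  have hb6 : C1 ≤ ε / 4 * u := by
    have : 4 * C1 / ε ≤ u := by linarith
    rw [div_le_iff₀ hε] at this; linarith
  have e := Ml_eq h u t
  have e2 : (u : ℂ) * Dw Mu w u t = Dw Ml w u t - Dw Mu (fun y => y * w y) u t := by rw [e]; ring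
  have e3 := norm_sub_le (Dw Ml w u t) (Dw Mu (fun y => y * w y) u t)
  rw [← e2, norm_mul, Complex.norm_real, norm_of_nonneg hu0.le] at e3
  have e4 := h1 Mu Mu_le u t
  have e5 : u * ‖Dw Mu w u t‖ ≤ u * ε := by
    have : 0 < ε * u := by positivity
    linarith
  exact le_of_mul_le_mul_left e5 hu0
end MR
namespace MR
open Real MeasureTheory

theorem cnt_bd (Q : Finset ℕ) (hQ : ∀ q ∈ Q, 1 ≤ q) (hc : ∀ q ∈ Q, ∀ r ∈ Q, q ≠ r → q.Coprime r) (N : ℕ) :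
    ∑ n ∈ Finset.Ioc 0 N, (((Q.filter (· ∣ n)).card : ℕ) : ℝ) ^ 2 ≤ N * ((∑ q ∈ Q, (1 / q : ℝ)) ^ 2 + ∑ q ∈ Q, (1 / q : ℝ)) ∧
    N * (∑ q ∈ Q, (1 / q : ℝ)) - Q.card ≤ ∑ n ∈ Finset.Ioc 0 N, (((Q.filter (· ∣ n)).card : ℕ) : ℝ) := by
  have e : ∀ n, (((Q.filter (· ∣ n)).card : ℕ) : ℝ) = ∑ q ∈ Q, if q ∣ n then (1 : ℝ) else 0 := by
    intro n; rw [Finset.sum_boole]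
  have cd : ∀ q : ℕ, (∑ n ∈ Finset.Ioc 0 N, if q ∣ n then (1 : ℝ) else 0) = ((N / q : ℕ) : ℝ) := by
    intro q; rw [Finset.sum_boole, Nat.Ioc_filter_dvd_card_eq_div]
  constructor
  · simp only [e, sq, Finset.sum_mul_sum]
    rw [Finset.sum_comm, mul_add, Finset.mul_sum, Finset.mul_sum, ← Finset.sum_add_distrib]
    refine Finset.sum_le_sum fun q hq => ?_
    rw [Finset.sum_comm, Finset.mul_sum]
    have : (N : ℝ) * (1 / q) = ∑ r ∈ Q, if r = q then (N : ℝ) * (1 / q) else 0 := by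
      rw [Finset.sum_ite_eq' Q q]; simp [hq]
    rw [this, ← Finset.sum_add_distrib]
    refine Finset.sum_le_sum fun r hr => ?_
    have hm : ∀ n, (if q ∣ n then (1 : ℝ) else 0) * (if r ∣ n then (1 : ℝ) else 0) = if (q ∣ n ∧ r ∣ n) then 1 else 0 := by
      intro n; split_ifs <;> simp_all
    simp only [hm]
    by_cases h : r = q
    · subst h
      simp only [and_self, if_true, cd]
      have : ((N / r : ℕ) : ℝ) ≤ N / r := Nat.cast_div_le
      have h0 : 0 ≤ (N : ℝ) * (1 / r * (1 / r)) := by positivity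
      rw [mul_one_div (N : ℝ) (r : ℝ)]; linarith
    · rw [if_neg h, add_zero]
      have : ∀ n, (q ∣ n ∧ r ∣ n) ↔ q * r ∣ n := fun n =>
        ⟨fun h' => (hc q hq r hr (Ne.symm h)).mul_dvd_of_dvd_of_dvd h'.1 h'.2, fun h' => ⟨dvd_of_mul_right_dvd h', dvd_of_mul_left_dvd h'⟩⟩
      simp only [this, cd]
      refine Nat.cast_div_le.trans (le_of_eq ?_)
      push_cast; field_simp
  · simp only [e]
    rw [Finset.sum_comm, Finset.mul_sum, Finset.card_eq_sum_ones, Nat.cast_sum, ← Finset.sum_sub_distrib]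
    refine Finset.sum_le_sum fun q hq => ?_
    rw [cd]
    have := Nat.lt_div_mul_add (a := N) (hQ q hq)
    have h2 : (N : ℝ) < (N / q : ℕ) * q + q := by exact_mod_cast this
    have h3 : (0 : ℝ) < q := by exact_mod_cast hQ q hq
    have : (N : ℝ) / q < (N / q : ℕ) + 1 := by rw [div_lt_iff₀ h3]; linarith
    rw [mul_one_div]; push_cast; linarith

theorem TK_term {w : ℝ → ℝ} {B : ℝ} (h : Bump w B) (p : ℕ) (hp : 1 ≤ p) (s x t : ℝ) (hs : |log p - s| ≤ 1) :
    E t p / p * Dw Mu w (x - s) t = ∑ n ∈ Wn (B + 1) x,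
      (if p ∣ n then Mu (n / p) * (w (log (n / p : ℕ) - (x - s)) : ℂ) else 0) / n * E t n := by
  have hp0 : (p : ℝ) ≠ 0 := by positivity
  rw [Dw_eq h Mu (x - s) t _ subset_rfl, Finset.mul_sum]
  refine Finset.sum_of_injOn (fun m => p * m) (fun a _ b _ hab => Nat.eq_of_mul_eq_mul_left hp hab) ?_ ?_ ?_
  · intro m hm
    obtain ⟨h1, h2⟩ := mem_Wn.1 hm
    refine Finset.mem_coe.2 (mem_Wn.2 ⟨Nat.mul_pos hp h1, ?_⟩)
    push_cast
    rw [log_mul hp0 (by positivity), abs_le]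
    rw [abs_le] at h2 hs
    constructor <;> linarith
  · intro n hn hn'
    split_ifs with hd
    · obtain ⟨m, rfl⟩ := hd
      have hm : 1 ≤ m := Nat.pos_of_ne_zero fun h0 => by
        have := (mem_Wn.1 hn).1
        simp [h0] at this
      rw [Nat.mul_div_cancel_left _ hp, h.supp _ ?_]
      · simp
      · by_contra hc
        exact hn' ⟨m, Finset.mem_coe.2 (mem_Wn.2 ⟨hm, not_lt.1 hc⟩), rfl⟩
    · simp
  · intro m hm
    have hm1 := (mem_Wn.1 hm).1
    simp only [dvd_mul_right, if_true]
    rw [Nat.mul_div_cancel_left _ hp, E_mul t (by omega) (by omega)]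
    push_cast
    field_simp

theorem TK_coef {w : ℝ → ℝ} {B : ℝ} (h : Bump w B) : ∃ C, 0 < C ∧ ∀ (Q : Finset ℕ), (∀ p ∈ Q, p.Prime) → ∀ (k L x : ℝ) (s : ℕ → ℝ),
    0 < k → 0 < L → (∀ p ∈ Q, |log p - s p| ≤ 1 / k) → ∀ n : ℕ, 1 ≤ n →
    ‖Mu n * (w (log n - x) : ℂ) + ((1 / L : ℝ) : ℂ) * ∑ p ∈ Q, (if p ∣ n then Mu (n / p) * (w (log (n / p : ℕ) - (x - s p)) : ℂ) else 0)‖ ≤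
    C * (|(Q.filter (· ∣ n)).card - L| / L + (Q.filter (· ∣ n)).card / L / k + (Q.filter (· ^ 2 ∣ n)).card / L) := by
  obtain ⟨C0, hC0, hb⟩ := h.bdd
  obtain ⟨C1, hC1, hl⟩ := h.lip
  refine ⟨2 * C0 + C1, by positivity, fun Q hQ k L x s hk hL hs n hn => ?_⟩
  have hw : ∀ u, ‖(w u : ℂ)‖ ≤ C0 := fun u => by rw [Complex.norm_real]; exact hb u
  have ht : ∀ p ∈ Q, ‖(if p ∣ n then Mu (n / p) * (w (log (n / p : ℕ) - (x - s p)) : ℂ) else 0) + (if p ∣ n then Mu n * (w (log n - x) : ℂ) else 0)‖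
      ≤ (if p ∣ n then C1 / k else 0) + if p ^ 2 ∣ n then 2 * C0 else 0 := by
    intro p hp
    have hpp := hQ p hp
    by_cases h1 : p ∣ n
    · simp only [h1, if_true]
      by_cases h2 : p ^ 2 ∣ n
      · rw [if_pos h2]
        refine (norm_add_le _ _).trans ?_
        rw [norm_mul, norm_mul]
        have a1 := mul_le_mul (Mu_le (n / p)) (hw (log (n / p : ℕ) - (x - s p))) (norm_nonneg _) zero_le_one
        have a2 := mul_le_mul (Mu_le n) (hw (log n - x)) (norm_nonneg _) zero_le_one
        have : 0 ≤ C1 / k := by positivity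
        linarith
      · rw [if_neg h2, add_zero]
        obtain ⟨m, rfl⟩ := h1
        have hm : 1 ≤ m := Nat.pos_of_ne_zero fun h0 => by simp [h0] at hn
        have hpm : p.Coprime m := hpp.coprime_iff_not_dvd.2 fun hd => h2 (by rw [sq]; exact mul_dvd_mul_left p hd)
        have e : Mu (p * m) = - Mu m := by
          simp only [Mu]
          rw [ArithmeticFunction.isMultiplicative_moebius.map_mul_of_coprime hpm, ArithmeticFunction.moebius_apply_prime hpp]
          push_cast; ring
        rw [Nat.mul_div_cancel_left _ hpp.pos, e, neg_mul, ← sub_eq_add_neg, ← mul_sub, norm_mul, ← Complex.ofReal_sub, Complex.norm_real]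
        have b := hl (log m - (x - s p)) (log (p * m : ℕ) - x)
        have e2 : log m - (x - s p) - (log (p * m : ℕ) - x) = - (log p - s p) := by
          push_cast
          rw [log_mul (by exact_mod_cast hpp.ne_zero) (by positivity)]; ring
        rw [e2, abs_neg] at b
        have b2 := mul_le_mul_of_nonneg_left (hs p hp) hC1.le
        have b3 := mul_le_mul (Mu_le m) (b.trans b2) (abs_nonneg _) zero_le_one
        refine b3.trans (le_of_eq (by ring))
    · have : ¬ p ^ 2 ∣ n := fun h => h1 ((dvd_pow_self p two_ne_zero).trans h)
      simp [h1, this]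
  have hsum := (norm_sum_le _ _).trans (Finset.sum_le_sum ht)
  rw [Finset.sum_add_distrib, Finset.sum_add_distrib, ← Finset.sum_filter, ← Finset.sum_filter, Finset.sum_const, ← Finset.sum_filter,
    ← Finset.sum_filter, Finset.sum_const, Finset.sum_const] at hsum
  simp only [nsmul_eq_mul] at hsum
  rw [← Finset.sum_filter]
  set S := ∑ p ∈ Q.filter (· ∣ n), Mu (n / p) * (w (log (n / p : ℕ) - (x - s p)) : ℂ)
  set m := Mu n * (w (log n - x) : ℂ)
  set a := (Q.filter (· ∣ n)).card
  set b := (Q.filter (· ^ 2 ∣ n)).card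
  have hm : ‖m‖ ≤ C0 := by
    rw [norm_mul]
    exact (mul_le_mul (Mu_le n) (hw _) (norm_nonneg _) zero_le_one).trans (by rw [one_mul])
  have hL' : (L : ℂ) ≠ 0 := by exact_mod_cast hL.ne'
  have e : m + ((1 / L : ℝ) : ℂ) * S = ((1 / L : ℝ) : ℂ) * (S + a * m) - ((((a : ℝ) - L) / L : ℝ) : ℂ) * m := by
    push_cast; field_simp; ring
  rw [e]
  refine (norm_sub_le _ _).trans ?_
  rw [norm_mul, norm_mul, Complex.norm_real, Complex.norm_real, norm_eq_abs, norm_eq_abs, abs_div, abs_div, abs_of_pos hL, abs_one]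
  have c1 := mul_le_mul_of_nonneg_left hsum (by positivity : 0 ≤ 1 / L)
  have c2 := mul_le_mul_of_nonneg_left hm (by positivity : 0 ≤ |(a : ℝ) - L| / L)
  have c3 : 1 / L * (a * (C1 / k) + b * (2 * C0)) = C1 * (a / L / k) + 2 * C0 * (b / L) := by ring
  rw [c3] at c1
  have p1 : 0 ≤ |(a : ℝ) - L| / L := by positivity
  have p2 : 0 ≤ (a : ℝ) / L / k := by positivity
  have p3 : 0 ≤ (b : ℝ) / L := by positivity
  have := mul_nonneg hC0.le p1
  have := mul_nonneg hC0.le p2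
  have := mul_nonneg hC1.le p1
  have := mul_nonneg hC1.le p3
  linarith

theorem TK {w : ℝ → ℝ} {B : ℝ} (h : Bump w B) : ∃ C, 0 < C ∧ ∀ (Q : Finset ℕ) (k x T : ℝ) (s : ℕ → ℝ), (∀ p ∈ Q, p.Prime ∧ k ≤ p) →
    1 ≤ k → 1 ≤ ∑ p ∈ Q, (1 / p : ℝ) → (∀ p ∈ Q, |log p - s p| ≤ 1 / k) → 1 ≤ T → T ≤ exp x →
    ∫ t in Set.Icc (-T) T, ‖Dw Mu w x t + ((1 / ∑ p ∈ Q, (1 / p : ℝ) : ℝ) : ℂ) * ∑ p ∈ Q, E t p / p * Dw Mu w (x - s p) t‖ ^ 2 ≤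
    C * (1 / (∑ p ∈ Q, (1 / p : ℝ)) + 1 / k ^ 2 + Q.card / exp x) := by
  obtain ⟨C0, hC0, hc⟩ := TK_coef h
  obtain ⟨C1, hC1, hm⟩ := mvt
  have hB := h.hB
  refine ⟨C1 * ((1 + exp (B + 1)) * exp (B + 1)) * (C0 ^ 2 * 3 * exp (B + 1) * 5), by positivity, fun Q k x T s hQ hk hL hs hT hTx => ?_⟩
  set L := ∑ p ∈ Q, (1 / p : ℝ) with hLd
  have hL0 : 0 < L := by linarith
  have hk0 : 0 < k := by linarith
  set S := Wn (B + 1) x with hS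
  set c : ℕ → ℂ := fun n => Mu n * (w (log n - x) : ℂ) + ((1 / L : ℝ) : ℂ) * ∑ p ∈ Q, (if p ∣ n then Mu (n / p) * (w (log (n / p : ℕ) - (x - s p)) : ℂ) else 0) with hcd
  have e : ∀ t, Dw Mu w x t + ((1 / L : ℝ) : ℂ) * ∑ p ∈ Q, E t p / p * Dw Mu w (x - s p) t = ∑ n ∈ S, c n / n * E t n := by
    intro t
    rw [Finset.sum_congr rfl fun p hp => TK_term h p (hQ p hp).1.one_le (s p) x t
      ((hs p hp).trans (by rw [div_le_one hk0]; exact hk)), Finset.sum_comm, Finset.mul_sum,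
      Dw_eq h Mu x t S (fun n hn => mem_Wn.2 ⟨(mem_Wn.1 hn).1, by linarith [(mem_Wn.1 hn).2]⟩), ← Finset.sum_add_distrib]
    refine Finset.sum_congr rfl fun n _ => ?_
    rw [← Finset.sum_mul, ← Finset.sum_div, hcd]
    push_cast; ring
  simp only [e]
  have hS1 : ∀ n ∈ S, 1 ≤ n := fun n hn => (mem_Wn.1 hn).1
  refine (hm T hT S (fun n => c n / n) hS1).trans ?_
  set N := ⌊exp (x + (B + 1))⌋₊ with hN
  have hSN : S ⊆ Finset.Ioc 0 N := fun n hn => Finset.mem_Ioc.2 ⟨hS1 n hn, Nat.le_floor (Wn_upper hn)⟩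
  set q : ℕ → ℝ := fun n => (|(Q.filter (· ∣ n)).card - L| / L + (Q.filter (· ∣ n)).card / L / k + (Q.filter (· ^ 2 ∣ n)).card / L) with hq
  have hq3 : ∀ n, q n ^ 2 ≤ 3 * (((((Q.filter (· ∣ n)).card : ℕ) : ℝ) - L) ^ 2 / L ^ 2 + (((Q.filter (· ∣ n)).card : ℕ) : ℝ) ^ 2 / L ^ 2 / k ^ 2 + (((Q.filter (· ^ 2 ∣ n)).card : ℕ) : ℝ) ^ 2 / L ^ 2) := by
    intro n
    have := sq_sum_le_card_mul_sum_sq (s := Finset.univ) (f := ![|(Q.filter (· ∣ n)).card - L| / L, (Q.filter (· ∣ n)).card / L / k, (Q.filter (· ^ 2 ∣ n)).card / L])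
    simp only [Fin.sum_univ_three, Matrix.cons_val, Finset.card_univ, Fintype.card_fin, div_pow, sq_abs] at this
    exact_mod_cast this
  have hqs : ∑ n ∈ Finset.Ioc 0 N, q n ^ 2 ≤ 3 * exp (B + 1) * 5 * exp x * (1 / L + 1 / k ^ 2 + Q.card / exp x) := by
    have hinj : Function.Injective (fun p : ℕ => p ^ 2) := Nat.pow_left_injective two_ne_zero
    obtain ⟨a1, a2⟩ := cnt_bd Q (fun p hp => (hQ p hp).1.one_le) (fun p hp r hr hpr => (Nat.coprime_primes (hQ p hp).1 (hQ r hr).1).2 hpr) N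
    obtain ⟨b1, -⟩ := cnt_bd (Q.image (· ^ 2)) (by
        intro q hq
        obtain ⟨p, hp, rfl⟩ := Finset.mem_image.1 hq
        exact Nat.one_le_pow _ _ (hQ p hp).1.pos) (by
        intro q hq r hr hqr
        obtain ⟨p, hp, rfl⟩ := Finset.mem_image.1 hq
        obtain ⟨p', hp', rfl⟩ := Finset.mem_image.1 hr
        exact Nat.Coprime.pow _ _ ((Nat.coprime_primes (hQ p hp).1 (hQ p' hp').1).2 fun h => hqr (by rw [h]))) N
    have e1 : ∀ n, ((Q.image (· ^ 2)).filter (· ∣ n)).card = (Q.filter (· ^ 2 ∣ n)).card := by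
      intro n
      rw [Finset.filter_image, Finset.card_image_of_injective _ hinj]
    simp only [e1] at b1
    rw [Finset.sum_image fun x _ y _ hxy => hinj hxy] at b1
    have b2 : ∑ p ∈ Q, (1 / (p ^ 2 : ℕ) : ℝ) ≤ L / k := by
      rw [hLd, Finset.sum_div]
      refine Finset.sum_le_sum fun p hp => ?_
      have hp0 : (0 : ℝ) < p := by exact_mod_cast (hQ p hp).1.pos
      rw [div_div, Nat.cast_pow, sq]
      exact one_div_le_one_div_of_le (by positivity) (mul_le_mul_of_nonneg_left (hQ p hp).2 hp0.le)
    set S2 := ∑ p ∈ Q, (1 / (p ^ 2 : ℕ) : ℝ)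
    have hS0 : 0 ≤ S2 := Finset.sum_nonneg fun p _ => by positivity
    have hN0 : (0 : ℝ) ≤ N := Nat.cast_nonneg N
    have b3 : N * (S2 ^ 2 + S2) ≤ N * ((L / k) ^ 2 + L / k) :=
      mul_le_mul_of_nonneg_left (add_le_add (pow_le_pow_left₀ hS0 b2 2) b2) hN0
    refine (Finset.sum_le_sum fun n _ => hq3 n).trans ?_
    rw [← Finset.mul_sum, Finset.sum_add_distrib, Finset.sum_add_distrib, ← Finset.sum_div, ← Finset.sum_div, ← Finset.sum_div, ← Finset.sum_div]
    have c1 : ∑ n ∈ Finset.Ioc 0 N, ((((Q.filter (· ∣ n)).card : ℕ) : ℝ) - L) ^ 2 ≤ N * L + 2 * L * Q.card := by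
      have : ∀ n ∈ Finset.Ioc 0 N, ((((Q.filter (· ∣ n)).card : ℕ) : ℝ) - L) ^ 2 = (((Q.filter (· ∣ n)).card : ℕ) : ℝ) ^ 2 - 2 * L * (((Q.filter (· ∣ n)).card : ℕ) : ℝ) + L ^ 2 := fun n _ => by ring
      rw [Finset.sum_congr rfl this, Finset.sum_add_distrib, Finset.sum_sub_distrib, ← Finset.mul_sum, Finset.sum_const, Nat.card_Ioc, nsmul_eq_mul, Nat.sub_zero]
      have := mul_le_mul_of_nonneg_left a2 (by positivity : 0 ≤ 2 * L)
      linarith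
    have d1 : (N : ℝ) ≤ exp (B + 1) * exp x := by
      rw [← exp_add, add_comm (B + 1) x]
      exact Nat.floor_le (exp_pos _).le
    have hLk : 1 / (L * k) ≤ 1 / L := one_div_le_one_div_of_le hL0 (le_mul_of_one_le_right hL0.le hk)
    have hL2 : 1 / L ≤ 1 := by rw [div_le_one hL0]; exact hL
    have f1 : (N * L + 2 * L * Q.card) / L ^ 2 ≤ N * (1 / L) + 2 * Q.card := by
      have : (N * L + 2 * L * Q.card) / L ^ 2 = N * (1 / L) + 2 * Q.card * (1 / L) := by field_simp
      rw [this]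
      have := mul_le_mul_of_nonneg_left hL2 (by positivity : (0 : ℝ) ≤ 2 * Q.card)
      linarith
    have f2 : N * (L ^ 2 + L) / L ^ 2 / k ^ 2 ≤ N * (2 * (1 / k ^ 2)) := by
      have : N * (L ^ 2 + L) / L ^ 2 / k ^ 2 = N * ((1 + 1 / L) * (1 / k ^ 2)) := by field_simp
      rw [this]
      exact mul_le_mul_of_nonneg_left (mul_le_mul_of_nonneg_right (by linarith) (by positivity)) hN0
    have f3 : N * ((L / k) ^ 2 + L / k) / L ^ 2 ≤ N * (1 / k ^ 2 + 1 / L) := by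
      have : N * ((L / k) ^ 2 + L / k) / L ^ 2 = N * (1 / k ^ 2 + 1 / (L * k)) := by field_simp
      rw [this]
      exact mul_le_mul_of_nonneg_left (by linarith) hN0
    have g1 := div_le_div_of_nonneg_right c1 (sq_nonneg L)
    have g2 := div_le_div_of_nonneg_right (div_le_div_of_nonneg_right a1 (sq_nonneg L)) (sq_nonneg k)
    have g3 := div_le_div_of_nonneg_right (b1.trans b3) (sq_nonneg L)
    have g4 := mul_le_mul_of_nonneg_right d1 (by positivity : 0 ≤ 1 / L)
    have g5 := mul_le_mul_of_nonneg_right d1 (by positivity : 0 ≤ 1 / k ^ 2)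
    have g6 : exp x * (Q.card / exp x) = Q.card := by field_simp
    have g7 : (Q.card : ℝ) ≤ exp (B + 1) * (exp x * (Q.card / exp x)) := by
      rw [g6]; exact le_mul_of_one_le_left (Nat.cast_nonneg _) (one_le_exp (by linarith))
    have g8 : 0 ≤ exp (B + 1) * exp x * (1 / L) := by positivity
    have g9 : 0 ≤ exp (B + 1) * exp x * (1 / k ^ 2) := by positivity
    have g10 : 0 ≤ exp (B + 1) * (exp x * (Q.card / exp x)) := by positivity
    linarith
  have hpt : ∀ n ∈ S, (T + n) * ‖c n / n‖ ^ 2 ≤ (1 + exp (B + 1)) * exp (B + 1) / exp x * (C0 ^ 2 * q n ^ 2) := by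
    intro n hn
    have h1 := hc Q (fun p hp => (hQ p hp).1) k L x s hk0 hL0 hs n (hS1 n hn)
    have h2 : ‖c n‖ ^ 2 ≤ C0 ^ 2 * q n ^ 2 := by
      rw [← mul_pow]; exact pow_le_pow_left₀ (norm_nonneg _) h1 2
    have h3 := Wn_lower hn
    have hn0 : (0 : ℝ) < n := by exact_mod_cast hS1 n hn
    have h4 : exp x ≤ exp (B + 1) * n := by
      have := mul_le_mul_of_nonneg_left h3 (exp_pos (B + 1)).le
      rwa [← exp_add, add_sub_cancel] at this
    rw [norm_div, div_pow, RCLike.norm_natCast]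
    have h5 : (T + n) / n ^ 2 ≤ (1 + exp (B + 1)) * exp (B + 1) / exp x := by
      rw [div_le_div_iff₀ (by positivity) (exp_pos x)]
      have h6 : T + n ≤ (1 + exp (B + 1)) * n := by linarith
      calc (T + n) * exp x ≤ ((1 + exp (B + 1)) * n) * (exp (B + 1) * n) := mul_le_mul h6 h4 (exp_pos x).le (by positivity)
        _ = _ := by ring
    calc (T + n) * (‖c n‖ ^ 2 / n ^ 2) = (T + n) / n ^ 2 * ‖c n‖ ^ 2 := by ring
      _ ≤ _ := mul_le_mul h5 h2 (by positivity) (by positivity)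
  have h1 := (Finset.sum_le_sum hpt).trans (Finset.sum_le_sum_of_subset_of_nonneg hSN fun n _ _ => by positivity)
  rw [← Finset.mul_sum, ← Finset.mul_sum] at h1
  have h2 := h1.trans (mul_le_mul_of_nonneg_left (mul_le_mul_of_nonneg_left hqs (sq_nonneg C0)) (by positivity))
  refine (mul_le_mul_of_nonneg_left h2 hC1.le).trans (le_of_eq ?_)
  field_simp
end MR
namespace MR
open Real MeasureTheory

theorem pow_coef (Q S : Finset ℕ) (r : ℕ → ℂ) (α B y κ : ℝ) (hQ : Q ⊆ PR α (α + 1)) (hκ : 0 ≤ κ)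
    (hS : ∀ n ∈ S, 1 ≤ n ∧ exp (y - B) ≤ n ∧ n ≤ exp (y + B)) (hr : ∀ n, ‖r n‖ ≤ κ) (l : ℕ) :
    ∃ (S' : Finset ℕ) (c : ℕ → ℂ), (∀ t, (∑ p ∈ Q, E t p / p) ^ l * ∑ n ∈ S, r n / n * E t n = ∑ n ∈ S', c n / n * E t n) ∧
      (∀ n ∈ S', 1 ≤ n ∧ exp (y - B + α * l) ≤ n ∧ n ≤ exp (y + B + (α + 1) * l)) ∧
      ∀ n ∈ S', ‖c n‖ ≤ κ * (((Q.filter (· ∣ n)).card : ℕ) : ℝ) ^ l := by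
  induction l with
  | zero => exact ⟨S, r, by simp, by simpa using hS, by simpa using fun n _ => hr n⟩
  | succ l ih =>
    obtain ⟨S', c, h1, h2, h3⟩ := ih
    have hq : ∀ p ∈ Q, 1 ≤ p ∧ exp α ≤ p ∧ p ≤ exp (α + 1) := by
      intro p hp
      obtain ⟨a, b, c⟩ := mem_PR.1 (hQ hp)
      have h0 : (0 : ℝ) < p := by exact_mod_cast a.pos
      exact ⟨a.one_le, (le_log_iff_exp_le h0).1 b, ((log_lt_iff_lt_exp h0).1 c).le⟩
    refine ⟨(Q ×ˢ S').image fun z => z.1 * z.2, fun k => ∑ z ∈ (Q ×ˢ S').filter fun z => z.1 * z.2 = k, c z.2, fun t => ?_, ?_, ?_⟩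
    · rw [pow_succ', mul_assoc, h1, Finset.sum_mul_sum, ← Finset.sum_product',
        ← Finset.sum_fiberwise_of_maps_to (s := Q ×ˢ S') (t := (Q ×ˢ S').image fun z => z.1 * z.2) (g := fun z => z.1 * z.2)
          (fun z hz => Finset.mem_image_of_mem _ hz)]
      refine Finset.sum_congr rfl fun k _ => ?_
      rw [Finset.sum_div, Finset.sum_mul]
      refine Finset.sum_congr rfl fun z hz => ?_
      obtain ⟨hz3, hz4⟩ := Finset.mem_filter.1 hz
      obtain ⟨hz1, hz2⟩ := Finset.mem_product.1 hz3
      rw [← hz4, E_mul t (by have := (hq _ hz1).1; omega) (by have := (h2 _ hz2).1; omega)]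
      push_cast
      field_simp
    · intro k hk
      obtain ⟨z, hz, rfl⟩ := Finset.mem_image.1 hk
      obtain ⟨hz1, hz2⟩ := Finset.mem_product.1 hz
      obtain ⟨a1, a2, a3⟩ := hq _ hz1
      obtain ⟨b1, b2, b3⟩ := h2 _ hz2
      refine ⟨Nat.mul_pos a1 b1, ?_, ?_⟩
      · have := mul_le_mul a2 b2 (exp_pos _).le (Nat.cast_nonneg _)
        rw [← exp_add] at this
        push_cast
        refine le_trans (le_of_eq ?_) this
        congr 1; ring
      · have := mul_le_mul a3 b3 (Nat.cast_nonneg _) (exp_pos _).le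
        rw [← exp_add] at this
        push_cast
        refine this.trans (le_of_eq ?_)
        congr 1; ring
    · intro k hk
      obtain ⟨z0, hz0, hk0⟩ := Finset.mem_image.1 hk
      have hk1 : k ≠ 0 := by
        rw [← hk0]
        exact (Nat.mul_pos (hq _ (Finset.mem_product.1 hz0).1).1 (h2 _ (Finset.mem_product.1 hz0).2).1).ne'
      refine (norm_sum_le _ _).trans ?_
      have : ∀ z ∈ (Q ×ˢ S').filter fun z => z.1 * z.2 = k, ‖c z.2‖ ≤ κ * (((Q.filter (· ∣ k)).card : ℕ) : ℝ) ^ l := by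
        intro z hz
        obtain ⟨hz, hzk⟩ := Finset.mem_filter.1 hz
        refine (h3 _ (Finset.mem_product.1 hz).2).trans (mul_le_mul_of_nonneg_left (pow_le_pow_left₀ (Nat.cast_nonneg _) ?_ _) hκ)
        refine Nat.cast_le.2 (Finset.card_le_card fun p hp => ?_)
        exact Finset.mem_filter.2 ⟨(Finset.mem_filter.1 hp).1, dvd_trans (Finset.mem_filter.1 hp).2 (Dvd.intro_left _ hzk)⟩
      refine (Finset.sum_le_card_nsmul _ _ _ this).trans ?_
      rw [nsmul_eq_mul, pow_succ', mul_left_comm]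
      refine mul_le_mul_of_nonneg_left (mul_le_mul_of_nonneg_right ?_ (by positivity)) hκ
      refine Nat.cast_le.2 (Finset.card_le_card_of_injOn Prod.fst ?_ ?_)
      · intro z hz
        obtain ⟨hz, hzk⟩ := Finset.mem_filter.1 hz
        exact Finset.mem_coe.2 (Finset.mem_filter.2 ⟨(Finset.mem_product.1 hz).1, Dvd.intro _ hzk⟩)
      · intro z hz z' hz' hzz
        obtain ⟨hz, hzk⟩ := Finset.mem_filter.1 hz
        obtain ⟨hz', hzk'⟩ := Finset.mem_filter.1 hz'
        refine Prod.ext hzz (Nat.eq_of_mul_eq_mul_left (hq _ (Finset.mem_product.1 hz).1).1 ?_)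
        rw [hzk, hzz, hzk']

theorem exp_omega (Q : Finset ℕ) (hQ : ∀ p ∈ Q, p.Prime) (N : ℕ) :
    ∑ n ∈ Finset.Ioc 0 N, exp ((Q.filter (· ∣ n)).card) ≤ N * exp (2 * ∑ p ∈ Q, (1 / p : ℝ)) := by
  have e : ∀ n : ℕ, exp ((Q.filter (· ∣ n)).card) ≤ ∑ D ∈ Q.powerset, if (∏ p ∈ D, p) ∣ n then (2 : ℝ) ^ D.card else 0 := by
    intro n
    have h1 : exp ((Q.filter (· ∣ n)).card) ≤ ∏ p ∈ Q, (1 + if p ∣ n then (2 : ℝ) else 0) := by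
      have : ((Q.filter (· ∣ n)).card : ℝ) = ∑ p ∈ Q, if p ∣ n then (1 : ℝ) else 0 := by rw [Finset.sum_boole]
      rw [this, exp_sum]
      refine Finset.prod_le_prod (fun _ _ => (exp_pos _).le) fun p _ => ?_
      split_ifs
      · linarith [exp_one_lt_three]
      · simp
    rw [Finset.prod_one_add] at h1
    refine h1.trans (Finset.sum_le_sum fun D hD => ?_)
    split_ifs with hd
    · refine (Finset.prod_le_prod (fun p _ => by positivity) fun p hp => ?_).trans (by rw [Finset.prod_const])
      split_ifs <;> norm_num
    · refine le_of_eq ?_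
      by_contra hne
      refine hd (Finset.prod_primes_dvd n (fun p hp => (hQ p (Finset.mem_powerset.1 hD hp)).prime) fun p hp => ?_)
      by_contra hpn
      exact hne (Finset.prod_eq_zero hp (by simp [hpn]))
  refine (Finset.sum_le_sum fun n _ => e n).trans ?_
  rw [Finset.sum_comm]
  have h2 : ∀ D ∈ Q.powerset, (∑ n ∈ Finset.Ioc 0 N, if (∏ p ∈ D, p) ∣ n then (2 : ℝ) ^ D.card else 0) ≤ N * ∏ p ∈ D, (2 * (1 / p : ℝ)) := by
    intro D _
    rw [← Finset.sum_filter, Finset.sum_const, Nat.Ioc_filter_dvd_card_eq_div, nsmul_eq_mul, Finset.prod_mul_distrib, Finset.prod_const]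
    refine (mul_le_mul_of_nonneg_right Nat.cast_div_le (by positivity)).trans (le_of_eq ?_)
    rw [Finset.prod_div_distrib, Nat.cast_prod, Finset.prod_const_one]; ring
  refine (Finset.sum_le_sum h2).trans ?_
  rw [← Finset.mul_sum, ← Finset.prod_one_add, Finset.mul_sum, exp_sum]
  refine mul_le_mul_of_nonneg_left (Finset.prod_le_prod (fun p _ => by positivity) fun p _ => ?_) (Nat.cast_nonneg _)
  linarith [add_one_le_exp (2 * (1 / p : ℝ))]

theorem moment (B : ℝ) : ∃ C, 0 < C ∧ ∀ (α y κ T : ℝ) (l : ℕ) (Q S : Finset ℕ) (r : ℕ → ℂ), 1 ≤ α → Q ⊆ PR α (α + 1) → 0 ≤ κ →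
    (∀ n ∈ S, 1 ≤ n ∧ exp (y - B) ≤ n ∧ n ≤ exp (y + B)) → (∀ n, ‖r n‖ ≤ κ) → 1 ≤ T → T ≤ exp (α * l + y) →
    ∫ t in Set.Icc (-T) T, ‖∑ p ∈ Q, E t p / p‖ ^ (2 * l) * ‖∑ n ∈ S, r n / n * E t n‖ ^ 2 ≤ C * κ ^ 2 * (6 * l : ℝ) ^ (2 * l) := by
  obtain ⟨C1, hC1, hm⟩ := mvt
  refine ⟨C1 * ((exp B + 1) * exp B * (exp B * exp 8)), by positivity, fun α y κ T l Q S r hα hQ hκ hS hr hT hT2 => ?_⟩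
  obtain ⟨S', c, h1, h2, h3⟩ := pow_coef Q S r α B y κ hQ hκ hS hr l
  have e : ∀ t, ‖∑ p ∈ Q, E t p / p‖ ^ (2 * l) * ‖∑ n ∈ S, r n / n * E t n‖ ^ 2 = ‖∑ n ∈ S', c n / n * E t n‖ ^ 2 := by
    intro t
    rw [← h1, norm_mul, norm_pow, mul_pow, ← pow_mul, mul_comm 2 l]
  simp only [e]
  refine (hm T hT S' _ fun n hn => (h2 n hn).1).trans ?_
  set N := ⌊exp (y + B + (α + 1) * l)⌋₊
  have hsub : S' ⊆ Finset.Ioc 0 N := fun n hn => Finset.mem_Ioc.2 ⟨(h2 n hn).1, Nat.le_floor (h2 n hn).2.2⟩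
  have hpt : ∀ n ∈ S', (T + n) * ‖c n / n‖ ^ 2 ≤ (exp B + 1) * exp B / exp (y + α * l) * κ ^ 2 * (2 * l : ℝ) ^ (2 * l) * exp ((Q.filter (· ∣ n)).card) := by
    intro n hn
    obtain ⟨a1, a2, a3⟩ := h2 n hn
    have hn0 : (0 : ℝ) < n := by exact_mod_cast a1
    set ω : ℝ := (((Q.filter (· ∣ n)).card : ℕ) : ℝ) with hω
    have hω0 : 0 ≤ ω := Nat.cast_nonneg _
    have b1 : exp (y + α * l) ≤ exp B * n := by
      have := mul_le_mul_of_nonneg_left a2 (exp_pos B).le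
      rw [← exp_add] at this
      refine le_trans (le_of_eq ?_) this
      congr 1; ring
    have b2 : (T + n) / n ^ 2 ≤ (exp B + 1) * exp B / exp (y + α * l) := by
      rw [div_le_div_iff₀ (by positivity) (exp_pos _)]
      have h6 : T + n ≤ (exp B + 1) * n := by rw [add_comm (α * l)] at hT2; linarith
      calc (T + n) * exp (y + α * l) ≤ ((exp B + 1) * n) * (exp B * n) := mul_le_mul h6 b1 (exp_pos _).le (by positivity)
        _ = _ := by ring
    have b3 : ω ^ (2 * l) ≤ (2 * l : ℝ) ^ (2 * l) * exp ω := by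
      rcases Nat.eq_zero_or_pos l with rfl | hl
      · simpa using hω0
      have hl0 : (0 : ℝ) < l := by exact_mod_cast hl
      have : ω ≤ 2 * l * exp (ω / (2 * l)) := by
        have := mul_le_mul_of_nonneg_left (add_one_le_exp (ω / (2 * l))) (by positivity : (0 : ℝ) ≤ 2 * l)
        rw [mul_add, mul_div_cancel₀ _ (by positivity)] at this
        linarith
      refine (pow_le_pow_left₀ hω0 this _).trans (le_of_eq ?_)
      rw [mul_pow, ← exp_nat_mul]
      congr 2
      push_cast
      field_simp
    have b4 : ‖c n‖ ^ 2 ≤ κ ^ 2 * ((2 * l : ℝ) ^ (2 * l) * exp ω) := by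
      refine (pow_le_pow_left₀ (norm_nonneg _) (h3 n hn) 2).trans ?_
      rw [mul_pow, ← pow_mul, mul_comm l 2]
      exact mul_le_mul_of_nonneg_left b3 (sq_nonneg _)
    rw [norm_div, div_pow, RCLike.norm_natCast]
    calc (T + n) * (‖c n‖ ^ 2 / n ^ 2) = (T + n) / n ^ 2 * ‖c n‖ ^ 2 := by ring
      _ ≤ _ := mul_le_mul b2 b4 (by positivity) (by positivity)
      _ = _ := by ring
  have g1 := (Finset.sum_le_sum hpt).trans (Finset.sum_le_sum_of_subset_of_nonneg hsub fun n _ _ => by positivity)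
  rw [← Finset.mul_sum] at g1
  have g2 : ∑ n ∈ Finset.Ioc 0 N, exp ((Q.filter (· ∣ n)).card) ≤ exp (y + B + (α + 1) * l) * exp 8 := by
    refine (exp_omega Q (fun p hp => (mem_PR.1 (hQ hp)).1) N).trans ?_
    refine mul_le_mul (Nat.floor_le (exp_pos _).le) (exp_le_exp.2 ?_) (exp_pos _).le (exp_pos _).le
    have := (Finset.sum_le_sum_of_subset_of_nonneg hQ fun n _ _ => (by positivity : (0 : ℝ) ≤ 1 / n)).trans (prime_upper (by linarith))
    have : 4 / α ≤ 4 := div_le_self (by norm_num) hα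
    linarith
  have g3 := g1.trans (mul_le_mul_of_nonneg_left g2 (by positivity))
  refine (mul_le_mul_of_nonneg_left g3 hC1.le).trans ?_
  have g4 : exp (y + B + (α + 1) * l) = exp (y + α * l) * exp B * exp l := by
    rw [← exp_add, ← exp_add]; congr 1; ring
  have g5 : exp (l : ℝ) * (2 * l : ℝ) ^ (2 * l) ≤ (6 * l : ℝ) ^ (2 * l) := by
    have : exp (l : ℝ) = exp 1 ^ l := by rw [← exp_nat_mul, mul_one]
    have e2 : (6 * l : ℝ) ^ (2 * l) = 9 ^ l * (2 * l : ℝ) ^ (2 * l) := by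
      rw [show (6 * l : ℝ) = 3 * (2 * l) by ring, mul_pow, pow_mul 3]; norm_num
    rw [this, e2]
    exact mul_le_mul_of_nonneg_right (pow_le_pow_left₀ (exp_pos 1).le (by linarith [exp_one_lt_three]) _) (by positivity)
  rw [g4]
  calc _ = C1 * ((exp B + 1) * exp B * (exp B * exp 8)) * κ ^ 2 * (exp (l : ℝ) * (2 * l : ℝ) ^ (2 * l)) := by field_simp
    _ ≤ _ := mul_le_mul_of_nonneg_left g5 (by positivity)
end MR
namespace MR
open Real MeasureTheory

noncomputable def Cl (Q : Finset ℕ) (k : ℝ) (v : ℕ) : Finset ℕ := Q.filter fun p : ℕ => ⌊k * log p⌋₊ = v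
noncomputable def Vx (Q : Finset ℕ) (k : ℝ) : Finset ℕ := Q.image fun p : ℕ => ⌊k * log p⌋₊
noncomputable def Pp (S : Finset ℕ) (t : ℝ) : ℂ := ∑ p ∈ S, E t p / p

theorem Pp_cont (S : Finset ℕ) : Continuous (Pp S) :=
  continuous_finset_sum _ fun p _ => (E_cont p).div_const _

theorem Dw_contt {w : ℝ → ℝ} {B : ℝ} (h : Bump w B) (a : ℕ → ℂ) (x : ℝ) : Continuous fun t => Dw a w x t := by
  have : (fun t => Dw a w x t) = fun t => ∑ n ∈ Wn B x, a n * ((w (log n - x) / n : ℝ) : ℂ) * E t n :=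
    funext fun t => Dw_eq h a x t _ subset_rfl
  rw [this]
  exact continuous_finset_sum _ fun n _ => (E_cont n).const_mul _

theorem Vx_mem {a b k : ℝ} (hk : 1 ≤ k) (ha : 0 ≤ a) {v : ℕ} (hv : v ∈ Vx (PR a b) k) :
    a - 1 ≤ v / k ∧ v / k ≤ b ∧ Cl (PR a b) k v ⊆ PR (v / k) (v / k + 1) := by
  have hk0 : 0 < k := by linarith
  have key : ∀ p ∈ PR a b, ⌊k * log p⌋₊ = v → v / k ≤ log p ∧ log p < v / k + 1 := by
    intro p hp he
    have h0 : 0 ≤ k * log p := mul_nonneg hk0.le (ha.trans (mem_PR.1 hp).2.1)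
    have h1 := Nat.floor_le h0
    have h2 := Nat.lt_floor_add_one (k * log p)
    rw [he] at h1 h2
    refine ⟨by rw [div_le_iff₀ hk0]; linarith, ?_⟩
    have : log p < (v + 1) / k := by rw [lt_div_iff₀ hk0]; linarith
    rw [add_div] at this
    have : 1 / k ≤ 1 := by rw [div_le_one hk0]; exact hk
    linarith
  obtain ⟨p, hp, he⟩ := Finset.mem_image.1 hv
  obtain ⟨h1, h2⟩ := key p hp he
  obtain ⟨-, h3, h4⟩ := mem_PR.1 hp
  refine ⟨by linarith, by linarith, fun q hq => ?_⟩
  obtain ⟨hq1, hq2⟩ := Finset.mem_filter.1 hq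
  exact mem_PR.2 ⟨(mem_PR.1 hq1).1, key q hq1 hq2⟩

theorem Vx_card {a b k : ℝ} (hk : 1 ≤ k) (ha : 0 ≤ a) (hb : 1 ≤ b) : ((Vx (PR a b) k).card : ℝ) ≤ 2 * (k * b) := by
  have hs : Vx (PR a b) k ⊆ Finset.range (⌊k * b⌋₊ + 1) := by
    intro v hv
    have := (Vx_mem hk ha hv).2.1
    rw [div_le_iff₀ (by linarith)] at this
    exact Finset.mem_range.2 (Nat.lt_succ_of_le (Nat.le_floor (by linarith)))
  have h1 := Finset.card_le_card hs
  rw [Finset.card_range] at h1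
  have h2 : ((Vx (PR a b) k).card : ℝ) ≤ ⌊k * b⌋₊ + 1 := by exact_mod_cast h1
  have h3 := Nat.floor_le (by positivity : 0 ≤ k * b)
  have h4 : 1 * 1 ≤ k * b := mul_le_mul hk hb zero_le_one (by linarith)
  linarith

theorem PR_card (a b : ℝ) : ((PR a b).card : ℝ) ≤ exp b := by
  have hs : PR a b ⊆ Finset.Ioc 0 ⌊exp b⌋₊ := by
    intro p hp
    obtain ⟨h1, -, h3⟩ := mem_PR.1 hp
    have h0 : (0 : ℝ) < p := by exact_mod_cast h1.pos
    exact Finset.mem_Ioc.2 ⟨h1.pos, Nat.le_floor ((log_lt_iff_lt_exp h0).1 h3).le⟩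
  have h1 := Finset.card_le_card hs
  rw [Nat.card_Ioc, Nat.sub_zero] at h1
  exact (Nat.cast_le.2 h1).trans (Nat.floor_le (exp_pos _).le)

theorem TKset {w : ℝ → ℝ} {B : ℝ} (h : Bump w B) : ∃ C, 0 < C ∧ ∀ (a b k x T : ℝ) (A : Set ℝ), 1 ≤ k → 0 ≤ a → k ≤ exp a →
    1 ≤ ∑ p ∈ PR a b, (1 / p : ℝ) → 1 ≤ T → T ≤ exp x → MeasurableSet A → A ⊆ Set.Icc (-T) T →
    ∫ t in A, ‖Dw Mu w x t‖ ^ 2 ≤ C * (1 / (∑ p ∈ PR a b, (1 / p : ℝ)) + 1 / k ^ 2 + exp (b - x)) +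
      2 * (Vx (PR a b) k).card * ∑ v ∈ Vx (PR a b) k, ∫ t in A, ‖Pp (Cl (PR a b) k v) t‖ ^ 2 * ‖Dw Mu w (x - v / k) t‖ ^ 2 := by
  obtain ⟨C, hC, hT⟩ := TK h
  refine ⟨2 * C, by positivity, fun a b k x T A hk ha hka hL hT1 hTx hA hAT => ?_⟩
  set Q := PR a b
  set L := ∑ p ∈ Q, (1 / p : ℝ)
  have hk0 : 0 < k := by linarith
  have hL0 : 0 < L := by linarith
  set R : ℕ → ℝ → ℂ := fun v t => Dw Mu w (x - v / k) t with hR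
  have hRc : ∀ v, Continuous (R v) := fun v => Dw_contt h Mu _
  have hPc : ∀ v, Continuous (Pp (Cl Q k v)) := fun v => Pp_cont _
  have h1 := hT Q k x T (fun p => ⌊k * log p⌋₊ / k) (fun p hp => by
      obtain ⟨h1, h2, -⟩ := mem_PR.1 hp
      exact ⟨h1, hka.trans ((le_log_iff_exp_le (by exact_mod_cast h1.pos)).1 h2)⟩) hk hL (fun p hp => by
      have h0 : 0 ≤ k * log p := mul_nonneg hk0.le (ha.trans (mem_PR.1 hp).2.1)
      have e : log p - ⌊k * log p⌋₊ / k = (k * log p - ⌊k * log p⌋₊) / k := by field_simp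
      rw [e, abs_div, abs_of_pos hk0]
      refine div_le_div_of_nonneg_right ?_ hk0.le
      rw [abs_le]
      constructor <;> linarith [Nat.floor_le h0, Nat.lt_floor_add_one (k * log p)]) hT1 hTx
  have e : ∀ t, ∑ p ∈ Q, E t p / p * Dw Mu w (x - ⌊k * log p⌋₊ / k) t = ∑ v ∈ Vx Q k, Pp (Cl Q k v) t * R v t := by
    intro t
    rw [← Finset.sum_fiberwise_of_maps_to (s := Q) (t := Vx Q k) (g := fun p : ℕ => ⌊k * log p⌋₊) (fun p hp => Finset.mem_image_of_mem _ hp)]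
    refine Finset.sum_congr rfl fun v _ => ?_
    rw [Pp, Finset.sum_mul, Cl]
    refine Finset.sum_congr rfl fun p hp => ?_
    rw [(Finset.mem_filter.1 hp).2]
  simp only [e] at h1
  set D : ℝ → ℂ := fun t => Dw Mu w x t + ((1 / L : ℝ) : ℂ) * ∑ v ∈ Vx Q k, Pp (Cl Q k v) t * R v t with hD
  change ∫ t in Set.Icc (-T) T, ‖D t‖ ^ 2 ≤ C * (1 / L + 1 / k ^ 2 + Q.card / exp x) at h1
  have hDc : Continuous D := (Dw_contt h Mu x).add (continuous_const.mul (continuous_finset_sum _ fun v _ => (hPc v).mul (hRc v)))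
  have hint : ∀ f : ℝ → ℝ, Continuous f → IntegrableOn f A := fun f hf => hf.integrableOn_Icc.mono_set hAT
  have hpt : ∀ t, ‖Dw Mu w x t‖ ^ 2 ≤ 2 * ‖D t‖ ^ 2 + 2 * (Vx Q k).card * ∑ v ∈ Vx Q k, ‖Pp (Cl Q k v) t‖ ^ 2 * ‖R v t‖ ^ 2 := by
    intro t
    have e1 : Dw Mu w x t = D t - ((1 / L : ℝ) : ℂ) * ∑ v ∈ Vx Q k, Pp (Cl Q k v) t * R v t := by simp only [hD]; ring
    have a1 : ‖((1 / L : ℝ) : ℂ) * ∑ v ∈ Vx Q k, Pp (Cl Q k v) t * R v t‖ ≤ ∑ v ∈ Vx Q k, ‖Pp (Cl Q k v) t‖ * ‖R v t‖ := by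
      rw [norm_mul, Complex.norm_real, norm_of_nonneg (by positivity)]
      refine (mul_le_of_le_one_left (norm_nonneg _) (by rw [div_le_one hL0]; exact hL)).trans ((norm_sum_le _ _).trans (le_of_eq ?_))
      exact Finset.sum_congr rfl fun v _ => norm_mul _ _
    have a2 := sq_sum_le_card_mul_sum_sq (s := Vx Q k) (f := fun v => ‖Pp (Cl Q k v) t‖ * ‖R v t‖)
    simp only [mul_pow] at a2
    have a3 := norm_sub_le (D t) (((1 / L : ℝ) : ℂ) * ∑ v ∈ Vx Q k, Pp (Cl Q k v) t * R v t)
    rw [← e1] at a3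
    have a4 := pow_le_pow_left₀ (norm_nonneg _) (a3.trans (add_le_add_right a1 _)) 2
    have a5 := add_sq_le (a := ‖D t‖) (b := ∑ v ∈ Vx Q k, ‖Pp (Cl Q k v) t‖ * ‖R v t‖)
    linarith
  have i1 : IntegrableOn (fun t => 2 * ‖D t‖ ^ 2) A := hint _ ((hDc.norm.pow 2).const_mul 2)
  have i2 : ∀ v, IntegrableOn (fun t => ‖Pp (Cl Q k v) t‖ ^ 2 * ‖R v t‖ ^ 2) A := fun v => hint _ (((hPc v).norm.pow 2).mul ((hRc v).norm.pow 2))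
  have i3 : IntegrableOn (fun t => 2 * (Vx Q k).card * ∑ v ∈ Vx Q k, ‖Pp (Cl Q k v) t‖ ^ 2 * ‖R v t‖ ^ 2) A :=
    Integrable.const_mul (integrable_finsetSum _ fun v _ => i2 v) _
  refine (setIntegral_mono_on (hint _ ((Dw_contt h Mu x).norm.pow 2)) (i1.add i3) hA fun t _ => hpt t).trans ?_
  simp only [Pi.add_apply]
  rw [integral_add i1 i3, integral_const_mul, integral_const_mul, integral_finsetSum _ fun v _ => i2 v]
  refine add_le_add_left ?_ _
  have h2 : ∫ t in A, ‖D t‖ ^ 2 ≤ ∫ t in Set.Icc (-T) T, ‖D t‖ ^ 2 :=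
    setIntegral_mono_set (hDc.norm.pow 2).integrableOn_Icc (Eventually.of_forall fun t => by positivity) (HasSubset.Subset.eventuallyLE hAT)
  have h3 : (Q.card : ℝ) / exp x ≤ exp (b - x) := by
    rw [exp_sub]; exact div_le_div_of_nonneg_right (PR_card a b) (exp_pos _).le
  have h4 := mul_le_mul_of_nonneg_left (add_le_add_right h3 (1 / L + 1 / k ^ 2)) hC.le
  linarith

theorem large (T : ℝ) (A : Set ℝ) (hA : MeasurableSet A) (hAT : A ⊆ Set.Icc (-T) T) (V : Finset ℕ) (P : ℕ → ℝ → ℂ) (hP : ∀ v, Continuous (P v))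
    (R : ℝ → ℂ) (hR : Continuous R) (b : ℕ → ℝ) (l : ℕ → ℕ) (h : ∀ t ∈ A, ∃ v ∈ V, exp (-b v) < ‖P v t‖) :
    ∫ t in A, ‖R t‖ ^ 2 ≤ ∑ v ∈ V, exp (2 * l v * b v) * ∫ t in Set.Icc (-T) T, ‖P v t‖ ^ (2 * l v) * ‖R t‖ ^ 2 := by
  have hc : ∀ v, Continuous fun t => ‖P v t‖ ^ (2 * l v) * ‖R t‖ ^ 2 := fun v => ((hP v).norm.pow _).mul (hR.norm.pow 2)
  have hi : ∀ v, IntegrableOn (fun t => exp (2 * l v * b v) * (‖P v t‖ ^ (2 * l v) * ‖R t‖ ^ 2)) A := fun v =>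
    ((hc v).integrableOn_Icc.mono_set hAT).const_mul _
  have h1 : ∫ t in A, ‖R t‖ ^ 2 ≤ ∫ t in A, ∑ v ∈ V, exp (2 * l v * b v) * (‖P v t‖ ^ (2 * l v) * ‖R t‖ ^ 2) := by
    refine setIntegral_mono_on ((hR.norm.pow 2).integrableOn_Icc.mono_set hAT) (integrable_finsetSum _ fun v _ => hi v) hA fun t ht => ?_
    obtain ⟨v, hv, hb⟩ := h t ht
    refine le_trans ?_ (Finset.single_le_sum (f := fun v => exp (2 * l v * b v) * (‖P v t‖ ^ (2 * l v) * ‖R t‖ ^ 2)) (fun v _ => by positivity) hv)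
    rw [← mul_assoc]
    refine le_mul_of_one_le_left (by positivity) ?_
    have e : exp (2 * l v * b v) = exp (b v) ^ (2 * l v) := by rw [← exp_nat_mul]; push_cast; ring_nf
    rw [e, ← mul_pow]
    refine one_le_pow₀ ?_
    have := mul_le_mul_of_nonneg_left hb.le (exp_pos (b v)).le
    rwa [← exp_add, add_neg_cancel, exp_zero] at this
  rw [integral_finsetSum _ fun v _ => hi v] at h1
  refine h1.trans (Finset.sum_le_sum fun v _ => ?_)
  rw [integral_const_mul]
  exact mul_le_mul_of_nonneg_left (setIntegral_mono_set (hc v).integrableOn_Icc (Eventually.of_forall fun t => by positivity)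
    (HasSubset.Subset.eventuallyLE hAT)) (exp_pos _).le
end MR
namespace MR
open Real MeasureTheory

noncomputable def al (a m : ℝ) : ℝ := a - 1 / log m
noncomputable def Ps (m : ℝ) (v : ℕ) (t : ℝ) : ℂ := Pp (Cl (PR m (m ^ 2)) m v) t
noncomputable def Vs (m : ℝ) : Finset ℕ := Vx (PR m (m ^ 2)) m
def Good (a m t : ℝ) : Prop := ∀ v ∈ Vs m, ‖Ps m v t‖ ≤ exp (-(al a m * (v / m)))

theorem Good_meas (a m : ℝ) : MeasurableSet {t | Good a m t} := by
  have : {t | Good a m t} = ⋂ v ∈ Vs m, {t | ‖Ps m v t‖ ≤ exp (-(al a m * (v / m)))} := by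
    ext t; simp [Good]
  rw [this]
  exact Finset.measurableSet_biInter _ fun v _ => measurableSet_le (Pp_cont _).norm.measurable measurable_const

theorem moment_R {w : ℝ → ℝ} {B : ℝ} (h : Bump w B) : ∃ C, 0 < C ∧ ∀ (α y T : ℝ) (l : ℕ) (Q : Finset ℕ), 1 ≤ α → Q ⊆ PR α (α + 1) →
    1 ≤ T → T ≤ exp (α * l + y) → ∫ t in Set.Icc (-T) T, ‖Pp Q t‖ ^ (2 * l) * ‖Dw Mu w y t‖ ^ 2 ≤ C * (6 * l : ℝ) ^ (2 * l) := by
  obtain ⟨C, hC, hm⟩ := moment B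
  obtain ⟨κ, hκ, hw⟩ := h.bdd
  refine ⟨C * κ ^ 2, by positivity, fun α y T l Q hα hQ hT hT2 => ?_⟩
  have := hm α y κ T l Q (Wn B y) (fun n => Mu n * (w (log n - y) : ℂ)) hα hQ hκ.le
    (fun n hn => ⟨(mem_Wn.1 hn).1, Wn_lower hn, Wn_upper hn⟩) (fun n => by
      rw [norm_mul, Complex.norm_real]
      exact (mul_le_mul (Mu_le n) (hw _) (abs_nonneg _) zero_le_one).trans (by rw [one_mul])) hT hT2
  refine le_trans (le_of_eq ?_) this
  congr 1
  funext t
  rw [Dw_eq h Mu y t _ subset_rfl, Pp]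
  congr 3
  refine Finset.sum_congr rfl fun n _ => ?_
  push_cast; ring

theorem good_step {w : ℝ → ℝ} {B : ℝ} (h : Bump w B) : ∃ C, 0 < C ∧ ∀ (a m x T Z : ℝ) (A : Set ℝ), exp 128 ≤ m → 2 * m ^ 2 ≤ x →
    1 ≤ T → T ≤ exp x → MeasurableSet A → A ⊆ Set.Icc (-T) T → (∀ t ∈ A, Good a m t) → 0 ≤ Z →
    (∀ v ∈ Vs m, exp (-(2 * (al a m * (v / m)))) * ∫ t in A, ‖Dw Mu w (x - v / m) t‖ ^ 2 ≤ Z) →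
    ∫ t in A, ‖Dw Mu w x t‖ ^ 2 ≤ C / log m + 8 * m ^ 6 * Z := by
  obtain ⟨C, hC, hT⟩ := TKset h
  refine ⟨C * 128, by positivity, fun a m x T Z A hm hx hT1 hTx hA hAT hg hZ hv => ?_⟩
  have hm129 : (129 : ℝ) ≤ m := by linarith [add_one_le_exp (128 : ℝ)]
  have hm0 : 0 < m := by linarith
  have hlog : 128 ≤ log m := (le_log_iff_exp_le hm0).2 hm
  have hlm : log m ≤ m := (log_le_sub_one_of_pos hm0).trans (by linarith)
  have hmm : m ≤ m ^ 2 := by rw [sq]; exact le_mul_of_one_le_left hm0.le (by linarith)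
  have hL : log m / 126 ≤ ∑ p ∈ PR m (m ^ 2), (1 / p : ℝ) := by
    have := prime_lower (a := m) (b := m ^ 2) (by linarith) hmm
    rw [show m ^ 2 / m = m by field_simp] at this
    linarith
  have hL1 : 1 ≤ ∑ p ∈ PR m (m ^ 2), (1 / p : ℝ) := by linarith
  have hcard := Vx_card (a := m) (b := m ^ 2) (k := m) (by linarith) hm0.le (by linarith)
  refine (hT m (m ^ 2) m x T A (by linarith) hm0.le (by linarith [add_one_le_exp m]) hL1 hT1 hTx hA hAT).trans (add_le_add ?_ ?_)
  · rw [mul_div_assoc]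
    refine mul_le_mul_of_nonneg_left ?_ hC.le
    have h1 : 1 / (∑ p ∈ PR m (m ^ 2), (1 / p : ℝ)) ≤ 126 / log m := by
      have := one_div_le_one_div_of_le (by positivity) hL
      rwa [one_div_div] at this
    have h2 : 1 / m ^ 2 ≤ 1 / log m := one_div_le_one_div_of_le (by linarith) (by linarith)
    have h3 : exp (m ^ 2 - x) ≤ 1 / log m := by
      rw [le_div_iff₀ (by linarith)]
      have : exp (m ^ 2 - x) ≤ exp (-log m) := exp_le_exp.2 (by linarith)
      rw [exp_neg, exp_log hm0] at this
      calc exp (m ^ 2 - x) * log m ≤ m⁻¹ * m := mul_le_mul this hlm (by linarith) (by positivity)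
        _ = 1 := inv_mul_cancel₀ hm0.ne'
    have : 128 / log m = 126 / log m + 1 / log m + 1 / log m := by ring
    linarith
  · have hs : ∀ v ∈ Vs m, ∫ t in A, ‖Pp (Cl (PR m (m ^ 2)) m v) t‖ ^ 2 * ‖Dw Mu w (x - v / m) t‖ ^ 2 ≤ Z := by
      intro v hv'
      refine le_trans ?_ (hv v hv')
      rw [← integral_const_mul]
      have hc := (Dw_contt h Mu (x - v / m)).norm.pow 2
      refine setIntegral_mono_on ((((Pp_cont _).norm.pow 2).mul hc).integrableOn_Icc.mono_set hAT)
        ((hc.const_mul _).integrableOn_Icc.mono_set hAT) hA fun t ht => ?_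
      refine mul_le_mul_of_nonneg_right ((pow_le_pow_left₀ (norm_nonneg _) (hg t ht v hv') 2).trans (le_of_eq ?_)) (by positivity)
      rw [← exp_nat_mul]; push_cast; ring_nf
    have h1 := Finset.sum_le_card_nsmul _ _ _ hs
    rw [nsmul_eq_mul] at h1
    have hcc : ((Vs m).card : ℝ) ^ 2 ≤ (2 * (m * m ^ 2)) ^ 2 := pow_le_pow_left₀ (Nat.cast_nonneg _) hcard 2
    calc _ ≤ 2 * ((Vs m).card : ℝ) * ((Vs m).card * Z) := mul_le_mul_of_nonneg_left h1 (by positivity)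
      _ = 2 * (((Vs m).card : ℝ) ^ 2) * Z := by ring
      _ ≤ 2 * (2 * (m * m ^ 2)) ^ 2 * Z := by gcongr
      _ = _ := by ring

theorem good_zero {w : ℝ → ℝ} {B : ℝ} (h : Bump w B) : ∃ C, 0 < C ∧ ∀ a : ℝ, 0 < a → ∃ m0, exp 128 ≤ m0 ∧ ∀ (m x T : ℝ) (A : Set ℝ),
    m0 ≤ m → 2 * m ^ 2 ≤ x → 1 ≤ T → T ≤ exp (x - m ^ 2) → MeasurableSet A → A ⊆ Set.Icc (-T) T → (∀ t ∈ A, Good a m t) →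
    ∫ t in A, ‖Dw Mu w x t‖ ^ 2 ≤ C / log m := by
  obtain ⟨C, hC, hg⟩ := good_step h
  obtain ⟨C1, hC1, hm⟩ := moment_R h
  refine ⟨C + 1, by positivity, fun a ha => ?_⟩
  have h1 : Tendsto (fun m : ℝ => 8 * C1 * exp a / a ^ 7 * ((a * m) ^ 7 * exp (-(a * m)))) atTop (𝓝 0) := by
    have := ((tendsto_pow_mul_exp_neg_atTop_nhds_zero 7).comp (tendsto_id.const_mul_atTop ha)).const_mul (8 * C1 * exp a / a ^ 7)
    rwa [mul_zero] at this
  obtain ⟨m1, hm1⟩ := eventually_atTop.1 (h1.eventually_le_const zero_lt_one)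
  refine ⟨max m1 (exp 128 + exp (2 / a)), (le_max_right _ _).trans' (by linarith [exp_pos (2 / a)]), fun m x T A hmm hx hT hTx hA hAT hG => ?_⟩
  have e1 := hm1 m ((le_max_left _ _).trans hmm)
  have e2 := (le_max_right _ _).trans hmm
  have hm128 : exp 128 ≤ m := by linarith [exp_pos (2 / a)]
  have hm129 : (129 : ℝ) ≤ m := by linarith [add_one_le_exp (128 : ℝ)]
  have hm0 : 0 < m := by linarith
  have hlm : log m ≤ m := (log_le_sub_one_of_pos hm0).trans (by linarith)
  have hl0 : 128 ≤ log m := (le_log_iff_exp_le hm0).2 hm128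
  have hal : a / 2 ≤ al a m := by
    have : 2 / a ≤ log m := (le_log_iff_exp_le hm0).2 (by linarith [exp_pos (128 : ℝ)])
    have : 1 / log m ≤ a / 2 := by
      have := one_div_le_one_div_of_le (by positivity) this
      rwa [one_div_div] at this
    rw [al]; linarith
  have hT' : T ≤ exp x := hTx.trans (exp_le_exp.2 (by linarith [sq_nonneg m]))
  refine (hg a m x T (C1 * exp (a - a * m)) A hm128 hx hT hT' hA hAT hG (by positivity) fun v hv => ?_).trans ?_
  · obtain ⟨v1, v2, -⟩ := Vx_mem (by linarith) hm0.le hv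
    have b1 : ∫ t in A, ‖Dw Mu w (x - v / m) t‖ ^ 2 ≤ C1 := by
      have := hm 1 (x - v / m) T 0 ∅ le_rfl (by simp) hT (hTx.trans (exp_le_exp.2 (by push_cast; linarith)))
      simp only [mul_zero, pow_zero, one_mul, mul_one] at this
      have hc : Continuous fun t => ‖Dw Mu w (x - v / m) t‖ ^ 2 := (Dw_contt h Mu (x - v / m)).norm.pow 2
      exact (setIntegral_mono_set hc.integrableOn_Icc (Eventually.of_forall fun t => by positivity)
        (HasSubset.Subset.eventuallyLE hAT)).trans this
    have b2 : a / 2 * (m - 1) ≤ al a m * (v / m) := mul_le_mul hal v1 (by linarith) (by linarith)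
    rw [mul_comm C1]
    exact mul_le_mul (exp_le_exp.2 (by linarith)) b1 (integral_nonneg fun t => by positivity) (exp_pos _).le
  · rw [add_div]
    refine add_le_add_right ?_ _
    rw [le_div_iff₀ (by linarith)]
    have : 8 * C1 * exp a / a ^ 7 * ((a * m) ^ 7 * exp (-(a * m))) = 8 * m ^ 6 * (C1 * exp (a - a * m)) * m := by
      rw [sub_eq_add_neg, exp_add]; field_simp
    rw [this] at e1
    exact (mul_le_mul_of_nonneg_left hlm (by positivity)).trans e1
end MR
namespace MR
open Real MeasureTheory

theorem step_exp (a m V V' : ℝ) (l : ℕ) (ha : a ≤ 1) (hal : 0 ≤ al a m) (hm : exp 128 ≤ m) (hlog : 120 * log m ^ 2 ≤ m)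
    (hV : m ^ 3 - 1 ≤ V) (hV2 : V ≤ m ^ 6) (hV' : m - 1 ≤ V') (hV'2 : V' ≤ m ^ 2) (hl : l = ⌈V / V'⌉₊) :
    exp (-(2 * (al a (m ^ 3) * V))) * (exp (2 * l * (al a m * V')) * (6 * l : ℝ) ^ (2 * l)) ≤ exp (-m) := by
  have hm129 : (129 : ℝ) ≤ m := by linarith [add_one_le_exp (128 : ℝ)]
  have hm0 : 0 < m := by linarith
  set g := log m with hg
  have hg1 : 128 ≤ g := (le_log_iff_exp_le hm0).2 hm
  have hg0 : 0 < g := by linarith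
  have hV0' : 0 < V' := by linarith
  have hm1 : 1 ≤ m := by linarith
  have hm2 : m ≤ m ^ 2 := le_self_pow₀ hm1 (by norm_num)
  have hm3 : m ^ 3 / 2 ≤ m ^ 3 - 1 := by linarith [le_self_pow₀ hm1 (by norm_num : 3 ≠ 0)]
  have hV0 : m ^ 3 / 2 ≤ V := by linarith
  have hVp : 0 < V := lt_of_lt_of_le (by positivity) hV0
  have hd : V / V' ≤ 2 * V / m := by
    rw [div_le_div_iff₀ hV0' hm0]
    have := mul_le_mul_of_nonneg_left (by linarith : m ≤ 2 * V') hVp.le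
    linarith
  have hVm : 1 ≤ V / m := by
    rw [le_div_iff₀ hm0]
    have : m * 2 ≤ m ^ 3 := by
      have : m ^ 3 = m * m ^ 2 := by ring
      rw [this]; exact mul_le_mul_of_nonneg_left (by linarith) hm0.le
    linarith
  have hlt : (l : ℝ) < V / V' + 1 := by rw [hl]; exact Nat.ceil_lt_add_one (by positivity)
  have hl3 : (l : ℝ) ≤ 3 * (V / m) := by
    have : 2 * V / m = 2 * (V / m) := by ring
    linarith
  have hl1 : (1 : ℝ) ≤ l := by
    rw [hl]; exact_mod_cast Nat.one_le_iff_ne_zero.2 (Nat.ceil_pos.2 (by positivity)).ne'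
  have h6l : (6 * l : ℝ) ≤ m ^ 6 := by
    have h1 : V / m ≤ m ^ 5 := by rw [div_le_iff₀ hm0]; linarith [pow_succ m 5]
    have h2 : 18 * m ^ 5 ≤ m * m ^ 5 := mul_le_mul_of_nonneg_right (by linarith) (by positivity)
    linarith [pow_succ' m 5]
  have hlV : (l : ℝ) * V' ≤ V + V' := by
    have := mul_le_mul_of_nonneg_right hlt.le hV0'.le
    rwa [add_mul, div_mul_cancel₀ _ hV0'.ne', one_mul] at this
  have hpow : (6 * l : ℝ) ^ (2 * l) ≤ exp (36 * (V / m) * g) := by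
    refine (pow_le_pow_left₀ (by positivity) h6l _).trans ?_
    rw [← exp_log (by positivity : 0 < m ^ 6), log_pow, ← exp_nat_mul]
    refine exp_le_exp.2 ?_
    push_cast
    have := mul_le_mul_of_nonneg_right hl3 hg0.le
    linarith
  have hal1 : al a m ≤ 1 := by
    have : 0 ≤ 1 / log m := by positivity
    rw [al]; linarith
  have hdiff : al a (m ^ 3) - al a m = 2 / 3 / g := by
    rw [al, al, log_pow, ← hg]; push_cast; field_simp; ring
  obtain ⟨z, hz⟩ : ∃ z, V = z * g := ⟨V / g, by field_simp⟩
  have hz1 : 60 * m ^ 2 * g ≤ z := by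
    have h1 : 60 * m ^ 2 * g * g ≤ z * g := by
      have := mul_le_mul_of_nonneg_left hlog (sq_nonneg m)
      have e : m ^ 2 * m = m ^ 3 := by ring
      rw [← hz]; linarith
    exact le_of_mul_le_mul_right h1 hg0
  have hz2 : 60 * m ^ 2 ≤ z := by
    have : 60 * m ^ 2 * 1 ≤ 60 * m ^ 2 * g := mul_le_mul_of_nonneg_left (by linarith) (by positivity)
    linarith
  have hz0 : 0 ≤ z := by linarith [sq_nonneg m]
  have t1 : 36 * (V / m) * g ≤ 3 / 10 * z := by
    have : 36 * (V / m) * g = 36 * z * g ^ 2 / m := by rw [hz]; ring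
    rw [this, div_le_iff₀ hm0]
    have := mul_le_mul_of_nonneg_left hlog hz0
    linarith
  have t2 : 2 * (al a m * (l * V')) ≤ 2 * (al a m * V) + 2 * m ^ 2 := by
    have h1 := mul_le_mul_of_nonneg_left hlV hal
    have h2 := mul_le_mul hal1 hV'2 hV0'.le zero_le_one
    linarith
  have t3 : al a (m ^ 3) * V = al a m * V + 2 / 3 * z := by
    have : al a (m ^ 3) * V - al a m * V = 2 / 3 * z := by rw [← sub_mul, hdiff, hz]; field_simp
    linarith
  refine (mul_le_mul_of_nonneg_left (mul_le_mul_of_nonneg_left hpow (exp_pos _).le) (exp_pos _).le).trans ?_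
  rw [← exp_add, ← exp_add]
  refine exp_le_exp.2 ?_
  linarith

theorem good_succ {w : ℝ → ℝ} {B : ℝ} (h : Bump w B) : ∃ C, 0 < C ∧ ∀ a : ℝ, 0 < a → a ≤ 1 → ∃ m0, exp 128 ≤ m0 ∧ ∀ (m x T : ℝ) (A : Set ℝ),
    m0 ≤ m → 2 * (m ^ 3) ^ 2 ≤ x → 1 ≤ T → T ≤ exp x → MeasurableSet A → A ⊆ Set.Icc (-T) T → (∀ t ∈ A, Good a (m ^ 3) t ∧ ¬ Good a m t) →
    ∫ t in A, ‖Dw Mu w x t‖ ^ 2 ≤ C / log (m ^ 3) := by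
  obtain ⟨C, hC, hg⟩ := good_step h
  obtain ⟨C1, hC1, hm⟩ := moment_R h
  refine ⟨C + 1, by positivity, fun a ha ha1 => ?_⟩
  have h1 : Tendsto (fun m : ℝ => 48 * C1 * (m ^ 22 * exp (-m))) atTop (𝓝 0) := by
    have := (tendsto_pow_mul_exp_neg_atTop_nhds_zero 22).const_mul (48 * C1)
    rwa [mul_zero] at this
  have h2 : ∀ᶠ m : ℝ in atTop, 120 * log m ^ 2 ≤ m := by
    filter_upwards [(isLittleO_pow_log_id_atTop (n := 2)).def (by norm_num : (0 : ℝ) < 1 / 120), eventually_ge_atTop 0] with m hm hm0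
    rw [norm_of_nonneg (sq_nonneg _), id, norm_of_nonneg hm0] at hm
    linarith
  obtain ⟨m1, hm1⟩ := eventually_atTop.1 ((h1.eventually_le_const zero_lt_one).and h2)
  refine ⟨max m1 (exp 128 + exp (1 / a)), (le_max_right _ _).trans' (by linarith [exp_pos (1 / a)]), fun m x T A hmm hx hT hTx hA hAT hG => ?_⟩
  obtain ⟨e1, e3⟩ := hm1 m ((le_max_left _ _).trans hmm)
  have e2 := (le_max_right _ _).trans hmm
  have hm128 : exp 128 ≤ m := by linarith [exp_pos (1 / a)]
  have hm129 : (129 : ℝ) ≤ m := by linarith [add_one_le_exp (128 : ℝ)]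
  have hm0 : 0 < m := by linarith
  have hmm3 : m ≤ m ^ 3 := le_self_pow₀ (by linarith) (by norm_num)
  have hlm : log m ≤ m := (log_le_sub_one_of_pos hm0).trans (by linarith)
  have hl0 : 128 ≤ log m := (le_log_iff_exp_le hm0).2 hm128
  have hal : 0 ≤ al a m := by
    have : 1 / a ≤ log m := (le_log_iff_exp_le hm0).2 (by linarith [exp_pos (128 : ℝ)])
    have : 1 / log m ≤ a := by
      have := one_div_le_one_div_of_le (by positivity) this
      rwa [one_div_one_div] at this
    rw [al]; linarith
  refine (hg a (m ^ 3) x T (2 * (m * m ^ 2) * (C1 * exp (-m))) A (hm128.trans hmm3) hx hT hTx hA hAT (fun t ht => (hG t ht).1) (by positivity) fun v hv => ?_).trans ?_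
  · obtain ⟨v1, v2, -⟩ := Vx_mem (by linarith) (by positivity) hv
    rw [← pow_mul] at v2
    set V := (v : ℝ) / m ^ 3
    have hV1 : 0 < V := by linarith
    have b1 := large T A hA hAT (Vs m) (Ps m) (fun r => Pp_cont _) (fun t => Dw Mu w (x - V) t) (Dw_contt h Mu _)
      (fun r => al a m * (r / m)) (fun r => ⌈V / (r / m)⌉₊) (fun t ht => by
        have := (hG t ht).2
        rw [Good] at this
        push Not at this
        exact this)
    refine (mul_le_mul_of_nonneg_left b1 (exp_pos _).le).trans ?_
    rw [Finset.mul_sum]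
    have b2 : ∀ r ∈ Vs m, exp (-(2 * (al a (m ^ 3) * V))) * (exp (2 * ⌈V / (r / m)⌉₊ * (al a m * (r / m))) *
        ∫ t in Set.Icc (-T) T, ‖Ps m r t‖ ^ (2 * ⌈V / (r / m)⌉₊) * ‖Dw Mu w (x - V) t‖ ^ 2) ≤ C1 * exp (-m) := by
      intro r hr
      obtain ⟨r1, r2, r3⟩ := Vx_mem (by linarith) hm0.le hr
      have c1 := step_exp a m V (r / m) ⌈V / (r / m)⌉₊ ha1 hal hm128 e3 v1 v2 r1 r2 rfl
      have hr0 : 0 < (r : ℝ) / m := by linarith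
      have c2 := hm (r / m) (x - V) T ⌈V / (r / m)⌉₊ _ (by linarith) r3 hT (hTx.trans (exp_le_exp.2 (by
        have := Nat.le_ceil (V / (r / m))
        rw [div_le_iff₀ hr0] at this
        linarith)))
      refine (mul_le_mul_of_nonneg_left (mul_le_mul_of_nonneg_left c2 (exp_pos _).le) (exp_pos _).le).trans ?_
      have := mul_le_mul_of_nonneg_left c1 hC1.le
      linarith
    refine (Finset.sum_le_card_nsmul _ _ _ b2).trans ?_
    rw [nsmul_eq_mul]
    exact mul_le_mul_of_nonneg_right (Vx_card (by linarith) hm0.le (one_le_pow₀ (by linarith))) (by positivity)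
  · rw [add_div]
    refine add_le_add_right ?_ _
    rw [log_pow, le_div_iff₀ (by push_cast; linarith)]
    push_cast
    refine (mul_le_mul_of_nonneg_left (mul_le_mul_of_nonneg_left hlm (by norm_num)) (by positivity)).trans (le_trans (le_of_eq ?_) e1)
    ring

theorem good_all {w : ℝ → ℝ} {B : ℝ} (h : Bump w B) : ∃ C, 0 < C ∧ ∀ a : ℝ, 0 < a → a ≤ 1 → ∃ m0, exp 128 ≤ m0 ∧ ∀ (m x T : ℝ) (J : ℕ),
    m0 ≤ m → 2 * (m ^ 3 ^ J) ^ 2 ≤ x → 1 ≤ T → T ≤ exp (x - m ^ 2) →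
    ∫ t in Set.Icc (-T) T ∩ {t | ∃ j ≤ J, Good a (m ^ 3 ^ j) t}, ‖Dw Mu w x t‖ ^ 2 ≤ C / log m := by
  obtain ⟨C0, hC0, h0⟩ := good_zero h
  obtain ⟨C1, hC1, h1⟩ := good_succ h
  refine ⟨(C0 + C1) * 2, by positivity, fun a ha ha1 => ?_⟩
  obtain ⟨m0, hm0, h0⟩ := h0 a ha
  obtain ⟨m1, hm1, h1⟩ := h1 a ha ha1
  refine ⟨max m0 m1, hm0.trans (le_max_left _ _), fun m x T J hm hx hT hTx => ?_⟩
  have hm129 : (129 : ℝ) ≤ m := by linarith [add_one_le_exp (128 : ℝ), (le_max_left m0 m1).trans hm]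
  have hl : 0 < log m := log_pos (by linarith)
  have hc : Continuous fun t => ‖Dw Mu w x t‖ ^ 2 := (Dw_contt h Mu x).norm.pow 2
  have hms : ∀ J : ℕ, MeasurableSet {t | ∃ j ≤ J, Good a (m ^ 3 ^ j) t} := by
    intro J
    have : {t | ∃ j ≤ J, Good a (m ^ 3 ^ j) t} = ⋃ j ∈ Finset.range (J + 1), {t | Good a (m ^ 3 ^ j) t} := by
      ext t; simp [Nat.lt_succ_iff]
    rw [this]
    exact Finset.measurableSet_biUnion _ fun j _ => Good_meas _ _
  suffices H : ∫ t in Set.Icc (-T) T ∩ {t | ∃ j ≤ J, Good a (m ^ 3 ^ j) t}, ‖Dw Mu w x t‖ ^ 2 ≤ (C0 + C1) / log m * (2 - (1 / 3) ^ J) by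
    refine H.trans ?_
    rw [mul_div_right_comm]
    exact mul_le_mul_of_nonneg_left (by linarith [(by positivity : (0 : ℝ) ≤ (1 / 3) ^ J)]) (by positivity)
  induction J with
  | zero =>
    have := h0 m x T (Set.Icc (-T) T ∩ {t | ∃ j ≤ 0, Good a (m ^ 3 ^ j) t}) ((le_max_left _ _).trans hm) (by simpa using hx) hT hTx
      (measurableSet_Icc.inter (hms 0)) Set.inter_subset_left (by
        rintro t ⟨-, j, hj, hg⟩
        obtain rfl := Nat.le_zero.1 hj
        simpa using hg)
    refine this.trans ?_
    rw [pow_zero, show (2 - 1 : ℝ) = 1 by norm_num, mul_one]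
    exact div_le_div_of_nonneg_right (by linarith) hl.le
  | succ J ih =>
    have hpm : m ≤ m ^ 3 ^ J := le_self_pow₀ (by linarith) (by positivity)
    have e3 : (m ^ 3 ^ J) ^ 3 = m ^ 3 ^ (J + 1) := by rw [← pow_mul, pow_succ]
    have hx' : 2 * (m ^ 3 ^ J) ^ 2 ≤ x := by
      refine le_trans ?_ hx
      have : m ^ 3 ^ J ≤ m ^ 3 ^ (J + 1) := by rw [← e3]; exact le_self_pow₀ (by linarith) (by norm_num)
      gcongr
    have ih := ih hx'
    set A := Set.Icc (-T) T ∩ {t | ∃ j ≤ J, Good a (m ^ 3 ^ j) t} with hA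
    set A' := Set.Icc (-T) T ∩ {t | ∃ j ≤ J + 1, Good a (m ^ 3 ^ j) t} with hA'
    have hAm : MeasurableSet A := measurableSet_Icc.inter (hms J)
    have hAm' : MeasurableSet A' := measurableSet_Icc.inter (hms (J + 1))
    have hsub : A' \ A ⊆ Set.Icc (-T) T := fun t ht => ht.1.1
    have s1 := h1 (m ^ 3 ^ J) x T (A' \ A) (((le_max_right _ _).trans hm).trans hpm) (by rw [e3]; exact hx) hT
      (hTx.trans (exp_le_exp.2 (by linarith [sq_nonneg m]))) (hAm'.diff hAm) hsub (by
        rintro t ⟨⟨ht, j, hj, hg⟩, hn⟩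
        have hno : ∀ i ≤ J, ¬ Good a (m ^ 3 ^ i) t := fun i hi hgi => hn ⟨ht, i, hi, hgi⟩
        refine ⟨?_, hno J le_rfl⟩
        rcases Nat.le_succ_iff.1 hj with h' | rfl
        · exact absurd hg (hno j h')
        · rw [e3]; exact hg)
    have hAA : A ⊆ A' := by
      rintro t ⟨ht, j, hj, hg⟩
      exact ⟨ht, j, hj.trans (Nat.le_succ J), hg⟩
    have s2 : A ∪ (A' \ A) = A' := Set.union_diff_cancel hAA
    have s5 := setIntegral_union Set.disjoint_sdiff_right (hAm'.diff hAm) (hc.integrableOn_Icc.mono_set (μ := volume) (Set.inter_subset_left : A ⊆ Set.Icc (-T) T)) (hc.integrableOn_Icc.mono_set hsub)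
    rw [s2] at s5
    rw [s5]
    rw [e3, log_pow] at s1
    have s3 : C1 / ((3 ^ (J + 1) : ℕ) * log m) ≤ (C0 + C1) / log m * (1 / 3) ^ (J + 1) := by
      have : (C0 + C1) / log m * (1 / 3) ^ (J + 1) = (C0 + C1) / ((3 ^ (J + 1) : ℕ) * log m) := by
        push_cast; rw [one_div, inv_pow]; field_simp
      rw [this]
      exact div_le_div_of_nonneg_right (by linarith) (by positivity)
    have s4 : (C0 + C1) / log m * (2 - (1 / 3) ^ (J + 1)) - (C0 + C1) / log m * (2 - (1 / 3) ^ J) - (C0 + C1) / log m * (1 / 3) ^ (J + 1) =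
      (C0 + C1) / log m * (1 / 3) ^ (J + 1) := by rw [pow_succ]; ring
    have : 0 ≤ (C0 + C1) / log m * (1 / 3) ^ (J + 1) := by positivity
    linarith
end MR
namespace MR
open Real MeasureTheory

theorem bad_meas (a : ℝ) (ha : 0 < a) (ha1 : a ≤ 1) : ∃ x0, 1 ≤ x0 ∧ ∀ x m : ℝ, x0 ≤ x → 16 / a * log x ≤ m → 25 ≤ m → m ^ 2 ≤ a * x / 8 →
    (volume (Set.Icc (-exp x) (exp x) ∩ {t | ¬ Good a m t})).toReal ≤ exp (3 * a * x) := by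
  obtain ⟨C, hC, hm⟩ := moment 0
  have hev : ∀ᶠ x : ℝ in atTop, C * 2 * x ^ 2 * exp (-(a / 4 * x)) ≤ 1 := by
    have h1 := ((tendsto_pow_mul_exp_neg_atTop_nhds_zero 2).comp (tendsto_id.const_mul_atTop (by positivity : 0 < a / 4))).const_mul (C * 2 * (4 / a) ^ 2)
    rw [mul_zero] at h1
    filter_upwards [h1.eventually_le_const (zero_lt_one)] with x hx
    refine le_trans (le_of_eq ?_) hx
    simp only [Function.comp, id]
    field_simp
  obtain ⟨x0, hx0⟩ := eventually_atTop.1 hev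
  refine ⟨max x0 1, le_max_right _ _, fun x m hx hmx hm25 hmm => ?_⟩
  have hx1 : 1 ≤ x := (le_max_right _ _).trans hx
  have hm0 : 0 < m := by linarith
  have hax : a * x ≤ x := by simpa using mul_le_mul_of_nonneg_right ha1 (by linarith : 0 ≤ x)
  have hmx2 : m ^ 2 ≤ x := by linarith
  set U := Set.Icc (-exp x) (exp x) ∩ {t | ¬ Good a m t}
  have hU : MeasurableSet U := measurableSet_Icc.inter (Good_meas a m).compl
  have b1 := large (exp x) U hU Set.inter_subset_left (Vs m) (Ps m) (fun v => Pp_cont _) (fun _ => 1) continuous_const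
    (fun r => al a m * (r / m)) (fun r => ⌈x / (r / m)⌉₊) (by
      rintro t ⟨-, ht⟩
      rw [Set.mem_setOf_eq, Good] at ht
      push Not at ht
      exact ht)
  have e0 : ∫ t in U, ‖(1 : ℂ)‖ ^ 2 = (volume U).toReal := by simp [measureReal_def]
  rw [e0] at b1
  refine b1.trans ?_
  have b2 : ∀ r ∈ Vs m, exp (2 * ⌈x / (r / m)⌉₊ * (al a m * (r / m))) *
      ∫ t in Set.Icc (-exp x) (exp x), ‖Ps m r t‖ ^ (2 * ⌈x / (r / m)⌉₊) * ‖(1 : ℂ)‖ ^ 2 ≤ C * exp (11 / 4 * a * x) := by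
    intro r hr
    obtain ⟨r1, r2, r3⟩ := Vx_mem (by linarith) hm0.le hr
    set V : ℝ := r / m
    set l := ⌈x / V⌉₊
    have hV0 : 0 < V := by linarith
    have l1 : x ≤ V * l := by
      have := Nat.le_ceil (x / V)
      rwa [div_le_iff₀ hV0, mul_comm] at this
    have l2 : (l : ℝ) * V ≤ x + V := by
      have := (Nat.ceil_lt_add_one (by positivity : 0 ≤ x / V)).le
      have := mul_le_mul_of_nonneg_right this hV0.le
      rwa [add_mul, one_mul, div_mul_cancel₀ _ hV0.ne'] at this
    have c2 := hm V 0 1 (exp x) l (Cl (PR m (m ^ 2)) m r) {1} (fun _ => 1) (by linarith) r3 zero_le_one (by simp) (by simp) (one_le_exp (by linarith)) (exp_le_exp.2 (by linarith))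
    have c3 : ∫ t in Set.Icc (-exp x) (exp x), ‖Ps m r t‖ ^ (2 * l) * ‖(1 : ℂ)‖ ^ 2 ≤ C * (6 * l : ℝ) ^ (2 * l) := by
      refine le_trans (le_of_eq ?_) (c2.trans (by simp))
      simp [Ps, Pp]
    refine (mul_le_mul_of_nonneg_left c3 (exp_pos _).le).trans ?_
    have hl : (l : ℝ) * m ≤ 4 * x := by
      have : (l : ℝ) * m ≤ l * (2 * V) := mul_le_mul_of_nonneg_left (by linarith) (by positivity)
      linarith
    have hlm : 6 * (l : ℝ) ≤ x := by
      have : (l : ℝ) * 25 ≤ l * m := mul_le_mul_of_nonneg_left hm25 (by positivity)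
      linarith
    have d1 : (6 * l : ℝ) ^ (2 * l) ≤ exp (a / 2 * x) := by
      refine (pow_le_pow_left₀ (by positivity) hlm _).trans ?_
      rw [← exp_log (by linarith : 0 < x), ← exp_nat_mul, exp_log (by linarith), exp_le_exp]
      push_cast
      have : (l : ℝ) * (16 / a * log x) ≤ l * m := mul_le_mul_of_nonneg_left hmx (by positivity)
      have h3 : a * ((l : ℝ) * (16 / a * log x)) ≤ a * (4 * x) := mul_le_mul_of_nonneg_left (this.trans hl) ha.le
      have : a * ((l : ℝ) * (16 / a * log x)) = 16 * (l * log x) := by field_simp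
      linarith
    have d2 : exp (2 * l * (al a m * V)) ≤ exp (9 / 4 * a * x) := by
      rw [exp_le_exp]
      have h1 : al a m ≤ a := by
        have : 0 ≤ 1 / log m := by have := log_nonneg (by linarith : 1 ≤ m); positivity
        rw [al]; linarith
      have h2 : al a m * (l * V) ≤ a * (l * V) := mul_le_mul_of_nonneg_right h1 (by positivity)
      have h3 : a * (l * V) ≤ a * (x + a * x / 8) := mul_le_mul_of_nonneg_left (by linarith) ha.le
      have h4 : a * (a * x) ≤ a * x := mul_le_mul_of_nonneg_left hax ha.le
      linarith
    calc _ ≤ exp (9 / 4 * a * x) * (C * exp (a / 2 * x)) := mul_le_mul d2 (mul_le_mul_of_nonneg_left d1 hC.le) (by positivity) (exp_pos _).le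
      _ = C * exp (11 / 4 * a * x) := by rw [mul_left_comm, ← exp_add]; ring_nf
  refine (Finset.sum_le_card_nsmul _ _ _ b2).trans ?_
  rw [nsmul_eq_mul]
  have c1 := Vx_card (a := m) (b := m ^ 2) (k := m) (by linarith) hm0.le (one_le_pow₀ (by linarith))
  have c4 : m ^ 3 ≤ x ^ 2 := by
    refine (pow_le_pow_right₀ (by linarith) (by norm_num : 3 ≤ 4)).trans ?_
    rw [show m ^ 4 = (m ^ 2) ^ 2 by ring]
    gcongr
  have c5 : ((Vs m).card : ℝ) ≤ 2 * x ^ 2 := by rw [Vs]; linarith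
  refine (mul_le_mul_of_nonneg_right c5 (by positivity)).trans ?_
  have c6 := mul_le_mul_of_nonneg_right (hx0 x ((le_max_left _ _).trans hx)) (exp_pos (3 * a * x)).le
  rw [one_mul, mul_assoc _ (exp _) (exp _), ← exp_add] at c6
  refine le_trans (le_of_eq ?_) c6
  rw [show -(a / 4 * x) + 3 * a * x = 11 / 4 * a * x by ring]; ring

theorem dual (S : Finset ℕ) (κ : ℕ → ℝ) (b : ℕ → ℂ) (hb : ∀ n ∈ S, ‖b n‖ ≤ κ n) (T M : ℝ) (hM0 : 0 ≤ M) (U : Set ℝ) (hU : MeasurableSet U)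
    (hUT : U ⊆ Set.Icc (-T) T) (hM : ∀ s ∈ U, ∫ t in U, ‖∑ n ∈ S, (κ n : ℂ) * E (s - t) n‖ ≤ M) :
    ∫ t in U, ‖∑ n ∈ S, b n * E t n‖ ^ 2 ≤ (∑ n ∈ S, κ n) * M := by
  set D : ℝ → ℂ := fun t => ∑ n ∈ S, b n * E t n with hD
  set K : ℝ → ℂ := fun t => ∑ n ∈ S, (κ n : ℂ) * E t n with hK
  have hDc : Continuous D := continuous_finsetSum _ fun n _ => continuous_const.mul (E_cont n)
  have hKc : Continuous K := continuous_finsetSum _ fun n _ => continuous_const.mul (E_cont n)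
  have hUi : ∀ {f : ℝ → ℂ}, Continuous f → IntegrableOn f U := fun hf => hf.integrableOn_Icc.mono_set hUT
  have hUr : ∀ {f : ℝ → ℝ}, Continuous f → IntegrableOn f U := fun hf => hf.integrableOn_Icc.mono_set hUT
  set I := ∫ t in U, ‖D t‖ ^ 2 with hI
  have hI0 : 0 ≤ I := integral_nonneg fun t => by positivity
  set g : ℕ → ℂ := fun n => ∫ t in U, E t n * (starRingEnd ℂ) (D t) with hg
  have hκ : ∀ n ∈ S, 0 ≤ κ n := fun n hn => (norm_nonneg _).trans (hb n hn)
  have ce : ∀ n (c : ℂ), Continuous fun t => c * (E t n * (starRingEnd ℂ) (D t)) := fun n c =>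
    continuous_const.mul ((E_cont n).mul (Complex.continuous_conj.comp hDc))
  have ce2 : ∀ n (c : ℂ), Continuous fun t => c * ((starRingEnd ℂ) (E t n) * D t) := fun n c =>
    continuous_const.mul ((Complex.continuous_conj.comp (E_cont n)).mul hDc)
  have i1 : ((I : ℝ) : ℂ) = ∑ n ∈ S, b n * g n := by
    rw [hI, ← integral_complex_ofReal]
    simp only [hg, ← integral_const_mul]
    rw [← integral_finsetSum _ fun n _ => hUi (ce n (b n))]
    refine integral_congr_ae (Eventually.of_forall fun t => ?_)
    change ((‖D t‖ ^ 2 : ℝ) : ℂ) = ∑ n ∈ S, b n * (E t n * (starRingEnd ℂ) (D t))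
    rw [← Complex.normSq_eq_norm_sq, ← Complex.mul_conj]
    nth_rw 1 [hD]
    rw [Finset.sum_mul]
    exact Finset.sum_congr rfl fun n _ => by ring
  have i2 : I ^ 2 ≤ (∑ n ∈ S, κ n) * ∑ n ∈ S, κ n * ‖g n‖ ^ 2 := by
    have : I ≤ ∑ n ∈ S, κ n * ‖g n‖ := by
      have h1 : I = ‖((I : ℝ) : ℂ)‖ := by rw [Complex.norm_real, norm_of_nonneg hI0]
      rw [h1, i1]
      refine (norm_sum_le _ _).trans (Finset.sum_le_sum fun n hn => ?_)
      rw [norm_mul]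
      exact mul_le_mul_of_nonneg_right (hb n hn) (norm_nonneg _)
    refine (pow_le_pow_left₀ hI0 this 2).trans (Finset.sum_sq_le_sum_mul_sum_of_sq_le_mul _ hκ (fun n hn => mul_nonneg (hκ n hn) (by positivity)) fun n _ => le_of_eq (by ring))
  have hE : ∀ s t n, E (s - t) n = E s n * (starRingEnd ℂ) (E t n) := by
    intro s t n
    simp only [E]
    rw [← Complex.exp_conj, ← Complex.exp_add]
    congr 1
    simp only [map_mul, map_neg, Complex.conj_ofReal, Complex.conj_I]
    push_cast; ring
  have i3 : ((∑ n ∈ S, κ n * ‖g n‖ ^ 2 : ℝ) : ℂ) = ∫ s in U, (starRingEnd ℂ) (D s) * ∫ t in U, D t * K (s - t) := by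
    have j1 : ∀ s, ∫ t in U, D t * K (s - t) = ∑ n ∈ S, (κ n : ℂ) * E s n * (starRingEnd ℂ) (g n) := by
      intro s
      have : ∀ n, (starRingEnd ℂ) (g n) = ∫ t in U, (starRingEnd ℂ) (E t n) * D t := by
        intro n
        rw [hg]; simp only
        rw [← integral_conj]
        exact integral_congr_ae (Eventually.of_forall fun t => by simp)
      simp only [this, ← integral_const_mul]
      rw [← integral_finsetSum _ fun n _ => hUi (ce2 n _)]
      refine integral_congr_ae (Eventually.of_forall fun t => ?_)
      simp only [hK, hE, Finset.mul_sum]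
      exact Finset.sum_congr rfl fun n _ => by ring
    simp only [j1]
    have : ∀ s, (starRingEnd ℂ) (D s) * ∑ n ∈ S, ((κ n : ℂ) * E s n * (starRingEnd ℂ) (g n)) = ∑ n ∈ S, (κ n * (starRingEnd ℂ) (g n)) * (E s n * (starRingEnd ℂ) (D s)) := fun s => by
      rw [Finset.mul_sum]
      exact Finset.sum_congr rfl fun n _ => by ring
    simp only [this]
    rw [integral_finsetSum _ fun n _ => hUi (ce n _)]
    push_cast
    refine Finset.sum_congr rfl fun n _ => ?_
    rw [integral_const_mul, ← Complex.ofReal_pow, ← Complex.normSq_eq_norm_sq, ← Complex.mul_conj]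
    ring
  have hKs : ∀ s t, ‖K (s - t)‖ = ‖K (t - s)‖ := by
    intro s t
    have : K (s - t) = (starRingEnd ℂ) (K (t - s)) := by
      simp only [hK, map_sum, map_mul, Complex.conj_ofReal, hE, Complex.conj_conj]
      exact Finset.sum_congr rfl fun n _ => by ring
    rw [this, Complex.norm_conj]
  have i4 : ∑ n ∈ S, κ n * ‖g n‖ ^ 2 ≤ M * I := by
    have h1 : ∑ n ∈ S, κ n * ‖g n‖ ^ 2 = ‖((∑ n ∈ S, κ n * ‖g n‖ ^ 2 : ℝ) : ℂ)‖ := by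
      rw [Complex.norm_real, norm_of_nonneg (Finset.sum_nonneg fun n hn => mul_nonneg (hκ n hn) (by positivity))]
    have hc1 : Continuous fun z : ℝ × ℝ => ‖D z.1‖ ^ 2 * ‖K (z.1 - z.2)‖ :=
      ((hDc.comp continuous_fst).norm.pow 2).mul (hKc.comp (continuous_fst.sub continuous_snd)).norm
    have hc2 : Continuous fun z : ℝ × ℝ => ‖D z.2‖ ^ 2 * ‖K (z.1 - z.2)‖ :=
      ((hDc.comp continuous_snd).norm.pow 2).mul (hKc.comp (continuous_fst.sub continuous_snd)).norm
    have hp : ∀ {f : ℝ × ℝ → ℝ}, Continuous f → Integrable f ((volume.restrict U).prod (volume.restrict U)) := by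
      intro f hf
      rw [Measure.prod_restrict]
      exact (hf.continuousOn.integrableOn_compact (isCompact_Icc.prod isCompact_Icc)).mono_set (Set.prod_mono hUT hUT)
    have q1 : ∫ s in U, ∫ t in U, ‖D s‖ ^ 2 * ‖K (s - t)‖ ≤ M * I := by
      rw [hI, ← integral_const_mul]
      refine setIntegral_mono_on (hp hc1).integral_prod_left ((hUr (hDc.norm.pow 2)).const_mul M) hU fun s hs => ?_
      rw [integral_const_mul, mul_comm]
      exact mul_le_mul_of_nonneg_right (hM s hs) (by positivity)
    have q2 : ∫ s in U, ∫ t in U, ‖D t‖ ^ 2 * ‖K (s - t)‖ = ∫ s in U, ∫ t in U, ‖D s‖ ^ 2 * ‖K (s - t)‖ := by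
      rw [integral_integral_swap (f := fun s t => ‖D t‖ ^ 2 * ‖K (s - t)‖) (hp hc2)]
      refine integral_congr_ae (Eventually.of_forall fun s => ?_)
      exact integral_congr_ae (Eventually.of_forall fun t => by simp only [hKs s t])
    rw [h1, i3]
    have q3 : ‖∫ s in U, (starRingEnd ℂ) (D s) * ∫ t in U, D t * K (s - t)‖ ≤
        ∫ s in U, 1 / 2 * ((∫ t in U, ‖D s‖ ^ 2 * ‖K (s - t)‖) + ∫ t in U, ‖D t‖ ^ 2 * ‖K (s - t)‖) := by
      refine norm_integral_le_of_norm_le (((hp hc1).integral_prod_left.add (hp hc2).integral_prod_left).const_mul _) (Eventually.of_forall fun s => ?_)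
      rw [norm_mul, Complex.norm_conj]
      have k1 : Continuous fun t => ‖D s‖ ^ 2 * ‖K (s - t)‖ := continuous_const.mul (hKc.comp (continuous_const.sub continuous_id)).norm
      have k2 : Continuous fun t => ‖D t‖ ^ 2 * ‖K (s - t)‖ := (hDc.norm.pow 2).mul (hKc.comp (continuous_const.sub continuous_id)).norm
      have k3 : Continuous fun t => D t * K (s - t) := hDc.mul (hKc.comp (continuous_const.sub continuous_id))
      rw [← integral_add (hUr k1) (hUr k2), ← integral_const_mul]
      refine (mul_le_mul_of_nonneg_left (norm_integral_le_integral_norm _) (norm_nonneg _)).trans ?_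
      rw [← integral_const_mul]
      refine integral_mono ((hUr k3.norm).const_mul _) ((((hUr k1).add (hUr k2))).const_mul _) fun t => ?_
      simp only [norm_mul, Pi.add_apply]
      have := mul_le_mul_of_nonneg_right (two_mul_le_add_sq ‖D s‖ ‖D t‖) (norm_nonneg (K (s - t)))
      linarith
    refine q3.trans ?_
    rw [integral_const_mul, integral_add (hp hc1).integral_prod_left (hp hc2).integral_prod_left, q2]
    linarith
  rcases hI0.eq_or_lt with h0 | h0
  · rw [← h0]
    exact mul_nonneg (Finset.sum_nonneg hκ) hM0
  · have := i2.trans (mul_le_mul_of_nonneg_left i4 (Finset.sum_nonneg hκ))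
    rw [sq, ← mul_assoc] at this
    exact le_of_mul_le_mul_right this h0
end MR
namespace MR
open Real MeasureTheory

theorem dual2 {W : ℝ → ℝ} {B : ℝ} (h : Bump W B) : ∃ C, 0 < C ∧ ∀ (S : Finset ℕ) (κ : ℕ → ℝ) (b : ℕ → ℂ) (T A e : ℝ) (U : Set ℝ),
    (∀ n ∈ S, ‖b n‖ ≤ κ n) → 0 ≤ T → 0 ≤ A → 0 ≤ e → MeasurableSet U → U ⊆ Set.Icc (-T) T →
    (∀ r : ℝ, |r| ≤ 2 * T → ‖∑ n ∈ S, (κ n : ℂ) * E r n‖ ≤ A * ‖wh W r‖ + e) →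
    ∫ t in U, ‖∑ n ∈ S, b n * E t n‖ ^ 2 ≤ (A * C + e) * (A * C + e * (volume U).toReal) := by
  have hi := h.wh_int.norm
  refine ⟨(∫ t, ‖wh W t‖) + ‖wh W 0‖ + 1, by
    have : 0 ≤ ∫ t, ‖wh W t‖ := integral_nonneg fun _ => norm_nonneg _
    positivity, fun S κ b T A e U hb hT hA he hU hUT hK => ?_⟩
  have h0 : 0 ≤ ∫ t, ‖wh W t‖ := integral_nonneg fun _ => norm_nonneg _
  set C := (∫ t, ‖wh W t‖) + ‖wh W 0‖ + 1
  have hC0 : 0 ≤ C := by positivity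
  have hM0 : 0 ≤ A * C + e * (volume U).toReal := by positivity
  refine (dual S κ b hb T _ hM0 U hU hUT fun s hs => ?_).trans (mul_le_mul_of_nonneg_right ?_ hM0)
  · have hUf : volume U ≠ ⊤ := ((measure_mono hUT).trans_lt measure_Icc_lt_top).ne
    have hc : Continuous fun t => ‖∑ n ∈ S, (κ n : ℂ) * E (s - t) n‖ :=
      (continuous_finsetSum _ fun n _ => continuous_const.mul ((E_cont n).comp (continuous_const.sub continuous_id))).norm
    have hi' : Integrable fun t => ‖wh W (s - t)‖ := hi.comp_sub_left s
    have i2 : IntegrableOn (fun t => A * ‖wh W (s - t)‖) U := (hi'.const_mul A).integrableOn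
    have i3 : IntegrableOn (fun _ : ℝ => e) U := integrableOn_const hUf
    have h1 : ∫ t in U, ‖∑ n ∈ S, (κ n : ℂ) * E (s - t) n‖ ≤ ∫ t in U, (A * ‖wh W (s - t)‖ + e) := by
      refine setIntegral_mono_on (hc.integrableOn_Icc.mono_set hUT) (i2.add i3) hU fun t ht => hK _ ?_
      have h1 := hUT hs
      have h2 := hUT ht
      rw [abs_le]; constructor <;> linarith [h1.1, h1.2, h2.1, h2.2]
    refine h1.trans ?_
    rw [integral_add i2 i3, integral_const_mul, setIntegral_const, smul_eq_mul, measureReal_def, mul_comm e]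
    refine add_le_add_left (mul_le_mul_of_nonneg_left ?_ hA) _
    refine (setIntegral_le_integral hi' (Eventually.of_forall fun _ => norm_nonneg _)).trans ?_
    rw [integral_sub_left_eq_self (fun t => ‖wh W t‖)]
    linarith [norm_nonneg (wh W 0)]
  · have h1 := hK 0 (by simpa using hT)
    have h2 : ∑ n ∈ S, (κ n : ℂ) * E 0 n = ((∑ n ∈ S, κ n : ℝ) : ℂ) := by
      push_cast
      exact Finset.sum_congr rfl fun n _ => by simp [E]
    rw [h2, Complex.norm_real] at h1
    have h3 : A * ‖wh W 0‖ ≤ A * C := mul_le_mul_of_nonneg_left (by linarith) hA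
    linarith [le_abs_self (∑ n ∈ S, κ n), Real.norm_eq_abs (∑ n ∈ S, κ n)]

theorem R_dual {w : ℝ → ℝ} {B : ℝ} (h : Bump w B) : ∃ C c, 0 < C ∧ 0 < c ∧ ∀ (x y : ℝ) (U : Set ℝ), 2 ≤ x → 3 / 4 * x ≤ y → MeasurableSet U →
    U ⊆ Set.Icc (-exp x) (exp x) → ∫ t in U, ‖Dw Mu w y t‖ ^ 2 ≤ C * (1 + exp (-(c * x)) * (volume U).toReal) := by
  obtain ⟨W, hW, hW0, -, hW1⟩ := exists_W B h.hB
  obtain ⟨C1, hC1, hd⟩ := dual2 hW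
  obtain ⟨C2, c, hC2, hc, hk⟩ := kernel hW 3 (by norm_num)
  obtain ⟨κ, hκ, hw⟩ := h.bdd
  have hA : 0 < κ * C1 + κ * C2 := by positivity
  refine ⟨(κ * C1 + κ * C2) ^ 2, c * (3 / 4), by positivity, by positivity, fun x y U hx hy hU hUT => ?_⟩
  have hy0 : 0 ≤ y := by linarith
  have hsub : Wn B y ⊆ Wn (B + 1) y := fun n hn => by
    rw [mem_Wn] at hn ⊢
    exact ⟨hn.1, by linarith⟩
  have key := hd (Wn (B + 1) y) (fun n => κ * (W (log n - y) / n)) (fun n => Mu n * ((w (log n - y) / n : ℝ) : ℂ)) (exp x) κ (κ * (C2 * exp (-(c * y)))) U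
    (fun n hn => by
      rw [norm_mul, Complex.norm_real, Real.norm_eq_abs, abs_div, Nat.abs_cast]
      refine (mul_le_of_le_one_left (by positivity) (Mu_le n)).trans ?_
      rw [← mul_div_assoc]
      refine div_le_div_of_nonneg_right ?_ (Nat.cast_nonneg n)
      by_cases hB : |log n - y| ≤ B
      · rw [hW1 _ hB, mul_one]; exact hw _
      · rw [h.supp _ (not_le.1 hB), abs_zero]; exact mul_nonneg hκ.le (hW0 _))
    (exp_pos _).le hκ.le (by positivity) hU hUT (fun r hr => by
      have e1 : ∑ n ∈ Wn (B + 1) y, ((κ * (W (log n - y) / n) : ℝ) : ℂ) * E r n = κ * Dw (fun _ => 1) W y r := by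
        rw [Dw_eq hW _ y r _ subset_rfl, Finset.mul_sum]
        exact Finset.sum_congr rfl fun n _ => by push_cast; ring
      rw [e1, norm_mul, Complex.norm_real, norm_of_nonneg hκ.le, ← mul_add]
      refine mul_le_mul_of_nonneg_left ?_ hκ.le
      have h1 := hk y hy0 r (hr.trans (by
        have : (2 : ℝ) ≤ exp 1 := by linarith [add_one_le_exp (1 : ℝ)]
        refine (mul_le_mul_of_nonneg_right this (exp_pos _).le).trans ?_
        rw [← exp_add, exp_le_exp]
        push_cast
        linarith))
      have h2 := norm_sub_norm_le (Dw (fun _ => 1) W y r) (Complex.exp (-(r * y : ℝ) * Complex.I) * wh W r)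
      have h3 : ‖Complex.exp (-(r * y : ℝ) * Complex.I) * wh W r‖ = ‖wh W r‖ := by
        rw [norm_mul, ← Complex.ofReal_neg, Complex.norm_exp_ofReal_mul_I, one_mul]
      linarith)
  have e2 : ∀ t, ∑ n ∈ Wn (B + 1) y, Mu n * ((w (log n - y) / n : ℝ) : ℂ) * E t n = Dw Mu w y t := fun t => (Dw_eq h _ y t _ hsub).symm
  simp only [e2] at key
  refine key.trans ?_
  have he1 : exp (-(c * y)) ≤ 1 := exp_le_one_iff.2 (by have := mul_nonneg hc.le hy0; linarith)
  have he2 : exp (-(c * y)) ≤ exp (-(c * (3 / 4) * x)) := exp_le_exp.2 (by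
    have := mul_le_mul_of_nonneg_left hy hc.le; linarith)
  set V := (volume U).toReal
  have hV : 0 ≤ V := ENNReal.toReal_nonneg
  have hb : 0 < κ * C2 := by positivity
  have h1 : κ * C1 + κ * (C2 * exp (-(c * y))) ≤ κ * C1 + κ * C2 := by
    have := mul_le_mul_of_nonneg_left he1 hb.le
    linarith
  have h2 : κ * C1 + κ * (C2 * exp (-(c * y))) * V ≤ (κ * C1 + κ * C2) * (1 + exp (-(c * (3 / 4) * x)) * V) := by
    have e3 := mul_le_mul_of_nonneg_left (mul_le_mul_of_nonneg_right he2 hV) hb.le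
    have e4 : 0 ≤ κ * C1 * (exp (-(c * (3 / 4) * x)) * V) := by positivity
    linarith
  calc _ ≤ (κ * C1 + κ * C2) * ((κ * C1 + κ * C2) * (1 + exp (-(c * (3 / 4) * x)) * V)) := mul_le_mul h1 h2 (by positivity) hA.le
    _ = _ := by ring
end MR
namespace MR
open Real MeasureTheory

theorem sqf_sum (R : ℕ) : log (R + 1) / 2 ≤ ∑ k ∈ Finset.Icc 1 R, ((ArithmeticFunction.moebius k : ℤ) : ℝ) ^ 2 / k := by
  have h1 := log_add_one_le_harmonic R
  rw [harmonic_eq_sum_Icc] at h1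
  push_cast at h1
  set G := ∑ k ∈ Finset.Icc 1 R, ((ArithmeticFunction.moebius k : ℤ) : ℝ) ^ 2 / k
  choose f g hfg hf using Nat.sq_mul_squarefree
  have h2 : ∑ n ∈ Finset.Icc 1 R, ((n : ℝ))⁻¹ ≤ ∑ z ∈ Finset.Icc 1 R ×ˢ Finset.Ioo 0 (R + 1), ((ArithmeticFunction.moebius z.1 : ℤ) : ℝ) ^ 2 / z.1 * ((z.2 : ℝ) ^ 2)⁻¹ := by
    have inj : Set.InjOn (fun n => (f n, g n)) (Finset.Icc 1 R : Finset ℕ) := by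
      intro m _ n _ h
      simp only [Prod.mk.injEq] at h
      rw [← hfg m, ← hfg n, h.1, h.2]
    have e1 : ∑ n ∈ Finset.Icc 1 R, ((n : ℝ))⁻¹ = ∑ z ∈ (Finset.Icc 1 R).image (fun n => (f n, g n)), ((ArithmeticFunction.moebius z.1 : ℤ) : ℝ) ^ 2 / z.1 * ((z.2 : ℝ) ^ 2)⁻¹ := by
      rw [Finset.sum_image inj]
      refine Finset.sum_congr rfl fun n _ => ?_
      have : ((ArithmeticFunction.moebius (f n) : ℤ) : ℝ) ^ 2 = 1 := by
        exact_mod_cast ArithmeticFunction.moebius_sq_eq_one_of_squarefree (hf n)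
      simp only [this]
      conv_lhs => rw [← hfg n]
      push_cast
      rw [mul_inv, one_div, mul_comm]
    rw [e1]
    refine Finset.sum_le_sum_of_subset_of_nonneg (fun z hz => ?_) fun z _ _ => by positivity
    obtain ⟨n, hn, rfl⟩ := Finset.mem_image.1 hz
    rw [Finset.mem_Icc] at hn
    have h3 := hfg n
    have hg0 : g n ≠ 0 := by rintro h; rw [h] at h3; simp at h3; omega
    have hf0 : f n ≠ 0 := by rintro h; rw [h] at h3; simp at h3; omega
    have d1 : f n ≤ n := Nat.le_of_dvd (by omega) ⟨g n ^ 2, by rw [mul_comm]; exact h3.symm⟩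
    have d2 : g n ≤ n := Nat.le_of_dvd (by omega) ⟨g n * f n, by rw [← mul_assoc, ← sq]; exact h3.symm⟩
    simp only [Finset.mem_product, Finset.mem_Icc, Finset.mem_Ioo]
    omega
  rw [Finset.sum_product] at h2
  simp only at h2
  rw [← Finset.sum_mul_sum] at h2
  have h3 := sum_Ioo_inv_sq_le (α := ℝ) 0 (R + 1)
  have hG : 0 ≤ G := Finset.sum_nonneg fun k _ => by positivity
  have h4 := mul_le_mul_of_nonneg_left h3 hG
  norm_num at h4
  linarith

theorem mu_inv (R j k : ℕ) (hj : j ∈ Finset.Icc 1 R) (hk : k ∈ Finset.Icc 1 R) :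
    ∑ d ∈ Finset.Icc 1 R, (if k ∣ d ∧ d ∣ j then ((ArithmeticFunction.moebius (j / d) : ℤ) : ℝ) else 0) = if j = k then 1 else 0 := by
  rw [Finset.mem_Icc] at hj hk
  by_cases hkj : k ∣ j
  · obtain ⟨n, rfl⟩ := hkj
    have hn : n ≠ 0 := by rintro rfl; simp at hj
    have h1 : ∑ d ∈ n.divisors, ((ArithmeticFunction.moebius (n / d) : ℤ) : ℝ) = if n = 1 then 1 else 0 := by
      rw [Nat.sum_div_divisors n fun d => ((ArithmeticFunction.moebius d : ℤ) : ℝ)]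
      have := congrArg (fun f => f n) (ArithmeticFunction.coe_moebius_mul_coe_zeta (R := ℝ))
      simp only [ArithmeticFunction.coe_mul_zeta_apply, ArithmeticFunction.one_apply, ArithmeticFunction.intCoe_apply] at this
      exact this
    have e1 : (k * n = k) ↔ n = 1 := by
      constructor
      · intro h; exact Nat.eq_of_mul_eq_mul_left (by omega : 0 < k) (by simpa using h)
      · rintro rfl; simp
    simp only [e1]
    rw [← h1]
    symm
    refine Finset.sum_of_injOn (fun d => k * d) (fun a _ b _ h => Nat.eq_of_mul_eq_mul_left (by omega) h) (fun d hd => ?_) (fun d hd hd' => ?_) (fun d hd => ?_)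
    · have hd := Nat.dvd_of_mem_divisors hd
      have : k * d ≤ k * n := Nat.mul_le_mul_left k (Nat.le_of_dvd (by omega) hd)
      have : 0 < k * d := Nat.mul_pos (by omega) (Nat.pos_of_dvd_of_pos hd (by omega))
      simp only [Finset.coe_Icc, Set.mem_Icc]
      omega
    · rw [if_neg]
      rintro ⟨⟨q, rfl⟩, h2⟩
      exact hd' ⟨q, by simpa [hn] using Nat.dvd_of_mul_dvd_mul_left (by omega) h2, rfl⟩
    · have hd := Nat.dvd_of_mem_divisors hd
      rw [if_pos ⟨dvd_mul_right _ _, mul_dvd_mul_left k hd⟩, Nat.mul_div_mul_left _ _ (by omega)]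
  · rw [if_neg (by rintro rfl; exact hkj dvd_rfl)]
    exact Finset.sum_eq_zero fun d _ => if_neg fun h => hkj (h.1.trans h.2)

theorem sieve_wts (R : ℕ) (hR : 1 ≤ R) : ∃ l : ℕ → ℝ, l 1 = 1 ∧ (∀ d ∈ Finset.Icc 1 R, |l d| ≤ d) ∧
    0 ≤ ∑ d ∈ Finset.Icc 1 R, ∑ e ∈ Finset.Icc 1 R, l d * l e / (d.lcm e : ℕ) ∧
    ∑ d ∈ Finset.Icc 1 R, ∑ e ∈ Finset.Icc 1 R, l d * l e / (d.lcm e : ℕ) ≤ 2 / log (R + 1) := by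
  have hG1 := sqf_sum R
  set G := ∑ k ∈ Finset.Icc 1 R, ((ArithmeticFunction.moebius k : ℤ) : ℝ) ^ 2 / k with hGd
  have hlog : 0 < log ((R : ℝ) + 1) := log_pos (by have : (1 : ℝ) ≤ R := by exact_mod_cast hR
                                                   linarith)
  have hG : 0 < G := by linarith
  set y : ℕ → ℝ := fun k => ((ArithmeticFunction.moebius k : ℤ) : ℝ) / (k * G) with hy
  set l : ℕ → ℝ := fun d => d * ∑ k ∈ Finset.Icc 1 R, if d ∣ k then ((ArithmeticFunction.moebius (k / d) : ℤ) : ℝ) * y k else 0 with hl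
  have hmu : ∀ n : ℕ, |((ArithmeticFunction.moebius n : ℤ) : ℝ)| ≤ 1 := fun n => by exact_mod_cast ArithmeticFunction.abs_moebius_le_one
  have hmusq : ∀ n : ℕ, |((ArithmeticFunction.moebius n : ℤ) : ℝ)| = ((ArithmeticFunction.moebius n : ℤ) : ℝ) ^ 2 := fun n => by
    have h : |ArithmeticFunction.moebius n| = ArithmeticFunction.moebius n ^ 2 := by
      rcases ArithmeticFunction.moebius_eq_or n with h | h | h <;> simp [h]
    exact_mod_cast h
  have hyk : ∀ k ∈ Finset.Icc 1 R, ∑ d ∈ Finset.Icc 1 R, (if k ∣ d then l d / d else 0) = y k := by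
    intro k hk
    have e1 : ∀ d ∈ Finset.Icc 1 R, (if k ∣ d then l d / d else 0) = ∑ j ∈ Finset.Icc 1 R, y j * (if k ∣ d ∧ d ∣ j then ((ArithmeticFunction.moebius (j / d) : ℤ) : ℝ) else 0) := by
      intro d hd
      have hd0 : (d : ℝ) ≠ 0 := by rw [Finset.mem_Icc] at hd; norm_cast; omega
      by_cases h : k ∣ d
      · simp only [h, if_true, true_and, hl]
        rw [mul_div_cancel_left₀ _ hd0]
        exact Finset.sum_congr rfl fun j _ => by split_ifs <;> ring
      · simp [h]
    rw [Finset.sum_congr rfl e1, Finset.sum_comm]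
    simp only [← Finset.mul_sum]
    rw [Finset.sum_congr rfl fun j hj => by rw [mu_inv R j k hj hk]]
    simp [hk]
  have hform : ∑ d ∈ Finset.Icc 1 R, ∑ e ∈ Finset.Icc 1 R, l d * l e / (d.lcm e : ℕ) = ∑ k ∈ Finset.Icc 1 R, (Nat.totient k : ℝ) * y k ^ 2 := by
    have e1 : ∀ d ∈ Finset.Icc 1 R, ∀ e ∈ Finset.Icc 1 R, l d * l e / (d.lcm e : ℕ) =
        ∑ k ∈ Finset.Icc 1 R, (Nat.totient k : ℝ) * ((if k ∣ d then l d / d else 0) * (if k ∣ e then l e / e else 0)) := by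
      intro d hd e he
      rw [Finset.mem_Icc] at hd he
      have hg : 0 < d.gcd e := Nat.gcd_pos_of_pos_left _ (by omega)
      have h1 : ((d.gcd e : ℕ) : ℝ) = ∑ k ∈ Finset.Icc 1 R, if k ∣ d ∧ k ∣ e then (Nat.totient k : ℝ) else 0 := by
        rw [← Finset.sum_filter]
        conv_lhs => rw [← Nat.sum_totient (d.gcd e)]
        push_cast
        refine Finset.sum_congr ?_ fun _ _ => rfl
        ext k
        simp only [Nat.mem_divisors, Finset.mem_filter, Finset.mem_Icc, Nat.dvd_gcd_iff]
        refine ⟨fun h => ⟨⟨Nat.pos_of_dvd_of_pos h.1.1 (by omega), (Nat.le_of_dvd (by omega) h.1.1).trans hd.2⟩, h.1⟩, fun h => ⟨h.2, hg.ne'⟩⟩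
      have h2 : ((d.gcd e : ℕ) : ℝ) * (d.lcm e : ℕ) = d * e := by exact_mod_cast Nat.gcd_mul_lcm d e
      have hd0 : (d : ℝ) ≠ 0 := by norm_cast; omega
      have he0 : (e : ℝ) ≠ 0 := by norm_cast; omega
      have hl0 : ((d.lcm e : ℕ) : ℝ) ≠ 0 := by norm_cast; exact Nat.lcm_ne_zero (by omega) (by omega)
      have h3 : l d * l e / (d.lcm e : ℕ) = (d.gcd e : ℕ) * (l d / d * (l e / e)) := by
        field_simp
        linear_combination (-(l d * l e)) * h2
      rw [h3, h1, Finset.sum_mul]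
      refine Finset.sum_congr rfl fun k _ => ?_
      by_cases a1 : k ∣ d <;> by_cases a2 : k ∣ e <;> simp [a1, a2]
    rw [Finset.sum_congr rfl fun d hd => Finset.sum_congr rfl (e1 d hd)]
    rw [Finset.sum_congr rfl fun d _ => Finset.sum_comm, Finset.sum_comm]
    refine Finset.sum_congr rfl fun k hk => ?_
    simp only [← Finset.mul_sum]
    rw [hyk k hk, ← Finset.sum_mul, hyk k hk, sq]
  refine ⟨l, ?_, ?_, ?_, ?_⟩
  · have : ∑ k ∈ Finset.Icc 1 R, ((ArithmeticFunction.moebius k : ℤ) : ℝ) * y k = 1 := by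
      have : ∀ k ∈ Finset.Icc 1 R, ((ArithmeticFunction.moebius k : ℤ) : ℝ) * y k = (((ArithmeticFunction.moebius k : ℤ) : ℝ) ^ 2 / k) / G := fun k _ => by
        rw [hy]; simp only; rw [← div_div]; ring
      rw [Finset.sum_congr rfl this, ← Finset.sum_div, ← hGd, div_self hG.ne']
    simpa [hl] using this
  · intro d hd
    rw [hl]; simp only
    rw [abs_mul, Nat.abs_cast]
    refine mul_le_of_le_one_right (Nat.cast_nonneg d) ((Finset.abs_sum_le_sum_abs _ _).trans ?_)
    rw [← div_self hG.ne']
    nth_rw 2 [hGd]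
    rw [Finset.sum_div]
    refine Finset.sum_le_sum fun k hk => ?_
    have : |y k| = ((ArithmeticFunction.moebius k : ℤ) : ℝ) ^ 2 / k / G := by
      rw [hy]; simp only
      rw [abs_div, hmusq, abs_of_nonneg (by positivity : 0 ≤ (k : ℝ) * G), div_div]
    rw [← this]
    split_ifs
    · rw [abs_mul]; exact mul_le_of_le_one_left (abs_nonneg _) (hmu _)
    · rw [abs_zero]; exact abs_nonneg _
  · rw [hform]; exact Finset.sum_nonneg fun k _ => by positivity
  · rw [hform]
    have : ∀ k ∈ Finset.Icc 1 R, (Nat.totient k : ℝ) * y k ^ 2 ≤ (((ArithmeticFunction.moebius k : ℤ) : ℝ) ^ 2 / k) / G ^ 2 := by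
      intro k hk
      have hk0 : (0 : ℝ) < k := by rw [Finset.mem_Icc] at hk; norm_cast; omega
      have : (Nat.totient k : ℝ) ≤ k := by exact_mod_cast Nat.totient_le k
      refine (mul_le_mul_of_nonneg_right this (sq_nonneg _)).trans (le_of_eq ?_)
      rw [hy]; simp only; field_simp
    refine (Finset.sum_le_sum this).trans ?_
    rw [← Finset.sum_div, ← hGd, sq, div_mul_cancel_left₀ hG.ne', ← one_div, div_le_div_iff₀ hG hlog]
    linarith
end MR
namespace MR
open Real MeasureTheory

theorem mult_sum {W : ℝ → ℝ} {B : ℝ} (h : Bump W B) (y r : ℝ) (q : ℕ) (hq : 1 ≤ q) :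
    ∑ n ∈ Wn B y, (if q ∣ n then ((W (log n - y) / n : ℝ) : ℂ) * E r n else 0) = E r q / q * Dw (fun _ => 1) W (y - log q) r := by
  rw [Dw_eq h _ _ r _ subset_rfl, Finset.mul_sum]
  have hq0 : (q : ℝ) ≠ 0 := by norm_cast; omega
  have hlog : ∀ m : ℕ, 1 ≤ m → log ((q * m : ℕ) : ℝ) - y = log m - (y - log q) := by
    intro m hm
    have : (m : ℝ) ≠ 0 := by norm_cast; omega
    push_cast
    rw [log_mul hq0 this]; ring
  symm
  refine Finset.sum_of_injOn (fun d => q * d) (fun a _ b _ h => Nat.eq_of_mul_eq_mul_left (by omega) h) (fun m hm => ?_) (fun n hn hn' => ?_) (fun m hm => ?_)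
  · have hm := mem_Wn.1 hm
    exact mem_Wn.2 ⟨Nat.mul_pos (by omega) (by omega), by rw [hlog m hm.1]; exact hm.2⟩
  · rw [if_neg]
    rintro ⟨m, rfl⟩
    have hn := mem_Wn.1 hn
    have hm : 1 ≤ m := Nat.pos_of_mul_pos_left (by omega : 0 < q * m)
    exact hn' ⟨m, mem_Wn.2 ⟨hm, by rw [← hlog m hm]; exact hn.2⟩, rfl⟩
  · have hm := mem_Wn.1 hm
    rw [if_pos (dvd_mul_right _ _), hlog m hm.1, E_mul r (by omega) (by omega)]
    push_cast
    rw [div_mul_eq_div_div]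
    ring

theorem sieve_K {W : ℝ → ℝ} {B : ℝ} (h : Bump W B) (k : ℕ) (hk : 1 ≤ k) : ∃ C c, 0 < C ∧ 0 < c ∧ c ≤ 1 ∧ ∀ (α : ℝ) (R : ℕ) (l : ℕ → ℝ) (r : ℝ), 0 ≤ α → 1 ≤ R →
    log R ≤ c * α / 20 → |r| ≤ exp (k * (9 / 10 * α)) → (∀ d ∈ Finset.Icc 1 R, |l d| ≤ d) →
    ‖∑ n ∈ Wn B α, (((∑ d ∈ Finset.Icc 1 R, if d ∣ n then l d else 0) ^ 2 * (W (log n - α) / n) : ℝ) : ℂ) * E r n‖ ≤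
      |∑ d ∈ Finset.Icc 1 R, ∑ e ∈ Finset.Icc 1 R, l d * l e / (d.lcm e : ℕ)| * ‖wh W r‖ + C * exp (-(c * α / 2)) := by
  obtain ⟨C, c0, hC, hc0, hker⟩ := kernel h k hk
  refine ⟨C, min c0 1, hC, by positivity, min_le_right _ _, fun α R l r hα hR hlR hr hl => ?_⟩
  set c := min c0 1 with hcd
  have hc : 0 < c := by positivity
  have hc1 : c ≤ 1 := min_le_right _ _
  have hR0 : (0 : ℝ) < R := by norm_cast
  have hRe : (R : ℝ) ≤ exp (c * α / 20) := (log_le_iff_le_exp hR0).1 hlR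
  set Θ : ℂ := Complex.exp (-(r * α : ℝ) * Complex.I) * wh W r with hΘ
  have e1 : ∑ n ∈ Wn B α, (((∑ d ∈ Finset.Icc 1 R, if d ∣ n then l d else 0) ^ 2 * (W (log n - α) / n) : ℝ) : ℂ) * E r n =
      ∑ d ∈ Finset.Icc 1 R, ∑ e ∈ Finset.Icc 1 R, ((l d * l e : ℝ) : ℂ) * (E r (d.lcm e) / (d.lcm e : ℕ) * Dw (fun _ => 1) W (α - log (d.lcm e : ℕ)) r) := by
    have : ∀ d ∈ Finset.Icc 1 R, ∀ e ∈ Finset.Icc 1 R, ((l d * l e : ℝ) : ℂ) * (E r (d.lcm e) / (d.lcm e : ℕ) * Dw (fun _ => 1) W (α - log (d.lcm e : ℕ)) r) =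
        ∑ n ∈ Wn B α, ((((if d ∣ n then l d else 0) * (if e ∣ n then l e else 0) * (W (log n - α) / n) : ℝ)) : ℂ) * E r n := by
      intro d hd e he
      rw [Finset.mem_Icc] at hd he
      rw [← mult_sum h α r _ (Nat.lcm_pos (by omega) (by omega)), Finset.mul_sum]
      refine Finset.sum_congr rfl fun n _ => ?_
      by_cases a1 : d ∣ n <;> by_cases a2 : e ∣ n <;> simp [a1, a2, Nat.lcm_dvd_iff, mul_assoc]
    rw [Finset.sum_congr rfl fun d hd => Finset.sum_congr rfl (this d hd)]
    rw [Finset.sum_congr rfl fun d _ => Finset.sum_comm, Finset.sum_comm]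
    refine Finset.sum_congr rfl fun n _ => ?_
    rw [sq, Finset.sum_mul_sum, Finset.sum_mul]
    push_cast
    rw [Finset.sum_mul]
    refine Finset.sum_congr rfl fun d _ => ?_
    rw [Finset.sum_mul, Finset.sum_mul]
  have e2 : ((∑ d ∈ Finset.Icc 1 R, ∑ e ∈ Finset.Icc 1 R, l d * l e / (d.lcm e : ℕ) : ℝ) : ℂ) * Θ =
      ∑ d ∈ Finset.Icc 1 R, ∑ e ∈ Finset.Icc 1 R, ((l d * l e / (d.lcm e : ℕ) : ℝ) : ℂ) * Θ := by
    push_cast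
    simp only [Finset.sum_mul]
  have hΘn : ‖Θ‖ = ‖wh W r‖ := by rw [hΘ, norm_mul, ← Complex.ofReal_neg, Complex.norm_exp_ofReal_mul_I, one_mul]
  have hcα : 0 ≤ c * α := by positivity
  have e3 : ∀ d ∈ Finset.Icc 1 R, ∀ e ∈ Finset.Icc 1 R, ‖((l d * l e : ℝ) : ℂ) * (E r (d.lcm e) / (d.lcm e : ℕ) * Dw (fun _ => 1) W (α - log (d.lcm e : ℕ)) r) -
      ((l d * l e / (d.lcm e : ℕ) : ℝ) : ℂ) * Θ‖ ≤ R ^ 2 * (C * exp (-(c * (9 / 10 * α)))) := by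
    intro d hd e he
    have hld := hl d hd
    have hle := hl e he
    rw [Finset.mem_Icc] at hd he
    set q := d.lcm e with hq
    have hq1 : 1 ≤ q := Nat.lcm_pos (by omega) (by omega)
    have hq1' : (1 : ℝ) ≤ q := by exact_mod_cast hq1
    have hqR : (q : ℝ) ≤ R * R := by
      have : q ≤ d * e := Nat.le_of_dvd (Nat.mul_pos (by omega) (by omega)) (Nat.lcm_dvd (dvd_mul_right _ _) (dvd_mul_left _ _))
      exact_mod_cast this.trans (Nat.mul_le_mul hd.2 he.2)
    have hlq : log q ≤ α / 10 := by
      refine (log_le_log (by linarith) hqR).trans ?_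
      rw [log_mul hR0.ne' hR0.ne']
      have : c * α ≤ 1 * α := mul_le_mul_of_nonneg_right hc1 hα
      linarith
    have hz : 9 / 10 * α ≤ α - log q := by linarith
    have hK := hker (α - log q) (by linarith) r (hr.trans (exp_le_exp.2 (mul_le_mul_of_nonneg_left hz (Nat.cast_nonneg k))))
    have hE : E r q * Complex.exp (-(r * (α - log q) : ℝ) * Complex.I) = Complex.exp (-(r * α : ℝ) * Complex.I) := by
      rw [E, ← Complex.exp_add]
      congr 1
      push_cast; ring
    have : ((l d * l e : ℝ) : ℂ) * (E r q / (q : ℕ) * Dw (fun _ => 1) W (α - log (q : ℕ)) r) - ((l d * l e / (q : ℕ) : ℝ) : ℂ) * Θ =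
        ((l d * l e / (q : ℕ) : ℝ) : ℂ) * E r q * (Dw (fun _ => 1) W (α - log (q : ℕ)) r - Complex.exp (-(r * (α - log q) : ℝ) * Complex.I) * wh W r) := by
      rw [hΘ, ← hE]
      push_cast; ring
    rw [this, norm_mul, norm_mul, norm_E, mul_one, Complex.norm_real, Real.norm_eq_abs, abs_div, abs_mul, Nat.abs_cast]
    have hd' : (d : ℝ) ≤ R := by exact_mod_cast hd.2
    have he' : (e : ℝ) ≤ R := by exact_mod_cast he.2
    refine mul_le_mul ?_ (hK.trans (mul_le_mul_of_nonneg_left (exp_le_exp.2 ?_) hC.le)) (norm_nonneg _) (by positivity)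
    · refine (div_le_self (by positivity) hq1').trans ?_
      rw [sq]
      exact mul_le_mul (hld.trans hd') (hle.trans he') (abs_nonneg _) hR0.le
    · have := mul_le_mul (min_le_left c0 1) hz (by positivity) hc0.le
      linarith
  rw [e1]
  have e4 : ‖(∑ d ∈ Finset.Icc 1 R, ∑ e ∈ Finset.Icc 1 R, ((l d * l e : ℝ) : ℂ) * (E r (d.lcm e) / (d.lcm e : ℕ) * Dw (fun _ => 1) W (α - log (d.lcm e : ℕ)) r)) -
      ((∑ d ∈ Finset.Icc 1 R, ∑ e ∈ Finset.Icc 1 R, l d * l e / (d.lcm e : ℕ) : ℝ) : ℂ) * Θ‖ ≤ R ^ 2 * (R ^ 2 * (C * exp (-(c * (9 / 10 * α))))) := by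
    rw [e2]
    simp only [← Finset.sum_sub_distrib]
    refine (norm_sum_le _ _).trans ((Finset.sum_le_sum fun d hd => (norm_sum_le _ _).trans (Finset.sum_le_sum (e3 d hd))).trans (le_of_eq ?_))
    simp only [Finset.sum_const, Nat.card_Icc, nsmul_eq_mul, Nat.add_sub_cancel]
    ring
  have e5 : (R : ℝ) ^ 2 * (R ^ 2 * (C * exp (-(c * (9 / 10 * α))))) ≤ C * exp (-(c * α / 2)) := by
    have : (R : ℝ) ^ 4 ≤ exp (4 * (c * α / 20)) := by
      have := pow_le_pow_left₀ hR0.le hRe 4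
      rwa [← exp_nat_mul] at this
    calc _ = R ^ 4 * (C * exp (-(c * (9 / 10 * α)))) := by ring
      _ ≤ exp (4 * (c * α / 20)) * (C * exp (-(c * (9 / 10 * α)))) := mul_le_mul_of_nonneg_right this (by positivity)
      _ = C * exp (4 * (c * α / 20) + -(c * (9 / 10 * α))) := by rw [exp_add]; ring
      _ ≤ _ := mul_le_mul_of_nonneg_left (exp_le_exp.2 (by linarith)) hC.le
  have e6 := norm_le_norm_add_norm_sub' (∑ d ∈ Finset.Icc 1 R, ∑ e ∈ Finset.Icc 1 R, ((l d * l e : ℝ) : ℂ) * (E r (d.lcm e) / (d.lcm e : ℕ) * Dw (fun _ => 1) W (α - log (d.lcm e : ℕ)) r))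
    (((∑ d ∈ Finset.Icc 1 R, ∑ e ∈ Finset.Icc 1 R, l d * l e / (d.lcm e : ℕ) : ℝ) : ℂ) * Θ)
  rw [norm_mul, hΘn, Complex.norm_real, Real.norm_eq_abs] at e6
  linarith

theorem prime_dual (ρ : ℝ) (hρ : 0 < ρ) (hρ1 : ρ ≤ 1) : ∃ C c x0, 0 < C ∧ 0 < c ∧ 1 ≤ x0 ∧ ∀ (x α : ℝ) (Q : Finset ℕ) (U : Set ℝ), x0 ≤ x → ρ * x ≤ α →
    Q ⊆ PR α (α + 1) → MeasurableSet U → U ⊆ Set.Icc (-exp x) (exp x) →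
    ∫ t in U, ‖Pp Q t‖ ^ 2 ≤ C / x * (C / x + C * exp (-(c * x)) * (volume U).toReal) := by
  obtain ⟨W, hW, hW0, -, hW1⟩ := exists_W 1 le_rfl
  obtain ⟨C1, hC1, hd⟩ := dual2 hW
  obtain ⟨C2, c, hC2, hc, hc1, hK⟩ := sieve_K hW ⌈4 / ρ⌉₊ (Nat.ceil_pos.2 (by positivity))
  set c' := c * ρ / 2 with hc'
  have hc'0 : 0 < c' := by positivity
  refine ⟨80 / (c * ρ) * C1 + C2 / c' + C2, c', 40 / (c * ρ) + 1, by positivity, hc'0, by linarith [(by positivity : 0 < 40 / (c * ρ))], fun x α Q U hx hα hQ hU hUT => ?_⟩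
  have hx1 : 40 / (c * ρ) < x := by linarith
  have hx40 : 40 < c * ρ * x := by rwa [div_lt_iff₀' (by positivity)] at hx1
  have hx0 : 0 < x := lt_trans (by positivity) hx1
  have hcα : c * ρ * x ≤ c * α := by have := mul_le_mul_of_nonneg_left hα hc.le; linarith
  have hα40 : 40 < α := by
    have : c * α ≤ 1 * α := mul_le_mul_of_nonneg_right hc1 ((mul_pos hρ hx0).le.trans hα)
    linarith
  have hx1' : 1 < x := by
    have h1 : c * ρ ≤ 1 := mul_le_one₀ hc1 hρ.le hρ1
    have := mul_le_mul_of_nonneg_right h1 hx0.le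
    linarith
  set R := ⌊exp (c * α / 20)⌋₊ with hR
  have hRe : (R : ℝ) ≤ exp (c * α / 20) := Nat.floor_le (exp_pos _).le
  have hR1 : 1 ≤ R := Nat.le_floor (by simpa using one_le_exp (by linarith : 0 ≤ c * α / 20))
  have hR0 : (0 : ℝ) < R := by norm_cast
  have hlR : log R ≤ c * α / 20 := (log_le_iff_le_exp hR0).2 hRe
  have hlR2 : c * α / 20 ≤ log (R + 1) := by
    rw [le_log_iff_exp_le (by positivity)]
    exact (Nat.lt_floor_add_one _).le
  obtain ⟨l, hl1, hl, hs0, hs⟩ := sieve_wts R hR1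
  set A := ∑ d ∈ Finset.Icc 1 R, ∑ e ∈ Finset.Icc 1 R, l d * l e / (d.lcm e : ℕ)
  have hA : A ≤ 80 / (c * ρ) / x := by
    refine hs.trans ?_
    rw [div_div, div_le_div_iff₀ (by linarith) (by positivity)]
    linarith
  have hQS : ∀ p ∈ Q, p ∈ Wn (1 + 1) α := fun p hp => by
    have := mem_PR.1 (hQ hp)
    exact mem_Wn.2 ⟨this.1.one_lt.le, by rw [abs_le]; constructor <;> linarith⟩
  have key := hd (Wn (1 + 1) α) (fun n => (∑ d ∈ Finset.Icc 1 R, if d ∣ n then l d else 0) ^ 2 * (W (log n - α) / n)) (fun n => if n ∈ Q then 1 / (n : ℂ) else 0)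
    (exp x) A (C2 * exp (-(c * α / 2))) U (fun n hn => by
      split_ifs with hnQ
      · have hp := mem_PR.1 (hQ hnQ)
        have h1 : ∑ d ∈ Finset.Icc 1 R, (if d ∣ n then l d else 0) = 1 := by
          rw [Finset.sum_eq_single 1, if_pos (one_dvd _), hl1]
          · intro d hd hd1
            rw [if_neg]
            intro hdn
            rcases (Nat.dvd_prime hp.1).1 hdn with h | h
            · exact hd1 h
            · have h2 : (n : ℝ) ≤ R := by rw [← h]; exact_mod_cast (Finset.mem_Icc.1 hd).2
              have h3 := log_le_log (by exact_mod_cast hp.1.pos) h2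
              have : c * α ≤ 1 * α := mul_le_mul_of_nonneg_right hc1 (by linarith)
              linarith
          · intro h; exact absurd (Finset.mem_Icc.2 ⟨le_rfl, hR1⟩) h
        rw [h1, hW1 _ (by rw [abs_le]; constructor <;> linarith)]
        simp
      · rw [norm_zero]; have := hW0 (log n - α); positivity)
    (exp_pos _).le hs0 (by positivity) hU hUT (fun r hr => by
      have := hK α R l r (by linarith) hR1 hlR (hr.trans (by
        have : (2 : ℝ) ≤ exp 1 := by linarith [add_one_le_exp (1 : ℝ)]
        refine (mul_le_mul_of_nonneg_right this (exp_pos _).le).trans ?_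
        rw [← exp_add, exp_le_exp]
        have h1 : 4 / ρ * (9 / 10 * (ρ * x)) ≤ ⌈4 / ρ⌉₊ * (9 / 10 * α) := mul_le_mul (Nat.le_ceil _) (by linarith) (by positivity) (by positivity)
        have h2 : 4 / ρ * (9 / 10 * (ρ * x)) = 36 / 10 * x := by field_simp; norm_num
        linarith)) hl
      rwa [abs_of_nonneg hs0] at this)
  have e1 : ∀ t, ∑ n ∈ Wn (1 + 1) α, (if n ∈ Q then 1 / (n : ℂ) else 0) * E t n = Pp Q t := by
    intro t
    rw [Pp, ← Finset.sum_subset hQS (fun n _ hn => by rw [if_neg hn, zero_mul])]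
    exact Finset.sum_congr rfl fun n hn => by rw [if_pos hn]; ring
  simp only [e1] at key
  refine key.trans ?_
  set V := (volume U).toReal
  have hV : 0 ≤ V := ENNReal.toReal_nonneg
  have f1 : exp (-(c * α / 2)) ≤ exp (-(c' * x)) := exp_le_exp.2 (by rw [hc']; linarith)
  have f2 : exp (-(c' * x)) ≤ 1 / c' / x := by
    rw [exp_neg, div_div, ← one_div]
    exact one_div_le_one_div_of_le (by positivity) (by linarith [add_one_le_exp (c' * x)])
  set D := 80 / (c * ρ) * C1 + C2 / c' + C2 with hD
  have hAC : A * C1 ≤ 80 / (c * ρ) * C1 / x := by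
    have := mul_le_mul_of_nonneg_right hA hC1.le
    rwa [div_mul_eq_mul_div] at this
  have f3 : C2 * exp (-(c * α / 2)) ≤ C2 / c' / x := by
    refine (mul_le_mul_of_nonneg_left (f1.trans f2) hC2.le).trans (le_of_eq ?_)
    rw [div_div, div_div, mul_one_div]
  have g0 : 0 ≤ C2 / x := by positivity
  have g1 : A * C1 + C2 * exp (-(c * α / 2)) ≤ D / x := by
    rw [hD, add_div, add_div]; linarith
  have g2 : A * C1 ≤ D / x := by
    rw [hD, add_div, add_div]
    have : 0 ≤ C2 / c' / x := by positivity
    linarith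
  have g3 : C2 * exp (-(c * α / 2)) * V ≤ D * exp (-(c' * x)) * V := by
    refine mul_le_mul_of_nonneg_right (mul_le_mul ?_ f1 (exp_pos _).le (by positivity)) hV
    have : 0 ≤ 80 / (c * ρ) * C1 + C2 / c' := by positivity
    linarith
  exact mul_le_mul g1 (add_le_add g2 g3) (by positivity) (by positivity)
end MR
namespace MR
open Real MeasureTheory

theorem Iv {w : ℝ → ℝ} {B : ℝ} (h : Bump w B) (ρ e : ℝ) (hρ : 0 < ρ) (hρ1 : ρ ≤ 1) (he : 0 < e) : ∃ a x0, 0 < a ∧ a ≤ 1 ∧ ∀ (x α : ℝ) (Q : Finset ℕ) (U : Set ℝ),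
    x0 ≤ x → ρ * x ≤ α → α ≤ x / 4 → Q ⊆ PR α (α + 1) → MeasurableSet U → U ⊆ Set.Icc (-exp x) (exp x) → (volume U).toReal ≤ exp (3 * a * x) →
    ∫ t in U, ‖Pp Q t‖ ^ 2 * ‖Dw Mu w (x - α) t‖ ^ 2 ≤ e / x ^ 2 := by
  obtain ⟨C1, c1, hC1, hc1, h1⟩ := R_dual h
  obtain ⟨C2, c2, y0, hC2, hc2, -, h2⟩ := prime_dual ρ hρ hρ1
  set δ := √(e / (4 * C1)) with hδ
  have hδ0 : 0 < δ := by positivity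
  have hδ2 : δ ^ 2 = e / (4 * C1) := sq_sqrt (by positivity)
  set D := 2 * C2 ^ 2 / δ ^ 2 with hD
  have hD0 : 0 < D := by positivity
  set η := √(e * ρ ^ 2 / (32 * D)) with hη
  have hη0 : 0 < η := by positivity
  have hη2 : η ^ 2 = e * ρ ^ 2 / (32 * D) := sq_sqrt (by positivity)
  obtain ⟨u0, hu0, h3⟩ := Mu_ptwise h 2 η (by norm_num) hη0
  have hev : ∀ᶠ x : ℝ in atTop, C2 ^ 2 * x * exp (-(c2 * x)) ≤ δ ^ 2 / 2 := by
    have h1 := ((tendsto_pow_mul_exp_neg_atTop_nhds_zero 1).comp (tendsto_id.const_mul_atTop hc2)).const_mul (C2 ^ 2 / c2)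
    rw [mul_zero] at h1
    filter_upwards [h1.eventually_le_const (by positivity : 0 < δ ^ 2 / 2)] with x hx
    refine le_trans (le_of_eq ?_) hx
    simp only [Function.comp, id, pow_one]
    field_simp
  obtain ⟨x1, hx1⟩ := eventually_atTop.1 hev
  refine ⟨min 1 (c1 / 3), max (max y0 x1) (max 2 (2 * u0)), by positivity, min_le_left _ _, fun x α Q U hx hα hα4 hQ hU hUT hvol => ?_⟩
  have hy0 : y0 ≤ x := ((le_max_left _ _).trans (le_max_left _ _)).trans hx
  have hx1' : x1 ≤ x := ((le_max_right _ _).trans (le_max_left _ _)).trans hx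
  have hx2 : 2 ≤ x := ((le_max_left _ _).trans (le_max_right _ _)).trans hx
  have hxu : 2 * u0 ≤ x := ((le_max_right _ _).trans (le_max_right _ _)).trans hx
  have hx0 : 0 < x := by linarith
  have hα0 : 0 < α := lt_of_lt_of_le (by positivity) hα
  have hcR : Continuous fun t => ‖Dw Mu w (x - α) t‖ ^ 2 := (Dw_contt h Mu _).norm.pow 2
  have hcQ : Continuous fun t => ‖Pp Q t‖ ^ 2 := (Pp_cont Q).norm.pow 2
  have hcP : Continuous fun t => ‖Pp Q t‖ ^ 2 * ‖Dw Mu w (x - α) t‖ ^ 2 := hcQ.mul hcR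
  set V := U ∩ {t | δ / x < ‖Pp Q t‖} with hV
  have hVm : MeasurableSet V := hU.inter (measurableSet_lt measurable_const (Pp_cont Q).norm.measurable)
  have hVU : V ⊆ U := Set.inter_subset_left
  have hfin : ∀ {A : Set ℝ}, A ⊆ U → volume A ≠ ⊤ := fun hA => ((measure_mono (hA.trans hUT)).trans_lt measure_Icc_lt_top).ne
  set v := (volume V).toReal with hv
  have hv0 : 0 ≤ v := ENNReal.toReal_nonneg
  have hvD : v ≤ D := by
    have a1 := h2 x α Q V hy0 hα hQ hVm (hVU.trans hUT)
    have a2 : (δ / x) ^ 2 * v ≤ ∫ t in V, ‖Pp Q t‖ ^ 2 := by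
      have : ∫ t in V, (δ / x) ^ 2 = (δ / x) ^ 2 * v := by rw [setIntegral_const, smul_eq_mul, measureReal_def, mul_comm]
      rw [← this]
      exact setIntegral_mono_on (integrableOn_const (hfin hVU)) (hcQ.integrableOn_Icc.mono_set (hVU.trans hUT)) hVm fun t ht => pow_le_pow_left₀ (by positivity) (le_of_lt ht.2) 2
    have a3 := mul_le_mul_of_nonneg_right (a2.trans a1) (sq_nonneg x)
    have a4 : (δ / x) ^ 2 * v * x ^ 2 = δ ^ 2 * v := by field_simp
    have a5 : C2 / x * (C2 / x + C2 * exp (-(c2 * x)) * v) * x ^ 2 = C2 ^ 2 + C2 ^ 2 * x * exp (-(c2 * x)) * v := by field_simp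
    have a6 := mul_le_mul_of_nonneg_right (hx1 x hx1') hv0
    rw [hD, le_div_iff₀ (by positivity)]
    linarith
  have s1 : ∫ t in V, ‖Pp Q t‖ ^ 2 * ‖Dw Mu w (x - α) t‖ ^ 2 ≤ e / x ^ 2 / 2 := by
    have b1 : ∀ t ∈ V, ‖Pp Q t‖ ^ 2 * ‖Dw Mu w (x - α) t‖ ^ 2 ≤ (4 / (ρ * x)) ^ 2 * η ^ 2 := by
      intro t ht
      have c1 : ‖Pp Q t‖ ≤ 4 / (ρ * x) := by
        rw [Pp]
        refine (norm_sum_le _ _).trans ?_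
        have : ∑ p ∈ Q, ‖E t p / p‖ ≤ ∑ p ∈ PR α (α + 1), (1 / p : ℝ) := by
          refine le_trans (le_of_eq ?_) (Finset.sum_le_sum_of_subset_of_nonneg hQ fun p _ _ => by positivity)
          exact Finset.sum_congr rfl fun p _ => by simp
        exact (this.trans (prime_upper hα0)).trans (div_le_div_of_nonneg_left (by norm_num) (by positivity) hα)
      have c2 : ‖Dw Mu w (x - α) t‖ ≤ η := by
        refine h3 _ (by linarith) t ?_
        have := hUT ht.1
        refine (abs_le.2 this).trans (exp_le_exp.2 (by linarith))
      exact mul_le_mul (pow_le_pow_left₀ (norm_nonneg _) c1 2) (pow_le_pow_left₀ (norm_nonneg _) c2 2) (by positivity) (by positivity)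
    refine (setIntegral_mono_on (hcP.integrableOn_Icc.mono_set (hVU.trans hUT)) (integrableOn_const (hfin hVU)) hVm b1).trans ?_
    rw [setIntegral_const, smul_eq_mul, measureReal_def]
    refine (mul_le_mul_of_nonneg_right hvD (by positivity)).trans (le_of_eq ?_)
    rw [hη2]
    field_simp
    norm_num
  have s2 : ∫ t in U \ V, ‖Pp Q t‖ ^ 2 * ‖Dw Mu w (x - α) t‖ ^ 2 ≤ e / x ^ 2 / 2 := by
    have b1 : ∀ t ∈ U \ V, ‖Pp Q t‖ ^ 2 * ‖Dw Mu w (x - α) t‖ ^ 2 ≤ (δ / x) ^ 2 * ‖Dw Mu w (x - α) t‖ ^ 2 := by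
      intro t ht
      have : ‖Pp Q t‖ ≤ δ / x := by
        by_contra! hlt
        exact ht.2 ⟨ht.1, hlt⟩
      exact mul_le_mul_of_nonneg_right (pow_le_pow_left₀ (norm_nonneg _) this 2) (by positivity)
    have hd : U \ V ⊆ U := Set.diff_subset
    refine (setIntegral_mono_on (hcP.integrableOn_Icc.mono_set (hd.trans hUT)) ((hcR.integrableOn_Icc.mono_set (hd.trans hUT)).const_mul _) (hU.diff hVm) b1).trans ?_
    rw [integral_const_mul]
    have b2 := (setIntegral_mono_set (hcR.integrableOn_Icc.mono_set hUT) (Eventually.of_forall fun t => by positivity) (HasSubset.Subset.eventuallyLE hd)).trans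
      (h1 x (x - α) U hx2 (by linarith) hU hUT)
    have b3 : exp (-(c1 * x)) * (volume U).toReal ≤ 1 := by
      refine (mul_le_mul_of_nonneg_left hvol (exp_pos _).le).trans ?_
      rw [← exp_add, exp_le_one_iff]
      have := mul_le_mul_of_nonneg_right (min_le_right 1 (c1 / 3)) hx0.le
      linarith
    have b4 := b2.trans (mul_le_mul_of_nonneg_left (add_le_add_right b3 1) hC1.le)
    refine (mul_le_mul_of_nonneg_left b4 (by positivity)).trans (le_of_eq ?_)
    rw [div_pow, hδ2]
    field_simp
    norm_num
  have s3 := setIntegral_union Set.disjoint_sdiff_right (hU.diff hVm) (hcP.integrableOn_Icc.mono_set (μ := volume) (hVU.trans hUT)) (hcP.integrableOn_Icc.mono_set (Set.diff_subset.trans hUT))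
  rw [Set.union_diff_cancel hVU] at s3
  rw [s3]
  linarith

theorem Ustep {w : ℝ → ℝ} {B : ℝ} (h : Bump w B) (ε : ℝ) (hε : 0 < ε) : ∃ a x0, 0 < a ∧ a ≤ 1 ∧ ∀ (x : ℝ) (U : Set ℝ), x0 ≤ x → MeasurableSet U →
    U ⊆ Set.Icc (-exp x) (exp x) → (volume U).toReal ≤ exp (3 * a * x) → ∫ t in U, ‖Dw Mu w x t‖ ^ 2 ≤ ε := by
  obtain ⟨C, hC, hTK⟩ := TKset h
  set k := 6 * C / ε + 1 with hk
  have hk1 : 1 ≤ k := by rw [hk]; linarith [(by positivity : 0 < 6 * C / ε)]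
  have hk0 : 0 < k := by linarith
  have hCk : C / k ≤ ε / 6 := by
    rw [div_le_iff₀ hk0, hk]
    have : ε / 6 * (6 * C / ε + 1) = C + ε / 6 := by field_simp
    linarith
  set ρ := exp (-(63 * k + 2)) / 4 with hρ
  have hρ0 : 0 < ρ := by positivity
  have hρ4 : ρ ≤ 1 / 4 := by
    have : exp (-(63 * k + 2)) ≤ 1 := exp_le_one_iff.2 (by linarith)
    linarith
  obtain ⟨a, x1, ha, ha1, hI⟩ := Iv h (ρ / 2) (ε / k ^ 2) (by positivity) (by linarith) (by positivity)
  refine ⟨a, max (max x1 (k / ρ)) (max (21 / ρ) (6 * C / ε)), ha, ha1, fun x U hx hU hUT hvol => ?_⟩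
  have hx1 : x1 ≤ x := ((le_max_left _ _).trans (le_max_left _ _)).trans hx
  have hxk : k ≤ ρ * x := by
    have := ((le_max_right _ _).trans (le_max_left _ _)).trans hx
    rwa [div_le_iff₀' hρ0] at this
  have hx21 : 21 ≤ ρ * x := by
    have := ((le_max_left _ _).trans (le_max_right _ _)).trans hx
    rwa [div_le_iff₀' hρ0] at this
  have hxC : 6 * C / ε ≤ x := ((le_max_right _ _).trans (le_max_right _ _)).trans hx
  have hx0 : 0 < x := lt_of_lt_of_le (by positivity) hxC
  have hρx : ρ * x ≤ x / 4 := by have := mul_le_mul_of_nonneg_right hρ4 hx0.le; linarith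
  have hL : k ≤ ∑ p ∈ PR (ρ * x) (x / 4), (1 / p : ℝ) := by
    refine le_trans ?_ (prime_lower hx21 hρx)
    have : x / 4 / (ρ * x) = exp (63 * k + 2) := by
      rw [hρ, exp_neg]; field_simp
    rw [this, log_exp]; linarith
  have key := hTK (ρ * x) (x / 4) k x (exp x) U hk1 (by linarith) (by linarith [add_one_le_exp (ρ * x)]) (hk1.trans hL) (one_le_exp hx0.le) le_rfl hU hUT
  refine key.trans ?_
  have t1 : C * (1 / (∑ p ∈ PR (ρ * x) (x / 4), (1 / p : ℝ)) + 1 / k ^ 2 + exp (x / 4 - x)) ≤ ε / 2 := by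
    have u1 : C * (1 / (∑ p ∈ PR (ρ * x) (x / 4), (1 / p : ℝ))) ≤ ε / 6 := by
      rw [mul_one_div]; exact (div_le_div_of_nonneg_left hC.le hk0 hL).trans hCk
    have u2 : C * (1 / k ^ 2) ≤ ε / 6 := by
      rw [mul_one_div]; exact (div_le_div_of_nonneg_left hC.le hk0 (le_self_pow₀ hk1 (by norm_num))).trans hCk
    have u3 : C * exp (x / 4 - x) ≤ ε / 6 := by
      have e1 : exp (x / 4 - x) ≤ 1 / k := by
        rw [show x / 4 - x = -(3 / 4 * x) by ring, exp_neg, ← one_div]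
        exact one_div_le_one_div_of_le hk0 (by linarith [add_one_le_exp (3 / 4 * x)])
      exact (mul_le_mul_of_nonneg_left e1 hC.le).trans (by rwa [mul_one_div])
    linarith
  have t2 : 2 * ((Vx (PR (ρ * x) (x / 4)) k).card : ℝ) * ∑ v ∈ Vx (PR (ρ * x) (x / 4)) k, ∫ t in U, ‖Pp (Cl (PR (ρ * x) (x / 4)) k v) t‖ ^ 2 * ‖Dw Mu w (x - v / k) t‖ ^ 2 ≤ ε / 2 := by
    have u1 := Finset.sum_le_card_nsmul (Vx (PR (ρ * x) (x / 4)) k) (fun v : ℕ => ∫ t in U, ‖Pp (Cl (PR (ρ * x) (x / 4)) k v) t‖ ^ 2 * ‖Dw Mu w (x - v / k) t‖ ^ 2) (ε / k ^ 2 / x ^ 2) (fun v hv => by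
      obtain ⟨r1, r2, r3⟩ := Vx_mem hk1 (by linarith) hv
      exact hI x (v / k) _ U hx1 (by linarith) r2 r3 hU hUT hvol)
    rw [nsmul_eq_mul] at u1
    have u2 := Vx_card (a := ρ * x) (b := x / 4) hk1 (by linarith) (by linarith)
    set N : ℝ := ((Vx (PR (ρ * x) (x / 4)) k).card : ℝ)
    have hN : 0 ≤ N := Nat.cast_nonneg _
    refine (mul_le_mul_of_nonneg_left u1 (by positivity)).trans ?_
    have u3 : N ^ 2 ≤ (2 * (k * (x / 4))) ^ 2 := pow_le_pow_left₀ hN u2 2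
    calc _ = 2 * N ^ 2 * (ε / k ^ 2 / x ^ 2) := by ring
      _ ≤ 2 * (2 * (k * (x / 4))) ^ 2 * (ε / k ^ 2 / x ^ 2) := by gcongr
      _ = ε / 2 := by field_simp; norm_num
  linarith

theorem main_int {w : ℝ → ℝ} {B : ℝ} (h : Bump w B) (ε : ℝ) (hε : 0 < ε) : ∃ H x0 : ℝ, 0 ≤ H ∧ ∀ x, x0 ≤ x →
    ∫ t in Set.Icc (-exp (x - H)) (exp (x - H)), ‖Dw Mu w x t‖ ^ 2 ≤ ε := by
  obtain ⟨C, hC, hg⟩ := good_all h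
  obtain ⟨a, x1, ha, ha1, hU⟩ := Ustep h (ε / 2) (by positivity)
  obtain ⟨m0, hm0, hg⟩ := hg a ha ha1
  obtain ⟨x2, hx2, hb⟩ := bad_meas a ha ha1
  set m := max m0 (exp (2 * C / ε)) with hm
  have hm129 : 129 ≤ m := by linarith [add_one_le_exp (128 : ℝ), le_max_left m0 (exp (2 * C / ε))]
  have hlm : C / log m ≤ ε / 2 := by
    have h1 : 2 * C / ε ≤ log m := (le_log_iff_exp_le (by linarith)).2 (le_max_right _ _)
    have h2 : 0 < log m := lt_of_lt_of_le (by positivity) h1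
    rw [div_le_iff₀ h2]
    rw [div_le_iff₀ hε] at h1
    linarith
  have hev : ∀ᶠ x : ℝ in atTop, (16 / a * log x) ^ 6 ≤ a * x / 8 := by
    have h1 := (isLittleO_pow_log_id_atTop (n := 6)).bound (by positivity : 0 < a / 8 / (16 / a) ^ 6)
    filter_upwards [h1, eventually_ge_atTop 1] with x hx hx1
    simp only [id, norm_pow, Real.norm_eq_abs, abs_of_nonneg (log_nonneg hx1), abs_of_nonneg (zero_le_one.trans hx1)] at hx
    rw [mul_pow]
    refine (mul_le_mul_of_nonneg_left hx (by positivity)).trans (le_of_eq ?_)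
    field_simp
  obtain ⟨x3, hx3⟩ := eventually_atTop.1 hev
  refine ⟨m ^ 2, max (max x1 x2) (max x3 (m ^ 2 * 8 / a)), by positivity, fun x hx => ?_⟩
  have k1 : x1 ≤ x := ((le_max_left _ _).trans (le_max_left _ _)).trans hx
  have k2 : x2 ≤ x := ((le_max_right _ _).trans (le_max_left _ _)).trans hx
  have k3 : x3 ≤ x := ((le_max_left _ _).trans (le_max_right _ _)).trans hx
  have k4 : m ^ 2 ≤ a * x / 8 := by
    have := ((le_max_right _ _).trans (le_max_right _ _)).trans hx
    rw [div_le_iff₀ ha] at this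
    linarith
  have hx1 : 1 ≤ x := hx2.trans k2
  have hax : a * x ≤ x := by simpa using mul_le_mul_of_nonneg_right ha1 (by linarith : 0 ≤ x)
  have hex : ∃ J : ℕ, 16 / a * log x ≤ m ^ 3 ^ J := by
    obtain ⟨n, hn⟩ := pow_unbounded_of_one_lt (16 / a * log x) (by linarith : 1 < m)
    exact ⟨n, hn.le.trans (pow_le_pow_right₀ (by linarith) (Nat.lt_pow_self (by norm_num)).le)⟩
  classical
  set J := Nat.find hex with hJ
  have hJ1 : 16 / a * log x ≤ m ^ 3 ^ J := Nat.find_spec hex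
  have hJ2 : (m ^ 3 ^ J) ^ 2 ≤ a * x / 8 := by
    rcases Nat.eq_zero_or_pos J with h0 | h0
    · rw [h0]; simpa using k4
    · obtain ⟨j, hj⟩ : ∃ j, J = j + 1 := ⟨J - 1, by omega⟩
      have : ¬ 16 / a * log x ≤ m ^ 3 ^ j := Nat.find_min hex (by omega)
      have h1 : m ^ 3 ^ J = (m ^ 3 ^ j) ^ 3 := by rw [hj, pow_succ, pow_mul]
      rw [h1, ← pow_mul]
      exact (pow_le_pow_left₀ (by positivity) (not_le.1 this).le 6).trans (hx3 x k3)
  set T := exp (x - m ^ 2) with hT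
  have hT1 : 1 ≤ T := one_le_exp (by linarith)
  have hTx : T ≤ exp x := exp_le_exp.2 (by linarith [sq_nonneg m])
  set A := Set.Icc (-T) T ∩ {t | ∃ j ≤ J, Good a (m ^ 3 ^ j) t} with hA
  have hAm : MeasurableSet A := by
    refine measurableSet_Icc.inter ?_
    have : {t | ∃ j ≤ J, Good a (m ^ 3 ^ j) t} = ⋃ j ∈ Finset.range (J + 1), {t | Good a (m ^ 3 ^ j) t} := by
      ext t; simp [Nat.lt_succ_iff]
    rw [this]
    exact Finset.measurableSet_biUnion _ fun j _ => Good_meas _ _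
  have hAT : A ⊆ Set.Icc (-T) T := Set.inter_subset_left
  have hc : Continuous fun t => ‖Dw Mu w x t‖ ^ 2 := (Dw_contt h Mu x).norm.pow 2
  have s1 := hg m x T J (le_max_left _ _) (by linarith) hT1 le_rfl
  have hm25 : (25 : ℝ) ≤ m ^ 3 ^ J := by
    have : m ≤ m ^ 3 ^ J := le_self_pow₀ (by linarith) (by positivity)
    linarith
  have hsub : Set.Icc (-T) T \ A ⊆ Set.Icc (-exp x) (exp x) ∩ {t | ¬ Good a (m ^ 3 ^ J) t} := by
    rintro t ⟨ht, hn⟩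
    exact ⟨⟨by linarith [ht.1], ht.2.trans hTx⟩, fun hgd => hn ⟨ht, J, le_rfl, hgd⟩⟩
  have s2 := hU x (Set.Icc (-T) T \ A) k1 (measurableSet_Icc.diff hAm) (hsub.trans Set.inter_subset_left)
    ((ENNReal.toReal_mono ((measure_mono Set.inter_subset_left).trans_lt measure_Icc_lt_top).ne (measure_mono hsub)).trans (hb x _ k2 hJ1 hm25 hJ2))
  have s3 := setIntegral_union Set.disjoint_sdiff_right (measurableSet_Icc.diff hAm) (hc.integrableOn_Icc.mono_set (μ := volume) hAT) (hc.integrableOn_Icc.mono_set (Set.diff_subset : Set.Icc (-T) T \ A ⊆ Set.Icc (-T) T))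
  rw [Set.union_diff_cancel hAT] at s3
  rw [s3]
  change ∫ t in A, ‖Dw Mu w x t‖ ^ 2 ≤ C / log m at s1
  linarith
end MR
namespace MR
open Real MeasureTheory

theorem DwInt {w φ : ℝ → ℝ} {B B' : ℝ} (h : Bump w B) (hφ : Bump φ B') (x : ℝ) {T : ℝ} (hT : 0 < T) :
    Integrable fun t => ‖Dw Mu w x t‖ ^ 2 * ‖wh φ (t / T)‖ ^ 2 := by
  obtain ⟨C, hC, hD⟩ := Dw_triv h
  obtain ⟨C0, hC0, h0⟩ := hφ.decay 0
  have hc : Continuous fun t => wh φ (t / T) := hφ.wh_cont.comp (by fun_prop)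
  have hc1 : Continuous fun t => ‖Dw Mu w x t‖ ^ 2 * ‖wh φ (t / T)‖ ^ 2 :=
    ((Dw_contt h Mu x).norm.pow 2).mul (hc.norm.pow 2)
  refine ((hφ.wh_int.comp_div hT.ne').norm.const_mul (C ^ 2 * C0)).mono' hc1.aestronglyMeasurable (Eventually.of_forall fun t => ?_)
  have h1 := hD Mu Mu_le x t
  have h2 := h0 (t / T)
  rw [pow_zero, one_mul] at h2
  rw [norm_of_nonneg (by positivity), mul_assoc, sq ‖wh φ (t / T)‖]
  gcongr

theorem full_int {w φ : ℝ → ℝ} {B B' : ℝ} (h : Bump w B) (hφ : Bump φ B') (ε : ℝ) (hε : 0 < ε) :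
    ∃ H x0 : ℝ, 0 ≤ H ∧ ∀ x, x0 ≤ x →
      ∫ t, ‖Dw Mu w x t‖ ^ 2 * ‖wh φ (t / exp (x - H))‖ ^ 2 ≤ ε := by
  obtain ⟨C0, hC0, h0⟩ := hφ.decay 0
  obtain ⟨Cm, hCm, hm⟩ := mvt_phi hφ.der
  obtain ⟨Cw, hCw, hw⟩ := h.bdd
  set M := Cm * (2 * exp (2 * B) * Cw ^ 2 * exp B) with hM
  have hM0 : 0 < M := by positivity
  obtain ⟨H, x0, hH, hI⟩ := main_int h (ε / (2 * C0 ^ 2)) (by positivity)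
  set R := max 1 (2 * M / ε) with hR
  have hR1 : 1 ≤ R := le_max_left _ _
  have hR2 : M ≤ R * (ε / 2) := by
    have : 2 * M / ε ≤ R := le_max_right _ _
    rw [div_le_iff₀ hε] at this; linarith
  have hlR : 0 ≤ log R := log_nonneg hR1
  refine ⟨H + log R, max x0 (H + log R), by linarith, fun x hx => ?_⟩
  have hx1 := (le_max_left _ _).trans hx
  have hx2 := (le_max_right _ _).trans hx
  set T := exp (x - (H + log R)) with hT
  have hT1 : 1 ≤ T := one_le_exp (by linarith)
  have hT0 : 0 < T := by linarith
  have hRT : exp (x - H) = R * T := by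
    rw [hT, show x - H = log R + (x - (H + log R)) by ring, exp_add, exp_log (by linarith)]
  have hTx : T ≤ exp x := exp_le_exp.2 (by linarith)
  have hi := hI x hx1
  rw [hRT] at hi
  have hc : Continuous fun t => ‖Dw Mu w x t‖ ^ 2 := (Dw_contt h Mu x).norm.pow 2
  have i1 : Integrable (Set.indicator (Set.Icc (-(R * T)) (R * T)) fun t => ‖Dw Mu w x t‖ ^ 2) :=
    (integrable_indicator_iff measurableSet_Icc).2 hc.integrableOn_Icc
  have i2 := DwInt h hφ.der x hT0
  have hmv : ∫ t, ‖Dw Mu w x t‖ ^ 2 * ‖wh (deriv φ) (t / T)‖ ^ 2 ≤ M := by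
    have := hm T hT1 (Wn B x) (fun n => Mu n * ((w (log n - x) / n : ℝ) : ℂ)) (fun n hn => (mem_Wn.1 hn).1)
    simp_rw [← Dw_eq h Mu x _ (Wn B x) subset_rfl] at this
    refine this.trans (mul_le_mul_of_nonneg_left ?_ hCm.le)
    calc _ ≤ ∑ n ∈ Wn B x, (2 * Cw ^ 2 * exp B) * (1 / n : ℝ) := Finset.sum_le_sum fun n hn => by
          have hn1 : (1 : ℝ) ≤ n := by exact_mod_cast (mem_Wn.1 hn).1
          have hB := h.hB
          have e1 := Wn_lower hn
          have e2 : T ≤ n * exp B := by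
            calc T ≤ exp x := hTx
              _ = exp (x - B) * exp B := by rw [← exp_add]; ring_nf
              _ ≤ _ := by gcongr
          have e3 : (n : ℝ) ≤ n * exp B := le_mul_of_one_le_right (by linarith) (one_le_exp (by linarith))
          have e4 : ‖Mu n * ((w (log n - x) / n : ℝ) : ℂ)‖ ≤ Cw / n := by
            rw [norm_mul, Complex.norm_real, norm_eq_abs, abs_div, Nat.abs_cast]
            calc _ ≤ 1 * (Cw / n) := by gcongr; exacts [Mu_le n, hw _]
              _ = _ := one_mul _
          calc _ ≤ (2 * (n * exp B)) * (Cw / n) ^ 2 := by gcongr; linarith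
            _ = _ := by field_simp
      _ = (2 * Cw ^ 2 * exp B) * ∑ n ∈ Wn B x, (1 / n : ℝ) := by rw [Finset.mul_sum]
      _ ≤ (2 * Cw ^ 2 * exp B) * exp (2 * B) := by gcongr; exact Wn_sum B x
      _ = _ := by ring
  calc _ ≤ ∫ t, (C0 ^ 2 * Set.indicator (Set.Icc (-(R * T)) (R * T)) (fun t => ‖Dw Mu w x t‖ ^ 2) t +
        1 / R * (‖Dw Mu w x t‖ ^ 2 * ‖wh (deriv φ) (t / T)‖ ^ 2)) := by
        refine integral_mono_of_nonneg (Eventually.of_forall fun t => by positivity) ((i1.const_mul _).add (i2.const_mul _)) (Eventually.of_forall fun t => ?_)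
        dsimp only
        by_cases ht : t ∈ Set.Icc (-(R * T)) (R * T)
        · rw [Set.indicator_of_mem ht]
          have h2 := h0 (t / T)
          rw [pow_zero, one_mul] at h2
          have : ‖Dw Mu w x t‖ ^ 2 * ‖wh φ (t / T)‖ ^ 2 ≤ C0 ^ 2 * ‖Dw Mu w x t‖ ^ 2 := by
            rw [mul_comm]; gcongr
          have h3 : 0 ≤ 1 / R * (‖Dw Mu w x t‖ ^ 2 * ‖wh (deriv φ) (t / T)‖ ^ 2) := by positivity
          linarith
        · rw [Set.indicator_of_notMem ht, mul_zero, zero_add, hφ.wh_der]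
          have h3 : R ≤ |t / T| := by
            rw [abs_div, abs_of_pos hT0, le_div_iff₀ hT0]
            by_contra hh
            push Not at hh
            exact ht ⟨by linarith [neg_abs_le t], by linarith [le_abs_self t]⟩
          have h4 : R ≤ |t / T| ^ 2 := by
            rw [sq]; exact h3.trans (le_mul_of_one_le_right (by positivity) (hR1.trans h3))
          rw [mul_pow, show 1 / R * (‖Dw Mu w x t‖ ^ 2 * (|t / T| ^ 2 * ‖wh φ (t / T)‖ ^ 2)) = (|t / T| ^ 2 / R) * (‖Dw Mu w x t‖ ^ 2 * ‖wh φ (t / T)‖ ^ 2) by ring]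
          exact le_mul_of_one_le_left (by positivity) ((one_le_div (by linarith)).2 h4)
    _ = C0 ^ 2 * (∫ t in Set.Icc (-(R * T)) (R * T), ‖Dw Mu w x t‖ ^ 2) + 1 / R * ∫ t, ‖Dw Mu w x t‖ ^ 2 * ‖wh (deriv φ) (t / T)‖ ^ 2 := by
        rw [integral_add (i1.const_mul _) (i2.const_mul _), integral_const_mul, integral_const_mul, integral_indicator measurableSet_Icc]
    _ ≤ C0 ^ 2 * (ε / (2 * C0 ^ 2)) + 1 / R * (R * (ε / 2)) := by
        have := hmv.trans hR2
        gcongr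
    _ = ε := by
        have : R ≠ 0 := by linarith
        field_simp; ring
end MR
namespace MR
open Real MeasureTheory

theorem Bump.expm {W : ℝ → ℝ} {B : ℝ} (h : Bump W B) : Bump (fun v => exp v * W v) B :=
  ⟨Real.contDiff_exp.mul h.sm, fun y hy => by rw [h.supp y hy, mul_zero], h.hB⟩

noncomputable def Fs (w φ : ℝ → ℝ) (x T v : ℝ) : ℂ :=
  ∑' n : ℕ, Mu n * ((w (log n - x) / n : ℝ) : ℂ) * (φ (v - T * log n) : ℂ)

theorem coef_zero {w : ℝ → ℝ} {B : ℝ} (h : Bump w B) (x : ℝ) {n : ℕ} (hn : n ∉ Wn B x) :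
    Mu n * ((w (log n - x) / n : ℝ) : ℂ) = 0 := by
  rcases Nat.eq_zero_or_pos n with rfl | h0
  · simp
  · rw [mem_Wn, not_and, not_le] at hn
    rw [h.supp _ (hn h0)]; simp

theorem Fs_eq {w φ : ℝ → ℝ} {B : ℝ} (h : Bump w B) (x T v : ℝ) :
    Fs w φ x T v = ∑ n ∈ Wn B x, Mu n * ((w (log n - x) / n : ℝ) : ℂ) * (φ (v - T * log n) : ℂ) := by
  rw [Fs, tsum_eq_sum]
  intro n hn
  rw [coef_zero h x hn, zero_mul]

theorem Fs_L2 {w φ : ℝ → ℝ} {B B' : ℝ} (h : Bump w B) (hφ : Bump φ B') (x : ℝ) {T : ℝ} (hT : 0 < T) :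
    Continuous (Fs w φ x T) ∧ Integrable (fun v => ‖Fs w φ x T v‖ ^ 2) ∧
    ∫ v, ‖Fs w φ x T v‖ ^ 2 ≤ 1 / T * ∫ t, ‖Dw Mu w x t‖ ^ 2 * ‖wh φ (t / T)‖ ^ 2 := by
  have hs : Summable fun n : ℕ => ‖Mu n * ((w (log n - x) / n : ℝ) : ℂ)‖ :=
    summable_of_ne_finset_zero (s := Wn B x) fun n hn => by rw [coef_zero h x hn, norm_zero]
  obtain ⟨h1, -, -, -, h2⟩ := dp_aux hφ _ hs (fun n => T * log n)
  refine ⟨h1, h2, ?_⟩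
  have h3 := dp hφ _ hs (fun n => T * log n)
  have h4 : ∀ t : ℝ, ‖∑' n : ℕ, Mu n * ((w (log n - x) / n : ℝ) : ℂ) * Complex.exp (-(t * (T * log n) : ℝ) * Complex.I)‖ ^ 2 * ‖wh φ t‖ ^ 2
      = (fun s => ‖Dw Mu w x s‖ ^ 2 * ‖wh φ (s / T)‖ ^ 2) (t * T) := fun t => by
    dsimp only
    rw [mul_div_cancel_right₀ _ hT.ne', Dw]
    simp_rw [E, mul_assoc]
  rw [integral_congr_ae (Eventually.of_forall h4), Measure.integral_comp_mul_right (fun s => ‖Dw Mu w x s‖ ^ 2 * ‖wh φ (s / T)‖ ^ 2) T, abs_of_pos (inv_pos.2 hT), smul_eq_mul, inv_eq_one_div] at h3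
  rw [← h3]
  exact le_mul_of_one_le_left (integral_nonneg fun v => by positivity) (by linarith [pi_gt_three])

theorem near_card {S : Finset ℕ} (hS : ∀ n ∈ S, 1 ≤ n) {a N : ℕ} (ha : 1 ≤ a) (haN : a ≤ N) {T : ℝ} (hT : 1 ≤ T) :
    ((S.filter fun n : ℕ => |T * log n - T * log a| ≤ 1).card : ℝ) ≤ 4 * (N / T) + 1 := by
  have ha0 : (0 : ℝ) < a := by exact_mod_cast ha
  have haN' : (a : ℝ) ≤ N := by exact_mod_cast haN
  have hT0 : 0 < T := by linarith
  refine (card_near _ a (2 * (N / T)) (by positivity) fun n hn => ?_).trans (by linarith)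
  obtain ⟨hnS, hn⟩ := Finset.mem_filter.1 hn
  have hn0 : (0 : ℝ) < n := by exact_mod_cast hS n hnS
  rw [← mul_sub, abs_mul, abs_of_pos hT0] at hn
  have h1 : |log n - log a| ≤ 1 / T := by rw [le_div_iff₀ hT0]; linarith
  have h2 : 1 / T ≤ 1 := by rw [div_le_one hT0]; exact hT
  have h3 := abs_exp_sub_one_le (h1.trans h2)
  have h4 : (n : ℝ) - a = a * (exp (log n - log a) - 1) := by
    rw [exp_sub, exp_log hn0, exp_log ha0]; field_simp
  rw [h4, abs_mul, abs_of_pos ha0]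
  calc _ ≤ (N : ℝ) * (2 * (1 / T)) := by gcongr; linarith
    _ = _ := by ring

theorem p_est {φ : ℝ → ℝ} (hφ : Bump φ 1) (h0 : ∀ u, 0 ≤ φ u) (h1 : ∫ u, φ u = 1) {α β : ℝ} (hab : α ≤ β) (c : ℝ) :
    0 ≤ (∫ v in α..β, φ (v - c)) ∧ (∫ v in α..β, φ (v - c)) ≤ 1 ∧
    (α < c - 1 → c + 1 < β → (∫ v in α..β, φ (v - c)) = 1) ∧
    (c + 1 < α ∨ β < c - 1 → (∫ v in α..β, φ (v - c)) = 0) := by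
  have hi : Integrable fun v => φ (v - c) := by
    have := hφ.w_int.re
    exact Integrable.comp_sub_right (by simpa using this) c
  have h1' : ∫ v, φ (v - c) = 1 := by rw [integral_sub_right_eq_self φ c, h1]
  refine ⟨intervalIntegral.integral_nonneg hab fun v _ => h0 _, ?_, fun ha hb => ?_, fun hh => ?_⟩
  · rw [intervalIntegral.integral_of_le hab, ← h1']
    exact setIntegral_le_integral hi (Eventually.of_forall fun v => h0 _)
  · rw [intervalIntegral.integral_eq_integral_of_support_subset, h1']
    intro v hv
    by_contra hn
    refine hv (hφ.supp _ ?_)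
    rw [lt_abs]
    by_contra hh
    push Not at hh
    exact hn ⟨by linarith [hh.2], by linarith [hh.1]⟩
  · rw [intervalIntegral.integral_congr (g := fun _ => 0)]
    · simp
    · intro v hv
      rw [Set.uIcc_of_le hab] at hv
      refine hφ.supp _ ?_
      rw [lt_abs]
      rcases hh with hh | hh
      · left; linarith [hv.1]
      · right; linarith [hv.2]

theorem block_est {φ W : ℝ → ℝ} {B D : ℝ} (hφ : Bump φ 1) (h0 : ∀ u, 0 ≤ φ u) (h1 : ∫ u, φ u = 1)
    (hW : Bump W B) (hW0 : ∀ u, 0 ≤ W u) (hW1 : ∀ u, W u ≤ 1) (hWD : ∀ u, |u| ≤ D → W u = 1) (hDB : D ≤ B)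
    {a b N : ℕ} (ha : 1 ≤ a) (hab : a ≤ b) (hbN : b ≤ N) (haN : exp (-D) * N ≤ a) {T : ℝ} (hT : 1 ≤ T) :
    |∑ n ∈ Finset.Ico a b, ((ArithmeticFunction.moebius n : ℤ) : ℝ)| ≤
      N * (∫ v in (T * log a)..(T * log b), ‖Fs (fun v => exp v * W v) φ (log N) T v‖) + 2 * (4 * (N / T) + 1) := by
  have ha0 : (0 : ℝ) < a := by exact_mod_cast ha
  have hN0 : (0 : ℝ) < N := by exact_mod_cast (ha.trans hab).trans hbN
  have hT0 : 0 < T := by linarith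
  have hlab : T * log a ≤ T * log b := by gcongr
  set S := Wn B (log N) with hS
  have hS1 : ∀ n ∈ S, 1 ≤ n := fun n hn => (mem_Wn.1 hn).1
  have hD : ∀ n ∈ Finset.Ico a b, |log n - log N| ≤ D := fun n hn => by
    obtain ⟨n1, n2⟩ := Finset.mem_Ico.1 hn
    have e1 : (a : ℝ) ≤ n := by exact_mod_cast n1
    have e2 : (n : ℝ) ≤ N := by exact_mod_cast (n2.le.trans hbN)
    have e3 : log n ≤ log N := log_le_log (by linarith) e2
    have e4 : log (exp (-D) * N) ≤ log n := log_le_log (by positivity) (haN.trans e1)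
    rw [log_mul (exp_ne_zero _) hN0.ne', log_exp] at e4
    rw [abs_le]; constructor <;> linarith
  have hsub : Finset.Ico a b ⊆ S := fun n hn =>
    mem_Wn.2 ⟨ha.trans (Finset.mem_Ico.1 hn).1, (hD n hn).trans hDB⟩
  set p : ℕ → ℝ := fun n => ∫ v in (T * log a)..(T * log b), φ (v - T * log n) with hp
  have hI : (N : ℂ) * (∫ v in (T * log a)..(T * log b), Fs (fun v => exp v * W v) φ (log N) T v)
      = ∑ n ∈ S, Mu n * ((W (log n - log N) * p n : ℝ) : ℂ) := by
    simp_rw [Fs_eq hW.expm]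
    rw [intervalIntegral.integral_finsetSum, Finset.mul_sum]
    · refine Finset.sum_congr rfl fun n hn => ?_
      have hn0 : (0 : ℝ) < n := by exact_mod_cast hS1 n hn
      rw [intervalIntegral.integral_const_mul, intervalIntegral.integral_ofReal, exp_sub, exp_log hn0, exp_log hN0]
      change _ * (_ * ((p n : ℝ) : ℂ)) = _
      have c1 : (n : ℂ) ≠ 0 := by exact_mod_cast hn0.ne'
      have c2 : (N : ℂ) ≠ 0 := by exact_mod_cast hN0.ne'
      push_cast
      field_simp
    · intro n hn
      have : Continuous fun v : ℝ => (φ (v - T * log n) : ℂ) := hφ.smc.continuous.comp (by fun_prop)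
      exact (continuous_const.mul this).intervalIntegrable _ _
  have hM : ((∑ n ∈ Finset.Ico a b, ((ArithmeticFunction.moebius n : ℤ) : ℝ) : ℝ) : ℂ)
      = ∑ n ∈ S, Mu n * (((if n ∈ Finset.Ico a b then 1 else 0 : ℝ)) : ℂ) := by
    rw [← Finset.sum_subset hsub]
    · push_cast
      refine Finset.sum_congr rfl fun n hn => ?_
      rw [if_pos hn, Mu]; simp
    · intro n _ hn
      rw [if_neg hn]; simp
  have hdiff : ‖∑ n ∈ S, Mu n * (((if n ∈ Finset.Ico a b then 1 else 0 : ℝ)) : ℂ) - ∑ n ∈ S, Mu n * ((W (log n - log N) * p n : ℝ) : ℂ)‖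
      ≤ 2 * (4 * (N / T) + 1) := by
    rw [← Finset.sum_sub_distrib]
    calc _ ≤ ∑ n ∈ S, ((if |T * log n - T * log a| ≤ 1 then 1 else 0 : ℝ) + (if |T * log n - T * log b| ≤ 1 then 1 else 0 : ℝ)) := by
          refine norm_sum_le_of_le _ fun n hn => ?_
          have hn0 : (0 : ℝ) < n := by exact_mod_cast hS1 n hn
          rw [← mul_sub, ← Complex.ofReal_sub, norm_mul, Complex.norm_real, norm_eq_abs]
          refine (mul_le_of_le_one_left (abs_nonneg _) (Mu_le n)).trans ?_
          obtain ⟨p0, p1, p2, p3⟩ := p_est hφ h0 h1 hlab (T * log n)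
          change 0 ≤ p n at p0
          change p n ≤ 1 at p1
          have q0 : 0 ≤ W (log n - log N) * p n := mul_nonneg (hW0 _) p0
          have q1 : W (log n - log N) * p n ≤ 1 := mul_le_one₀ (hW1 _) p0 p1
          have tr : |(if n ∈ Finset.Ico a b then 1 else 0 : ℝ) - W (log n - log N) * p n| ≤ 1 := by
            rw [abs_le]; split_ifs <;> constructor <;> linarith
          by_cases c1 : |T * log n - T * log a| ≤ 1
          · rw [if_pos c1]; split_ifs at tr ⊢ <;> linarith
          by_cases c2 : |T * log n - T * log b| ≤ 1
          · rw [if_pos c2]; split_ifs at tr ⊢ <;> linarith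
          rw [if_neg c1, if_neg c2, add_zero]
          push Not at c1 c2
          refine (abs_eq_zero.2 ?_).le
          by_cases hm : n ∈ Finset.Ico a b
          · obtain ⟨n1, n2⟩ := Finset.mem_Ico.1 hm
            have l1 : T * log a ≤ T * log n := by gcongr
            have l2 : T * log n ≤ T * log b := by gcongr
            rw [abs_of_nonneg (by linarith)] at c1
            rw [abs_of_nonpos (by linarith)] at c2
            have := p2 (by linarith) (by linarith)
            change p n = 1 at this
            rw [if_pos hm, hWD _ (hD n hm), this]; norm_num
          · rw [if_neg hm]
            have : p n = 0 := by
              refine p3 ?_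
              rw [Finset.mem_Ico, not_and_or, not_le, not_lt] at hm
              rcases hm with hm | hm
              · have l1 : T * log n ≤ T * log a := by gcongr
                rw [abs_of_nonpos (by linarith)] at c1
                left; linarith
              · have hb0 : (0 : ℝ) < b := by exact_mod_cast ha.trans hab
                have l1 : T * log b ≤ T * log n := by gcongr
                rw [abs_of_nonneg (by linarith)] at c2
                right; linarith
            rw [this]; norm_num
      _ ≤ (4 * (N / T) + 1) + (4 * (N / T) + 1) := by
          rw [Finset.sum_add_distrib, Finset.sum_boole, Finset.sum_boole]
          exact add_le_add (near_card hS1 ha (hab.trans hbN) hT) (near_card hS1 (ha.trans hab) hbN hT)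
      _ = _ := by ring
  rw [← hM, ← hI] at hdiff
  have e1 := norm_le_norm_add_norm_sub' ((∑ n ∈ Finset.Ico a b, ((ArithmeticFunction.moebius n : ℤ) : ℝ) : ℝ) : ℂ)
    ((N : ℂ) * (∫ v in (T * log a)..(T * log b), Fs (fun v => exp v * W v) φ (log N) T v))
  rw [Complex.norm_real, norm_eq_abs, norm_mul, Complex.norm_natCast] at e1
  have e2 := intervalIntegral.norm_integral_le_integral_norm (f := Fs (fun v => exp v * W v) φ (log N) T) (μ := volume) hlab
  have e3 := mul_le_mul_of_nonneg_left e2 hN0.le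
  linarith

theorem blocks (D ε : ℝ) (hD : 1 ≤ D) (hε : 0 < ε) : ∃ Q : ℝ, ∃ N0 : ℕ, 0 < Q ∧ ∀ N, N0 ≤ N → ∀ (c : ℕ → ℕ) (K : ℕ),
    Monotone c → 1 ≤ c 0 → exp (-D) * N ≤ c 0 → c K = N →
    ∑ k ∈ Finset.range K, |∑ n ∈ Finset.Ico (c k) (c (k + 1)), ((ArithmeticFunction.moebius n : ℤ) : ℝ)| ≤ ε * N + Q * K := by
  obtain ⟨φ, hφ, h0, h1⟩ := exists_phi
  obtain ⟨W, hW, hW0, hW1, hWD⟩ := exists_W D hD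
  obtain ⟨H, x0, hH, hI⟩ := full_int hW.expm hφ (ε ^ 2 / D) (by positivity)
  refine ⟨2 * (4 * exp H + 1), ⌈exp (max x0 H)⌉₊, by positivity, fun N hN c K hc c1 c2 cK => ?_⟩
  have hN1 : exp (max x0 H) ≤ N := Nat.ceil_le.1 hN
  have hN0 : (0 : ℝ) < N := (exp_pos _).trans_le hN1
  have hx : max x0 H ≤ log N := (le_log_iff_exp_le hN0).2 hN1
  have hi := hI (log N) ((le_max_left _ _).trans hx)
  set T := exp (log N - H) with hT
  have hT1 : 1 ≤ T := one_le_exp (by linarith [(le_max_right x0 H).trans hx])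
  have hT0 : 0 < T := by linarith
  have hNT : (N : ℝ) / T = exp H := by
    rw [hT, exp_sub, exp_log hN0]; field_simp
  obtain ⟨f1, f2, f3⟩ := Fs_L2 hW.expm hφ (log N) hT0
  set F := Fs (fun v => exp v * W v) φ (log N) T with hF
  have hcN : ∀ k, k ≤ K → c k ≤ N := fun k hk => cK ▸ hc hk
  have hck : ∀ k, c 0 ≤ c k := fun k => hc (Nat.zero_le k)
  have hsum : ∑ k ∈ Finset.range K, (∫ v in (T * log (c k))..(T * log (c (k + 1))), ‖F v‖) = ∫ v in (T * log (c 0))..(T * log (c K)), ‖F v‖ :=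
    intervalIntegral.sum_integral_adjacent_intervals (a := fun k => T * log (c k)) fun k _ => f1.norm.intervalIntegrable _ _
  have hc0 : (0 : ℝ) < c 0 := by exact_mod_cast c1
  have hlog : log N - D ≤ log (c 0) := by
    have e4 : log (exp (-D) * N) ≤ log (c 0) := log_le_log (by positivity) c2
    rw [log_mul (exp_ne_zero _) hN0.ne', log_exp] at e4
    linarith
  have hle : T * log (c 0) ≤ T * log (c K) := by
    have := hck K
    gcongr
  have hCS : (∫ v in (T * log (c 0))..(T * log (c K)), ‖F v‖) ≤ ε := by
    set l := T * (D / ε) with hl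
    have hl0 : 0 < l := by positivity
    calc _ ≤ ∫ v in (T * log (c 0))..(T * log (c K)), (l / 2 * ‖F v‖ ^ 2 + 1 / (2 * l)) := by
          refine intervalIntegral.integral_mono_on hle (f1.norm.intervalIntegrable _ _) ?_ fun v _ => ?_
          · have : Continuous fun v => l / 2 * ‖F v‖ ^ 2 + 1 / (2 * l) := by fun_prop
            exact this.intervalIntegrable _ _
          · have : l / 2 * ‖F v‖ ^ 2 + 1 / (2 * l) - ‖F v‖ = (l * ‖F v‖ - 1) ^ 2 / (2 * l) := by
              field_simp; ring
            have : 0 ≤ (l * ‖F v‖ - 1) ^ 2 / (2 * l) := by positivity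
            linarith
      _ = l / 2 * (∫ v in (T * log (c 0))..(T * log (c K)), ‖F v‖ ^ 2) + (T * log (c K) - T * log (c 0)) * (1 / (2 * l)) := by
          have : Continuous fun v => l / 2 * ‖F v‖ ^ 2 := by fun_prop
          rw [intervalIntegral.integral_add (this.intervalIntegrable _ _) (continuous_const.intervalIntegrable _ _), intervalIntegral.integral_const_mul, intervalIntegral.integral_const, smul_eq_mul]
      _ ≤ l / 2 * (1 / T * (ε ^ 2 / D)) + (T * D) * (1 / (2 * l)) := by
          gcongr
          · rw [intervalIntegral.integral_of_le hle]
            refine (setIntegral_le_integral f2 (Eventually.of_forall fun v => by positivity)).trans (f3.trans ?_)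
            gcongr
          · rw [cK, ← mul_sub]; gcongr; linarith
      _ = ε := by rw [hl]; field_simp; ring
  calc _ ≤ ∑ k ∈ Finset.range K, (N * (∫ v in (T * log (c k))..(T * log (c (k + 1))), ‖F v‖) + 2 * (4 * exp H + 1)) := by
        refine Finset.sum_le_sum fun k hk => ?_
        have hk' := Finset.mem_range.1 hk
        have := block_est hφ h0 h1 hW hW0 hW1 hWD (by linarith) (c1.trans (hck k)) (hc (Nat.le_succ k)) (hcN (k + 1) hk')
          (c2.trans (by exact_mod_cast hck k)) hT1
        rwa [hNT] at this
    _ = N * (∫ v in (T * log (c 0))..(T * log (c K)), ‖F v‖) + K * (2 * (4 * exp H + 1)) := by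
        rw [Finset.sum_add_distrib, ← Finset.mul_sum, hsum, Finset.sum_const, Finset.card_range, nsmul_eq_mul]
    _ ≤ N * ε + K * (2 * (4 * exp H + 1)) := by gcongr
    _ = _ := by ring
end MR

theorem MR.split (b : ℕ → ℕ) (hmono : Monotone b) (M : ℕ) (k : ℕ) :
    |∑ n ∈ Finset.Ico (b k) (b (k + 1)), ((ArithmeticFunction.moebius n : ℤ) : ℝ)| ≤
      ((min (b (k + 1)) M : ℕ) : ℝ) - ((min (b k) M : ℕ) : ℝ) +
      |∑ n ∈ Finset.Ico (max (b k) M) (max (b (k + 1)) M), ((ArithmeticFunction.moebius n : ℤ) : ℝ)| := by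
  have hk := hmono (Nat.le_succ k)
  have triv : ∀ p q : ℕ, p ≤ q → |∑ n ∈ Finset.Ico p q, ((ArithmeticFunction.moebius n : ℤ) : ℝ)| ≤ (q : ℝ) - p := fun p q hpq => by
    refine (Finset.abs_sum_le_sum_abs _ _).trans ?_
    calc _ ≤ ∑ n ∈ Finset.Ico p q, (1 : ℝ) := Finset.sum_le_sum fun n _ => by
          exact_mod_cast ArithmeticFunction.abs_moebius_le_one
      _ = _ := by simp [Nat.cast_sub hpq]
  rcases le_total M (b k) with h | h
  · rw [min_eq_right h, min_eq_right (h.trans hk), max_eq_left h, max_eq_left (h.trans hk)]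
    linarith
  rcases le_total M (b (k + 1)) with h' | h'
  · rw [min_eq_left h, min_eq_right h', max_eq_right h, max_eq_left h', ← Finset.sum_Ico_consecutive _ h h']
    exact (abs_add_le _ _).trans (add_le_add (triv _ _ h) le_rfl)
  · rw [min_eq_left h, min_eq_left h', max_eq_right h, max_eq_right h']
    have := triv _ _ hk
    simpa using this

theorem moebius_short_intervals_along_blocks (b : ℕ → ℕ) (hb0 : b 0 = 0)
    (hmono : StrictMono b)
    (hgap : Tendsto (fun k : ℕ => b (k + 1) - b k) atTop atTop) :
    Tendsto
      (fun K : ℕ => (1 / (b (K + 1) : ℝ)) *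
        ∑ k ∈ Finset.range (K + 1),
          |∑ n ∈ Finset.Ico (b k) (b (k + 1)), ((ArithmeticFunction.moebius n : ℤ) : ℝ)|)
      atTop (nhds 0) := by
  rw [Metric.tendsto_atTop]
  intro η hη
  set D := max 1 (-Real.log (η / 5)) with hD
  have hD1 : 1 ≤ D := le_max_left _ _
  have hDe : Real.exp (-D) ≤ η / 5 := by
    rw [← Real.le_log_iff_exp_le (by positivity)]
    linarith [le_max_right 1 (-Real.log (η / 5))]
  obtain ⟨Q, N0, hQ, hbl⟩ := MR.blocks D (η / 5) hD1 (by positivity)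
  obtain ⟨R, hR⟩ := exists_nat_gt (Q / (η / 5))
  obtain ⟨k0, hk0⟩ := (hgap.eventually_ge_atTop R).exists_forall_of_atTop
  have hgr : ∀ j, R * j ≤ b (k0 + j) := fun j => by
    induction j with
    | zero => simp
    | succ j ih =>
      have h1 : R ≤ b (k0 + j + 1) - b (k0 + j) := hk0 (k0 + j) (by omega)
      have h2 : b (k0 + j) < b (k0 + j + 1) := hmono (Nat.lt_succ_self (k0 + j))
      rw [mul_add, mul_one, ← add_assoc]
      omega
  have hid : ∀ k, k ≤ b k := hmono.id_le
  obtain ⟨N1, hN1⟩ := exists_nat_gt ((1 + Q * k0) / (η / 5))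
  refine ⟨N0 + N1 + k0 + 1, fun K hK => ?_⟩
  set N := b (K + 1) with hN
  have hKN : K + 1 ≤ N := hid (K + 1)
  have hNp : (0 : ℝ) < N := by exact_mod_cast (show 0 < N by omega)
  set M := ⌈Real.exp (-D) * N⌉₊ with hM
  have hM1 : (M : ℝ) ≤ Real.exp (-D) * N + 1 := (Nat.ceil_lt_add_one (by positivity)).le
  have hMN : M ≤ N := by
    refine Nat.ceil_le.2 (mul_le_of_le_one_left hNp.le ?_)
    rw [Real.exp_le_one_iff]; linarith
  have hMp : 1 ≤ M := Nat.ceil_pos.2 (by positivity)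
  have hB := hbl N (by omega) (fun k => max (b k) M) (K + 1)
    (fun i j hij => max_le_max (hmono.monotone hij) le_rfl) (hMp.trans (le_max_right _ _))
    ((Nat.le_ceil _).trans (by exact_mod_cast le_max_right _ _)) (max_eq_left hMN)
  have hS : ∑ k ∈ Finset.range (K + 1), |∑ n ∈ Finset.Ico (b k) (b (k + 1)), ((ArithmeticFunction.moebius n : ℤ) : ℝ)|
      ≤ M + (η / 5 * N + Q * (K + 1 : ℕ)) := by
    refine (Finset.sum_le_sum fun k _ => MR.split b hmono.monotone M k).trans ?_
    rw [Finset.sum_add_distrib, Finset.sum_range_sub (fun k => ((min (b k) M : ℕ) : ℝ))]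
    refine add_le_add ?_ hB
    have h1 : ((min (b (K + 1)) M : ℕ) : ℝ) ≤ M := by exact_mod_cast min_le_right _ _
    have h2 : (0 : ℝ) ≤ ((min (b 0) M : ℕ) : ℝ) := by positivity
    linarith
  have hQK : Q * (K + 1 : ℕ) ≤ η / 5 * N + Q * k0 := by
    obtain ⟨j, hj⟩ := Nat.exists_eq_add_of_le (show k0 ≤ K + 1 by omega)
    have h1 := hgr j
    rw [← hj] at h1
    have h2 : (R : ℝ) * j ≤ N := by exact_mod_cast h1
    have h3 : Q ≤ η / 5 * R := by
      rw [div_lt_iff₀ (by positivity)] at hR; linarith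
    rw [hj]; push_cast
    have h4 : Q * j ≤ η / 5 * R * j := by gcongr
    have h5 : η / 5 * (R * j) ≤ η / 5 * N := by gcongr
    linarith
  have hc : 1 + Q * k0 < η / 5 * N := by
    rw [div_lt_iff₀ (by positivity)] at hN1
    have : (N1 : ℝ) ≤ N := by exact_mod_cast (show N1 ≤ N by omega)
    have h5 : N1 * (η / 5) ≤ N * (η / 5) := by gcongr
    linarith
  have hfin : Real.exp (-D) * N ≤ η / 5 * N := by gcongr
  have hηN : 0 < η * N := by positivity
  rw [Real.dist_eq, sub_zero, abs_of_nonneg (by positivity), one_div, inv_mul_lt_iff₀ hNp]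
  linarith
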